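/- Let γ₁ denote the infimum of the ordinates of the Riemann zeta function (the positive imaginary parts of its nontrivial zeros). For every ε > 0 there exists T₀ such that for every T ≥ T₀ there exist real numbers 2 ≤ x₁ < x₂ < ⋯ < x_N ≤ T with N ≥ (γ₁/π + 1.867 × 10^{−30} − ε) · log T such that (ψ(x_i) − x_i) and (ψ(x_{i+1}) − x_{i+1}) have strictly opposite signs for each 1 ≤ i < N; that is, liminf_{T→∞} W^ψ(T)/log T ≥ γ₁/π + 1.867 × 10^{−30}. -/

import Mathlib

/-- The Chebyshev function `ψ(x) = Σ_{n ≤ x} Λ(n)`. -/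
noncomputable def chebyshevPsi (x : ℝ) : ℝ :=
  ∑ n ∈ Finset.Icc 1 ⌊x⌋₊, ArithmeticFunction.vonMangoldt n

/-- The set of ordinates of the Riemann zeta function: positive imaginary parts of
nontrivial zeros. -/
def zetaOrdinates : Set ℝ :=
  {t : ℝ | 0 < t ∧ ∃ ρ : ℂ, riemannZeta ρ = 0 ∧ 0 < ρ.re ∧ ρ.re < 1 ∧ ρ.im = t}

section

/-- `AltEnd g x n s`: there are `n` points `0 < x₁ < ⋯ < xₙ = x` at which `g` alternates in sign,
the sign at the last one being `s`. -/
inductive AltEnd (g : ℝ → ℝ) : ℝ → ℕ → ℝ → Prop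
  | one {x s : ℝ} : s = 1 ∨ s = -1 → 0 < x → 0 < s * g x → AltEnd g x 1 s
  | step {x y s : ℝ} {n : ℕ} : AltEnd g x n (-s) → x < y → 0 < s * g y → AltEnd g y (n + 1) s

namespace AltEnd

variable {g : ℝ → ℝ} {x s : ℝ} {n : ℕ}

theorem sign_eq (h : AltEnd g x n s) : s = 1 ∨ s = -1 := by
  induction h with
  | one hs _ _ => exact hs
  | step _ _ _ ih => rcases ih with h | h <;> [right; left] <;> linarith

theorem pos (h : AltEnd g x n s) : 0 < x := by
  induction h with
  | one _ hx _ => exact hx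
  | step _ hxy _ ih => exact ih.trans hxy

theorem sign_mul_pos (h : AltEnd g x n s) : 0 < s * g x := by
  cases h <;> assumption

theorem one_le (h : AltEnd g x n s) : 1 ≤ n := by
  cases h <;> omega

theorem drop_first (h : AltEnd g x n s) (hn : 2 ≤ n) : AltEnd g x (n - 1) s := by
  induction h with
  | one _ _ _ => omega
  | @step x y s n h hxy hy ih =>
    have hs : s = 1 ∨ s = -1 := (step h hxy hy).sign_eq
    rcases Nat.lt_or_ge n 2 with hlt | hge
    · have : n = 1 := by have := h.one_le; omega
      subst this
      exact one hs (h.pos.trans hxy) hy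
    · have := step (ih hge) hxy hy
      rwa [Nat.sub_add_cancel (by omega)] at this

end AltEnd

/-- `AltBy g t n s`: `g` alternates at `n` points of `(0, t]`, with sign `s` at the last one. -/
def AltBy (g : ℝ → ℝ) (t : ℝ) (n : ℕ) (s : ℝ) : Prop := ∃ x ≤ t, AltEnd g x n s

namespace AltBy

variable {g : ℝ → ℝ} {t t' s : ℝ} {n : ℕ}

theorem mono (h : AltBy g t n s) (ht : t ≤ t') : AltBy g t' n s :=
  let ⟨x, hx, hA⟩ := h; ⟨x, hx.trans ht, hA⟩

theorem drop_first (h : AltBy g t (n + 1) s) (hn : 1 ≤ n) : AltBy g t n s :=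
  let ⟨x, hx, hA⟩ := h; ⟨x, hx, hA.drop_first (by omega)⟩

theorem extend (h : AltBy g t n (-s)) {v : ℝ} (hv : t < v) (hv' : v ≤ t') (hs : 0 < s * g v) :
    AltBy g t' (n + 1) s :=
  let ⟨_, hx, hA⟩ := h; ⟨v, hv', hA.step (hx.trans_lt hv) hs⟩

theorem exists_seq (h : AltBy g t n s) :
    ∃ x : ℕ → ℝ, (∀ i < n, 0 < x i ∧ x i ≤ t) ∧ (∀ i j, i < j → j < n → x i < x j) ∧
      ∀ i, i + 1 < n → g (x i) * g (x (i + 1)) < 0 := by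
  obtain ⟨y, hy, hA⟩ := h
  have key : ∃ x : ℕ → ℝ, x (n - 1) = y ∧ (∀ i < n, 0 < x i ∧ x i ≤ y) ∧
      (∀ i j, i < j → j < n → x i < x j) ∧ ∀ i, i + 1 < n → g (x i) * g (x (i + 1)) < 0 := by
    clear hy
    induction hA with
    | @one x _ _ hx _ =>
      exact ⟨fun _ => x, rfl, fun _ _ => ⟨hx, le_rfl⟩, fun i j _ _ => by omega, fun i _ => by omega⟩
    | @step x y s n h hxy hsy ih =>
      obtain ⟨w, hw, h1, h2, h3⟩ := ih
      have hn := h.one_le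
      refine ⟨fun i => if i < n then w i else y, by simp, fun i hi => ?_, fun i j hij hj => ?_,
        fun i hi => ?_⟩
      · by_cases hin : i < n
        · simp only [hin, if_true]; exact ⟨(h1 i hin).1, (h1 i hin).2.trans hxy.le⟩
        · simp only [hin, if_false]; exact ⟨h.pos.trans hxy, le_rfl⟩
      · have hin : i < n := by omega
        by_cases hjn : j < n
        · simp only [hin, hjn, if_true]; exact h2 i j hij hjn
        · simp only [hin, hjn, if_true, if_false]; exact (h1 i hin).2.trans_lt hxy
      · have hin : i < n := by omega
        by_cases hjn : i + 1 < n
        · simp only [hin, hjn, if_true]; exact h3 i hjn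
        · have hi' : i = n - 1 := by omega
          simp only [hin, hjn, if_true, if_false]
          rw [hi', hw]
          have ha := h.sign_mul_pos
          rcases h.sign_eq with hs | hs
          · have : s = -1 := by linarith
            subst this; nlinarith
          · have : s = 1 := by linarith
            subst this; nlinarith
  obtain ⟨x, -, h1, h2, h3⟩ := key
  exact ⟨x, fun i hi => ⟨(h1 i hi).1, (h1 i hi).2.trans hy⟩, h2, h3⟩

end AltBy

/-- The conclusion of Rolle's theorem for a function `F` that has the sign of the derivative
of `q` on `[0, ∞)`, where `q` vanishes at `0`. -/
structure RollePair (F q : ℝ → ℝ) : Prop where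
  zero : q 0 = 0
  exists_sign : ∀ x y s : ℝ, 0 ≤ x → x < y → 0 < s * (q y - q x) →
    ∃ v, x < v ∧ v ≤ y ∧ 0 < s * F v

namespace RollePair

variable {F q : ℝ → ℝ} {x y s t : ℝ} {n : ℕ}

theorem extend (hR : RollePair F q) (h : AltBy F x n (-s)) (hx : 0 ≤ x) (hxy : x < y)
    (hq : 0 < s * (q y - q x)) : AltBy F y (n + 1) s := by
  obtain ⟨v, h1, h2, h3⟩ := hR.exists_sign x y s hx hxy hq
  exact h.extend h1 h2 h3

theorem altBy (hR : RollePair F q) (h : AltEnd q x n s) : AltBy F x n s := by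
  induction h with
  | @one x s hs hx hq =>
    obtain ⟨v, h1, h2, h3⟩ := hR.exists_sign 0 x s le_rfl hx (by rwa [hR.zero, sub_zero])
    exact ⟨v, h2, .one hs h1 h3⟩
  | @step x y s n h hxy hy ih =>
    have := h.sign_mul_pos
    exact hR.extend ih h.pos.le hxy (by nlinarith)

/-- Each window on which `q` keeps its sign and has an interior dip of `|q|` contributes two sign
changes of `F` beyond those forced by the sign changes of `q`. -/
theorem altBy_add_windows (hR : RollePair F q) {σ : ℝ} (hσ : σ = 1 ∨ σ = -1) (α β γ : ℕ → ℝ)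
    (k : ℕ) (hα : ∀ i < k, 0 < α i) (hαβ : ∀ i < k, α i < β i) (hβγ : ∀ i < k, β i < γ i)
    (hord : ∀ i, i + 1 < k → γ i ≤ α (i + 1))
    (hpos : ∀ i < k, ∀ x, α i ≤ x → x ≤ γ i → 0 < σ * q x)
    (hdown : ∀ i < k, 0 < σ * (q (α i) - q (β i))) (hup : ∀ i < k, 0 < σ * (q (γ i) - q (β i)))
    (h : AltEnd q x n s) (hxt : x ≤ t) (hγt : ∀ i < k, γ i ≤ t) :
    AltBy F t (n + 2 * k) s := by
  induction k generalizing x n s t with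
  | zero => exact (hR.altBy h).mono hxt
  | succ k ih =>
    set a := α k
    set b := β k
    set c := γ k
    have ha : 0 < a := hα k (by omega)
    have hab : a < b := hαβ k (by omega)
    have hbc : b < c := hβγ k (by omega)
    have hpk := hpos k (by omega)
    have hγa : ∀ i < k, γ i ≤ a := by
      intro i hi
      have key : ∀ j, i + j < k → γ i ≤ γ (i + j) := by
        intro j
        induction j with
        | zero => intro _; simp
        | succ j ihj =>
          intro hj
          have h1 := ihj (by omega)
          have h2 := hord (i + j) (by omega)
          have h3 := hαβ (i + j + 1) (by omega)
          have h4 := hβγ (i + j + 1) (by omega)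
          have : i + (j + 1) = i + j + 1 := by ring
          rw [this]; linarith
      have h1 := key (k - 1 - i) (by omega)
      have h2 := hord (k - 1) (by omega)
      have e1 : i + (k - 1 - i) = k - 1 := by omega
      have e2 : k - 1 + 1 = k := by omega
      rw [e1] at h1; rw [e2] at h2
      exact h1.trans h2
    have IH : ∀ {x s : ℝ} {n : ℕ}, AltEnd q x n s → x ≤ a → AltBy F a (n + 2 * k) s :=
      fun h hx => ih (fun i hi => hα i (by omega)) (fun i hi => hαβ i (by omega))
        (fun i hi => hβγ i (by omega)) (fun i hi => hord i (by omega))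
        (fun i hi => hpos i (by omega)) (fun i hi => hdown i (by omega))
        (fun i hi => hup i (by omega)) h hx hγa
    have toB : ∀ {m : ℕ}, AltBy F a m σ → AltBy F b (m + 1) (-σ) := fun h =>
      hR.extend (by rwa [neg_neg]) ha.le hab (by have := hdown k (by omega); linarith)
    have toC : ∀ {m : ℕ}, AltBy F a m σ → AltBy F c (m + 2) σ := fun h =>
      hR.extend (toB h) (ha.trans hab).le hbc (hup k (by omega))
    have hneg : ∀ {s : ℝ}, (s = 1 ∨ s = -1) → s ≠ σ → s = -σ := by
      intro s hs hne
      rcases hs with h1 | h1 <;> rcases hσ with h2 | h2 <;> 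
        first | exact absurd (h1.trans h2.symm) hne | linarith
    have caseA : ∀ {x s : ℝ} {n : ℕ}, AltEnd q x n s → x ≤ a →
        AltBy F c (n + 2 * (k + 1)) s := by
      intro x s n h hx
      by_cases hs : s = σ
      · subst hs
        exact toC (IH h hx)
      · have hs' := hneg h.sign_eq hs
        subst hs'
        have hxa : x < a := by
          rcases hx.lt_or_eq with h1 | h1
          · exact h1
          · exfalso
            have h2 := h.sign_mul_pos
            have h3 := hpk a le_rfl (hab.trans hbc).le
            rw [h1] at h2; linarith
        have h1 : AltEnd q a (n + 1) σ := h.step hxa (hpk a le_rfl (hab.trans hbc).le)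
        have h2 := toB (IH h1 le_rfl)
        have e : n + 1 + 2 * k + 1 = n + 2 * (k + 1) := by ring
        rw [e] at h2
        exact h2.mono hbc.le
    have startA : AltEnd q a 1 σ := .one hσ ha (hpk a le_rfl (hab.trans hbc).le)
    have hct : c ≤ t := hγt k (by omega)
    have main : ∀ t', x ≤ t' → c ≤ t' → AltBy F t' (n + 2 * (k + 1)) s := by
      clear hxt hγt
      induction h with
      | @one x s hs hx hq =>
        intro t' hxt hct
        by_cases hsσ : s = σ
        · subst hsσ
          exact (caseA startA le_rfl).mono hct
        · have hs' := hneg hs hsσ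
          subst hs'
          rcases le_or_gt x a with hxa | hxa
          · exact (caseA (.one hs hx hq) hxa).mono hct
          · have hxc : c < x := by
              by_contra hcon
              have := hpk x hxa.le (not_lt.mp hcon)
              linarith
            have h1 : AltBy F c (1 + 2 * (k + 1)) (- -σ) := by
              rw [neg_neg]; exact caseA startA le_rfl
            have hc := hpk c (hab.trans hbc).le le_rfl
            have h2 := hR.extend h1 (ha.trans (hab.trans hbc)).le hxc (by nlinarith)
            exact (h2.drop_first (by omega)).mono hxt
      | @step x' x s n h hxx hq ihd =>
        intro t' hxt hct
        rcases le_or_gt x a with hxa | hxa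
        · exact (caseA (h.step hxx hq) hxa).mono hct
        have hs : s = 1 ∨ s = -1 := (h.step hxx hq).sign_eq
        have hmove : s = σ → x' < c → AltBy F t' (n + 1 + 2 * (k + 1)) s := by
          intro hsσ hx'c
          subst hsσ
          have hx'a : x' < a := by
            by_contra hcon
            have h1 := hpk x' (not_lt.mp hcon) hx'c.le
            have h2 := h.sign_mul_pos
            linarith
          exact (caseA (h.step hx'a (hpk a le_rfl (hab.trans hbc).le)) le_rfl).mono hct
        rcases le_or_gt x c with hxc | hxc
        · have hsσ : s = σ := by
            by_contra hne
            have hs' := hneg hs hne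
            subst hs'
            have := hpk x hxa.le hxc
            linarith
          exact hmove hsσ (hxx.trans_le hxc)
        · rcases le_or_gt c x' with hcx' | hcx'
          · have h1 := ihd x' le_rfl hcx'
            have h2 := h.sign_mul_pos
            have h3 := hR.extend h1 h.pos.le hxx (by nlinarith)
            have e : n + 2 * (k + 1) + 1 = n + 1 + 2 * (k + 1) := by ring
            rw [e] at h3
            exact h3.mono hxt
          · by_cases hsσ : s = σ
            · exact hmove hsσ hcx'
            · have hs' := hneg hs hsσ
              subst hs'
              have h1 := ihd c hcx'.le le_rfl
              have hc := hpk c (hab.trans hbc).le le_rfl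
              have h3 := hR.extend h1 (ha.trans (hab.trans hbc)).le hxc (by nlinarith)
              have e : n + 2 * (k + 1) + 1 = n + 1 + 2 * (k + 1) := by ring
              rw [e] at h3
              exact h3.mono hxt
    exact main t hxt hct

end RollePair

end

section

open MeasureTheory intervalIntegral

/-- The solution `H` of `H' + a H = h`, `H(0) = 0`. -/
noncomputable def expInt (a : ℝ) (h : ℝ → ℝ) (u : ℝ) : ℝ :=
  ∫ v in (0 : ℝ)..u, Real.exp (-(a * (u - v))) * h v

/-- Interval integrability on every bounded interval. -/
def LocInt (h : ℝ → ℝ) : Prop := ∀ x y : ℝ, IntervalIntegrable h volume x y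

theorem LocInt.exp_mul {h : ℝ → ℝ} (hh : LocInt h) (a c : ℝ) :
    LocInt fun v => Real.exp (a * v + c) * h v := fun x y =>
  (hh x y).continuousOn_mul (by fun_prop)

theorem expInt_eq (a : ℝ) (h : ℝ → ℝ) (u : ℝ) :
    expInt a h u = Real.exp (-(a * u)) * ∫ v in (0 : ℝ)..u, Real.exp (a * v) * h v := by
  rw [expInt, ← intervalIntegral.integral_const_mul]
  congr 1; ext v
  rw [← mul_assoc, ← Real.exp_add]; ring_nf

theorem exp_mul_expInt (a : ℝ) (h : ℝ → ℝ) (u : ℝ) :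
    Real.exp (a * u) * expInt a h u = ∫ v in (0 : ℝ)..u, Real.exp (a * v) * h v := by
  rw [expInt_eq, ← mul_assoc, ← Real.exp_add, add_neg_cancel, Real.exp_zero, one_mul]

theorem LocInt.exp_mul' {h : ℝ → ℝ} (hh : LocInt h) (a : ℝ) :
    LocInt fun v => Real.exp (a * v) * h v := by simpa using hh.exp_mul a 0

theorem continuous_expInt {h : ℝ → ℝ} (hh : LocInt h) (a : ℝ) : Continuous (expInt a h) := by
  have : expInt a h = fun u => Real.exp (-(a * u)) * ∫ v in (0 : ℝ)..u, Real.exp (a * v) * h v :=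
    funext (expInt_eq a h)
  rw [this]
  exact (by fun_prop : Continuous fun u : ℝ => Real.exp (-(a * u))).mul
    (intervalIntegral.continuous_primitive (hh.exp_mul' a) 0)

theorem Continuous.locInt {h : ℝ → ℝ} (hh : Continuous h) : LocInt h :=
  fun x y => hh.intervalIntegrable x y

theorem locInt_expInt {h : ℝ → ℝ} (hh : LocInt h) (a : ℝ) : LocInt (expInt a h) :=
  (continuous_expInt hh a).locInt

theorem expInt_zero (a : ℝ) (h : ℝ → ℝ) : expInt a h 0 = 0 := by simp [expInt]

theorem expInt_congr {a u : ℝ} {h k : ℝ → ℝ} (hu : 0 ≤ u) (hk : ∀ v, 0 ≤ v → v ≤ u → h v = k v) :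
    expInt a h u = expInt a k u := by
  refine intervalIntegral.integral_congr fun v hv => ?_
  rw [Set.uIcc_of_le hu] at hv
  simp only [hk v hv.1 hv.2]

theorem expInt_add {h k : ℝ → ℝ} (hh : LocInt h) (hk : LocInt k) (a u : ℝ) :
    expInt a (fun v => h v + k v) u = expInt a h u + expInt a k u := by
  simp only [expInt_eq]
  rw [← mul_add, ← intervalIntegral.integral_add (hh.exp_mul' a 0 u) (hk.exp_mul' a 0 u)]
  simp only [mul_add]

theorem expInt_const_mul (h : ℝ → ℝ) (a c u : ℝ) :
    expInt a (fun v => c * h v) u = c * expInt a h u := by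
  simp only [expInt_eq]
  have : (∫ v in (0 : ℝ)..u, Real.exp (a * v) * (c * h v)) =
      c * ∫ v in (0 : ℝ)..u, Real.exp (a * v) * h v := by
    rw [← intervalIntegral.integral_const_mul]
    simp only [mul_left_comm]
  rw [this]; ring

theorem abs_expInt_le {h : ℝ → ℝ} {a b C u : ℝ} (hu : 0 ≤ u) (hab : 0 < a + b) (hC : 0 ≤ C)
    (hh : ∀ v, 0 ≤ v → v ≤ u → |h v| ≤ C * Real.exp (b * v)) :
    |expInt a h u| ≤ C / (a + b) * Real.exp (b * u) := by
  have h1 : ‖∫ v in (0 : ℝ)..u, Real.exp (a * v) * h v‖ ≤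
      ∫ v in (0 : ℝ)..u, C * Real.exp ((a + b) * v) := by
    refine intervalIntegral.norm_integral_le_of_norm_le hu ?_
      ((by fun_prop : Continuous fun v : ℝ => C * Real.exp ((a + b) * v)).intervalIntegrable _ _)
    refine Filter.Eventually.of_forall fun v hv => ?_
    rw [norm_mul, Real.norm_eq_abs, Real.norm_eq_abs, Real.abs_exp]
    calc Real.exp (a * v) * |h v| ≤ Real.exp (a * v) * (C * Real.exp (b * v)) := by
          gcongr; exact hh v hv.1.le hv.2
      _ = C * Real.exp ((a + b) * v) := by rw [add_mul, Real.exp_add]; ring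
  have h2 : ∫ v in (0 : ℝ)..u, C * Real.exp ((a + b) * v) =
      C / (a + b) * (Real.exp ((a + b) * u) - 1) := by
    rw [intervalIntegral.integral_const_mul]
    rw [intervalIntegral.integral_comp_mul_left (fun x => Real.exp x) hab.ne']
    simp [integral_exp]; field_simp
  rw [expInt_eq, abs_mul, Real.abs_exp]
  rw [Real.norm_eq_abs, h2] at h1
  calc Real.exp (-(a * u)) * |∫ v in (0 : ℝ)..u, Real.exp (a * v) * h v|
      ≤ Real.exp (-(a * u)) * (C / (a + b) * (Real.exp ((a + b) * u) - 1)) := by gcongr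
    _ ≤ Real.exp (-(a * u)) * (C / (a + b) * Real.exp ((a + b) * u)) := by gcongr; linarith
    _ = C / (a + b) * Real.exp (b * u) := by
      rw [mul_left_comm, ← Real.exp_add]; ring_nf

theorem rollePair_expInt {h : ℝ → ℝ} (hh : LocInt h) (a : ℝ) :
    RollePair h fun u => Real.exp (a * u) * expInt a h u where
  zero := by simp [expInt_zero]
  exists_sign := by
    intro x y s _ hxy hs
    by_contra! hcon
    have hsub : (∫ v in (0 : ℝ)..y, Real.exp (a * v) * h v) -
        ∫ v in (0 : ℝ)..x, Real.exp (a * v) * h v = ∫ v in x..y, Real.exp (a * v) * h v :=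
      intervalIntegral.integral_interval_sub_left (hh.exp_mul' a 0 y) (hh.exp_mul' a 0 x)
    simp only [exp_mul_expInt] at hs
    rw [hsub, ← intervalIntegral.integral_const_mul] at hs
    refine absurd hs (not_lt.mpr ?_)
    rw [intervalIntegral.integral_of_le hxy.le]
    refine setIntegral_nonpos measurableSet_Ioc fun v hv => ?_
    have := hcon v hv.1 hv.2
    have he := Real.exp_pos (a * v)
    nlinarith

theorem AltEnd.congr_pos {g g' : ℝ → ℝ} {x s : ℝ} {n : ℕ} (h : AltEnd g x n s) {p : ℝ → ℝ}
    (hp : ∀ x, 0 < p x) (hg : ∀ x, g' x = p x * g x) : AltEnd g' x n s := by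
  induction h with
  | @one x s hs hx hq =>
    exact .one hs hx (by rw [hg, mul_left_comm]; exact mul_pos (hp x) hq)
  | @step x y s n _ hxy hy ih =>
    exact ih.step hxy (by rw [hg, mul_left_comm]; exact mul_pos (hp y) hy)

theorem AltBy.of_expInt {h : ℝ → ℝ} (hh : LocInt h) {a t s : ℝ} {n : ℕ}
    (hA : AltBy (expInt a h) t n s) : AltBy h t n s := by
  obtain ⟨x, hx, hA⟩ := hA
  exact ((rollePair_expInt hh a).altBy (hA.congr_pos (p := fun u => Real.exp (a * u))
    (fun _ => Real.exp_pos _) fun _ => rfl)).mono hx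

end

section

open Complex Metric Filter Topology

namespace EntireZeros

theorem exists_factor {f : ℂ → ℂ} (hf : Differentiable ℂ f) (hne : ∀ z, analyticOrderAt f z ≠ ⊤)
    (ρ : ℂ) : ∃ h : ℂ → ℂ, Differentiable ℂ h ∧
      (∀ s, f s = (s - ρ) ^ analyticOrderNatAt f ρ * h s) ∧ h ρ ≠ 0 := by
  obtain ⟨g, hg, hg0, hfg⟩ := (hf.analyticAt ρ).analyticOrderAt_ne_top.1 (hne ρ)
  set m := analyticOrderNatAt f ρ
  refine ⟨Function.update (fun s => f s / (s - ρ) ^ m) ρ (g ρ), ?_, ?_, by simpa using hg0⟩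
  · intro s
    rcases eq_or_ne s ρ with rfl | hs
    · refine (hg.differentiableAt).congr_of_eventuallyEq ?_
      filter_upwards [hfg] with z hz
      rcases eq_or_ne z s with rfl | hz'
      · simp
      · rw [Function.update_of_ne hz', hz, smul_eq_mul, mul_div_cancel_left₀]
        exact pow_ne_zero _ (sub_ne_zero.2 hz')
    · have h1 : DifferentiableAt ℂ (fun s => f s / (s - ρ) ^ m) s :=
        (hf s).div (by fun_prop) (pow_ne_zero _ (sub_ne_zero.2 hs))
      refine h1.congr_of_eventuallyEq ?_
      filter_upwards [isOpen_ne.mem_nhds hs] with z hz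
      exact Function.update_of_ne hz _ _
  · intro s
    rcases eq_or_ne s ρ with rfl | hs
    · simpa using hfg.self_of_nhds
    · rw [Function.update_of_ne hs, mul_div_cancel₀]
      exact pow_ne_zero _ (sub_ne_zero.2 hs)

theorem order_ne_top {f : ℂ → ℂ} (hf : Differentiable ℂ f) (h0 : f 0 ≠ 0) (z : ℂ) :
    analyticOrderAt f z ≠ ⊤ := by
  have hA : AnalyticOnNhd ℂ f Set.univ := fun z _ => hf.analyticAt z
  have := hA.analyticOrderAt_ne_top_of_isPreconnected isPreconnected_univ (Set.mem_univ 0)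
    (Set.mem_univ z)
  apply this
  rw [(hf.analyticAt 0).analyticOrderAt_eq_zero.2 h0]
  simp

theorem finite_zeros {f : ℂ → ℂ} (hf : Differentiable ℂ f) (h0 : f 0 ≠ 0) (R : ℝ) :
    {z | z ∈ closedBall (0 : ℂ) R ∧ f z = 0}.Finite := by
  have hA : AnalyticOnNhd ℂ f Set.univ := fun z _ => hf.analyticAt z
  have h1 := hA.preimage_zero_mem_codiscrete (x := 0) h0
  rw [mem_codiscrete'] at h1
  have hc : IsClosed (f ⁻¹' {0}) := by
    exact isClosed_singleton.preimage hf.continuous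
  have hd : IsDiscrete (f ⁻¹' {0}) := by simpa using h1.2
  have := ((isCompact_closedBall (0 : ℂ) R).inter_right hc).finite (hd.mono Set.inter_subset_right)
  exact this.subset fun z hz => ⟨hz.1, hz.2⟩

theorem analyticOrderNatAt_eq_zero_of_ne {f : ℂ → ℂ} (hf : Differentiable ℂ f) {z : ℂ}
    (hz : f z ≠ 0) : analyticOrderNatAt f z = 0 := by
  simp [analyticOrderNatAt, (hf.analyticAt z).analyticOrderAt_eq_zero.2 hz]

theorem exists_factor_finset {f : ℂ → ℂ} (hf : Differentiable ℂ f) (h0 : f 0 ≠ 0)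
    (S : Finset ℂ) : ∃ h : ℂ → ℂ, Differentiable ℂ h ∧
      (∀ s, f s = (∏ ρ ∈ S, (s - ρ) ^ analyticOrderNatAt f ρ) * h s) ∧ ∀ ρ ∈ S, h ρ ≠ 0 := by
  classical
  induction S using Finset.induction_on with
  | empty => exact ⟨f, hf, by simp, by simp⟩
  | insert a S ha ih =>
    obtain ⟨h, hh, hfh, hS⟩ := ih
    have hP : Differentiable ℂ (fun s => ∏ ρ ∈ S, (s - ρ) ^ analyticOrderNatAt f ρ) := by
      fun_prop
    have hPa : (∏ ρ ∈ S, (a - ρ) ^ analyticOrderNatAt f ρ) ≠ 0 :=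
      Finset.prod_ne_zero_iff.2 fun ρ hρ => pow_ne_zero _
        (sub_ne_zero.2 fun h => ha (h ▸ hρ))
    have hh0 : h 0 ≠ 0 := fun h' => h0 (by rw [hfh, h', mul_zero])
    have hord : analyticOrderNatAt f a = analyticOrderNatAt h a := by
      have h1 : f = (fun s => ∏ ρ ∈ S, (s - ρ) ^ analyticOrderNatAt f ρ) * h := funext hfh
      have h2 := analyticOrderAt_mul (hP.analyticAt a) (hh.analyticAt a)
      rw [← h1, (hP.analyticAt a).analyticOrderAt_eq_zero.2 hPa, zero_add] at h2
      simp [analyticOrderNatAt, h2]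
    obtain ⟨k, hk, hhk, hka⟩ := exists_factor hh (order_ne_top hh hh0) a
    refine ⟨k, hk, fun s => ?_, fun ρ hρ => ?_⟩
    · rw [Finset.prod_insert ha, hfh s, hhk s, hord]; ring
    · rcases Finset.mem_insert.1 hρ with rfl | hρ
      · exact hka
      · intro h'
        exact hS ρ hρ (by rw [hhk, h', mul_zero])

theorem exists_normalized_factor {f : ℂ → ℂ} (hf : Differentiable ℂ f) (h0 : f 0 = 1)
    (S : Finset ℂ) (hS : ∀ ρ ∈ S, f ρ = 0) : ∃ h : ℂ → ℂ, Differentiable ℂ h ∧ h 0 = 1 ∧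
      (∀ s, f s = (∏ ρ ∈ S, (1 - s / ρ) ^ analyticOrderNatAt f ρ) * h s) ∧ ∀ ρ ∈ S, h ρ ≠ 0 := by
  obtain ⟨h, hh, hfh, hS'⟩ := exists_factor_finset hf (by simp [h0]) S
  have hne : ∀ ρ ∈ S, ρ ≠ 0 := fun ρ hρ h' => by
    have := hS ρ hρ; rw [h', h0] at this; exact one_ne_zero this
  have hc : (∏ ρ ∈ S, (-ρ) ^ analyticOrderNatAt f ρ) ≠ 0 :=
    Finset.prod_ne_zero_iff.2 fun ρ hρ => pow_ne_zero _ (neg_ne_zero.2 (hne ρ hρ))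
  have key : ∀ s, f s = (∏ ρ ∈ S, (1 - s / ρ) ^ analyticOrderNatAt f ρ) *
      ((∏ ρ ∈ S, (-ρ) ^ analyticOrderNatAt f ρ) * h s) := by
    intro s
    rw [hfh s, ← mul_assoc, ← Finset.prod_mul_distrib]
    congr 1
    refine Finset.prod_congr rfl fun ρ hρ => ?_
    rw [← mul_pow]; congr 1
    have := hne ρ hρ
    field_simp; ring
  refine ⟨fun s => (∏ ρ ∈ S, (-ρ) ^ analyticOrderNatAt f ρ) * h s, by fun_prop, ?_, key,
    fun ρ hρ => mul_ne_zero hc (hS' ρ hρ)⟩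
  have := key 0
  simpa [h0] using this.symm

/-- The zeros of `f` in the closed ball of radius `R`. -/
noncomputable def zerosIn {f : ℂ → ℂ} (hf : Differentiable ℂ f) (h0 : f 0 = 1) (R : ℝ) :
    Finset ℂ := (finite_zeros hf (by simp [h0]) R).toFinset

theorem mem_zerosIn {f : ℂ → ℂ} (hf : Differentiable ℂ f) (h0 : f 0 = 1) {R : ℝ} {z : ℂ} :
    z ∈ zerosIn hf h0 R ↔ ‖z‖ ≤ R ∧ f z = 0 := by
  simp [zerosIn]

theorem norm_factor_le {f : ℂ → ℂ} (hf : Differentiable ℂ f) (h0 : f 0 = 1) {R B : ℝ}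
    (hR : 0 < R) (hB : ∀ s, ‖s‖ = 4 * R → ‖f s‖ ≤ Real.exp B) {g : ℂ → ℂ}
    (hg : Differentiable ℂ g) (hg0 : g 0 = 1)
    (hfg : ∀ s, f s = (∏ ρ ∈ zerosIn hf h0 R, (1 - s / ρ) ^ analyticOrderNatAt f ρ) * g s) :
    (∀ s, ‖s‖ ≤ 4 * R → ‖g s‖ ≤ Real.exp B) ∧
      (∑ ρ ∈ zerosIn hf h0 R, (analyticOrderNatAt f ρ : ℝ)) ≤ B := by
  set S := zerosIn hf h0 R
  set N := ∑ ρ ∈ S, analyticOrderNatAt f ρ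
  have h3 : ∀ s, ‖s‖ = 4 * R →
      (3 : ℝ) ^ N ≤ ‖∏ ρ ∈ S, (1 - s / ρ) ^ analyticOrderNatAt f ρ‖ := by
    intro s hs
    rw [norm_prod, ← Finset.prod_pow_eq_pow_sum]
    refine Finset.prod_le_prod (fun _ _ => by positivity) fun ρ hρ => ?_
    rw [norm_pow]
    refine pow_le_pow_left₀ (by norm_num) ?_ _
    obtain ⟨h1, h2⟩ := (mem_zerosIn hf h0).1 hρ
    have hρ0 : ρ ≠ 0 := fun h => by rw [h, h0] at h2; exact one_ne_zero h2
    have h4 : 4 ≤ ‖s / ρ‖ := by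
      rw [norm_div, hs, le_div_iff₀ (norm_pos_iff.2 hρ0)]
      linarith
    have := norm_sub_norm_le (s / ρ) 1
    rw [norm_sub_rev, norm_one] at this
    linarith
  have hb : ∀ s, ‖s‖ ≤ 4 * R → ‖g s‖ ≤ Real.exp B / 3 ^ N := by
    intro s hs
    refine norm_le_of_forall_mem_frontier_norm_le (U := ball (0 : ℂ) (4 * R)) isBounded_ball
      hg.diffContOnCl (fun z hz => ?_) ?_
    · rw [frontier_ball _ (by positivity), mem_sphere_zero_iff_norm] at hz
      rw [le_div_iff₀ (by positivity)]
      calc ‖g z‖ * 3 ^ N ≤ ‖g z‖ * ‖∏ ρ ∈ S, (1 - z / ρ) ^ analyticOrderNatAt f ρ‖ := by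
            gcongr; exact h3 z hz
        _ = ‖f z‖ := by rw [hfg z, norm_mul, mul_comm]
        _ ≤ _ := hB z hz
    · rw [closure_ball _ (by positivity)]; simpa using hs
  constructor
  · intro s hs
    refine (hb s hs).trans (div_le_self (Real.exp_pos _).le ?_)
    exact one_le_pow₀ (by norm_num)
  · have := hb 0 (by simp; positivity)
    rw [hg0, norm_one, le_div_iff₀ (by positivity), one_mul] at this
    have h4 := Real.log_le_log (by positivity) this
    rw [Real.log_exp, Real.log_pow] at h4
    have h5 : (1 : ℝ) ≤ Real.log 3 := by
      rw [Real.le_log_iff_exp_le (by norm_num)]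
      exact Real.exp_one_lt_three.le
    have h6 : (N : ℝ) ≤ B := by nlinarith [Nat.cast_nonneg (α := ℝ) N]
    simpa [N] using h6

theorem dist_logDeriv_le {g : ℂ → ℂ} (hg : Differentiable ℂ g) (hg0 : g 0 = 1) {R B : ℝ}
    (hR : 0 < R) (hB : 0 < B) (hb : ∀ s, ‖s‖ < R → ‖g s‖ ≤ Real.exp B)
    (hz : ∀ s, ‖s‖ < R → g s ≠ 0) {s : ℂ} (hs : ‖s‖ < R / 4) :
    ‖logDeriv g s - logDeriv g 0‖ ≤ 68 * B / R ^ 2 * ‖s‖ := by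
  have hL : DifferentiableOn ℂ (logDeriv g) (ball 0 R) := by
    have h1 : Differentiable ℂ (deriv g) := by
      exact (hg.contDiff (n := 2)).differentiable_deriv_two
    exact h1.differentiableOn.div hg.differentiableOn fun x hx => hz x (by simpa using hx)
  obtain ⟨K₀, hK₀⟩ := hL.isExactOn_ball
  set K : ℂ → ℂ := fun z => K₀ z - K₀ 0
  have hK : ∀ z ∈ ball (0 : ℂ) R, HasDerivAt K (logDeriv g z) z :=
    fun z hz => (hK₀ z hz).sub_const _
  have hKd : DifferentiableOn ℂ K (ball 0 R) :=
    fun z hz => (hK z hz).differentiableAt.differentiableWithinAt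
  have hexp : ∀ z ∈ ball (0 : ℂ) R, g z = Complex.exp (K z) := by
    have hconst : ∀ z ∈ ball (0 : ℂ) R, g z * Complex.exp (-K z) = g 0 * Complex.exp (-K 0) := by
      intro z hz'
      refine (convex_ball (0 : ℂ) R).is_const_of_fderivWithin_eq_zero (𝕜 := ℂ)
        (f := fun z => g z * Complex.exp (-K z)) ?_ ?_ hz' (mem_ball_self hR)
      · exact hg.differentiableOn.mul (hKd.neg.cexp)
      · intro x hx
        have hd : HasDerivAt (fun z => g z * Complex.exp (-K z)) 0 x := by
          have h2 := (hg x).hasDerivAt.mul ((hK x hx).neg.cexp)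
          refine h2.congr_deriv ?_
          have := hz x (by simpa using hx)
          have hl : logDeriv g x = deriv g x / g x := rfl
          rw [hl]
          field_simp; ring_nf
        have hf := hd.hasFDerivAt
        rw [hf.hasFDerivWithinAt.fderivWithin (isOpen_ball.uniqueDiffWithinAt hx)]
        ext; simp
    intro z hz'
    have := hconst z hz'
    rw [hg0, Complex.exp_neg] at this
    have hk0 : K 0 = 0 := by simp [K]
    rw [hk0] at this
    have hne := Complex.exp_ne_zero (K z)
    field_simp at this
    simpa using this
  have hre : Set.MapsTo K (ball 0 R) {z | z.re ≤ B} := by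
    intro z hz'
    have := hb z (by simpa using hz')
    rw [hexp z hz', Complex.norm_exp] at this
    exact Real.exp_le_exp.1 this
  have hKb : ∀ z, ‖z‖ ≤ R / 2 → ‖K z‖ ≤ 2 * B := by
    intro z hz'
    have h1 := borelCaratheodory_zero hB hKd hre hR (z := z) (by simp; linarith) (by simp [K])
    refine h1.trans ?_
    rw [div_le_iff₀ (by linarith)]
    nlinarith [norm_nonneg z]
  have hK' : ∀ z, ‖z‖ < R / 4 → ‖logDeriv g z‖ ≤ 8 * B / R := by
    intro z hz'
    have h1 : DiffContOnCl ℂ K (ball z (R / 4)) := by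
      refine DifferentiableOn.diffContOnCl (hKd.mono ?_)
      rw [closure_ball _ (by positivity)]
      intro w hw
      rw [mem_closedBall_iff_norm] at hw
      have := norm_sub_norm_le w z
      simp; linarith
    have h2 := norm_deriv_le_of_forall_mem_sphere_norm_le (by positivity) h1 (C := 2 * B) ?_
    · rw [(hK z (by simp; linarith)).deriv] at h2
      refine h2.trans (le_of_eq ?_)
      field_simp; norm_num
    · intro w hw
      rw [mem_sphere_iff_norm] at hw
      have := norm_sub_norm_le w z
      exact hKb w (by linarith)
  have h1 := dist_le_div_mul_dist_of_mapsTo_ball (f := logDeriv g) (c := (0 : ℂ)) (z := s)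
    (R₁ := R / 4) (R₂ := 17 * B / R)
    (hL.mono (ball_subset_ball (by linarith))) ?_ (by simpa using hs)
  · rw [dist_eq_norm, dist_eq_norm, sub_zero] at h1
    refine h1.trans (le_of_eq ?_)
    field_simp; ring
  · intro w hw
    have hb1 := hK' w (by simpa using hw)
    have hb2 := hK' 0 (by simpa using hR)
    have h3 := norm_sub_le (logDeriv g w) (logDeriv g 0)
    rw [mem_closedBall_iff_norm]
    refine h3.trans ?_
    have : 17 * B / R = 8 * B / R + 8 * B / R + B / R := by ring
    have hpos : 0 < B / R := by positivity
    linarith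


theorem sum_order_le {f : ℂ → ℂ} (hf : Differentiable ℂ f) (h0 : f 0 = 1) {C : ℝ}
    (hgrow : ∀ R : ℝ, 1 ≤ R → ∀ s, ‖s‖ ≤ R → ‖f s‖ ≤ Real.exp (C * R ^ (3 / 2 : ℝ)))
    {R : ℝ} (hR : 1 ≤ R) :
    (∑ ρ ∈ zerosIn hf h0 R, (analyticOrderNatAt f ρ : ℝ)) ≤ C * (4 * R) ^ (3 / 2 : ℝ) := by
  obtain ⟨g, hg, hg0, hfg, -⟩ := exists_normalized_factor hf h0 (zerosIn hf h0 R)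
    fun ρ hρ => ((mem_zerosIn hf h0).1 hρ).2
  exact (norm_factor_le hf h0 (by linarith) (fun s hs => hgrow (4 * R) (by linarith) s hs.le)
    hg hg0 hfg).2

theorem finite_support_order {f : ℂ → ℂ} (hf : Differentiable ℂ f) (h0 : f 0 = 1) (R : ℝ)
    {ρ : ℂ} (h1 : ‖ρ‖ ≤ R) (h2 : analyticOrderNatAt f ρ ≠ 0) : ρ ∈ zerosIn hf h0 R := by
  rw [mem_zerosIn]
  refine ⟨h1, ?_⟩
  by_contra h
  exact h2 (analyticOrderNatAt_eq_zero_of_ne hf h)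

theorem summable_order_div_sq {f : ℂ → ℂ} (hf : Differentiable ℂ f) (h0 : f 0 = 1) {C : ℝ}
    (hgrow : ∀ R : ℝ, 1 ≤ R → ∀ s, ‖s‖ ≤ R → ‖f s‖ ≤ Real.exp (C * R ^ (3 / 2 : ℝ))) :
    Summable fun ρ : ℂ => (analyticOrderNatAt f ρ : ℝ) / ‖ρ‖ ^ 2 := by
  classical
  set a : ℂ → ℝ := fun ρ => if ‖ρ‖ < 1 then 0 else (analyticOrderNatAt f ρ : ℝ) / ‖ρ‖ ^ 2
  have hgeo : Summable fun k : ℕ => C * 8 * ((2 : ℝ) ^ (-(1 / 2) : ℝ)) ^ k :=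
    (summable_geometric_of_lt_one (by positivity)
      (Real.rpow_lt_one_of_one_lt_of_neg (by norm_num) (by norm_num))).mul_left _
  have ha : Summable a := by
    refine summable_of_sum_le (c := 4 * ∑' k : ℕ, C * 8 * ((2 : ℝ) ^ (-(1 / 2) : ℝ)) ^ k)
      (fun ρ => by dsimp only [a]; split_ifs <;> positivity) fun T => ?_
    obtain ⟨K, hK⟩ : ∃ K : ℕ, ∀ ρ ∈ T, ‖ρ‖ ≤ (2 : ℝ) ^ K := by
      induction T using Finset.induction_on with
      | empty => exact ⟨0, by simp⟩
      | insert b T hb ih =>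
        obtain ⟨K, hK⟩ := ih
        obtain ⟨K', hK'⟩ := pow_unbounded_of_one_lt ‖b‖ (one_lt_two (α := ℝ))
        refine ⟨max K K', fun ρ hρ => ?_⟩
        rcases Finset.mem_insert.1 hρ with rfl | hρ
        · exact hK'.le.trans (pow_le_pow_right₀ (by norm_num) (le_max_right _ _))
        · exact (hK ρ hρ).trans (pow_le_pow_right₀ (by norm_num) (le_max_left _ _))
    have hterm : ∀ ρ ∈ T, a ρ ≤ 4 * ∑ k ∈ Finset.range (K + 1),
        if ‖ρ‖ ≤ 2 ^ k then (analyticOrderNatAt f ρ : ℝ) * (1 / 4) ^ k else 0 := by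
      intro ρ hρ
      dsimp only [a]
      have hnn : ∀ k ∈ Finset.range (K + 1), (0 : ℝ) ≤
          if ‖ρ‖ ≤ 2 ^ k then (analyticOrderNatAt f ρ : ℝ) * (1 / 4) ^ k else 0 :=
        fun k _ => by split_ifs <;> positivity
      split_ifs with h
      · exact mul_nonneg (by norm_num) (Finset.sum_nonneg hnn)
      · push Not at h
        have hex : ∃ k, ‖ρ‖ ≤ (2 : ℝ) ^ k := ⟨K, hK ρ hρ⟩
        have hmem : Nat.find hex ∈ Finset.range (K + 1) :=
          Finset.mem_range.2 (Nat.lt_succ_of_le (Nat.find_min' hex (hK ρ hρ)))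
        have h1 := Finset.single_le_sum hnn hmem
        rw [if_pos (Nat.find_spec hex)] at h1
        refine le_trans ?_ (mul_le_mul_of_nonneg_left h1 (by norm_num))
        have h2 : (2 : ℝ) ^ Nat.find hex ≤ 2 * ‖ρ‖ := by
          rcases Nat.eq_zero_or_pos (Nat.find hex) with h3 | h3
          · rw [h3]; linarith
          · have h4 := Nat.find_min hex (Nat.sub_lt h3 one_pos)
            push Not at h4
            rw [← Nat.sub_add_cancel h3, pow_succ]
            simp only [Nat.succ_eq_add_one, zero_add] at *
            linarith
        have h5 : 1 / ‖ρ‖ ^ 2 ≤ 4 * (1 / 4) ^ Nat.find hex := by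
          have h6 : (4 : ℝ) ^ Nat.find hex ≤ 4 * ‖ρ‖ ^ 2 := by
            calc (4 : ℝ) ^ Nat.find hex = (2 ^ Nat.find hex) ^ 2 := by
                  rw [← pow_mul, mul_comm, pow_mul]; norm_num
              _ ≤ (2 * ‖ρ‖) ^ 2 := by gcongr
              _ = _ := by ring
          rw [one_div_pow, mul_one_div, div_le_div_iff₀ (by positivity) (by positivity)]
          linarith
        calc (analyticOrderNatAt f ρ : ℝ) / ‖ρ‖ ^ 2
            = (analyticOrderNatAt f ρ : ℝ) * (1 / ‖ρ‖ ^ 2) := by ring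
          _ ≤ (analyticOrderNatAt f ρ : ℝ) * (4 * (1 / 4) ^ Nat.find hex) := by gcongr
          _ = _ := by ring
    calc ∑ ρ ∈ T, a ρ ≤ ∑ ρ ∈ T, 4 * ∑ k ∈ Finset.range (K + 1),
          (if ‖ρ‖ ≤ 2 ^ k then (analyticOrderNatAt f ρ : ℝ) * (1 / 4) ^ k else 0) :=
          Finset.sum_le_sum hterm
      _ = 4 * ∑ k ∈ Finset.range (K + 1), ∑ ρ ∈ T,
          (if ‖ρ‖ ≤ 2 ^ k then (analyticOrderNatAt f ρ : ℝ) * (1 / 4) ^ k else 0) := by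
          rw [← Finset.mul_sum, Finset.sum_comm]
      _ ≤ 4 * ∑ k ∈ Finset.range (K + 1), C * 8 * ((2 : ℝ) ^ (-(1 / 2) : ℝ)) ^ k := by
          gcongr with k _
          have h1 := sum_order_le hf h0 hgrow (one_le_pow₀ (one_le_two (α := ℝ)) : (1 : ℝ) ≤ 2 ^ k)
          have h2 : ∑ ρ ∈ T,
              (if ‖ρ‖ ≤ 2 ^ k then (analyticOrderNatAt f ρ : ℝ) * (1 / 4) ^ k else 0) ≤
              ∑ ρ ∈ zerosIn hf h0 (2 ^ k), (analyticOrderNatAt f ρ : ℝ) * (1 / 4) ^ k := by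
            rw [← Finset.sum_filter]
            rw [← Finset.sum_filter_ne_zero]
            refine Finset.sum_le_sum_of_subset_of_nonneg (fun ρ hρ => ?_)
              fun _ _ _ => by positivity
            rw [Finset.mem_filter, Finset.mem_filter] at hρ
            refine finite_support_order hf h0 _ hρ.1.2 fun h => hρ.2 ?_
            simp [h]
          refine h2.trans ?_
          rw [← Finset.sum_mul]
          calc _ ≤ C * (4 * 2 ^ k) ^ (3 / 2 : ℝ) * (1 / 4) ^ k := by gcongr
            _ = _ := by
              rw [Real.mul_rpow (by norm_num) (by positivity)]
              have e1 : (4 : ℝ) ^ (3 / 2 : ℝ) = 8 := by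
                rw [show (4 : ℝ) = 2 ^ (2 : ℝ) by norm_num, ← Real.rpow_mul (by norm_num)]
                norm_num
              have e2 : ((2 : ℝ) ^ k) ^ (3 / 2 : ℝ) * (1 / 4) ^ k =
                  ((2 : ℝ) ^ (-(1 / 2) : ℝ)) ^ k := by
                rw [← Real.rpow_natCast, ← Real.rpow_natCast, ← Real.rpow_natCast,
                  show (1 / 4 : ℝ) = 2 ^ (-2 : ℝ) by norm_num [Real.rpow_neg],
                  ← Real.rpow_mul (by norm_num), ← Real.rpow_mul (by norm_num),
                  ← Real.rpow_mul (by norm_num), ← Real.rpow_add (by norm_num)]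
                congr 1; ring
              rw [e1, mul_assoc, mul_assoc, e2, mul_assoc]
      _ ≤ _ := by
          gcongr
          refine hgeo.sum_le_tsum _ fun k _ => ?_
          have hC : 0 ≤ C := by
            have := sum_order_le hf h0 hgrow le_rfl
            have h2 : 0 ≤ C * (4 * 1 : ℝ) ^ (3 / 2 : ℝ) :=
              (Finset.sum_nonneg fun _ _ => Nat.cast_nonneg _).trans this
            exact nonneg_of_mul_nonneg_left h2 (by positivity)
          positivity
  refine ha.congr_cofinite ?_
  rw [Filter.EventuallyEq, Filter.eventually_cofinite]
  refine (zerosIn hf h0 1).finite_toSet.subset fun ρ hρ => ?_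
  have hρ : ¬ (a ρ = _) := hρ
  dsimp only [a] at hρ
  split_ifs at hρ with h
  · exact finite_support_order hf h0 1 h.le fun h' => hρ (by simp [h'])
  · exact absurd rfl hρ

theorem hasSum_logDeriv {f : ℂ → ℂ} (hf : Differentiable ℂ f) (h0 : f 0 = 1) {C : ℝ}
    (hC : 0 < C)
    (hgrow : ∀ R : ℝ, 1 ≤ R → ∀ s, ‖s‖ ≤ R → ‖f s‖ ≤ Real.exp (C * R ^ (3 / 2 : ℝ)))
    {s : ℂ} (hs : f s ≠ 0) :
    HasSum (fun ρ : ℂ => (analyticOrderNatAt f ρ : ℂ) * (1 / (s - ρ) + 1 / ρ))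
      (logDeriv f s - logDeriv f 0) := by
  have hsum : Summable (fun ρ : ℂ => (analyticOrderNatAt f ρ : ℂ) * (1 / (s - ρ) + 1 / ρ)) := by
    refine Summable.of_norm_bounded_eventually
      (g := fun ρ : ℂ => 2 * ‖s‖ * ((analyticOrderNatAt f ρ : ℝ) / ‖ρ‖ ^ 2))
      ((summable_order_div_sq hf h0 hgrow).mul_left _) ?_
    rw [Filter.eventually_cofinite]
    refine (zerosIn hf h0 (2 * ‖s‖)).finite_toSet.subset fun ρ hρ => ?_
    by_contra hcon
    apply hρ
    by_cases hm : analyticOrderNatAt f ρ = 0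
    · simp [hm]
    have hbig : 2 * ‖s‖ < ‖ρ‖ := by
      by_contra h; push Not at h
      exact hcon (finite_support_order hf h0 _ h hm)
    have hρ0 : 0 < ‖ρ‖ := lt_of_le_of_lt (by positivity) hbig
    have hd : ‖ρ‖ / 2 ≤ ‖s - ρ‖ := by
      have := norm_sub_norm_le ρ s
      rw [norm_sub_rev] at this; linarith
    have hsρ : s - ρ ≠ 0 := norm_pos_iff.1 (by linarith)
    have e : 1 / (s - ρ) + 1 / ρ = s / ((s - ρ) * ρ) := by
      have : ρ ≠ 0 := norm_pos_iff.1 hρ0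
      field_simp; ring
    rw [e, norm_mul, norm_div, norm_mul, Complex.norm_natCast]
    calc (analyticOrderNatAt f ρ : ℝ) * (‖s‖ / (‖s - ρ‖ * ‖ρ‖))
        ≤ (analyticOrderNatAt f ρ : ℝ) * (‖s‖ / (‖ρ‖ / 2 * ‖ρ‖)) := by gcongr
      _ = _ := by field_simp
  have hlim := hsum.hasSum
  convert hlim using 1
  set t : ℕ → Finset ℂ := fun n => zerosIn hf h0 (n : ℝ)
  set F := fun ρ : ℂ => (analyticOrderNatAt f ρ : ℂ) * (1 / (s - ρ) + 1 / ρ)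
  have h1 : Tendsto (fun n => ∑ ρ ∈ t n, F ρ) atTop (𝓝 (∑' ρ, F ρ)) := by
    have hE : ∀ n, ∑ ρ ∈ t n, F ρ = ∑' ρ, Set.indicator (closedBall (0 : ℂ) n) F ρ := by
      intro n
      rw [tsum_eq_sum (s := t n)]
      · refine Finset.sum_congr rfl fun ρ hρ => ?_
        rw [Set.indicator_of_mem]
        simpa using ((mem_zerosIn hf h0).1 hρ).1
      · intro ρ hρ
        by_cases h : ρ ∈ closedBall (0 : ℂ) n
        · rw [Set.indicator_of_mem h]
          by_contra hne
          refine hρ (finite_support_order hf h0 _ (by simpa using h) fun h' => hne ?_)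
          simp [F, h']
        · rw [Set.indicator_of_notMem h]
    simp_rw [hE]
    refine tendsto_tsum_of_dominated_convergence hsum.norm (fun ρ => ?_) (.of_forall fun n ρ => ?_)
    · refine tendsto_const_nhds.congr' ?_
      filter_upwards [eventually_ge_atTop ⌈‖ρ‖⌉₊] with n hn
      rw [Set.indicator_of_mem]
      simpa using (Nat.le_ceil _).trans (Nat.cast_le.2 hn)
    · exact norm_indicator_le_norm_self _ _
  refine tendsto_nhds_unique ?_ h1
  rw [tendsto_iff_norm_sub_tendsto_zero]
  have hbound : Tendsto (fun n : ℕ => 68 * (C * 8) * ‖s‖ * ((n : ℝ) ^ (1 / 2 : ℝ))⁻¹) atTop (𝓝 0) := by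
    have := ((tendsto_rpow_atTop (by norm_num : (0 : ℝ) < 1 / 2)).comp
      tendsto_natCast_atTop_atTop).inv_tendsto_atTop.const_mul (68 * (C * 8) * ‖s‖)
    simpa using this
  refine squeeze_zero' (.of_forall fun _ => norm_nonneg _) ?_ hbound
  filter_upwards [eventually_ge_atTop 1, eventually_gt_atTop ⌈4 * ‖s‖⌉₊] with n hn1 hn2
  have hn1' : (1 : ℝ) ≤ n := by exact_mod_cast hn1
  have hn2' : ‖s‖ < n / 4 := by
    have := Nat.lt_of_ceil_lt hn2
    linarith
  obtain ⟨g, hg, hg0, hfg, hgS⟩ := exists_normalized_factor hf h0 (t n)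
    fun ρ hρ => ((mem_zerosIn hf h0).1 hρ).2
  have hgb := (norm_factor_le hf h0 (by linarith : (0 : ℝ) < n)
    (fun s hs => hgrow (4 * n) (by linarith) s hs.le) hg hg0 hfg).1
  have hgz : ∀ z, ‖z‖ < n → g z ≠ 0 := by
    intro z hz hgz
    have : f z = 0 := by rw [hfg, hgz, mul_zero]
    exact hgS z ((mem_zerosIn hf h0).2 ⟨hz.le, this⟩) hgz
  have hlog : ∀ z, f z ≠ 0 →
      logDeriv f z = ∑ ρ ∈ t n, (analyticOrderNatAt f ρ : ℂ) * (1 / (z - ρ)) + logDeriv g z := by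
    intro z hz
    have hfun : f = fun z => (∏ ρ ∈ t n, (1 - z / ρ) ^ analyticOrderNatAt f ρ) * g z := funext hfg
    have hP : ∏ ρ ∈ t n, (1 - z / ρ) ^ analyticOrderNatAt f ρ ≠ 0 := fun h => hz (by
      rw [hfg, h, zero_mul])
    have hgz' : g z ≠ 0 := fun h => hz (by rw [hfg, h, mul_zero])
    conv_lhs => rw [hfun]
    rw [logDeriv_mul z hP hgz' (by fun_prop) (hg z)]
    congr 1
    rw [logDeriv_prod (fun ρ hρ => Finset.prod_ne_zero_iff.1 hP ρ hρ) (by fun_prop)]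
    refine Finset.sum_congr rfl fun ρ hρ => ?_
    rw [logDeriv_fun_pow (by fun_prop)]
    congr 1
    have hρ0 : ρ ≠ 0 := fun h => by
      have := ((mem_zerosIn hf h0).1 hρ).2; rw [h, h0] at this; exact one_ne_zero this
    have hzρ : z - ρ ≠ 0 := sub_ne_zero.2 fun h => hz (h ▸ ((mem_zerosIn hf h0).1 hρ).2)
    have hd : HasDerivAt (fun z : ℂ => 1 - z / ρ) (-(1 / ρ)) z := by
      simpa using ((hasDerivAt_id z).div_const ρ).const_sub 1
    rw [logDeriv_apply, hd.deriv]
    have hρz : ρ - z ≠ 0 := sub_ne_zero.2 (sub_ne_zero.1 hzρ).symm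
    rw [show 1 - z / ρ = (ρ - z) / ρ by field_simp]
    field_simp
    ring
  have hfin : logDeriv f s - logDeriv f 0 - ∑ ρ ∈ t n, F ρ = logDeriv g s - logDeriv g 0 := by
    rw [hlog s hs, hlog 0 (by simp [h0])]
    have : ∑ ρ ∈ t n, F ρ = ∑ ρ ∈ t n, (analyticOrderNatAt f ρ : ℂ) * (1 / (s - ρ)) -
        ∑ ρ ∈ t n, (analyticOrderNatAt f ρ : ℂ) * (1 / (0 - ρ)) := by
      rw [← Finset.sum_sub_distrib]
      refine Finset.sum_congr rfl fun ρ _ => ?_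
      simp only [F, zero_sub, div_neg]; ring
    rw [this]; ring
  rw [norm_sub_rev, hfin]
  refine (dist_logDeriv_le hg hg0 (by linarith : (0 : ℝ) < n) (B := C * (4 * n) ^ (3 / 2 : ℝ))
    (by positivity) (fun z hz => hgb z (by linarith)) hgz hn2').trans (le_of_eq ?_)
  have e1 : (4 : ℝ) ^ (3 / 2 : ℝ) = 8 := by
    rw [show (4 : ℝ) = 2 ^ (2 : ℝ) by norm_num, ← Real.rpow_mul (by norm_num)]
    norm_num
  have e2 : (n : ℝ) ^ 2 = (n : ℝ) ^ (3 / 2 : ℝ) * (n : ℝ) ^ (1 / 2 : ℝ) := by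
    rw [← Real.rpow_add (by linarith)]; norm_num
  rw [Real.mul_rpow (by norm_num) (by linarith), e1, e2]
  have : (n : ℝ) ^ (3 / 2 : ℝ) ≠ 0 := by positivity
  have : (n : ℝ) ^ (1 / 2 : ℝ) ≠ 0 := by positivity
  field_simp

end EntireZeros

end

section

open Complex Filter Topology Set MeasureTheory HurwitzZeta

/-- The entire function `s (s - 1) π^(-s/2) Γ(s/2) ζ(s)`. -/
noncomputable def xiFun (s : ℂ) : ℂ := 1 + s * (s - 1) * completedRiemannZeta₀ s

namespace xiFun

theorem differentiable : Differentiable ℂ xiFun := by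
  unfold xiFun
  have := differentiable_completedZeta₀
  fun_prop

theorem zero : xiFun 0 = 1 := by simp [xiFun]

theorem one : xiFun 1 = 1 := by simp [xiFun]

theorem one_sub (s : ℂ) : xiFun (1 - s) = xiFun s := by
  rw [xiFun, xiFun, completedRiemannZeta₀_one_sub]; ring

theorem eq_completed {s : ℂ} (h0 : s ≠ 0) (h1 : s ≠ 1) :
    xiFun s = s * (s - 1) * completedRiemannZeta s := by
  have : 1 - s ≠ 0 := sub_ne_zero.2 h1.symm
  rw [completedRiemannZeta_eq, xiFun]
  field_simp
  ring

theorem eq_zeta {s : ℂ} (h0 : s ≠ 0) (h1 : s ≠ 1) (hG : Gammaℝ s ≠ 0) :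
    xiFun s = s * (s - 1) * Gammaℝ s * riemannZeta s := by
  rw [eq_completed h0 h1, riemannZeta_def_of_ne_zero h0]
  field_simp

theorem ne_zero_of_one_le_re {s : ℂ} (hs : 1 ≤ s.re) : xiFun s ≠ 0 := by
  rcases eq_or_ne s 1 with rfl | h1
  · simp [one]
  have h0 : s ≠ 0 := fun h => by norm_num [h] at hs
  have hG : Gammaℝ s ≠ 0 := Gammaℝ_ne_zero_of_re_pos (by linarith)
  rw [eq_zeta h0 h1 hG]
  exact mul_ne_zero (mul_ne_zero (mul_ne_zero h0 (sub_ne_zero.2 h1)) hG)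
    (riemannZeta_ne_zero_of_one_le_re hs)

theorem re_mem_of_eq_zero {s : ℂ} (hs : xiFun s = 0) : 0 < s.re ∧ s.re < 1 := by
  constructor
  · by_contra! h
    refine ne_zero_of_one_le_re (s := 1 - s) ?_ (by rw [one_sub, hs])
    simp; linarith
  · by_contra! h
    exact ne_zero_of_one_le_re h hs

theorem eq_zero_iff {s : ℂ} : xiFun s = 0 ↔ riemannZeta s = 0 ∧ 0 < s.re ∧ s.re < 1 := by
  constructor
  · intro h
    have hre := re_mem_of_eq_zero h
    have h0 : s ≠ 0 := fun h => by simp [h] at hre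
    have h1 : s ≠ 1 := fun h => by simp [h] at hre
    have hG : Gammaℝ s ≠ 0 := Gammaℝ_ne_zero_of_re_pos hre.1
    rw [eq_zeta h0 h1 hG] at h
    refine ⟨?_, hre⟩
    exact (mul_eq_zero.1 h).resolve_left
      (mul_ne_zero (mul_ne_zero h0 (sub_ne_zero.2 h1)) hG)
  · rintro ⟨h, hre⟩
    have h0 : s ≠ 0 := fun h => by simp [h] at hre
    have h1 : s ≠ 1 := fun h => by simp [h] at hre
    have hG : Gammaℝ s ≠ 0 := Gammaℝ_ne_zero_of_re_pos hre.1
    rw [eq_zeta h0 h1 hG, h, mul_zero]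

theorem norm_kernel_le : ∃ C p : ℝ, 0 < C ∧ 0 < p ∧
    ∀ t : ℝ, 1 ≤ t → ‖(hurwitzEvenFEPair 0).f_modif t‖ ≤ C * Real.exp (-p * t) := by
  obtain ⟨p, hp, hO⟩ := isBigO_atTop_evenKernel_sub 0
  obtain ⟨c, hc, hO⟩ := hO.exists_pos
  obtain ⟨A, hA⟩ := eventually_atTop.1 hO.bound
  have hcont : ContinuousOn (fun t : ℝ => ‖evenKernel 0 t - 1‖) (Icc 1 (max A 1)) :=
    (((continuousOn_evenKernel 0).mono fun t ht => lt_of_lt_of_le one_pos ht.1).sub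
      continuousOn_const).norm
  obtain ⟨B, hB⟩ := isCompact_Icc.bddAbove_image hcont
  have hB' : ∀ t, 1 ≤ t → t ≤ max A 1 → ‖evenKernel 0 t - 1‖ ≤ max B 0 := fun t h1 h2 =>
    (hB (mem_image_of_mem _ ⟨h1, h2⟩)).trans (le_max_left _ _)
  refine ⟨c + max B 0 * Real.exp (p * max A 1), p, by positivity, hp, fun t ht => ?_⟩
  rcases ht.eq_or_lt with rfl | ht1
  · have : (hurwitzEvenFEPair 0).f_modif 1 = 0 := by simp [WeakFEPair.f_modif]
    rw [this, norm_zero]; positivity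
  have h1 : (hurwitzEvenFEPair 0).f_modif t = ((evenKernel 0 t - 1 : ℝ) : ℂ) := by
    simp [WeakFEPair.f_modif, ht1, not_lt.2 ht1.le, hurwitzEvenFEPair]
  rw [h1, Complex.norm_real]
  rcases le_total t (max A 1) with h | h
  · refine (hB' t ht h).trans ?_
    have e1 : 1 ≤ Real.exp (p * max A 1) * Real.exp (-p * t) := by
      rw [← Real.exp_add]; apply Real.one_le_exp; nlinarith
    have : 0 ≤ c * Real.exp (-p * t) := by positivity
    nlinarith [le_max_right B 0]
  · have := hA t ((le_max_left _ _).trans h)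
    simp only [Real.norm_eq_abs, Real.abs_exp] at this
    rw [Real.norm_eq_abs]
    refine this.trans ?_
    gcongr
    exact le_add_of_nonneg_right (by positivity)

theorem pow_le_exp {p R t : ℝ} (hp : 0 < p) (hR : 0 < R) (ht : 0 < t) :
    t ^ R ≤ (2 * R / p) ^ R * Real.exp (p / 2 * t) := by
  have h1 : t ≤ 2 * R / p * Real.exp (p / (2 * R) * t) := by
    have := Real.add_one_le_exp (p / (2 * R) * t)
    calc t = 2 * R / p * (p / (2 * R) * t) := by field_simp
      _ ≤ _ := by gcongr; linarith
  calc t ^ R ≤ (2 * R / p * Real.exp (p / (2 * R) * t)) ^ R := by gcongr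
    _ = _ := by
      rw [Real.mul_rpow (by positivity) (by positivity), ← Real.exp_mul]
      congr 2; field_simp

theorem norm_completed_le : ∃ K p : ℝ, 0 < K ∧ 0 < p ∧ ∀ R : ℝ, 1 ≤ R → ∀ s : ℂ, ‖s‖ ≤ R →
    ‖completedRiemannZeta₀ s‖ ≤ K * (2 * (R + 2) / p) ^ (R + 2) := by
  obtain ⟨C, p, hC, hp, hb⟩ := norm_kernel_le
  refine ⟨C * Real.exp (p / 2) * (2 / p), p, by positivity, hp, fun R hR s hs => ?_⟩
  have hsre : |(s / 2).re| ≤ R := by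
    refine (abs_re_le_norm _).trans ?_
    rw [norm_div]; simp
    linarith [norm_nonneg s]
  set σ := (s / 2).re with hσ
  set B := (2 * (R + 2) / p) ^ (R + 2) with hBdef
  have hBpos : 0 < B := by positivity
  have habs := abs_le.1 hsre
  have hpt : ∀ t ∈ Ioi (0 : ℝ), ‖(t : ℂ) ^ (s / 2 - 1) • (hurwitzEvenFEPair 0).f_modif t‖ ≤
      C * Real.exp (p / 2) * B * Real.exp (-(p / 2) * t) := by
    intro t ht
    have ht : 0 < t := ht
    rw [norm_smul, norm_cpow_eq_rpow_re_of_pos ht, sub_re, one_re, ← hσ]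
    rcases le_total 1 t with h1 | h1
    · have e1 := hb t h1
      have e2 := pow_le_exp hp (by linarith : 0 < R + 2) ht
      have e3 : t ^ (σ - 1) ≤ t ^ (R + 2) :=
        Real.rpow_le_rpow_of_exponent_le h1 (by linarith)
      have e4 : 1 ≤ Real.exp (p / 2) := Real.one_le_exp (by positivity)
      calc t ^ (σ - 1) * ‖(hurwitzEvenFEPair 0).f_modif t‖
          ≤ (B * Real.exp (p / 2 * t)) * (C * Real.exp (-p * t)) := by
            gcongr; exact e3.trans e2
        _ = C * 1 * B * (Real.exp (p / 2 * t) * Real.exp (-p * t)) := by ring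
        _ = C * 1 * B * Real.exp (-(p / 2) * t) := by rw [← Real.exp_add]; ring_nf
        _ ≤ _ := by gcongr
    · have hFE := (hurwitzEvenFEPair 0).hf_modif_FE (1 / t) (by positivity)
      have hsymm : (hurwitzEvenFEPair 0).g_modif = (hurwitzEvenFEPair 0).f_modif := by
        have h2 : (hurwitzEvenFEPair 0).symm.f_modif = (hurwitzEvenFEPair 0).f_modif := by
          rw [hurwitzEvenFEPair_zero_symm]
        exact h2
      rw [hsymm, one_div_one_div] at hFE
      have hk : (hurwitzEvenFEPair 0).k = 1 / 2 := rfl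
      have hε : (hurwitzEvenFEPair 0).ε = 1 := rfl
      rw [hFE, hk, hε, norm_smul, one_mul, Complex.norm_real, Real.norm_eq_abs,
        abs_of_nonneg (by positivity)]
      set y := 1 / t
      have hy : 1 ≤ y := (one_le_div ht).2 h1
      have hy0 : 0 < y := by linarith
      have e1 := hb y hy
      have e2 := pow_le_exp hp (by linarith : 0 < R + 2) hy0
      have e3 : t ^ (σ - 1) * y ^ (1 / 2 : ℝ) ≤ y ^ (R + 2) := by
        have : t = y⁻¹ := by simp [y]
        rw [this, Real.inv_rpow hy0.le, ← Real.rpow_neg hy0.le, ← Real.rpow_add hy0]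
        exact Real.rpow_le_rpow_of_exponent_le hy (by linarith)
      have e4 : 1 ≤ Real.exp (p / 2) * Real.exp (-(p / 2) * t) := by
        rw [← Real.exp_add]; apply Real.one_le_exp; nlinarith
      calc t ^ (σ - 1) * (y ^ (1 / 2 : ℝ) * ‖(hurwitzEvenFEPair 0).f_modif y‖)
          = (t ^ (σ - 1) * y ^ (1 / 2 : ℝ)) * ‖(hurwitzEvenFEPair 0).f_modif y‖ := by ring
        _ ≤ (B * Real.exp (p / 2 * y)) * (C * Real.exp (-p * y)) :=
            mul_le_mul (e3.trans e2) e1 (norm_nonneg _) (by positivity)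
        _ = C * B * (Real.exp (p / 2 * y) * Real.exp (-p * y)) := by ring
        _ = C * B * Real.exp (-(p / 2) * y) := by rw [← Real.exp_add]; ring_nf
        _ ≤ C * B * 1 := by
            gcongr; apply Real.exp_le_one_iff.2; nlinarith
        _ ≤ C * B * (Real.exp (p / 2) * Real.exp (-(p / 2) * t)) := by gcongr
        _ = _ := by ring
  have hInteg : IntegrableOn (fun t : ℝ => C * Real.exp (p / 2) * B * Real.exp (-(p / 2) * t))
      (Ioi 0) :=
    (integrableOn_exp_mul_Ioi (by linarith : -(p / 2) < 0) 0).const_mul _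
  have hmain := norm_integral_le_of_norm_le hInteg
    ((ae_restrict_iff' measurableSet_Ioi).2 (.of_forall hpt))
  have hval : ∫ t in Ioi (0 : ℝ), C * Real.exp (p / 2) * B * Real.exp (-(p / 2) * t) =
      C * Real.exp (p / 2) * (2 / p) * B := by
    rw [integral_const_mul, integral_exp_mul_Ioi (by linarith : -(p / 2) < 0)]
    simp; field_simp
  rw [hval] at hmain
  have hdef : completedRiemannZeta₀ s =
      (∫ t in Ioi (0 : ℝ), (t : ℂ) ^ (s / 2 - 1) • (hurwitzEvenFEPair 0).f_modif t) / 2 := rfl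
  rw [hdef, norm_div]
  have : ‖(2 : ℂ)‖ = 2 := by simp
  rw [this]
  have h0 : 0 ≤ C * Real.exp (p / 2) * (2 / p) * B := by positivity
  linarith

theorem growth : ∃ C : ℝ, 0 < C ∧ ∀ R : ℝ, 1 ≤ R → ∀ s, ‖s‖ ≤ R →
    ‖xiFun s‖ ≤ Real.exp (C * R ^ (3 / 2 : ℝ)) := by
  obtain ⟨K, p, hK, hp, hb⟩ := norm_completed_le
  set c := 6 * (6 / p) ^ (1 / 2 : ℝ)
  refine ⟨2 + 2 * K + c, by positivity, fun R hR s hs => ?_⟩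
  have hR0 : 0 < R := by linarith
  have hR1 : R ≤ R ^ (3 / 2 : ℝ) := by
    conv_lhs => rw [← Real.rpow_one R]
    exact Real.rpow_le_rpow_of_exponent_le hR (by norm_num)
  have h1 : (2 * (R + 2) / p) ^ (R + 2) ≤ Real.exp (c * R ^ (3 / 2 : ℝ)) := by
    rw [Real.rpow_def_of_pos (by positivity), Real.exp_le_exp]
    have e1 : Real.log (2 * (R + 2) / p) ≤ 2 * (6 / p) ^ (1 / 2 : ℝ) * R ^ (1 / 2 : ℝ) := by
      have e2 : Real.log (2 * (R + 2) / p) ≤ Real.log (6 / p * R) := by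
        apply Real.log_le_log (by positivity)
        rw [div_mul_eq_mul_div]; gcongr 1; linarith
      refine e2.trans ((Real.log_le_rpow_div (by positivity) (by norm_num : (0 : ℝ) < 1 / 2)).trans
        (le_of_eq ?_))
      rw [Real.mul_rpow (by positivity) hR0.le]; ring
    have e3 : R ^ (3 / 2 : ℝ) = R ^ (1 / 2 : ℝ) * R := by
      rw [← Real.rpow_add_one hR0.ne']; norm_num
    calc Real.log (2 * (R + 2) / p) * (R + 2)
        ≤ (2 * (6 / p) ^ (1 / 2 : ℝ) * R ^ (1 / 2 : ℝ)) * (3 * R) := by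
          gcongr; linarith
      _ = _ := by rw [e3]; ring
  have h2 : ‖xiFun s‖ ≤ 1 + R * (R + 1) * (K * (2 * (R + 2) / p) ^ (R + 2)) := by
    refine (norm_add_le _ _).trans ?_
    rw [norm_one, norm_mul, norm_mul]
    gcongr
    · exact (norm_sub_le _ _).trans (by rw [norm_one]; linarith)
    · exact hb R hR s hs
  refine h2.trans ?_
  set E := Real.exp (c * R ^ (3 / 2 : ℝ))
  have hE : 1 ≤ E := Real.one_le_exp (by positivity)
  have h3 : R ^ 2 ≤ Real.exp (2 * R ^ (3 / 2 : ℝ)) := by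
    have : R ≤ Real.exp R := by linarith [Real.add_one_le_exp R]
    calc R ^ 2 ≤ (Real.exp R) ^ 2 := by gcongr
      _ = Real.exp (2 * R) := by rw [← Real.exp_nat_mul]; norm_num
      _ ≤ _ := by gcongr
  have h4 : 1 + 2 * K ≤ Real.exp (2 * K * R ^ (3 / 2 : ℝ)) := by
    have h5 := Real.add_one_le_exp (2 * K * R ^ (3 / 2 : ℝ))
    have : 2 * K * 1 ≤ 2 * K * R ^ (3 / 2 : ℝ) := by gcongr; linarith
    linarith
  calc 1 + R * (R + 1) * (K * (2 * (R + 2) / p) ^ (R + 2)) ≤ 1 + R * (R + 1) * (K * E) := by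
        gcongr
    _ ≤ R ^ 2 * (1 + 2 * K) * E := by
        have a1 : 1 ≤ R ^ 2 * E := one_le_mul_of_one_le_of_one_le (one_le_pow₀ hR) hE
        have a2 : R * (R + 1) * (K * E) ≤ R * (2 * R) * (K * E) := by gcongr; linarith
        nlinarith
    _ ≤ Real.exp (2 * R ^ (3 / 2 : ℝ)) * Real.exp (2 * K * R ^ (3 / 2 : ℝ)) * E := by gcongr
    _ = _ := by rw [← Real.exp_add, ← Real.exp_add]; ring_nf

end xiFun

end

section

open Complex Filter Topology ComplexConjugate

theorem HasSum.of_eq {ι : Type*} {f g : ι → ℂ} {a b : ℂ} (h : HasSum f a) (hf : ∀ i, g i = f i)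
    (ha : b = a) : HasSum g b := by
  rw [ha, funext hf]; exact h

namespace xiFun

theorem conj_apply (s : ℂ) : xiFun (conj s) = conj (xiFun s) := by
  have key : ∀ s : ℂ, 0 < s.re → xiFun (conj s) = conj (xiFun s) := by
    intro s hs
    rcases eq_or_ne s 1 with rfl | h1
    · simp [one]
    have h0 : s ≠ 0 := fun h => by simp [h] at hs
    have hc0 : conj s ≠ 0 := by simpa using h0
    have hc1 : conj s ≠ 1 := fun h => h1 (by simpa using congrArg conj h)
    rw [eq_zeta h0 h1 (Gammaℝ_ne_zero_of_re_pos hs),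
      eq_zeta hc0 hc1 (Gammaℝ_ne_zero_of_re_pos (by simpa using hs)), riemannZeta_conj,
      Gammaℝ_def, Gammaℝ_def]
    have e0 : conj (2 : ℂ) = 2 := conj_ofNat 2
    have e1 : conj s / 2 = conj (s / 2) := by simp [e0]
    have e2 : -conj s / 2 = conj (-s / 2) := by simp [e0]
    have e3 : (Real.pi : ℂ) ^ conj (-s / 2) = conj ((Real.pi : ℂ) ^ (-s / 2)) := by
      rw [cpow_conj _ _ (by rw [arg_ofReal_of_nonneg Real.pi_pos.le]; exact Real.pi_ne_zero.symm),
        conj_ofReal]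
    rw [e1, e2, Gamma_conj, e3]
    simp
  rcases lt_or_ge 0 s.re with hs | hs
  · exact key s hs
  · rw [← one_sub (conj s), ← one_sub s, ← key (1 - s) (by simp; linarith)]
    simp

/-- Multiplicity of `ρ` as a zero of `xiFun`. -/
noncomputable def mult (ρ : ℂ) : ℕ := analyticOrderNatAt xiFun ρ

theorem zero_ne : xiFun 0 ≠ 0 := by simp [zero]

theorem mult_eq_of_factor {ρ : ℂ} {n : ℕ} {h : ℂ → ℂ} (hh : Differentiable ℂ h) (h0 : h ρ ≠ 0)
    (hf : ∀ s, xiFun s = (s - ρ) ^ n * h s) : mult ρ = n := by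
  have : analyticOrderAt xiFun ρ = n :=
    (differentiable.analyticAt ρ).analyticOrderAt_eq_natCast.2
      ⟨h, hh.analyticAt ρ, h0, Eventually.of_forall hf⟩
  rw [mult, analyticOrderNatAt, this]; rfl

theorem exists_factor (ρ : ℂ) : ∃ h : ℂ → ℂ, Differentiable ℂ h ∧
    (∀ s, xiFun s = (s - ρ) ^ mult ρ * h s) ∧ h ρ ≠ 0 :=
  EntireZeros.exists_factor differentiable (EntireZeros.order_ne_top differentiable zero_ne) ρ

theorem mult_one_sub (ρ : ℂ) : mult (1 - ρ) = mult ρ := by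
  obtain ⟨h, hd, hf, h0⟩ := exists_factor ρ
  refine mult_eq_of_factor (h := fun s => (-1) ^ mult ρ * h (1 - s)) ?_ ?_ fun s => ?_
  · exact (differentiable_const _).mul (hd.comp (by fun_prop))
  · simpa using h0
  · rw [← one_sub, hf, ← mul_assoc, ← mul_pow]; ring_nf

theorem mult_conj (ρ : ℂ) : mult (conj ρ) = mult ρ := by
  obtain ⟨h, hd, hf, h0⟩ := exists_factor ρ
  refine mult_eq_of_factor (h := fun s => conj (h (conj s))) ?_ ?_ fun s => ?_
  · exact fun s => by simpa [Function.comp_def] using (hd (conj s)).conj_conj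
  · simpa using h0
  · have := conj_apply (conj s)
    rw [conj_conj] at this
    rw [this, hf]; simp

theorem mult_eq_zero {ρ : ℂ} (h : xiFun ρ ≠ 0) : mult ρ = 0 :=
  EntireZeros.analyticOrderNatAt_eq_zero_of_ne differentiable h

theorem eq_zero_of_mult_ne {ρ : ℂ} (h : mult ρ ≠ 0) : xiFun ρ = 0 :=
  not_not.1 fun h' => h (mult_eq_zero h')

theorem mult_ne_zero {ρ : ℂ} (h : xiFun ρ = 0) : mult ρ ≠ 0 := by
  intro h'
  obtain ⟨k, -, hf, h0⟩ := exists_factor ρ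
  have := hf ρ
  rw [h', pow_zero, one_mul, h] at this
  exact h0 this.symm

theorem re_mem_of_mult_ne {ρ : ℂ} (h : mult ρ ≠ 0) : 0 < ρ.re ∧ ρ.re < 1 :=
  re_mem_of_eq_zero (eq_zero_of_mult_ne h)

theorem summable_mult_div_sq : Summable fun ρ : ℂ => (mult ρ : ℝ) / ‖ρ‖ ^ 2 := by
  obtain ⟨C, -, hC⟩ := growth
  exact EntireZeros.summable_order_div_sq differentiable zero hC

theorem hasSum_logDeriv {s : ℂ} (hs : xiFun s ≠ 0) :
    HasSum (fun ρ : ℂ => (mult ρ : ℂ) * (1 / (s - ρ) + 1 / ρ)) (logDeriv xiFun s - logDeriv xiFun 0) := by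
  obtain ⟨C, h0, hC⟩ := growth
  exact EntireZeros.hasSum_logDeriv differentiable zero h0 hC hs

theorem logDeriv_one_sub (s : ℂ) : logDeriv xiFun (1 - s) = -logDeriv xiFun s := by
  have h : (fun z => xiFun (1 - z)) = xiFun := funext one_sub
  have h1 := (differentiable (1 - s)).hasDerivAt.comp s ((hasDerivAt_id s).const_sub 1)
  have h2 : deriv xiFun s = -deriv xiFun (1 - s) := by
    have h3 : HasDerivAt xiFun (deriv xiFun (1 - s) * -1) s := by
      have h4 : xiFun ∘ (fun z => 1 - z) = xiFun := h
      have h5 : HasDerivAt (xiFun ∘ fun z => 1 - z) (deriv xiFun (1 - s) * -1) s := h1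
      rwa [h4] at h5
    rw [h3.deriv]; ring
  rw [logDeriv_apply, logDeriv_apply, one_sub, h2]; ring

theorem hasSum_pair {s : ℂ} (hs : xiFun s ≠ 0) :
    HasSum (fun ρ : ℂ => (mult ρ : ℂ) * ((2 * s - 1) / (ρ * (1 - ρ) + s * (s - 1)) + 1 / (ρ * (1 - ρ))))
      (2 * (logDeriv xiFun s - logDeriv xiFun 0)) := by
  have h1 := hasSum_logDeriv hs
  have h2 := (Equiv.subLeft (1 : ℂ)).hasSum_iff.2 h1
  refine (h1.add h2).of_eq (fun ρ => ?_) (by ring)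
  simp only [Function.comp, Equiv.subLeft_apply, mult_one_sub]
  by_cases hm : mult ρ = 0
  · simp [hm]
  have hρ := eq_zero_of_mult_ne hm
  have hre := re_mem_of_mult_ne hm
  have e0 : ρ ≠ 0 := fun h => by simp [h] at hre
  have e1 : 1 - ρ ≠ 0 := fun h => by
    have := congrArg re h
    simp at this; linarith
  have e2 : s - ρ ≠ 0 := fun h => hs (by rwa [sub_eq_zero.1 h])
  have e3 : s - (1 - ρ) ≠ 0 := fun h => hs (by rwa [sub_eq_zero.1 h, one_sub])
  have e4 : ρ * (1 - ρ) + s * (s - 1) = (s - ρ) * (s - (1 - ρ)) := by ring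
  rw [e4, ← mul_add]
  congr 1
  field_simp
  ring

theorem hasSum_inv : HasSum (fun ρ : ℂ => (mult ρ : ℂ) / (ρ * (1 - ρ))) (-2 * logDeriv xiFun 0) := by
  have h := hasSum_pair (s := 1) (by simp [one])
  have h1 : logDeriv xiFun 1 = -logDeriv xiFun 0 := by simpa using logDeriv_one_sub 0
  rw [h1] at h
  exact (h.mul_left (1 / 2)).of_eq (fun ρ => by ring) (by ring)

theorem hasSum_inv_add {s : ℂ} (hs : xiFun s ≠ 0) (h2 : 2 * s - 1 ≠ 0) :
    HasSum (fun ρ : ℂ => (mult ρ : ℂ) / (ρ * (1 - ρ) + s * (s - 1)))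
      (2 * logDeriv xiFun s / (2 * s - 1)) := by
  have h := ((hasSum_pair hs).sub hasSum_inv).mul_left (1 / (2 * s - 1))
  refine h.of_eq (fun ρ => ?_) ?_
  · have : (2 * s - 1) / (ρ * (1 - ρ) + s * (s - 1)) =
      (2 * s - 1) * (1 / (ρ * (1 - ρ) + s * (s - 1))) := by ring
    rw [this]
    generalize ρ * (1 - ρ) + s * (s - 1) = A
    field_simp
    ring
  · field_simp; ring

theorem logDeriv_zero : logDeriv xiFun 0 =
    (Real.log (4 * Real.pi) - Real.eulerMascheroniConstant) / 2 - 1 := by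
  have h1 : HasDerivAt xiFun (-completedRiemannZeta₀ 0) 0 := by
    have hd := (differentiable_completedZeta₀ 0).hasDerivAt
    have hp : HasDerivAt (fun s : ℂ => s * (s - 1)) (-1) 0 := by
      have := (hasDerivAt_id (0 : ℂ)).mul ((hasDerivAt_id (0 : ℂ)).sub_const 1)
      have h3 : HasDerivAt (fun s : ℂ => s * (s - 1)) (1 * (0 - 1) + 0 * 1) 0 := this
      simpa using h3
    have h4 : HasDerivAt xiFun _ 0 := (hp.mul hd).const_add 1
    simpa using h4
  have h2 : completedRiemannZeta₀ 0 = completedRiemannZeta₀ 1 := by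
    have := completedRiemannZeta₀_one_sub 0
    simpa using this.symm
  rw [logDeriv_apply, h1.deriv, zero, h2, completedRiemannZeta₀_one, ofReal_log (by positivity)]
  push_cast
  ring

theorem logDeriv_eq {s : ℂ} (hs : 1 < s.re) : logDeriv xiFun s =
    1 / s + 1 / (s - 1) - Real.log Real.pi / 2 + digamma (s / 2) / 2 -
      LSeries (fun n => (ArithmeticFunction.vonMangoldt n : ℂ)) s := by
  have h0 : s ≠ 0 := fun h => by norm_num [h] at hs
  have h1 : s ≠ 1 := fun h => by norm_num [h] at hs
  have h1' : s - 1 ≠ 0 := sub_ne_zero.2 h1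
  have hG2 : Gamma (s / 2) ≠ 0 := Gamma_ne_zero_of_re_pos (by simp; linarith)
  have hπ : (Real.pi : ℂ) ≠ 0 := by exact_mod_cast Real.pi_ne_zero
  have hz : riemannZeta s ≠ 0 := riemannZeta_ne_zero_of_one_le_re hs.le
  have hev : xiFun =ᶠ[𝓝 s] fun z => z * ((z - 1) * ((Real.pi : ℂ) ^ (-z / 2) * (Gamma (z / 2) * riemannZeta z))) := by
    filter_upwards [(isOpen_lt continuous_const continuous_re).mem_nhds hs] with z hz
    have hz : 1 < z.re := hz
    rw [eq_zeta (fun h => by norm_num [h] at hz) (fun h => by norm_num [h] at hz)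
      (Gammaℝ_ne_zero_of_re_pos (by linarith)), Gammaℝ_def]
    ring
  have hGd : HasDerivAt (fun z : ℂ => Gamma (z / 2)) (deriv Gamma (s / 2) * (1 / 2)) s := by
    have h2 : DifferentiableAt ℂ Gamma (s / 2) := by
      refine differentiableAt_Gamma _ fun m h => ?_
      have := congrArg re h
      simp at this
      have : (0 : ℝ) ≤ m := Nat.cast_nonneg m
      linarith
    exact h2.hasDerivAt.comp s ((hasDerivAt_id s).div_const 2)
  have hPd : HasDerivAt (fun z : ℂ => (Real.pi : ℂ) ^ (-z / 2))
      ((Real.pi : ℂ) ^ (-s / 2) * log Real.pi * (-1 / 2)) s :=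
    ((hasDerivAt_id s).neg.div_const 2).const_cpow (Or.inl hπ)
  have hPne : (Real.pi : ℂ) ^ (-s / 2) ≠ 0 := by simp [cpow_eq_zero_iff, hπ]
  have dZ : DifferentiableAt ℂ riemannZeta s := differentiableAt_riemannZeta h1
  have hD : HasDerivAt (fun z => z * ((z - 1) * ((Real.pi : ℂ) ^ (-z / 2) *
      (Gamma (z / 2) * riemannZeta z)))) _ s :=
    (hasDerivAt_id s).mul (((hasDerivAt_id s).sub_const 1).mul (hPd.mul (hGd.mul dZ.hasDerivAt)))
  rw [logDeriv_apply, hev.deriv_eq, hev.self_of_nhds, hD.deriv,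
    ArithmeticFunction.LSeries_vonMangoldt_eq_deriv_riemannZeta_div hs, digamma_def, logDeriv_apply]
  simp only [id]
  rw [ofReal_log Real.pi_pos.le]
  field_simp
  ring

end xiFun

end

section

open Complex Filter Topology Set

namespace DigammaSeries

/-- The logarithmic derivative of the real Gamma function. -/
noncomputable def realDigamma (x : ℝ) : ℝ := deriv (fun y => Real.log (Real.Gamma y)) x

theorem differentiableAt_Gamma {s : ℂ} (hs : 0 < s.re) : DifferentiableAt ℂ Gamma s := by
  refine Complex.differentiableAt_Gamma _ fun m h => ?_
  have := congrArg re h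
  simp at this
  have : (0 : ℝ) ≤ m := Nat.cast_nonneg m
  linarith

theorem hasDerivAt_log_Gamma {x : ℝ} (hx : 0 < x) :
    HasDerivAt (fun y => Real.log (Real.Gamma y)) (deriv Real.Gamma x / Real.Gamma x) x := by
  have hd : DifferentiableAt ℝ Real.Gamma x := Real.differentiableAt_Gamma fun m h => by
    have : (0 : ℝ) ≤ m := Nat.cast_nonneg m
    linarith
  exact hd.hasDerivAt.log (Real.Gamma_pos_of_pos hx).ne'

theorem digamma_ofReal {x : ℝ} (hx : 0 < x) : digamma x = realDigamma x := by
  have hd : DifferentiableAt ℝ Real.Gamma x := Real.differentiableAt_Gamma fun m h => by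
    have : (0 : ℝ) ≤ m := Nat.cast_nonneg m
    linarith
  have h1 := (differentiableAt_Gamma (s := (x : ℂ)) (by simpa using hx)).hasDerivAt.comp_ofReal
  have h2 := hd.hasDerivAt.ofReal_comp
  simp only [Complex.Gamma_ofReal] at h1
  rw [realDigamma, (hasDerivAt_log_Gamma hx).deriv, digamma_def, logDeriv_apply, h1.unique h2,
    Complex.Gamma_ofReal]
  push_cast; rfl

theorem realDigamma_add_one {x : ℝ} (hx : 0 < x) : realDigamma (x + 1) = realDigamma x + 1 / x := by
  have h := digamma_apply_add_one (x : ℂ) fun m h => by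
    have := congrArg re h
    simp at this
    have : (0 : ℝ) ≤ m := Nat.cast_nonneg m
    linarith
  have e : ((x : ℂ) + 1) = ((x + 1 : ℝ) : ℂ) := by push_cast; rfl
  rw [e, digamma_ofReal hx, digamma_ofReal (by linarith)] at h
  rw [one_div]
  exact_mod_cast h

theorem realDigamma_add_nat {x : ℝ} (hx : 0 < x) (n : ℕ) :
    realDigamma (x + n) = realDigamma x + ∑ j ∈ Finset.range n, 1 / (x + j) := by
  induction n with
  | zero => simp
  | succ n ih =>
    rw [Finset.sum_range_succ, ← add_assoc, ← ih, ← realDigamma_add_one (by positivity)]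
    push_cast; ring_nf

theorem realDigamma_one : realDigamma 1 = -Real.eulerMascheroniConstant := by
  have := digamma_ofReal one_pos
  rw [ofReal_one, digamma_one] at this
  exact_mod_cast this.symm

theorem monotoneOn_realDigamma : MonotoneOn realDigamma (Ioi 0) := by
  exact Real.convexOn_log_Gamma.monotoneOn_deriv fun x hx => (hasDerivAt_log_Gamma hx).differentiableAt

theorem tendsto_realDigamma_sub {x : ℝ} (hx : 0 < x) :
    Tendsto (fun n : ℕ => realDigamma (x + n) - realDigamma (1 + n)) atTop (𝓝 0) := by
  set K := ⌈x⌉₊ + 1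
  have hK : x ≤ K := (Nat.le_ceil x).trans (by simp [K])
  have hlim : ∀ y : ℝ, Tendsto (fun n : ℕ => (K : ℝ) / (y + n)) atTop (𝓝 0) := fun y =>
    (tendsto_const_nhds (x := (K : ℝ))).div_atTop
      (tendsto_atTop_add_const_left _ _ tendsto_natCast_atTop_atTop)
  have bound : ∀ y : ℝ, 0 < y → ∀ n : ℕ, realDigamma (y + n + K) ≤ realDigamma (y + n) + K / (y + n) := by
    intro y hy n
    rw [realDigamma_add_nat (by positivity)]
    gcongr
    calc ∑ j ∈ Finset.range K, 1 / (y + n + j) ≤ ∑ j ∈ Finset.range K, 1 / (y + n) := by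
          refine Finset.sum_le_sum fun j _ => one_div_le_one_div_of_le (by positivity) ?_
          have : (0 : ℝ) ≤ j := Nat.cast_nonneg j
          linarith
      _ = _ := by simp; ring
  refine tendsto_of_tendsto_of_tendsto_of_le_of_le' (g := fun n : ℕ => -((K : ℝ) / (x + n)))
    (h := fun n : ℕ => (K : ℝ) / (1 + n)) (by simpa using (hlim x).neg) (hlim 1)
    (Eventually.of_forall fun n => ?_) (Eventually.of_forall fun n => ?_)
  · have h1 := bound x hx n
    have h2 : realDigamma (1 + n) ≤ realDigamma (x + n + K) := by
      refine monotoneOn_realDigamma (by simp; positivity) (by simp; positivity) ?_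
      have : (1 : ℝ) ≤ K := by simp [K]
      linarith
    linarith
  · have h1 := bound 1 one_pos n
    have h2 : realDigamma (x + n) ≤ realDigamma (1 + n + K) :=
      monotoneOn_realDigamma (by simp; positivity) (by simp; positivity) (by linarith)
    linarith

theorem norm_term_le {s : ℂ} {R δ : ℝ} (hδ : 0 < δ) (hs : δ ≤ s.re) (hR : ‖s‖ ≤ R) (n : ℕ) :
    ‖1 / ((n : ℂ) + 1) - 1 / (s + n)‖ ≤ (R + 1) * ((1 + 1 / δ) * (1 / ((n : ℝ) + 1) ^ 2)) := by
  have hR0 : 0 ≤ R := (norm_nonneg _).trans hR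
  have hn : (n : ℂ) + 1 ≠ 0 := by exact_mod_cast n.succ_ne_zero
  have hre : δ + n ≤ ‖s + n‖ := by
    refine le_trans ?_ (re_le_norm _)
    simp; linarith
  have hsn : s + n ≠ 0 := by
    have : (0 : ℝ) < ‖s + n‖ := lt_of_lt_of_le (by positivity) hre
    exact norm_pos_iff.1 this
  have h1 : 1 / ((n : ℂ) + 1) - 1 / (s + n) = (s - 1) / (((n : ℂ) + 1) * (s + n)) := by
    field_simp; ring
  have h2 : ‖(n : ℂ) + 1‖ = n + 1 := by
    rw [show (n : ℂ) + 1 = ((n + 1 : ℕ) : ℂ) by push_cast; rfl, norm_natCast]; push_cast; rfl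
  rw [h1, norm_div, norm_mul, h2]
  have h3 : ‖s - 1‖ ≤ R + 1 := (norm_sub_le _ _).trans (by simpa using hR)
  have h4 : 1 / (δ + n) ≤ (1 + 1 / δ) * (1 / ((n : ℝ) + 1)) := by
    have e : (1 + 1 / δ) * (1 / ((n : ℝ) + 1)) = (δ + 1) / (δ * (n + 1)) := by field_simp
    rw [e, div_le_div_iff₀ (by positivity) (by positivity)]
    have : (0 : ℝ) ≤ n := Nat.cast_nonneg n
    nlinarith
  calc ‖s - 1‖ / (((n : ℝ) + 1) * ‖s + n‖) ≤ (R + 1) / (((n : ℝ) + 1) * (δ + n)) := by gcongr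
    _ = (R + 1) * (1 / (n + 1) * (1 / (δ + n))) := by field_simp
    _ ≤ (R + 1) * (1 / (n + 1) * ((1 + 1 / δ) * (1 / ((n : ℝ) + 1)))) := by gcongr
    _ = _ := by field_simp

theorem summable_bound (R δ : ℝ) :
    Summable fun n : ℕ => (R + 1) * ((1 + 1 / δ) * (1 / ((n : ℝ) + 1) ^ 2)) := by
  have := (summable_nat_add_iff 1).2 (Real.summable_one_div_nat_pow.2 one_lt_two)
  push_cast at this
  exact (this.mul_left _).mul_left _

theorem summable_term {s : ℂ} (hs : 0 < s.re) :
    Summable fun n : ℕ => 1 / ((n : ℂ) + 1) - 1 / (s + n) :=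
  Summable.of_norm_bounded (summable_bound ‖s‖ s.re) fun n => norm_term_le hs le_rfl le_rfl n

theorem tsum_ofReal {x : ℝ} (hx : 0 < x) :
    ∑' n : ℕ, (1 / ((n : ℂ) + 1) - 1 / ((x : ℂ) + n)) = digamma x + Real.eulerMascheroniConstant := by
  have h1 := (summable_term (s := (x : ℂ)) (by simpa using hx)).hasSum.tendsto_sum_nat
  refine tendsto_nhds_unique h1 ?_
  have h2 : ∀ n : ℕ, ∑ j ∈ Finset.range n, (1 / ((j : ℂ) + 1) - 1 / ((x : ℂ) + j)) =
      ((realDigamma x + Real.eulerMascheroniConstant - (realDigamma (x + n) - realDigamma (1 + n)) : ℝ) : ℂ) := by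
    intro n
    rw [realDigamma_add_nat hx, realDigamma_add_nat one_pos, realDigamma_one, Finset.sum_sub_distrib]
    push_cast
    simp only [add_comm (1 : ℂ)]
    ring
  simp only [h2]
  rw [digamma_ofReal hx, ← ofReal_add]
  refine (continuous_ofReal.tendsto _).comp ?_
  simpa using (tendsto_realDigamma_sub hx).const_sub (realDigamma x + Real.eulerMascheroniConstant)

theorem hasSum_digamma {s : ℂ} (hs : 0 < s.re) :
    HasSum (fun n : ℕ => 1 / ((n : ℂ) + 1) - 1 / (s + n))
      (digamma s + Real.eulerMascheroniConstant) := by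
  rw [(summable_term hs).hasSum_iff]
  set δ := min s.re 1 / 2
  have hδ : 0 < δ := by positivity
  set U : Set ℂ := {z | δ < z.re} ∩ Metric.ball 0 (‖s‖ + 2)
  have hUo : IsOpen U := (isOpen_lt continuous_const continuous_re).inter Metric.isOpen_ball
  have hUc : IsPreconnected U :=
    ((convex_halfSpace_re_gt δ).inter (convex_ball _ _)).isPreconnected
  have hlt : δ < min s.re 1 := half_lt_self (lt_min hs one_pos)
  have hsU : s ∈ U := ⟨hlt.trans_le (min_le_left _ _), by simp⟩
  have h1U : (1 : ℂ) ∈ U := ⟨by simpa using hlt.trans_le (min_le_right _ _), by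
    simp; linarith [norm_nonneg s]⟩
  have hpos : ∀ z ∈ U, 0 < z.re := fun z hz => hδ.trans hz.1
  have hA : DifferentiableOn ℂ (fun z => ∑' n : ℕ, (1 / ((n : ℂ) + 1) - 1 / (z + n))) U := by
    refine differentiableOn_tsum_of_summable_norm (summable_bound (‖s‖ + 2) δ) (fun n z hz => ?_) hUo
      fun n z hz => norm_term_le hδ hz.1.le (by simpa using (mem_ball_zero_iff.1 hz.2).le) n
    have : z + n ≠ 0 := fun h => by
      have h1 := congrArg re h
      have h2 := hpos z hz
      simp at h1
      have : (0 : ℝ) ≤ n := Nat.cast_nonneg n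
      linarith
    have h' : DifferentiableAt ℂ (fun z : ℂ => 1 / ((n : ℂ) + 1) - 1 / (z + n)) z := by
      fun_prop (disch := exact this)
    exact h'.differentiableWithinAt
  have hG : ∀ z ∈ U, AnalyticAt ℂ Gamma z := fun z hz =>
    DifferentiableOn.analyticAt (s := {z : ℂ | 0 < z.re})
      (fun w hw => (differentiableAt_Gamma hw).differentiableWithinAt)
      ((isOpen_lt continuous_const continuous_re).mem_nhds (hpos z hz))
  have hB : AnalyticOnNhd ℂ (fun z => digamma z + (Real.eulerMascheroniConstant : ℂ)) U := by
    intro z hz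
    have : AnalyticAt ℂ digamma z := by
      have h := (hG z hz).deriv.div (hG z hz) (Gamma_ne_zero_of_re_pos (hpos z hz))
      exact h
    exact this.add analyticAt_const
  refine (hA.analyticOnNhd hUo).eqOn_of_preconnected_of_frequently_eq hB hUc h1U ?_ hsU
  have hm : Tendsto (fun n : ℕ => ((1 + 1 / ((n : ℝ) + 1) : ℝ) : ℂ)) atTop (𝓝[≠] 1) := by
    refine tendsto_nhdsWithin_iff.2 ⟨?_, Eventually.of_forall fun n => ?_⟩
    · have := (tendsto_one_div_add_atTop_nhds_zero_nat (𝕜 := ℝ)).const_add 1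
      have := (continuous_ofReal.tendsto _).comp this
      rw [add_zero, ofReal_one] at this
      exact this
    · simp only [mem_compl_iff, mem_singleton_iff]
      intro h
      have h : (1 + 1 / ((n : ℝ) + 1) : ℝ) = 1 := by exact_mod_cast h
      have : (0 : ℝ) < 1 / ((n : ℝ) + 1) := by positivity
      linarith
  exact hm.frequently (Frequently.of_forall fun n => tsum_ofReal (by positivity))

end DigammaSeries

end

section

open MeasureTheory ArithmeticFunction

/-- The exponential polynomial `Σ r e^{lam w}` attached to a list of pairs `(lam, r)`. -/
noncomputable def expPoly (l : List (ℝ × ℝ)) (w : ℝ) : ℝ :=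
  (l.map fun p => p.2 * Real.exp (p.1 * w)).sum

/-- The coefficients of the image under `expInt a` of an exponential polynomial. -/
noncomputable def expPolyInt (a : ℝ) (l : List (ℝ × ℝ)) : List (ℝ × ℝ) :=
  (-a, -(l.map fun p => p.2 / (p.1 + a)).sum) :: l.map fun p => (p.1, p.2 / (p.1 + a))

theorem continuous_expPoly (l : List (ℝ × ℝ)) : Continuous (expPoly l) := by
  unfold expPoly
  induction l with
  | nil => simpa using continuous_const
  | cons p l ih =>
    simp only [List.map_cons, List.sum_cons]
    exact (by fun_prop : Continuous fun w => p.2 * Real.exp (p.1 * w)).add ih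

theorem expInt_exp {a lam : ℝ} (h : lam + a ≠ 0) (u : ℝ) :
    expInt a (fun v => Real.exp (lam * v)) u =
      (Real.exp (lam * u) - Real.exp (-a * u)) / (lam + a) := by
  rw [expInt_eq]
  have : ∀ v, Real.exp (a * v) * Real.exp (lam * v) = Real.exp ((lam + a) * v) := fun v => by
    rw [← Real.exp_add]; ring_nf
  simp only [this]
  rw [intervalIntegral.integral_comp_mul_left (fun x => Real.exp x) h, integral_exp, mul_zero,
    Real.exp_zero, smul_eq_mul]
  have e : Real.exp (lam * u) = Real.exp (-(a * u)) * Real.exp ((lam + a) * u) := by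
    rw [← Real.exp_add]; ring_nf
  rw [e, neg_mul]
  field_simp

theorem expInt_expPoly {a : ℝ} (l : List (ℝ × ℝ)) (h : ∀ p ∈ l, p.1 + a ≠ 0) (u : ℝ) :
    expInt a (expPoly l) u = expPoly (expPolyInt a l) u := by
  induction l with
  | nil => simp [expPoly, expPolyInt, expInt]
  | cons p l ih =>
    have e : expPoly (p :: l) = fun v => p.2 * Real.exp (p.1 * v) + expPoly l v := by
      ext v; simp [expPoly]
    have ih' := ih fun q hq => h q (List.mem_cons_of_mem _ hq)
    rw [e, expInt_add (Continuous.locInt (by fun_prop)) (continuous_expPoly l).locInt,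
      expInt_const_mul, expInt_exp (h p List.mem_cons_self), ih']
    simp only [expPoly, expPolyInt, List.map_cons, List.sum_cons]
    ring

theorem expInt_shift {a c u : ℝ} (hc : 0 ≤ c) (hcu : c ≤ u) {g : ℝ → ℝ} (hg : Continuous g) :
    expInt a (fun v => if c ≤ v then g (v - c) else 0) u = expInt a g (u - c) := by
  have hInteg : ∀ x y, IntervalIntegrable
      (fun v => Real.exp (-(a * (u - v))) * if c ≤ v then g (v - c) else 0) volume x y := by
    intro x y
    refine IntervalIntegrable.continuousOn_mul ?_ (by fun_prop)
    have h1 : IntervalIntegrable (fun v => g (v - c)) volume x y :=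
      (hg.comp (by fun_prop)).intervalIntegrable _ _
    have : (fun v => if c ≤ v then g (v - c) else 0) = Set.indicator (Set.Ici c) fun v => g (v - c) := by
      ext v; simp [Set.indicator]
    rw [this, intervalIntegrable_iff] at *
    exact h1.indicator measurableSet_Ici
  unfold expInt
  rw [← intervalIntegral.integral_add_adjacent_intervals (hInteg 0 c) (hInteg c u)]
  have h0 : (∫ v in (0 : ℝ)..c, Real.exp (-(a * (u - v))) * if c ≤ v then g (v - c) else 0) = 0 := by
    refine intervalIntegral.integral_zero_ae ?_
    filter_upwards [compl_mem_ae_iff.2 (measure_singleton c)] with v hv hv'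
    rw [Set.uIoc_of_le hc] at hv'
    rw [if_neg (not_le.2 (lt_of_le_of_ne hv'.2 hv)), mul_zero]
  rw [h0, zero_add]
  have h1 : (∫ v in c..u, Real.exp (-(a * (u - v))) * if c ≤ v then g (v - c) else 0) =
      ∫ v in c..u, (fun w => Real.exp (-(a * (u - c - w))) * g w) (v - c) := by
    refine intervalIntegral.integral_congr fun v hv => ?_
    rw [Set.uIcc_of_le hcu] at hv
    simp only [if_pos hv.1]
    ring_nf
  rw [h1, intervalIntegral.integral_comp_sub_right (fun w => Real.exp (-(a * (u - c - w))) * g w),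
    sub_self]

/-- `F` is the sum over `n ≤ e^u` of `Λ(n)` times the exponential polynomial `l` at `u - log n`,
minus the exponential polynomial `l'` at `u`. -/
def PrimeSum (F : ℝ → ℝ) (l l' : List (ℝ × ℝ)) : Prop :=
  ∀ u, 0 ≤ u → F u = (∑ n ∈ Finset.Icc 1 ⌊Real.exp u⌋₊, Λ n * expPoly l (u - Real.log n)) -
    expPoly l' u

theorem expInt_sum {ι : Type*} (s : Finset ι) {h : ι → ℝ → ℝ} (hh : ∀ i ∈ s, LocInt (h i)) (a u : ℝ) :
    expInt a (fun v => ∑ i ∈ s, h i v) u = ∑ i ∈ s, expInt a (h i) u := by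
  unfold expInt
  simp only [Finset.mul_sum]
  exact intervalIntegral.integral_finsetSum fun i hi =>
    (hh i hi 0 u).continuousOn_mul (by fun_prop)

theorem PrimeSum.expInt {F : ℝ → ℝ} {l l' : List (ℝ × ℝ)} (hF : PrimeSum F l l') {a : ℝ}
    (h : ∀ p ∈ l, p.1 + a ≠ 0) (h' : ∀ p ∈ l', p.1 + a ≠ 0) :
    PrimeSum (expInt a F) (expPolyInt a l) (expPolyInt a l') := by
  intro u hu
  set N := ⌊Real.exp u⌋₊
  have key : ∀ v, 0 ≤ v → v ≤ u → F v = (∑ n ∈ Finset.Icc 1 N,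
      Λ n * (fun v => if Real.log n ≤ v then expPoly l (v - Real.log n) else 0) v) + (-1) * expPoly l' v := by
    intro v hv hvu
    rw [hF v hv, neg_one_mul, ← sub_eq_add_neg]
    congr 1
    have hsub : Finset.Icc 1 ⌊Real.exp v⌋₊ ⊆ Finset.Icc 1 N :=
      Finset.Icc_subset_Icc_right (Nat.floor_le_floor (Real.exp_le_exp.2 hvu))
    rw [← Finset.sum_subset hsub]
    · refine Finset.sum_congr rfl fun n hn => ?_
      obtain ⟨h1, h2⟩ := Finset.mem_Icc.1 hn
      have : Real.log n ≤ v := by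
        rw [Real.log_le_iff_le_exp (by exact_mod_cast h1)]
        exact (Nat.le_floor_iff (Real.exp_pos v).le).1 h2
      simp [this]
    · intro n hn hn'
      have h1 := (Finset.mem_Icc.1 hn).1
      have : ¬ Real.log n ≤ v := by
        rw [Real.log_le_iff_le_exp (by exact_mod_cast h1), ← Nat.le_floor_iff (Real.exp_pos v).le]
        exact fun h2 => hn' (Finset.mem_Icc.2 ⟨h1, h2⟩)
      simp [this]
  have hloc : ∀ n : ℕ, LocInt fun v => if Real.log n ≤ v then expPoly l (v - Real.log n) else 0 := by
    intro n x y
    have h1 : IntervalIntegrable (fun v => expPoly l (v - Real.log n)) volume x y :=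
      ((continuous_expPoly l).comp (by fun_prop)).intervalIntegrable _ _
    have : (fun v => if Real.log n ≤ v then expPoly l (v - Real.log n) else 0) =
        Set.indicator (Set.Ici (Real.log n)) fun v => expPoly l (v - Real.log n) := by
      ext v; simp [Set.indicator]
    rw [this, intervalIntegrable_iff] at *
    exact h1.indicator measurableSet_Ici
  have hloc' : ∀ n : ℕ, LocInt fun v => Λ n * (fun v => if Real.log n ≤ v then expPoly l (v - Real.log n) else 0) v :=
    fun n x y => (hloc n x y).const_mul _
  rw [expInt_congr hu key, expInt_add _ (Continuous.locInt ((continuous_expPoly l').const_mul _)),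
    expInt_sum _ fun n _ => hloc' n, expInt_const_mul, expInt_expPoly l' h', neg_one_mul,
    ← sub_eq_add_neg]
  · congr 1
    refine Finset.sum_congr rfl fun n hn => ?_
    obtain ⟨h1, h2⟩ := Finset.mem_Icc.1 hn
    have h3 : Real.log n ≤ u := by
      rw [Real.log_le_iff_le_exp (by exact_mod_cast h1)]
      exact (Nat.le_floor_iff (Real.exp_pos u).le).1 h2
    rw [expInt_const_mul, expInt_shift (Real.log_natCast_nonneg n) h3 (continuous_expPoly l),
      expInt_expPoly l h]
  · intro x y
    have := IntervalIntegrable.sum (Finset.Icc 1 N) fun n _ => hloc' n x y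
    rwa [Finset.sum_fn] at this

/-- The remainder `ψ(e^u) - e^u`. -/
noncomputable def psiErr (u : ℝ) : ℝ := chebyshevPsi (Real.exp u) - Real.exp u

theorem primeSum_psiErr : PrimeSum psiErr [(0, 1)] [(1, 1)] := by
  intro u _
  simp [psiErr, chebyshevPsi, expPoly]

theorem monotone_chebyshevPsi : Monotone chebyshevPsi := by
  intro x y hxy
  refine Finset.sum_le_sum_of_subset_of_nonneg
    (Finset.Icc_subset_Icc_right (Nat.floor_le_floor hxy)) fun _ _ _ => vonMangoldt_nonneg

theorem locInt_psiErr : LocInt psiErr := by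
  intro x y
  have h1 : Monotone fun u => chebyshevPsi (Real.exp u) :=
    monotone_chebyshevPsi.comp Real.exp_monotone
  exact h1.intervalIntegrable.sub (Real.continuous_exp.intervalIntegrable _ _)

theorem abs_psiErr_le {u : ℝ} (hu : 0 ≤ u) : |psiErr u| ≤ 2 * Real.exp (2 * u) := by
  have hx : 1 ≤ Real.exp u := Real.one_le_exp hu
  have e : Real.exp (2 * u) = Real.exp u * Real.exp u := by rw [← Real.exp_add]; ring_nf
  have h0 : 0 ≤ chebyshevPsi (Real.exp u) := Finset.sum_nonneg fun _ _ => vonMangoldt_nonneg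
  have h1 : chebyshevPsi (Real.exp u) ≤ Real.exp u * Real.exp u := by
    calc chebyshevPsi (Real.exp u) ≤ ∑ n ∈ Finset.Icc 1 ⌊Real.exp u⌋₊, Real.exp u := by
          refine Finset.sum_le_sum fun n hn => ?_
          obtain ⟨h1, h2⟩ := Finset.mem_Icc.1 hn
          have h3 : (n : ℝ) ≤ Real.exp u := (Nat.le_floor_iff (Real.exp_pos u).le).1 h2
          have h4 : Real.log n ≤ n := (Real.log_le_sub_one_of_pos (by exact_mod_cast h1)).trans (by linarith)
          exact vonMangoldt_le_log.trans (h4.trans h3)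
      _ = ⌊Real.exp u⌋₊ * Real.exp u := by simp
      _ ≤ _ := by gcongr; exact Nat.floor_le (Real.exp_pos u).le
  rw [psiErr, e, abs_le]
  constructor <;> nlinarith

end

section

open Complex MeasureTheory Set Filter Topology FourierTransform

/-- The image of `v ↦ e^{lam v}` under `expInt a`, for complex `lam`. -/
noncomputable def expKer (a : ℝ) (lam : ℂ) (u : ℝ) : ℂ :=
  (cexp (lam * u) - cexp (-a * u)) / (lam + a)

theorem continuous_expKer (a : ℝ) (lam : ℂ) : Continuous (expKer a lam) := by
  unfold expKer; fun_prop

theorem expKer_zero (a : ℝ) (lam : ℂ) : expKer a lam 0 = 0 := by simp [expKer]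

theorem norm_expKer_le {a : ℝ} (ha : 0 < a) {lam : ℂ} (hl : lam.re ≤ 1) {u : ℝ} (hu : 0 ≤ u) :
    ‖expKer a lam u‖ ≤ 2 / ‖lam + a‖ * Real.exp u := by
  have h1 : ‖cexp (lam * u)‖ ≤ Real.exp u := by
    rw [norm_exp]; simp; nlinarith
  have h2 : ‖cexp (-a * u)‖ ≤ Real.exp u := by
    rw [norm_exp]; simp; nlinarith
  rw [expKer, norm_div, div_mul_eq_mul_div]
  gcongr
  exact (norm_sub_le _ _).trans (by linarith)

/-- The Laplace transform. -/
noncomputable def lap (h : ℝ → ℂ) (s : ℂ) : ℂ := ∫ u in Ioi (0 : ℝ), cexp (-s * u) * h u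

theorem integrableOn_lap {h : ℝ → ℂ} (hc : ContinuousOn h (Ioi 0)) {C : ℝ}
    (hb : ∀ u, 0 ≤ u → ‖h u‖ ≤ C * Real.exp (2 * u)) {s : ℂ} (hs : s.re = 4) :
    IntegrableOn (fun u : ℝ => cexp (-s * u) * h u) (Ioi 0) := by
  have hg : IntegrableOn (fun u : ℝ => C * Real.exp (-2 * u)) (Ioi 0) :=
    (integrableOn_exp_mul_Ioi (by norm_num) 0).const_mul C
  refine hg.mono' ?_ ?_
  · exact ContinuousOn.aestronglyMeasurable
      ((by fun_prop : Continuous fun u : ℝ => cexp (-s * u)).continuousOn.mul hc) measurableSet_Ioi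
  · refine (ae_restrict_iff' measurableSet_Ioi).2 (Eventually.of_forall fun u hu => ?_)
    have hu : 0 < u := hu
    rw [norm_mul, norm_exp]
    have e : (-s * u).re = -4 * u := by simp [hs]
    rw [e]
    calc Real.exp (-4 * u) * ‖h u‖ ≤ Real.exp (-4 * u) * (C * Real.exp (2 * u)) := by
          gcongr; exact hb u hu.le
      _ = C * (Real.exp (-4 * u) * Real.exp (2 * u)) := by ring
      _ = _ := by rw [← Real.exp_add]; ring_nf

theorem eq_zero_of_lap_eq_zero {h : ℝ → ℂ} (hc : Continuous h) (h0 : h 0 = 0) {C : ℝ}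
    (hb : ∀ u, 0 ≤ u → ‖h u‖ ≤ C * Real.exp (2 * u)) (hL : ∀ s : ℂ, s.re = 4 → lap h s = 0)
    {u : ℝ} (hu : 0 ≤ u) : h u = 0 := by
  set D : ℝ → ℂ := fun u => if 0 ≤ u then cexp (-4 * u) * h u else 0
  have hDc : Continuous D := by
    refine Continuous.if_le (by fun_prop) continuous_const continuous_const continuous_id ?_
    intro x hx
    simp [← hx, h0]
  have hDi : D = Set.indicator (Ici 0) fun u : ℝ => cexp (-4 * u) * h u := by
    ext u; simp [D, indicator]
  have hInt : Integrable D := by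
    rw [hDi, integrable_indicator_iff measurableSet_Ici, integrableOn_Ici_iff_integrableOn_Ioi]
    exact integrableOn_lap hc.continuousOn hb (s := 4) (by simp)
  have hF : 𝓕 D = 0 := by
    ext ξ
    rw [Real.fourier_real_eq_integral_exp_smul]
    have h1 : ∀ v : ℝ, cexp (↑(-2 * Real.pi * v * ξ) * I) • D v =
        Set.indicator (Ici 0) (fun u : ℝ => cexp (-(4 + 2 * Real.pi * ξ * I) * u) * h u) v := by
      intro v
      by_cases hv : 0 ≤ v
      · simp only [D, hv, if_true, indicator, mem_Ici, smul_eq_mul]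
        rw [← mul_assoc, ← Complex.exp_add]
        congr 2; push_cast; ring
      · simp [D, hv, indicator]
    simp only [h1]
    rw [integral_indicator measurableSet_Ici, integral_Ici_eq_integral_Ioi]
    exact hL _ (by simp)
  have hinv := hInt.fourierInv_fourier_eq (v := u) (by rw [hF]; exact integrable_zero _ _ _) hDc.continuousAt
  rw [hF] at hinv
  have h2 : D u = 0 := by
    rw [← hinv, Real.fourierInv_eq]; simp
  simp only [D, hu, if_true] at h2
  exact (mul_eq_zero.1 h2).resolve_left (exp_ne_zero _)

theorem lap_expKer {a : ℝ} (ha : 0 < a) {lam : ℂ} (hl : lam.re ≤ 1) (hla : lam + a ≠ 0) {s : ℂ}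
    (hs : s.re = 4) : lap (expKer a lam) s = 1 / ((s - lam) * (s + a)) := by
  have e : ∀ u : ℝ, cexp (-s * u) * expKer a lam u =
      (cexp (-(s - lam) * u) - cexp (-(s + a) * u)) / (lam + a) := by
    intro u
    rw [expKer, mul_div_assoc', mul_sub, ← Complex.exp_add, ← Complex.exp_add]
    congr 3 <;> ring_nf
  have r1 : (-(s - lam)).re < 0 := by simp; linarith
  have r2 : (-(s + a)).re < 0 := by simp; linarith
  have n1 : s - lam ≠ 0 := fun h => by rw [h] at r1; simp at r1
  have n2 : s + a ≠ 0 := fun h => by rw [h] at r2; simp at r2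
  rw [lap]
  simp only [e]
  rw [integral_div, integral_sub (integrableOn_exp_mul_complex_Ioi r1 0)
    (integrableOn_exp_mul_complex_Ioi r2 0), integral_exp_mul_complex_Ioi r1,
    integral_exp_mul_complex_Ioi r2]
  simp only [ofReal_zero, mul_zero, Complex.exp_zero]
  have n3 : -(s - lam) ≠ 0 := neg_ne_zero.2 n1
  have n4 : -(s + a) ≠ 0 := neg_ne_zero.2 n2
  field_simp
  ring

theorem hasSum_lap {ι : Type*} {F : ι → ℝ → ℂ} {s : ℂ} {B : ι → ℝ} (hB : Summable B)
    (hz : ∀ i, B i = 0 → F i = 0) (hi : ∀ i, IntegrableOn (fun u : ℝ => cexp (-s * u) * F i u) (Ioi 0))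
    (hn : ∀ i, ∫ u in Ioi (0 : ℝ), ‖cexp (-s * u) * F i u‖ ≤ B i) :
    HasSum (fun i => lap (F i) s) (lap (fun u => ∑' i, F i u) s) := by
  set S := Function.support B
  have hS : S.Countable := hB.countable_support
  have : Countable S := hS.to_subtype
  have hzS : ∀ i, i ∉ S → F i = 0 := fun i h => hz i (by simpa [S] using h)
  have h1 := hasSum_integral_of_summable_integral_norm (ι := S) (μ := volume.restrict (Ioi (0 : ℝ)))
    (F := fun i u => cexp (-s * u) * F i u) (fun i => hi i)
    ((hB.subtype S).of_nonneg_of_le (fun i => integral_nonneg fun _ => norm_nonneg _) fun i => hn i)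
  have h2 : (fun u : ℝ => ∑' i : S, cexp (-s * u) * F i u) = fun u : ℝ => cexp (-s * u) * ∑' i, F i u := by
    ext u
    rw [tsum_mul_left]
    congr 1
    exact tsum_subtype_eq_of_support_subset (f := fun i => F i u) fun i hi => by
      by_contra h
      exact hi (by show F i u = 0; rw [hzS i h]; rfl)
  rw [h2] at h1
  refine (hasSum_subtype_iff_of_support_subset (f := fun i => lap (F i) s) ?_).1 h1
  intro i hi
  by_contra h
  exact hi (by simp [hzS i h, lap])

theorem hasSum_lap_expKer {ι : Type*} {a : ℝ} (ha : 0 < a) {w lam : ι → ℂ} (hl : ∀ i, (lam i).re ≤ 1)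
    (hla : ∀ i, lam i + a ≠ 0) (hw : Summable fun i => ‖w i‖ / ‖lam i + a‖) {s : ℂ} (hs : s.re = 4) :
    HasSum (fun i => w i / ((s - lam i) * (s + a))) (lap (fun u => ∑' i, w i * expKer a (lam i) u) s) := by
  have hb : ∀ i u, 0 ≤ u → ‖w i * expKer a (lam i) u‖ ≤ 2 * (‖w i‖ / ‖lam i + a‖) * Real.exp (2 * u) := by
    intro i u hu
    rw [norm_mul]
    calc ‖w i‖ * ‖expKer a (lam i) u‖ ≤ ‖w i‖ * (2 / ‖lam i + a‖ * Real.exp u) := by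
          gcongr; exact norm_expKer_le ha (hl i) hu
      _ ≤ ‖w i‖ * (2 / ‖lam i + a‖ * Real.exp (2 * u)) := by gcongr; linarith
      _ = _ := by ring
  have hi : ∀ i, IntegrableOn (fun u : ℝ => cexp (-s * u) * (w i * expKer a (lam i) u)) (Ioi 0) := fun i =>
    integrableOn_lap ((continuous_const.mul (continuous_expKer a (lam i))).continuousOn) (hb i) hs
  have h := hasSum_lap (F := fun i u => w i * expKer a (lam i) u) (s := s)
    (B := fun i => ‖w i‖ / ‖lam i + a‖) hw ?_ hi ?_
  · refine HasSum.of_eq h (fun i => ?_) rfl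
    have : lap (fun u => w i * expKer a (lam i) u) s = w i * lap (expKer a (lam i)) s := by
      rw [lap, lap, ← integral_const_mul]
      congr 1; ext u; ring
    rw [this, lap_expKer ha (hl i) (hla i) hs, mul_one_div]
  · intro i h0
    have : w i = 0 := by
      rcases div_eq_zero_iff.1 h0 with h | h
      · simpa using h
      · exact absurd (norm_eq_zero.1 h) (hla i)
    ext u; simp [this]
  · intro i
    have hg : IntegrableOn (fun u : ℝ => 2 * (‖w i‖ / ‖lam i + a‖) * Real.exp (-2 * u)) (Ioi 0) :=
      (integrableOn_exp_mul_Ioi (by norm_num) 0).const_mul _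
    calc _ ≤ ∫ u in Ioi (0 : ℝ), 2 * (‖w i‖ / ‖lam i + a‖) * Real.exp (-2 * u) := by
          refine setIntegral_mono_on (hi i).norm hg measurableSet_Ioi fun u hu => ?_
          have e : (-s * u).re = -4 * u := by simp [hs]
          rw [norm_mul, norm_exp, e]
          calc Real.exp (-4 * u) * ‖w i * expKer a (lam i) u‖
              ≤ Real.exp (-4 * u) * (2 * (‖w i‖ / ‖lam i + a‖) * Real.exp (2 * u)) := by
                gcongr; exact hb i u (le_of_lt hu)
            _ = 2 * (‖w i‖ / ‖lam i + a‖) * (Real.exp (-4 * u) * Real.exp (2 * u)) := by ring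
            _ = _ := by rw [← Real.exp_add]; ring_nf
      _ = _ := by
        rw [integral_const_mul, integral_exp_mul_Ioi (by norm_num)]
        norm_num
        ring

/-- Continuous functions on `[0, ∞)` vanishing at `0` and of growth at most `e^{2u}`. -/
structure LapAdm (h : ℝ → ℂ) : Prop where
  cont : ContinuousOn h (Ici 0)
  zero : h 0 = 0
  bound : ∃ C, ∀ u, 0 ≤ u → ‖h u‖ ≤ C * Real.exp (2 * u)

namespace LapAdm

variable {h g : ℝ → ℂ}

theorem integrableOn (hh : LapAdm h) {s : ℂ} (hs : s.re = 4) :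
    IntegrableOn (fun u : ℝ => cexp (-s * u) * h u) (Ioi 0) :=
  let ⟨_, hC⟩ := hh.bound
  integrableOn_lap (hh.cont.mono Ioi_subset_Ici_self) hC hs

theorem add (hh : LapAdm h) (hg : LapAdm g) : LapAdm fun u => h u + g u := by
  obtain ⟨C, hC⟩ := hh.bound
  obtain ⟨D, hD⟩ := hg.bound
  refine ⟨hh.cont.add hg.cont, by simp [hh.zero, hg.zero], C + D, fun u hu => ?_⟩
  refine (norm_add_le _ _).trans ?_
  linarith [hC u hu, hD u hu]

theorem const_mul (hh : LapAdm h) (c : ℂ) : LapAdm fun u => c * h u := by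
  obtain ⟨C, hC⟩ := hh.bound
  refine ⟨continuousOn_const.mul hh.cont, by simp [hh.zero], ‖c‖ * C, fun u hu => ?_⟩
  rw [norm_mul, mul_assoc]
  exact mul_le_mul_of_nonneg_left (hC u hu) (norm_nonneg _)

theorem lap_add (hh : LapAdm h) (hg : LapAdm g) {s : ℂ} (hs : s.re = 4) :
    lap (fun u => h u + g u) s = lap h s + lap g s := by
  unfold lap
  rw [← integral_add (hh.integrableOn hs) (hg.integrableOn hs)]
  simp only [mul_add]

theorem eqOn (hh : LapAdm h) (hg : LapAdm g) (hL : ∀ s : ℂ, s.re = 4 → lap h s = lap g s)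
    {u : ℝ} (hu : 0 ≤ u) : h u = g u := by
  have hd := hh.add (hg.const_mul (-1))
  set d : ℝ → ℂ := fun u => h u + -1 * g u
  obtain ⟨C, hC⟩ := hd.bound
  have h1 : d (max u 0) = 0 := by
    refine eq_zero_of_lap_eq_zero (h := fun u => d (max u 0)) (C := C) ?_ ?_ ?_ ?_ hu
    · exact hd.cont.comp_continuous (by fun_prop) fun x => mem_Ici.2 (le_max_right _ _)
    · simpa using hd.zero
    · intro u hu; simpa only [max_eq_left hu] using hC u hu
    · intro s hs
      have : lap (fun u => d (max u 0)) s = lap d s :=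
        setIntegral_congr_fun measurableSet_Ioi fun u hu => by
          simp only [max_eq_left (le_of_lt (mem_Ioi.1 hu))]
      rw [this, hh.lap_add (hg.const_mul (-1)) hs]
      have : lap (fun u => -1 * g u) s = -lap g s := by
        unfold lap; rw [← integral_neg]; congr 1; ext u; ring
      rw [this, hL s hs, add_neg_cancel]
  rw [max_eq_left hu] at h1
  linear_combination h1

end LapAdm

theorem lapAdm_expKer {a : ℝ} (ha : 0 < a) {lam : ℂ} (hl : lam.re ≤ 1) : LapAdm (expKer a lam) := by
  refine ⟨(continuous_expKer a lam).continuousOn, expKer_zero a lam, 2 / ‖lam + a‖, fun u hu => ?_⟩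
  refine (norm_expKer_le ha hl hu).trans ?_
  gcongr; linarith

theorem norm_mul_expKer_le {a : ℝ} (ha : 0 < a) {w lam : ℂ} (hl : lam.re ≤ 1) {u : ℝ} (hu : 0 ≤ u) :
    ‖w * expKer a lam u‖ ≤ 2 * (‖w‖ / ‖lam + a‖) * Real.exp u := by
  rw [norm_mul]
  calc _ ≤ ‖w‖ * (2 / ‖lam + a‖ * Real.exp u) := by gcongr; exact norm_expKer_le ha hl hu
    _ = _ := by ring

theorem lapAdm_tsum_expKer {ι : Type*} {a : ℝ} (ha : 0 < a) {w lam : ι → ℂ} (hl : ∀ i, (lam i).re ≤ 1)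
    (hw : Summable fun i => ‖w i‖ / ‖lam i + a‖) :
    LapAdm fun u => ∑' i, w i * expKer a (lam i) u := by
  refine ⟨?_, by simp [expKer_zero], 2 * ∑' i, ‖w i‖ / ‖lam i + a‖, fun u hu => ?_⟩
  · have : (fun u => ∑' i, w i * expKer a (lam i) u) =
        fun u : ℝ => cexp u * ∑' i, cexp (-u) * (w i * expKer a (lam i) u) := by
      ext u
      rw [tsum_mul_left, ← mul_assoc, ← Complex.exp_add]; simp
    rw [this]
    refine ContinuousOn.mul (by fun_prop) ?_
    refine continuousOn_tsum (u := fun i => 2 * (‖w i‖ / ‖lam i + a‖))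
      (fun i => (Continuous.mul (by fun_prop)
        (continuous_const.mul (continuous_expKer a (lam i)))).continuousOn) (hw.mul_left 2) ?_
    intro i u hu
    rw [norm_mul, norm_exp]
    calc _ ≤ Real.exp (-u) * (2 * (‖w i‖ / ‖lam i + a‖) * Real.exp u) := by
          gcongr
          · simp
          · exact norm_mul_expKer_le ha (hl i) hu
      _ = 2 * (‖w i‖ / ‖lam i + a‖) * (Real.exp (-u) * Real.exp u) := by ring
      _ = _ := by rw [← Real.exp_add]; simp
  · rw [← tsum_mul_left, ← tsum_mul_right]
    refine tsum_of_norm_bounded (((hw.mul_left 2).mul_right _).hasSum) fun i => ?_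
    refine (norm_mul_expKer_le ha (hl i) hu).trans ?_
    gcongr; linarith

end

section

open Complex MeasureTheory Set Filter Topology
open ArithmeticFunction (vonMangoldt)
open scoped ArithmeticFunction.vonMangoldt

/-- `expKer a 0` translated by `log n` and cut off to the left. -/
noncomputable def primeKer (a : ℝ) (n : ℕ) (u : ℝ) : ℂ :=
  if Real.log n < u then expKer a 0 (u - Real.log n) else 0

theorem norm_primeKer_le {a : ℝ} (ha : 0 < a) (n : ℕ) (u : ℝ) : ‖primeKer a n u‖ ≤ 1 / a := by
  unfold primeKer
  split_ifs with h
  · have h1 : 0 ≤ a * (u - Real.log n) := mul_nonneg ha.le (by linarith)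
    have e : expKer a 0 (u - Real.log n) = (((1 - Real.exp (-(a * (u - Real.log n)))) / a : ℝ) : ℂ) := by
      simp [expKer]
    rw [e, norm_real, Real.norm_eq_abs, abs_of_nonneg]
    · gcongr; linarith [Real.exp_pos (-(a * (u - Real.log n)))]
    · have := Real.exp_le_one_iff.2 (neg_nonpos.2 h1)
      exact div_nonneg (by linarith) ha.le
  · simp; positivity

theorem primeKer_laplace {a : ℝ} (ha : 0 < a) {n : ℕ} (hn : n ≠ 0) {s : ℂ} (hs : s.re = 4) :
    IntegrableOn (fun u : ℝ => cexp (-s * u) * primeKer a n u) (Ioi 0) ∧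
    ∫ u in Ioi (0 : ℝ), ‖cexp (-s * u) * primeKer a n u‖ ≤ 1 / a * (n : ℝ) ^ (-4 : ℝ) ∧
    lap (primeKer a n) s = 1 / ((n : ℂ) ^ s * (s * (s + a))) := by
  set c := Real.log n with hc
  have hc0 : 0 ≤ c := Real.log_natCast_nonneg n
  have e : ∀ u : ℝ, cexp (-s * u) * primeKer a n u = Set.indicator (Ioi c)
      (fun u : ℝ => (cexp (-s * u) - cexp (a * c) * cexp (-(s + a) * u)) / a) u := by
    intro u
    by_cases h : c < u
    · simp only [primeKer, ← hc, h, if_true, indicator, mem_Ioi, expKer, zero_mul, Complex.exp_zero, zero_add]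
      rw [mul_div_assoc', mul_sub, mul_one, ← Complex.exp_add, ← Complex.exp_add]
      congr 3; push_cast; ring_nf
    · simp [primeKer, ← hc, h, indicator]
  have r1 : (-s).re < 0 := by simp [hs]
  have r2 : (-(s + a)).re < 0 := by simp [hs]; linarith
  have n1 : s ≠ 0 := fun h => by rw [h] at r1; simp at r1
  have n2 : s + a ≠ 0 := fun h => by rw [h] at r2; simp at r2
  have i1 := integrableOn_exp_mul_complex_Ioi r1 c
  have i2 := (integrableOn_exp_mul_complex_Ioi r2 c).const_mul (cexp (a * c))
  have hInt : IntegrableOn (fun u : ℝ => cexp (-s * u) * primeKer a n u) (Ioi 0) := by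
    simp only [e]
    have : Integrable (Set.indicator (Ioi c)
      (fun u : ℝ => (cexp (-s * u) - cexp (a * c) * cexp (-(s + a) * u)) / a)) :=
      (integrable_indicator_iff measurableSet_Ioi).2 ((i1.sub i2).div_const _)
    exact this.integrableOn
  have hsub : Ioi c ⊆ Ioi 0 := Ioi_subset_Ioi hc0
  have hn4 : (n : ℝ) ^ (-4 : ℝ) = Real.exp (-4 * c) := by
    rw [Real.rpow_def_of_pos (by positivity), mul_comm]
  refine ⟨hInt, ?_, ?_⟩
  · have hg : IntegrableOn (fun u : ℝ => 1 / a * Real.exp (-4 * u)) (Ioi c) :=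
      (integrableOn_exp_mul_Ioi (by norm_num) c).const_mul _
    have hg' : Integrable (Set.indicator (Ioi c) fun u : ℝ => 1 / a * Real.exp (-4 * u)) :=
      (integrable_indicator_iff measurableSet_Ioi).2 hg
    calc _ ≤ ∫ u in Ioi (0 : ℝ), Set.indicator (Ioi c) (fun u : ℝ => 1 / a * Real.exp (-4 * u)) u := by
          refine setIntegral_mono_on hInt.norm hg'.integrableOn measurableSet_Ioi fun u hu => ?_
          by_cases h : c < u
          · simp only [indicator, mem_Ioi, h, if_true]
            rw [norm_mul, norm_exp, mul_comm]
            have : (-s * u).re = -4 * u := by simp [hs]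
            rw [this]
            gcongr
            exact norm_primeKer_le ha n u
          · simp [primeKer, ← hc, h, indicator]
      _ = ∫ u in Ioi c, 1 / a * Real.exp (-4 * u) := by
          rw [setIntegral_indicator measurableSet_Ioi, inter_eq_self_of_subset_right hsub]
      _ ≤ _ := by
          rw [integral_const_mul, integral_exp_mul_Ioi (by norm_num), hn4]
          gcongr
          have := Real.exp_pos (-4 * c)
          linarith
  · rw [lap]
    simp only [e]
    rw [setIntegral_indicator measurableSet_Ioi, inter_eq_self_of_subset_right hsub, integral_div,
      integral_sub i1 i2, integral_const_mul, integral_exp_mul_complex_Ioi r1,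
      integral_exp_mul_complex_Ioi r2]
    have h3 : cexp (a * c) * (-cexp (-(s + a) * c) / -(s + a)) = cexp (-s * c) / (s + a) := by
      rw [neg_div_neg_eq, mul_div_assoc', ← Complex.exp_add]
      congr 2; ring
    have h4 : (n : ℂ) ^ s = (cexp (-s * c))⁻¹ := by
      rw [cpow_def_of_ne_zero (by exact_mod_cast hn), ← Complex.exp_neg, hc, natCast_log]
      congr 1; ring
    have ha' : (a : ℂ) ≠ 0 := by exact_mod_cast ha.ne'
    rw [h3, h4]
    have := Complex.exp_ne_zero (-s * c)
    field_simp
    ring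

theorem summable_vonMangoldt_rpow : Summable fun n : ℕ => Λ n * (n : ℝ) ^ (-4 : ℝ) := by
  have h := (ArithmeticFunction.LSeriesSummable_vonMangoldt (s := 4) (by norm_num)).norm
  refine h.congr fun n => ?_
  rcases eq_or_ne n 0 with rfl | hn
  · simp
  · rw [LSeries.norm_term_eq, if_neg hn, Real.rpow_neg (by positivity)]
    simp [abs_of_nonneg, div_eq_mul_inv]

theorem lap_primeSide {a : ℝ} (ha : 0 < a) {s : ℂ} (hs : s.re = 4) :
    lap (fun u => ∑' n : ℕ, (Λ n : ℂ) * primeKer a n u) s =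
      LSeries (fun n => (Λ n : ℂ)) s / (s * (s + a)) := by
  have hz : ∀ n : ℕ, Λ n ≠ 0 → n ≠ 0 := fun n h h0 => h (by simp [h0])
  have h := hasSum_lap (F := fun (n : ℕ) u => (Λ n : ℂ) * primeKer a n u) (s := s)
    (B := fun n : ℕ => Λ n * (1 / a * (n : ℝ) ^ (-4 : ℝ)))
    ((summable_vonMangoldt_rpow.mul_left (1 / a)).congr fun n => by ring) ?_ ?_ ?_
  · rw [← h.tsum_eq, LSeries, ← tsum_div_const]
    refine tsum_congr fun n => ?_
    rcases eq_or_ne n 0 with rfl | hn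
    · simp [lap]
    have : lap (fun u => (Λ n : ℂ) * primeKer a n u) s = (Λ n : ℂ) * lap (primeKer a n) s := by
      rw [lap, lap, ← integral_const_mul]
      congr 1; ext u; ring
    rw [this, (primeKer_laplace ha hn hs).2.2, LSeries.term_of_ne_zero hn, mul_one_div, div_div]
  · intro n h
    have : Λ n = 0 := by
      by_contra h'
      have := hz n h'
      have h2 : (0 : ℝ) < (n : ℝ) ^ (-4 : ℝ) := Real.rpow_pos_of_pos (by positivity) _
      exact (mul_ne_zero h' (by positivity)) h
    ext u; simp [this]
  · intro n
    by_cases h : Λ n = 0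
    · simp [h]
    · have := ((primeKer_laplace ha (hz n h) hs).1).const_mul (Λ n : ℂ)
      refine this.congr (Eventually.of_forall fun u => ?_)
      simp only; ring
  · intro n
    by_cases h : Λ n = 0
    · simp [h]
    · calc _ = ∫ u in Ioi (0 : ℝ), Λ n * ‖cexp (-s * u) * primeKer a n u‖ := by
            congr 1; ext u
            rw [mul_left_comm, norm_mul, norm_real, Real.norm_of_nonneg ArithmeticFunction.vonMangoldt_nonneg]
        _ ≤ _ := by
            rw [integral_const_mul]
            gcongr
            exact (primeKer_laplace ha (hz n h) hs).2.1

theorem expInt_psiErr_eq_tsum {a : ℝ} (ha : 0 < a) {u : ℝ} (hu : 0 ≤ u) :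
    ((expInt a psiErr u : ℝ) : ℂ) + expKer a 1 u = ∑' n : ℕ, (Λ n : ℂ) * primeKer a n u := by
  have h := primeSum_psiErr.expInt (a := a) (by simp [ha.ne']) (by simp; linarith) u hu
  rw [tsum_eq_sum (s := Finset.Icc 1 ⌊Real.exp u⌋₊), h]
  · push_cast
    rw [sub_add_eq_add_sub, sub_eq_iff_eq_add]
    congr 1
    · refine Finset.sum_congr rfl fun n hn => ?_
      obtain ⟨h1, h2⟩ := Finset.mem_Icc.1 hn
      have h3 : Real.log n ≤ u := by
        rw [Real.log_le_iff_le_exp (by exact_mod_cast h1)]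
        exact (Nat.le_floor_iff (Real.exp_pos u).le).1 h2
      congr 1
      rcases h3.eq_or_lt with h3 | h3
      · simp [primeKer, h3, expPoly, expPolyInt]
      · simp [primeKer, h3, expPoly, expPolyInt, expKer]
        ring
    · simp [expPoly, expPolyInt, expKer]
      ring
  · intro n hn
    rcases Nat.eq_zero_or_pos n with rfl | h1
    · simp
    have : ¬ Real.log n < u := by
      intro h
      refine hn (Finset.mem_Icc.2 ⟨h1, ?_⟩)
      rw [Nat.le_floor_iff (Real.exp_pos u).le, ← Real.log_le_iff_le_exp (by exact_mod_cast h1)]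
      exact h.le
    simp [primeKer, this]

theorem norm_le_norm_add_ofReal {z : ℂ} (hz : 0 ≤ z.re) {a : ℝ} (ha : 0 ≤ a) : ‖z‖ ≤ ‖z + a‖ := by
  rw [← sq_le_sq₀ (norm_nonneg _) (norm_nonneg _), ← normSq_eq_norm_sq, ← normSq_eq_norm_sq,
    normSq_apply, normSq_apply]
  simp only [add_re, ofReal_re, add_im, ofReal_im, add_zero]
  nlinarith

theorem xiFun.summable_weight {a : ℝ} (ha : 0 ≤ a) :
    Summable fun ρ : ℂ => ‖-(mult ρ : ℂ) / ρ‖ / ‖ρ + a‖ := by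
  refine summable_mult_div_sq.of_nonneg_of_le (fun ρ => by positivity) fun ρ => ?_
  rcases eq_or_ne (mult ρ) 0 with h | h
  · simp [h]
  have h1 := re_mem_of_mult_ne h
  have h2 : 0 < ‖ρ‖ := norm_pos_iff.2 fun h => by simp [h] at h1
  rw [norm_div, norm_neg, div_div, norm_natCast, sq]
  gcongr
  exact norm_le_norm_add_ofReal h1.1.le ha

theorem norm_trivial_add {a : ℝ} (n : ℕ) : ‖-(2 * (n : ℂ) + 2) + a‖ = |a - (2 * n + 2)| := by
  have : -(2 * (n : ℂ) + 2) + a = ((a - (2 * n + 2) : ℝ) : ℂ) := by push_cast; ring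
  rw [this, norm_real, Real.norm_eq_abs]

theorem summable_trivial (a : ℝ) :
    Summable fun n : ℕ => ‖1 / (2 * (n : ℂ) + 2)‖ / ‖-(2 * (n : ℂ) + 2) + a‖ := by
  have hb : Summable fun n : ℕ => 1 / ((n : ℝ)) ^ 2 := Real.summable_one_div_nat_pow.2 (by norm_num)
  refine summable_of_isBigO_nat hb ?_
  refine Asymptotics.IsBigO.of_bound 1 ?_
  filter_upwards [eventually_ge_atTop (⌈|a|⌉₊ + 1)] with n hn
  have hn' : |a| ≤ n := (Nat.le_ceil _).trans (by exact_mod_cast (by omega))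
  have hn1 : (1 : ℝ) ≤ n := by exact_mod_cast (by omega)
  have h2 : ‖2 * (n : ℂ) + 2‖ = 2 * n + 2 := by
    have : (2 * (n : ℂ) + 2) = ((2 * n + 2 : ℝ) : ℂ) := by push_cast; ring
    rw [this, norm_real, Real.norm_of_nonneg (by positivity)]
  have h3 : (n : ℝ) ≤ |a - (2 * n + 2)| := by
    rw [abs_sub_comm]
    refine le_trans ?_ (le_abs_self _)
    linarith [le_abs_self a]
  rw [norm_trivial_add, norm_div (1 : ℂ), norm_one, h2, one_mul, div_div, Real.norm_of_nonneg (by positivity),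
    Real.norm_of_nonneg (by positivity), sq]
  gcongr
  linarith

theorem lapAdm_expInt_psiErr {a : ℝ} (ha : 0 < a) : LapAdm fun u => ((expInt a psiErr u : ℝ) : ℂ) := by
  refine ⟨(continuous_ofReal.comp (continuous_expInt locInt_psiErr a)).continuousOn, by simp [expInt_zero],
    2 / (a + 2), fun u hu => ?_⟩
  rw [norm_real, Real.norm_eq_abs]
  exact abs_expInt_le hu (by linarith) (by norm_num) fun v hv _ => abs_psiErr_le hv

theorem laplace_identity {s : ℂ} (hs : s.re = 4) :
    HasSum (fun ρ : ℂ => (-(xiFun.mult ρ : ℂ) / ρ) / (s - ρ)) (-(logDeriv xiFun s - logDeriv xiFun 0) / s) ∧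
    HasSum (fun n : ℕ => (1 / (2 * (n : ℂ) + 2)) / (s - -(2 * (n : ℂ) + 2)))
      ((digamma (s / 2) + 2 / s + Real.eulerMascheroniConstant) / (2 * s)) ∧
    LSeries (fun n => (Λ n : ℂ)) s / s - 1 / (s - 1) = -(Real.log (2 * Real.pi)) / s +
      (digamma (s / 2) + 2 / s + Real.eulerMascheroniConstant) / (2 * s) +
      -(logDeriv xiFun s - logDeriv xiFun 0) / s := by
  have s0 : s ≠ 0 := fun h => by norm_num [h] at hs
  have s1 : s - 1 ≠ 0 := fun h => by rw [sub_eq_zero.1 h] at hs; norm_num at hs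
  have hx : xiFun s ≠ 0 := xiFun.ne_zero_of_one_le_re (by linarith)
  refine ⟨?_, ?_, ?_⟩
  · refine HasSum.of_eq ((xiFun.hasSum_logDeriv hx).div_const (-s)) (fun ρ => ?_) (by rw [div_neg, neg_div])
    rcases eq_or_ne (xiFun.mult ρ) 0 with h | h
    · simp [h]
    have h1 := xiFun.re_mem_of_mult_ne h
    have h2 : ρ ≠ 0 := fun h => by simp [h] at h1
    have h3 : s - ρ ≠ 0 := fun h => by rw [← sub_eq_zero.1 h] at h1; linarith [h1.2]
    field_simp
    ring
  · have hd := DigammaSeries.hasSum_digamma (s := s / 2 + 1) (by simp [hs]; norm_num)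
    rw [digamma_apply_add_one] at hd
    · refine HasSum.of_eq (hd.div_const (2 * s)) (fun n => ?_) (by field_simp)
      have h1 : (n : ℂ) + 1 ≠ 0 := by exact_mod_cast n.succ_ne_zero
      have h2 : s / 2 + 1 + n ≠ 0 := fun h => by
        have := congrArg re h
        simp [hs] at this
        have h0 : (0 : ℝ) ≤ n := by positivity
        linarith
      have h3 : s - -(2 * (n : ℂ) + 2) ≠ 0 := fun h => h2 (by linear_combination h / 2)
      have h4 : 2 * (n : ℂ) + 2 ≠ 0 := fun h => h1 (by linear_combination h / 2)
      have h5 : s + 2 + 2 * n ≠ 0 := fun h => h3 (by linear_combination h)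
      have e1 : s / 2 + 1 + n = (s + 2 + 2 * n) / 2 := by ring
      have e2 : s - -(2 * (n : ℂ) + 2) = s + 2 + 2 * n := by ring
      have e3 : 2 * (n : ℂ) + 2 = 2 * (n + 1) := by ring
      rw [e1, e2, e3]
      field_simp
      ring
    · intro m h
      have := congrArg re h
      simp [hs] at this
      have h0 : (0 : ℝ) ≤ m := by positivity
      linarith
  · rw [xiFun.logDeriv_eq (by linarith), xiFun.logDeriv_zero]
    have e1 : Real.log (4 * Real.pi) = 2 * Real.log 2 + Real.log Real.pi := by
      rw [Real.log_mul (by norm_num) Real.pi_ne_zero, show (4 : ℝ) = 2 ^ 2 by norm_num, Real.log_pow]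
      norm_num
    have e2 : Real.log (2 * Real.pi) = Real.log 2 + Real.log Real.pi :=
      Real.log_mul (by norm_num) Real.pi_ne_zero
    rw [e1, e2]
    push_cast
    field_simp
    ring

/-- The explicit formula for the smoothed remainder `ψ(e^u) - e^u`. -/
theorem expInt_psiErr_explicit {a : ℝ} (ha : 0 < a) (hodd : ∀ n : ℕ, a - (2 * n + 2) ≠ 0) {u : ℝ}
    (hu : 0 ≤ u) : ((expInt a psiErr u : ℝ) : ℂ) = -(Real.log (2 * Real.pi)) * expKer a 0 u +
      ∑' n : ℕ, 1 / (2 * (n : ℂ) + 2) * expKer a (-(2 * (n : ℂ) + 2)) u +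
      ∑' ρ : ℂ, -(xiFun.mult ρ : ℂ) / ρ * expKer a ρ u := by
  set lam : ℂ → ℂ := fun ρ => if xiFun.mult ρ = 0 then 0 else ρ with hlam
  have hlam' : ∀ ρ, xiFun.mult ρ ≠ 0 → lam ρ = ρ := fun ρ h => by simp [hlam, h]
  have hl1 : ∀ ρ, (lam ρ).re ≤ 1 := by
    intro ρ
    by_cases h : xiFun.mult ρ = 0
    · simp [hlam, h]
    · rw [hlam' ρ h]; exact (xiFun.re_mem_of_mult_ne h).2.le
  have hl2 : ∀ ρ, lam ρ + a ≠ 0 := by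
    intro ρ h0
    have h0 := congrArg re h0
    by_cases h : xiFun.mult ρ = 0
    · simp [hlam, h] at h0; linarith
    · rw [hlam' ρ h] at h0
      have := (xiFun.re_mem_of_mult_ne h).1
      simp at h0; linarith
  have hsw : Summable fun ρ : ℂ => ‖-(xiFun.mult ρ : ℂ) / ρ‖ / ‖lam ρ + a‖ := by
    refine (xiFun.summable_weight ha.le).congr fun ρ => ?_
    by_cases h : xiFun.mult ρ = 0
    · simp [h]
    · rw [hlam' ρ h]
  have e1 : ∀ u, ∑' ρ : ℂ, -(xiFun.mult ρ : ℂ) / ρ * expKer a ρ u =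
      ∑' ρ : ℂ, -(xiFun.mult ρ : ℂ) / ρ * expKer a (lam ρ) u := by
    intro u
    refine tsum_congr fun ρ => ?_
    by_cases h : xiFun.mult ρ = 0
    · simp [h]
    · rw [hlam' ρ h]
  rw [e1]
  have ht1 : ∀ n : ℕ, (-(2 * (n : ℂ) + 2)).re ≤ 1 := by
    intro n
    have h0 : (0 : ℝ) ≤ n := by positivity
    simp; linarith
  have ht2 : ∀ n : ℕ, -(2 * (n : ℂ) + 2) + a ≠ 0 := by
    intro n
    rw [← norm_pos_iff, norm_trivial_add]
    exact abs_pos.2 (hodd n)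
  have A1 := (lapAdm_expKer ha (lam := 0) (by simp)).const_mul (-(Real.log (2 * Real.pi)))
  have A2 := lapAdm_tsum_expKer ha ht1 (summable_trivial a)
  have A3 := lapAdm_tsum_expKer ha hl1 hsw
  have B1 := lapAdm_expInt_psiErr ha
  have B2 := lapAdm_expKer ha (lam := 1) (by simp)
  refine B1.eqOn ((A1.add A2).add A3) (fun s hs => ?_) hu
  rw [(A1.add A2).lap_add A3 hs, A1.lap_add A2 hs]
  obtain ⟨L1, L2, L3⟩ := laplace_identity hs
  have sa : s + a ≠ 0 := fun h => by
    have := congrArg re h; simp [hs] at this; linarith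
  have s0 : s ≠ 0 := fun h => by norm_num [h] at hs
  have s1 : s - 1 ≠ 0 := fun h => by rw [sub_eq_zero.1 h] at hs; norm_num at hs
  have P := lap_primeSide ha hs
  have P' : lap (fun u => ∑' n : ℕ, (Λ n : ℂ) * primeKer a n u) s =
      lap (fun u => ((expInt a psiErr u : ℝ) : ℂ)) s + lap (expKer a 1) s := by
    rw [← B1.lap_add B2 hs]
    exact setIntegral_congr_fun measurableSet_Ioi fun u hu => by
      simp only [expInt_psiErr_eq_tsum ha (le_of_lt (mem_Ioi.1 hu))]
  rw [P', lap_expKer ha (by simp) (fun h => by have := congrArg re h; simp at this; linarith) hs] at P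
  have Q1 : lap (fun u => -(Real.log (2 * Real.pi)) * expKer a 0 u) s =
      -(Real.log (2 * Real.pi)) / (s * (s + a)) := by
    have : lap (fun u => -(Real.log (2 * Real.pi)) * expKer a 0 u) s =
        -(Real.log (2 * Real.pi)) * lap (expKer a 0) s := by
      rw [lap, lap, ← integral_const_mul]; congr 1; ext u; ring
    rw [this, lap_expKer ha (by simp) (by simpa using ha.ne') hs, sub_zero, mul_one_div]
  have Q2 := (hasSum_lap_expKer ha ht1 ht2 (summable_trivial a) hs).unique
    (HasSum.of_eq (L2.div_const (s + a)) (fun n => (div_div _ _ _).symm) rfl)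
  have Q3 := (hasSum_lap_expKer ha hl1 hl2 hsw hs).unique
    (HasSum.of_eq (L1.div_const (s + a)) (fun ρ => by
      by_cases h : xiFun.mult ρ = 0
      · simp [h]
      · rw [hlam' ρ h]; exact (div_div _ _ _).symm) rfl)
  rw [Q1, Q2, Q3]
  have : lap (fun u => ((expInt a psiErr u : ℝ) : ℂ)) s =
      (LSeries (fun n => (Λ n : ℂ)) s / s - 1 / (s - 1)) / (s + a) := by
    rw [eq_sub_of_add_eq P]; field_simp
  rw [this, L3]
  field_simp

end

section

open Complex MeasureTheory Set Filter Topology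

/-- The real exponential series with exponents `ρ` and coefficients `c ρ`. -/
noncomputable def zeroSum (c : ℂ → ℂ) (u : ℝ) : ℝ := (∑' ρ : ℂ, c ρ * cexp (ρ * u)).re

/-- Absolutely summable coefficients supported in the critical strip. -/
structure StripCoeff (c : ℂ → ℂ) : Prop where
  summable : Summable fun ρ => ‖c ρ‖
  strip : ∀ ρ, c ρ ≠ 0 → 0 < ρ.re ∧ ρ.re < 1

namespace StripCoeff

variable {c : ℂ → ℂ}

theorem norm_term_le (hc : StripCoeff c) {u : ℝ} (hu : 0 ≤ u) (ρ : ℂ) :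
    ‖c ρ * cexp (ρ * u)‖ ≤ ‖c ρ‖ * Real.exp u := by
  rcases eq_or_ne (c ρ) 0 with h | h
  · simp [h]
  rw [norm_mul, norm_exp]
  gcongr
  have := (hc.strip ρ h).2
  simp; nlinarith

theorem norm_add_ge (hc : StripCoeff c) {a : ℝ} {ρ : ℂ} (h : c ρ ≠ 0) : a < ‖ρ + a‖ := by
  refine lt_of_lt_of_le ?_ (re_le_norm _)
  have := (hc.strip ρ h).1
  simpa using this

theorem summable_term (hc : StripCoeff c) {u : ℝ} (hu : 0 ≤ u) :
    Summable fun ρ => c ρ * cexp (ρ * u) :=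
  .of_norm_bounded (hc.summable.mul_right _) (hc.norm_term_le hu)

theorem summable_div_norm (hc : StripCoeff c) {a : ℝ} (ha : 0 < a) :
    Summable fun ρ => ‖c ρ‖ / ‖ρ + a‖ := by
  refine (hc.summable.div_const a).of_nonneg_of_le (fun ρ => by positivity) fun ρ => ?_
  rcases eq_or_ne (c ρ) 0 with h | h
  · simp [h]
  have := hc.norm_add_ge (a := a) h
  gcongr

theorem div_add (hc : StripCoeff c) {a : ℝ} (ha : 0 < a) : StripCoeff fun ρ => c ρ / (ρ + a) := by
  refine ⟨?_, fun ρ h => hc.strip ρ fun h0 => h (by simp [h0])⟩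
  simpa only [norm_div] using hc.summable_div_norm ha

theorem hasSum_integral (hc : StripCoeff c) {a u : ℝ} (ha : 0 < a) (hu : 0 ≤ u) :
    HasSum (fun ρ => c ρ * expKer a ρ u)
      (∫ v in (0 : ℝ)..u, (Real.exp (-(a * (u - v))) : ℂ) * ∑' ρ : ℂ, c ρ * cexp (ρ * v)) := by
  set S := Function.support c
  have hS : S.Countable := by
    have := hc.summable.countable_support
    simpa [S, Function.support] using this
  have : Countable S := hS.to_subtype
  have hz : ∀ v : ℝ, ∑' ρ : ℂ, c ρ * cexp (ρ * v) = ∑' ρ : S, c ρ * cexp (ρ * v) := fun v =>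
    (tsum_subtype_eq_of_support_subset (f := fun ρ : ℂ => c ρ * cexp (ρ * v)) fun ρ hρ => by
      intro h0; exact hρ (by simp [h0])).symm
  have h1 := intervalIntegral.hasSum_integral_of_dominated_convergence (ι := S) (μ := volume)
    (a := 0) (b := u)
    (F := fun ρ (v : ℝ) => (Real.exp (-(a * (u - v))) : ℂ) * (c ρ * cexp (ρ * v)))
    (f := fun v => (Real.exp (-(a * (u - v))) : ℂ) * ∑' ρ : ℂ, c ρ * cexp (ρ * v))
    (fun ρ _ => ‖c ρ‖ * Real.exp u)
    (fun ρ => (by fun_prop : Continuous fun v : ℝ =>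
      (Real.exp (-(a * (u - v))) : ℂ) * (c ρ * cexp (ρ * v))).aestronglyMeasurable)
    ?_ ?_ ?_ ?_
  · rw [← hasSum_subtype_iff_of_support_subset (s := S)]
    · have h2 : ∀ ρ : S, (∫ v in (0 : ℝ)..u, (Real.exp (-(a * (u - v))) : ℂ) * (c ρ * cexp (ρ * v))) =
          c ρ * expKer a ρ u := by
        rintro ⟨ρ, hρ⟩
        have hne : ρ + a ≠ 0 := by
          rw [← norm_pos_iff]; exact ha.trans (hc.norm_add_ge hρ)
        have e : ∀ v : ℝ, (Real.exp (-(a * (u - v))) : ℂ) * (c ρ * cexp (ρ * v)) =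
            c ρ * cexp (-a * u) * cexp ((ρ + a) * v) := by
          intro v
          rw [ofReal_exp, mul_left_comm, mul_assoc, ← Complex.exp_add, ← Complex.exp_add]
          congr 2; push_cast; ring
        simp only [e]
        rw [intervalIntegral.integral_const_mul, integral_exp_mul_complex hne, expKer]
        have e2 : cexp (ρ * u) = cexp (-a * u) * cexp ((ρ + a) * u) := by
          rw [← Complex.exp_add]; congr 1; ring
        rw [e2]
        simp only [ofReal_zero, mul_zero, Complex.exp_zero]
        field_simp
      exact HasSum.of_eq h1 (fun ρ => (h2 ρ).symm) rfl
    · intro ρ hρ h0; exact hρ (by simp [h0])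
  · intro ρ
    refine Eventually.of_forall fun v hv => ?_
    rw [uIoc_of_le hu] at hv
    rw [norm_mul, norm_real, Real.norm_of_nonneg (Real.exp_pos _).le]
    have h1 : Real.exp (-(a * (u - v))) ≤ 1 := Real.exp_le_one_iff.2 (by
      have := mul_nonneg ha.le (sub_nonneg.2 hv.2); linarith)
    calc _ ≤ 1 * (‖c ρ‖ * Real.exp v) := by
          gcongr; exact hc.norm_term_le hv.1.le _
      _ ≤ _ := by rw [one_mul]; gcongr; exact hv.2
  · exact Eventually.of_forall fun v _ => (hc.summable.subtype S).mul_right _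
  · exact intervalIntegrable_const
  · refine Eventually.of_forall fun v hv => ?_
    rw [uIoc_of_le hu] at hv
    rw [hz]
    exact ((hc.summable_term hv.1.le).subtype S).hasSum.mul_left _

theorem continuousOn_tsum (hc : StripCoeff c) :
    ContinuousOn (fun u : ℝ => ∑' ρ : ℂ, c ρ * cexp (ρ * u)) (Ici 0) := by
  have : (fun u : ℝ => ∑' ρ : ℂ, c ρ * cexp (ρ * u)) =
      fun u : ℝ => cexp u * ∑' ρ : ℂ, cexp (-u) * (c ρ * cexp (ρ * u)) := by
    ext u
    rw [tsum_mul_left, ← mul_assoc, ← Complex.exp_add]; simp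
  rw [this]
  refine ContinuousOn.mul (by fun_prop) ?_
  refine _root_.continuousOn_tsum (u := fun ρ => ‖c ρ‖) (fun ρ => by fun_prop) hc.summable ?_
  intro ρ u hu
  rw [norm_mul, norm_exp]
  calc _ ≤ Real.exp (-u) * (‖c ρ‖ * Real.exp u) := by
        gcongr
        · simp
        · exact hc.norm_term_le hu ρ
    _ = ‖c ρ‖ * (Real.exp (-u) * Real.exp u) := by ring
    _ = _ := by rw [← Real.exp_add]; simp

theorem continuousOn_zeroSum (hc : StripCoeff c) : ContinuousOn (zeroSum c) (Ici 0) :=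
  continuous_re.comp_continuousOn hc.continuousOn_tsum

theorem expInt_zeroSum (hc : StripCoeff c) {a u : ℝ} (ha : 0 < a) (hu : 0 ≤ u) :
    expInt a (zeroSum c) u = zeroSum (fun ρ => c ρ / (ρ + a)) u -
      (∑' ρ : ℂ, c ρ / (ρ + a)).re * Real.exp (-(a * u)) := by
  have h1 := hc.hasSum_integral ha hu
  have h2 : expInt a (zeroSum c) u =
      (∫ v in (0 : ℝ)..u, (Real.exp (-(a * (u - v))) : ℂ) * ∑' ρ : ℂ, c ρ * cexp (ρ * v)).re := by
    rw [← reCLM_apply, ← ContinuousLinearMap.intervalIntegral_comp_comm]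
    · refine intervalIntegral.integral_congr fun v _ => ?_
      simp only [zeroSum, reCLM_apply, re_ofReal_mul]
    · refine ContinuousOn.intervalIntegrable ?_
      rw [uIcc_of_le hu]
      exact ContinuousOn.mul (by fun_prop) (hc.continuousOn_tsum.mono fun v hv => hv.1)
  rw [h2, ← h1.tsum_eq, zeroSum]
  have e : ∀ ρ : ℂ, c ρ * expKer a ρ u =
      c ρ / (ρ + a) * cexp (ρ * u) - c ρ / (ρ + a) * (Real.exp (-(a * u)) : ℂ) := by
    intro ρ; rw [expKer]; push_cast; ring_nf
  have hd := hc.div_add ha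
  simp only [e]
  rw [Summable.tsum_sub (hd.summable_term hu) (hd.summable.of_norm.mul_right _), tsum_mul_right,
    sub_re, re_mul_ofReal]

end StripCoeff

/-- `h` equals an exponential series plus a constant `K`, up to an error of size `B e^{-bu}`. -/
structure ZeroExp (h : ℝ → ℝ) (c : ℂ → ℂ) (K B b : ℝ) : Prop where
  loc : LocInt h
  coeff : StripCoeff c
  bound : ∀ u, 0 ≤ u → |h u - zeroSum c u - K| ≤ B * Real.exp (-(b * u))

theorem abs_expInt_le_of_lt {h : ℝ → ℝ} {a b C u : ℝ} (hu : 0 ≤ u) (hab : a < b) (hC : 0 ≤ C)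
    (hh : ∀ v, 0 ≤ v → v ≤ u → |h v| ≤ C * Real.exp (-(b * v))) :
    |expInt a h u| ≤ C / (b - a) * Real.exp (-(a * u)) := by
  have hba : 0 < b - a := by linarith
  have h1 : ‖∫ v in (0 : ℝ)..u, Real.exp (a * v) * h v‖ ≤
      ∫ v in (0 : ℝ)..u, C * Real.exp (-(b - a) * v) := by
    refine intervalIntegral.norm_integral_le_of_norm_le hu ?_
      ((by fun_prop : Continuous fun v : ℝ => C * Real.exp (-(b - a) * v)).intervalIntegrable _ _)
    refine Filter.Eventually.of_forall fun v hv => ?_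
    rw [norm_mul, Real.norm_eq_abs, Real.norm_eq_abs, Real.abs_exp]
    calc Real.exp (a * v) * |h v| ≤ Real.exp (a * v) * (C * Real.exp (-(b * v))) := by
          gcongr; exact hh v hv.1.le hv.2
      _ = C * Real.exp (-(b - a) * v) := by rw [mul_left_comm, ← Real.exp_add]; ring_nf
  have h2 : ∫ v in (0 : ℝ)..u, C * Real.exp (-(b - a) * v) =
      C / (b - a) * (1 - Real.exp (-(b - a) * u)) := by
    rw [intervalIntegral.integral_const_mul]
    rw [intervalIntegral.integral_comp_mul_left (fun x => Real.exp x) (neg_ne_zero.2 hba.ne')]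
    simp only [integral_exp, smul_eq_mul, mul_zero, Real.exp_zero]
    field_simp; ring
  rw [expInt_eq, abs_mul, Real.abs_exp]
  rw [Real.norm_eq_abs, h2] at h1
  calc Real.exp (-(a * u)) * |∫ v in (0 : ℝ)..u, Real.exp (a * v) * h v|
      ≤ Real.exp (-(a * u)) * (C / (b - a) * (1 - Real.exp (-(b - a) * u))) := by gcongr
    _ ≤ Real.exp (-(a * u)) * (C / (b - a) * 1) := by
      gcongr; linarith [Real.exp_pos (-(b - a) * u)]
    _ = _ := by ring

namespace ZeroExp

variable {h : ℝ → ℝ} {c : ℂ → ℂ} {K B b : ℝ}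

theorem nonneg (hz : ZeroExp h c K B b) : 0 ≤ B := by
  have := hz.bound 0 le_rfl
  simp at this
  exact (abs_nonneg _).trans this

theorem expInt_aux (hz : ZeroExp h c K B b) {a : ℝ} (ha : 0 < a) {b' D : ℝ} (hb' : b' ≤ a)
    (hD : ∀ g : ℝ → ℝ, ∀ u, 0 ≤ u → (∀ v, 0 ≤ v → v ≤ u → |g v| ≤ B * Real.exp (-(b * v))) →
      |expInt a g u| ≤ D * Real.exp (-(b' * u))) :
    ZeroExp (expInt a h) (fun ρ => c ρ / (ρ + a)) (K / a)
      (D + |K| / a + ∑' ρ : ℂ, ‖c ρ‖ / ‖ρ + a‖) b' := by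
  refine ⟨locInt_expInt hz.loc a, hz.coeff.div_add ha, fun u hu => ?_⟩
  set z : ℝ → ℝ := fun v => zeroSum c (max v 0) with hzd
  have hzc : Continuous z := hz.coeff.continuousOn_zeroSum.comp_continuous (by fun_prop)
    fun x => mem_Ici.2 (le_max_right _ _)
  set R : ℝ → ℝ := fun v => h v + (-1) * (z v + K * Real.exp (0 * v)) with hR
  have hloc2 : LocInt fun v => z v + K * Real.exp (0 * v) :=
    (hzc.add (by fun_prop)).locInt
  have e1 : expInt a R u = expInt a h u - (expInt a (zeroSum c) u + K * ((1 - Real.exp (-(a * u))) / a)) := by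
    rw [hR, expInt_add hz.loc (fun x y => (hloc2 x y).const_mul (-1)), expInt_const_mul,
      expInt_add hzc.locInt (by fun_prop : Continuous fun v : ℝ => K * Real.exp (0 * v)).locInt, expInt_const_mul,
      expInt_exp (by simpa using ha.ne')]
    have : expInt a z u = expInt a (zeroSum c) u := expInt_congr hu fun v hv _ => by
      simp only [hzd, max_eq_left hv]
    rw [this]
    simp only [zero_mul, Real.exp_zero, zero_add, neg_mul]
    ring
  have e2 := hD R u hu fun v hv _ => by
    have := hz.bound v hv
    simp only [hR, hzd, max_eq_left hv, zero_mul, Real.exp_zero, mul_one]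
    rwa [show h v + -1 * (zeroSum c v + K) = h v - zeroSum c v - K by ring]
  rw [hz.coeff.expInt_zeroSum ha hu] at e1
  set Z := zeroSum (fun ρ => c ρ / (ρ + a)) u
  set X := (∑' ρ : ℂ, c ρ / (ρ + a)).re with hX
  have e3 : expInt a h u - Z - K / a = expInt a R u + (-(K / a) - X) * Real.exp (-(a * u)) := by
    rw [e1]; ring
  have hXle : |X| ≤ ∑' ρ : ℂ, ‖c ρ‖ / ‖ρ + a‖ := by
    refine (abs_re_le_norm _).trans ?_
    simpa only [norm_div] using norm_tsum_le_tsum_norm (hz.coeff.div_add ha).summable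
  have hexp : Real.exp (-(a * u)) ≤ Real.exp (-(b' * u)) :=
    Real.exp_le_exp.2 (by nlinarith)
  have h4 : |(-(K / a) - X) * Real.exp (-(a * u))| ≤ (|K| / a + |X|) * Real.exp (-(b' * u)) := by
    rw [abs_mul, Real.abs_exp]
    have : |-(K / a) - X| ≤ |K| / a + |X| := by
      refine (abs_sub _ _).trans ?_
      rw [abs_neg, abs_div, abs_of_pos ha]
    gcongr
  rw [e3]
  refine (abs_add_le _ _).trans ?_
  have h5 : |X| * Real.exp (-(b' * u)) ≤ (∑' ρ : ℂ, ‖c ρ‖ / ‖ρ + a‖) * Real.exp (-(b' * u)) := by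
    gcongr
  linarith

theorem expInt (hz : ZeroExp h c K B b) {a : ℝ} (ha : 0 < a) (hba : b < a) :
    ZeroExp (expInt a h) (fun ρ => c ρ / (ρ + a)) (K / a)
      (B / (a - b) + |K| / a + ∑' ρ : ℂ, ‖c ρ‖ / ‖ρ + a‖) b := by
  refine hz.expInt_aux ha hba.le fun g u hu hg => ?_
  have := abs_expInt_le (h := g) (a := a) (b := -b) (C := B) hu (by linarith) hz.nonneg (by simpa using hg)
  simpa [sub_eq_add_neg] using this

theorem expInt_of_lt (hz : ZeroExp h c K B b) {a : ℝ} (ha : 0 < a) (hba : a < b) :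
    ZeroExp (_root_.expInt a h) (fun ρ => c ρ / (ρ + a)) (K / a)
      (B / (b - a) + |K| / a + ∑' ρ : ℂ, ‖c ρ‖ / ‖ρ + a‖) a :=
  hz.expInt_aux ha le_rfl fun _ _ hu hg => abs_expInt_le_of_lt hu hba hz.nonneg hg

end ZeroExp

theorem xiFun.stripCoeff {a : ℝ} (ha : 0 ≤ a) : StripCoeff fun ρ => -(mult ρ : ℂ) / (ρ * (ρ + a)) := by
  refine ⟨?_, fun ρ h => re_mem_of_mult_ne fun h0 => h (by simp [h0])⟩
  refine (summable_weight ha).congr fun ρ => ?_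
  rw [← norm_div, div_div]

/-- The bound for the contribution of the trivial zeros. -/
noncomputable def trivialBound (a : ℝ) : ℝ := ∑' n : ℕ, 1 / ((2 * (n : ℝ) + 2) * |a - (2 * n + 2)|)

theorem trivialBound_term (a : ℝ) (n : ℕ) : ‖1 / (2 * (n : ℂ) + 2)‖ / ‖-(2 * (n : ℂ) + 2) + a‖ =
    1 / ((2 * (n : ℝ) + 2) * |a - (2 * n + 2)|) := by
  have : ‖2 * (n : ℂ) + 2‖ = 2 * n + 2 := by
    have : (2 * (n : ℂ) + 2) = ((2 * n + 2 : ℝ) : ℂ) := by push_cast; ring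
    rw [this, norm_real, Real.norm_of_nonneg (by positivity)]
  rw [norm_trivial_add, norm_div, norm_one, this, div_div]

theorem zeroExp_psiErr {a : ℝ} (ha : 2 ≤ a) (hodd : ∀ n : ℕ, a - (2 * n + 2) ≠ 0) :
    ZeroExp (expInt a psiErr) (fun ρ => -(xiFun.mult ρ : ℂ) / (ρ * (ρ + a)))
      (-Real.log (2 * Real.pi) / a) (Real.log (2 * Real.pi) / a + trivialBound a +
        ∑' ρ : ℂ, ‖-(xiFun.mult ρ : ℂ) / (ρ * (ρ + a))‖) 2 := by
  have ha0 : 0 < a := by linarith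
  have hc := xiFun.stripCoeff ha0.le
  have hts : Summable fun n : ℕ => 1 / ((2 * (n : ℝ) + 2) * |a - (2 * n + 2)|) :=
    (summable_trivial a).congr fun n => trivialBound_term a n
  refine ⟨locInt_expInt locInt_psiErr a, hc, fun u hu => ?_⟩
  have hx := expInt_psiErr_explicit ha0 hodd hu
  set c : ℂ → ℂ := fun ρ => -(xiFun.mult ρ : ℂ) / (ρ * (ρ + a))
  have hea : Real.exp (-(a * u)) ≤ Real.exp (-(2 * u)) := Real.exp_le_exp.2 (by nlinarith)
  have h1 : (∑' ρ : ℂ, -(xiFun.mult ρ : ℂ) / ρ * expKer a ρ u).re =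
      zeroSum c u - (∑' ρ, c ρ).re * Real.exp (-(a * u)) := by
    have e : ∀ ρ : ℂ, -(xiFun.mult ρ : ℂ) / ρ * expKer a ρ u =
        c ρ * cexp (ρ * u) - c ρ * (Real.exp (-(a * u)) : ℂ) := by
      intro ρ; simp only [c, expKer]; rw [← div_div]; push_cast; ring_nf
    simp only [e]
    rw [Summable.tsum_sub (hc.summable_term hu) (hc.summable.of_norm.mul_right _), tsum_mul_right,
      sub_re, re_mul_ofReal, zeroSum]
  have h2 : ((-(Real.log (2 * Real.pi)) : ℂ) * expKer a 0 u).re =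
      -Real.log (2 * Real.pi) / a + Real.log (2 * Real.pi) / a * Real.exp (-(a * u)) := by
    have : (-(Real.log (2 * Real.pi)) : ℂ) * expKer a 0 u = ((-Real.log (2 * Real.pi) / a +
        Real.log (2 * Real.pi) / a * Real.exp (-(a * u)) : ℝ) : ℂ) := by
      rw [expKer]; push_cast; simp only [zero_mul, Complex.exp_zero, zero_add]; ring_nf
    rw [this, ofReal_re]
  have h3 : |(∑' n : ℕ, 1 / (2 * (n : ℂ) + 2) * expKer a (-(2 * (n : ℂ) + 2)) u).re| ≤
      trivialBound a * Real.exp (-(2 * u)) := by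
    refine (abs_re_le_norm _).trans ?_
    rw [trivialBound, ← tsum_mul_right]
    refine tsum_of_norm_bounded (hts.mul_right _).hasSum fun n => ?_
    rw [← trivialBound_term, norm_mul, div_mul_eq_mul_div, mul_div_assoc]
    gcongr
    rw [expKer, norm_div]
    gcongr
    have e : cexp (-(2 * (n : ℂ) + 2) * u) - cexp (-a * u) =
        ((Real.exp (-(2 * n + 2) * u) - Real.exp (-(a * u)) : ℝ) : ℂ) := by push_cast; ring_nf
    rw [e, norm_real, Real.norm_eq_abs, abs_le]
    have hn : (0 : ℝ) ≤ n := by positivity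
    have : Real.exp (-(2 * n + 2) * u) ≤ Real.exp (-(2 * u)) := Real.exp_le_exp.2 (by nlinarith)
    constructor <;> linarith [Real.exp_pos (-(2 * n + 2) * u), Real.exp_pos (-(a * u))]
  have hre : expInt a psiErr u = _ := (ofReal_re _).symm.trans (congrArg re hx)
  rw [add_re, add_re, h1, h2] at hre
  have hlog : 0 ≤ Real.log (2 * Real.pi) := Real.log_nonneg (by linarith [Real.pi_gt_three])
  have h4 : |(∑' ρ, c ρ).re| ≤ ∑' ρ, ‖c ρ‖ :=
    (abs_re_le_norm _).trans (norm_tsum_le_tsum_norm hc.summable)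
  set T := (∑' n : ℕ, 1 / (2 * (n : ℂ) + 2) * expKer a (-(2 * (n : ℂ) + 2)) u).re
  set X := (∑' ρ, c ρ).re
  have e5 : expInt a psiErr u - zeroSum c u - -Real.log (2 * Real.pi) / a =
      Real.log (2 * Real.pi) / a * Real.exp (-(a * u)) + T + -(X * Real.exp (-(a * u))) := by
    rw [hre]; ring
  rw [e5]
  refine (abs_add_three _ _ _).trans ?_
  have h6 : |Real.log (2 * Real.pi) / a * Real.exp (-(a * u))| ≤
      Real.log (2 * Real.pi) / a * Real.exp (-(2 * u)) := by
    rw [abs_of_nonneg (by positivity)]; gcongr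
  have h7 : |-(X * Real.exp (-(a * u)))| ≤ (∑' ρ, ‖c ρ‖) * Real.exp (-(2 * u)) := by
    rw [abs_neg, abs_mul, Real.abs_exp]; gcongr
  linarith

end

section

open Complex Set Filter Topology ComplexConjugate

/-- `g` alternates at `n` points of `(0, t]`, where `n = 0` is allowed. -/
def AltUpTo (g : ℝ → ℝ) (t : ℝ) (n : ℕ) : Prop := n = 0 ∨ ∃ s, AltBy g t n s

theorem AltUpTo.mono {g : ℝ → ℝ} {t t' : ℝ} {n : ℕ} (h : AltUpTo g t n) (ht : t ≤ t') : AltUpTo g t' n :=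
  h.imp id fun ⟨s, hs⟩ => ⟨s, hs.mono ht⟩

theorem AltUpTo.of_expInt {h : ℝ → ℝ} (hh : LocInt h) {a t : ℝ} {n : ℕ}
    (hA : AltUpTo (expInt a h) t n) : AltUpTo h t n :=
  hA.imp id fun ⟨s, hs⟩ => ⟨s, hs.of_expInt hh⟩

theorem cos_int_mul_pi_eq (j : ℤ) : Real.cos (j * Real.pi) = 1 ∨ Real.cos (j * Real.pi) = -1 := by
  rw [← sq_eq_one_iff, Real.cos_sq', Real.sin_int_mul_pi]; norm_num

theorem cos_int_succ_mul_pi (j : ℤ) :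
    Real.cos (((j + 1 : ℤ) : ℝ) * Real.pi) = -Real.cos (j * Real.pi) := by
  push_cast; rw [add_mul, one_mul, Real.cos_add_pi]

/-- A function close to `A(u) cos(ω u + θ)` changes sign regularly. -/
theorem AltUpTo.extend_cos {H A : ℝ → ℝ} {p q ω θ : ℝ} {n : ℕ} (hp : 0 ≤ p) (hω : 0 < ω)
    (hA : AltUpTo H p n) (hpq : p ≤ q)
    (hH : ∀ u, p ≤ u → u ≤ q → |H u - A u * Real.cos (ω * u + θ)| < A u) :
    ∃ n', AltUpTo H q n' ∧ n + ω * (q - p) / Real.pi - 2 ≤ n' := by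
  set j0 : ℤ := ⌊(ω * p + θ) / Real.pi⌋ + 1 with hj0
  have hpi := Real.pi_pos
  set P : ℤ → ℝ := fun j => (j * Real.pi - θ) / ω with hP
  have hPlt : ∀ i j : ℤ, i < j → P i < P j := by
    intro i j hij
    have : (i : ℝ) < j := by exact_mod_cast hij
    simp only [hP]; gcongr
  have hPp : p < P j0 := by
    have := Int.lt_floor_add_one ((ω * p + θ) / Real.pi)
    rw [div_lt_iff₀ hpi] at this
    simp only [hP, hj0]
    rw [lt_div_iff₀ hω]; push_cast; linarith
  have hsign : ∀ j : ℤ, p ≤ P j → P j ≤ q → 0 < Real.cos (j * Real.pi) * H (P j) := by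
    intro j h1 h2
    have h3 := hH _ h1 h2
    have e : ω * P j + θ = j * Real.pi := by simp only [hP]; field_simp; ring
    rw [e] at h3
    have h4 := abs_lt.1 h3
    rcases cos_int_mul_pi_eq j with h | h <;> rw [h] at h4 ⊢ <;> linarith
  have key : ∀ m : ℕ, P (j0 + m) ≤ q → ∃ n', n + m ≤ n' ∧
      AltBy H (P (j0 + m)) n' (Real.cos (((j0 + m : ℤ) : ℝ) * Real.pi)) := by
    intro m
    induction m with
    | zero =>
      intro hq
      simp only [Nat.cast_zero, add_zero] at hq ⊢
      have hs := hsign j0 hPp.le hq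
      rcases hA with h0 | ⟨s, hs'⟩
      · exact ⟨1, by omega, P j0, le_rfl, .one (cos_int_mul_pi_eq j0) (hp.trans_lt hPp) hs⟩
      · by_cases h : s = -Real.cos (j0 * Real.pi)
        · rw [h] at hs'
          exact ⟨n + 1, by omega, hs'.extend hPp le_rfl hs⟩
        · have hs1 : s = 1 ∨ s = -1 := let ⟨_, _, hx⟩ := hs'; hx.sign_eq
          have : s = Real.cos (j0 * Real.pi) := by
            rcases hs1 with h1 | h1 <;> rcases cos_int_mul_pi_eq j0 with h2 | h2 <;>
              rw [h2] at h ⊢ <;> rw [h1] at h ⊢ <;> norm_num at h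
          rw [← this]
          exact ⟨n, le_rfl, hs'.mono hPp.le⟩
    | succ m ih =>
      intro hq
      have hlt : P (j0 + m) < P (j0 + (m + 1 : ℕ)) := hPlt _ _ (by push_cast; omega)
      obtain ⟨n', h1, h2⟩ := ih (hlt.le.trans hq)
      refine ⟨n' + 1, by omega, ?_⟩
      have e : j0 + ((m + 1 : ℕ) : ℤ) = (j0 + m) + 1 := by push_cast; ring
      have hs := hsign (j0 + (m + 1 : ℕ)) ?_ hq
      · refine AltBy.extend ?_ hlt le_rfl hs
        rw [e, cos_int_succ_mul_pi, neg_neg]; exact h2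
      · exact (hPp.le.trans (by
          rcases Nat.eq_zero_or_pos m with rfl | hm
          · simp
          · exact (hPlt _ _ (by omega)).le)).trans hlt.le
  set J : ℤ := ⌊(ω * q + θ) / Real.pi⌋
  have hJ1 : P J ≤ q := by
    have := Int.floor_le ((ω * q + θ) / Real.pi)
    rw [le_div_iff₀ hpi] at this
    simp only [hP]; rw [div_le_iff₀ hω]; linarith
  have hJ2 : (ω * q + θ) / Real.pi < J + 1 := Int.lt_floor_add_one _
  have hj2 : ((j0 : ℤ) : ℝ) ≤ (ω * p + θ) / Real.pi + 1 := by
    simp only [hj0]; push_cast; linarith [Int.floor_le ((ω * p + θ) / Real.pi)]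
  have hdiff : ω * (q - p) / Real.pi = (ω * q + θ) / Real.pi - (ω * p + θ) / Real.pi := by ring
  rcases lt_or_ge J j0 with h | h
  · refine ⟨n, hA.mono hpq, ?_⟩
    have : (J : ℝ) + 1 ≤ j0 := by exact_mod_cast h
    linarith
  · obtain ⟨m, hm⟩ := Int.eq_ofNat_of_zero_le (sub_nonneg.2 h)
    have hJm : j0 + m = J := by omega
    obtain ⟨n', h1, h2⟩ := key m (by rw [hJm]; exact hJ1)
    refine ⟨n', .inr ⟨_, h2.mono (by rw [hJm]; exact hJ1)⟩, ?_⟩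
    have e1 : (n : ℝ) + m ≤ n' := by exact_mod_cast h1
    have e2 : (j0 : ℝ) + m = J := by exact_mod_cast hJm
    linarith

theorem Finset.exists_pos_le {α : Type*} (S : Finset α) (φ : α → ℝ) (h : ∀ a ∈ S, 0 < φ a) :
    ∃ g > 0, ∀ a ∈ S, g ≤ φ a := by
  classical
  induction S using Finset.induction_on with
  | empty => exact ⟨1, one_pos, by simp⟩
  | insert a S _ ih =>
    obtain ⟨g, hg, hS⟩ := ih fun b hb => h b (Finset.mem_insert_of_mem hb)
    refine ⟨min g (φ a), lt_min hg (h a (Finset.mem_insert_self _ _)), fun b hb => ?_⟩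
    rcases Finset.mem_insert.1 hb with rfl | hb
    · exact min_le_right _ _
    · exact (min_le_left _ _).trans (hS b hb)

namespace ZeroExp

variable {h : ℝ → ℝ} {c : ℂ → ℂ} {K B b : ℝ}

theorem mono_bound (hz : ZeroExp h c K B b) {B' : ℝ} (hB : B ≤ B') : ZeroExp h c K B' b :=
  ⟨hz.loc, hz.coeff, fun u hu => (hz.bound u hu).trans (by gcongr)⟩

theorem flatten (hz : ZeroExp h c K B b) (hb : 0 ≤ b) : ZeroExp h c 0 (B + |K|) 0 := by
  refine ⟨hz.loc, hz.coeff, fun u hu => ?_⟩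
  have h1 := hz.bound u hu
  have h2 : B * Real.exp (-(b * u)) ≤ B * 1 :=
    mul_le_mul_of_nonneg_left (Real.exp_le_one_iff.2 (by have := mul_nonneg hb hu; linarith)) hz.nonneg
  have h3 : h u - zeroSum c u - 0 = (h u - zeroSum c u - K) + K := by ring
  rw [h3, zero_mul, neg_zero, Real.exp_zero, mul_one]
  exact (abs_add_le _ _).trans (by linarith)

theorem iterate (hz : ZeroExp h c 0 B 0) (k : ℕ) :
    ZeroExp ((_root_.expInt 1)^[k] h) (fun ρ => c ρ / (ρ + 1) ^ k) 0 (B + k * ∑' ρ, ‖c ρ‖) 0 := by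
  induction k with
  | zero => simpa using hz
  | succ k ih =>
    have h1 := ih.expInt (a := 1) one_pos one_pos
    rw [Function.iterate_succ_apply']
    have e : (fun ρ : ℂ => c ρ / (ρ + 1) ^ k / (ρ + (1 : ℝ))) = fun ρ => c ρ / (ρ + 1) ^ (k + 1) := by
      ext ρ; rw [div_div, pow_succ]; norm_num
    rw [e, zero_div] at h1
    refine h1.mono_bound ?_
    have hle : ∑' ρ : ℂ, ‖c ρ / (ρ + 1) ^ k‖ / ‖ρ + (1 : ℝ)‖ ≤ ∑' ρ, ‖c ρ‖ := by
      refine (ih.coeff.summable_div_norm one_pos).tsum_le_tsum (fun ρ => ?_) hz.coeff.summable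
      rcases eq_or_ne (c ρ) 0 with h0 | h0
      · simp [h0]
      have h2 := (hz.coeff.norm_add_ge (a := 1) h0).le
      have h3 : 1 ≤ ‖ρ + 1‖ := by simpa using h2
      rw [norm_div, norm_pow, div_div]
      refine div_le_self (norm_nonneg _) ?_
      exact one_le_mul_of_one_le_of_one_le (one_le_pow₀ h3) h2
    push_cast
    simp only [sub_zero, div_one, abs_zero, add_zero]
    simp only [ofReal_one] at hle
    linarith

end ZeroExp

/-- The exponent of the term of `ρ` after `k` integrations at `k v`, divided by `k`. -/
noncomputable def growth (ρ : ℂ) (v : ℝ) : ℝ := ρ.re * v - Real.log ‖ρ + 1‖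

theorem norm_term_eq_growth {ρ : ℂ} (hρ : 0 < ‖ρ + 1‖) (z : ℂ) (k : ℕ) (v : ℝ) :
    ‖z / (ρ + 1) ^ k * cexp (ρ * (k * v : ℝ))‖ = ‖z‖ * Real.exp (k * growth ρ v) := by
  have e : Real.exp (k * growth ρ v) = Real.exp (ρ.re * (k * v)) / ‖ρ + 1‖ ^ k := by
    rw [growth, mul_sub, Real.exp_sub, Real.exp_nat_mul (Real.log _), Real.exp_log hρ]
    ring_nf
  rw [e, norm_mul, norm_div, norm_pow, norm_exp]
  have : (ρ * (k * v : ℝ)).re = ρ.re * (k * v) := by simp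
  rw [this]; ring

theorem ZeroExp.dominated {h : ℝ → ℝ} {c : ℂ → ℂ} {B : ℝ} (hz : ZeroExp h c 0 B 0)
    (hsymm : ∀ ρ, c (conj ρ) = conj (c ρ)) {σ : ℂ} (hσ : c σ ≠ 0) (him : σ.im ≠ 0) {x y g : ℝ}
    (hx : 0 ≤ x) (hg : 0 < g)
    (hgap : ∀ ρ, c ρ ≠ 0 → ρ ≠ σ → ρ ≠ conj σ → ∀ v, x ≤ v → v ≤ y → growth ρ v ≤ growth σ v - g)
    (hpos : ∀ v, x ≤ v → v ≤ y → g ≤ growth σ v) :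
    ∃ k0 : ℕ, ∀ k ≥ k0, ∀ u, k * x ≤ u → u ≤ k * y →
      |(_root_.expInt 1)^[k] h u - 2 * (c σ / (σ + 1) ^ k * cexp (σ * u)).re| <
        2 * ‖c σ / (σ + 1) ^ k * cexp (σ * u)‖ := by
  set S := ∑' ρ, ‖c ρ‖
  have hS : 0 ≤ S := tsum_nonneg fun _ => norm_nonneg _
  have hB := hz.nonneg
  have hlim : Tendsto (fun k : ℕ => (B + S + k * S) * Real.exp (-(k * g))) atTop (𝓝 0) := by
    have h1 : Tendsto (fun x : ℝ => x * Real.exp (-x)) atTop (𝓝 0) := by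
      simpa using Real.tendsto_pow_mul_exp_neg_atTop_nhds_zero 1
    have h2 : Tendsto (fun x : ℝ => Real.exp (-x)) atTop (𝓝 0) := Real.tendsto_exp_neg_atTop_nhds_zero
    have hk : Tendsto (fun k : ℕ => (k : ℝ) * g) atTop atTop :=
      tendsto_natCast_atTop_atTop.atTop_mul_const hg
    have h3 := ((h2.comp hk).const_mul (B + S)).add ((h1.comp hk).const_mul (S / g))
    simp only [mul_zero, add_zero] at h3
    refine h3.congr fun k => ?_
    simp only [Function.comp]
    field_simp
  obtain ⟨k0, hk0⟩ := ((hlim.eventually (gt_mem_nhds (norm_pos_iff.2 hσ))).and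
    (eventually_ge_atTop 1)).exists_forall_of_atTop
  refine ⟨k0, fun k hk u hu1 hu2 => ?_⟩
  obtain ⟨hsmall, hk1⟩ := hk0 k hk
  have hkpos : (0 : ℝ) < k := by exact_mod_cast hk1
  obtain ⟨v, rfl⟩ : ∃ v, u = k * v := ⟨u / k, by field_simp⟩
  have hv1 : x ≤ v := le_of_mul_le_mul_left hu1 hkpos
  have hv2 : v ≤ y := le_of_mul_le_mul_left hu2 hkpos
  have hu0 : 0 ≤ (k : ℝ) * v := mul_nonneg hkpos.le (hx.trans hv1)
  have hzk := hz.iterate k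
  set H := (_root_.expInt 1)^[k] h
  set F : ℂ → ℂ := fun ρ => c ρ / (ρ + 1) ^ k * cexp (ρ * (k * v : ℝ)) with hF
  have hnp : ∀ ρ, c ρ ≠ 0 → 0 < ‖ρ + 1‖ := fun ρ hρ => by
    have := hz.coeff.norm_add_ge (a := 1) hρ
    have : 1 < ‖ρ + 1‖ := by simpa using this
    linarith
  have hFn : ∀ ρ, c ρ ≠ 0 → ‖F ρ‖ = ‖c ρ‖ * Real.exp (k * growth ρ v) := fun ρ hρ =>
    norm_term_eq_growth (hnp ρ hρ) _ _ _
  have hsum : Summable F := hzk.coeff.summable_term hu0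
  have hne : conj σ ≠ σ := fun h => him (conj_eq_iff_im.1 h)
  have hconj : F (conj σ) = conj (F σ) := by
    simp only [hF, hsymm, map_mul, map_div₀, map_pow, map_add, map_one, ← exp_conj, conj_ofReal]
  have hs1 : Summable fun ρ => if ρ = σ then 0 else F ρ := by
    refine .of_norm_bounded hsum.norm fun ρ => ?_
    split_ifs <;> simp
  have hdec : ∑' ρ, F ρ = F σ + (F (conj σ) + ∑' ρ, if ρ = conj σ then 0 else if ρ = σ then 0 else F ρ) := by
    rw [hsum.tsum_eq_add_tsum_ite σ, hs1.tsum_eq_add_tsum_ite (conj σ), if_neg hne]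
  set R := ∑' ρ, if ρ = conj σ then 0 else if ρ = σ then 0 else F ρ with hR
  have hRle : ‖R‖ ≤ S * Real.exp (k * (growth σ v - g)) := by
    rw [hR, ← tsum_mul_right]
    refine tsum_of_norm_bounded (hz.coeff.summable.mul_right _).hasSum fun ρ => ?_
    split_ifs with h1 h2
    · simp; positivity
    · simp; positivity
    · rcases eq_or_ne (c ρ) 0 with h0 | h0
      · simp [hF, h0]
      rw [hFn ρ h0]
      gcongr
      exact hgap ρ h0 h2 h1 v hv1 hv2
  have hre : zeroSum (fun ρ => c ρ / (ρ + 1) ^ k) (k * v) = 2 * (F σ).re + R.re := by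
    rw [zeroSum]
    change (∑' ρ, F ρ).re = _
    rw [hdec, add_re, add_re, hconj, conj_re]; ring
  have hb := hzk.bound (k * v) hu0
  rw [hre, zero_mul, neg_zero, Real.exp_zero, mul_one, sub_zero] at hb
  have hFσ := hFn σ hσ
  have hone : 1 ≤ Real.exp (k * (growth σ v - g)) :=
    Real.one_le_exp (mul_nonneg hkpos.le (by linarith [hpos v hv1 hv2]))
  have hexp : Real.exp (k * (growth σ v - g)) = Real.exp (-(k * g)) * Real.exp (k * growth σ v) := by
    rw [← Real.exp_add]; ring_nf
  have hE := Real.exp_pos (k * growth σ v)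
  have htot : B + k * S + ‖R‖ < ‖F σ‖ := by
    calc B + k * S + ‖R‖ ≤ (B + k * S) * Real.exp (k * (growth σ v - g)) +
          S * Real.exp (k * (growth σ v - g)) := by
          have : B + k * S ≤ (B + k * S) * Real.exp (k * (growth σ v - g)) :=
            le_mul_of_one_le_right (by positivity) hone
          linarith
      _ = (B + S + k * S) * Real.exp (-(k * g)) * Real.exp (k * growth σ v) := by rw [hexp]; ring
      _ < ‖c σ‖ * Real.exp (k * growth σ v) := by gcongr
      _ = _ := hFσ.symm
  have hRre := abs_re_le_norm R
  have e : H (k * v) - 2 * (F σ).re = (H (k * v) - (2 * (F σ).re + R.re)) + R.re := by ring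
  change |H (k * v) - 2 * (F σ).re| < 2 * ‖F σ‖
  rw [e]
  refine (abs_add_le _ _).trans_lt ?_
  linarith [norm_nonneg (F σ)]

end

section

open Complex Set Filter Topology ComplexConjugate

/-- The number of sign changes of the `k`-fold integral on `(0, k x]` is at least
`k (ω (x - v₀) - o(1))`. -/
def IterAlt (h : ℝ → ℝ) (ω v₀ x : ℝ) : Prop :=
  ∀ ε > 0, ∃ k0 : ℕ, ∀ k ≥ k0, ∃ n : ℕ, AltUpTo ((expInt 1)^[k] h) (k * x) n ∧
    k * (ω * (x - v₀) - ε) ≤ n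

theorem re_mul_exp_eq (z σ : ℂ) (u : ℝ) :
    (z * cexp (σ * u)).re = ‖z * cexp (σ * u)‖ * Real.cos (σ.im * u + arg z) := by
  have e : z * cexp (σ * u) =
      (‖z * cexp (σ * u)‖ : ℂ) * cexp ((σ.im * u + arg z : ℝ) * I) := by
    conv_lhs => rw [← norm_mul_exp_arg_mul_I z]
    rw [norm_mul, norm_exp]
    push_cast
    rw [mul_assoc, mul_assoc, ← Complex.exp_add, ← Complex.exp_add]
    congr 2
    apply Complex.ext <;> simp
    ring
  conv_lhs => rw [e]
  rw [re_ofReal_mul, exp_ofReal_mul_I_re]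

theorem IterAlt.extend {h : ℝ → ℝ} {c : ℂ → ℂ} {B : ℝ} (hz : ZeroExp h c 0 B 0)
    (hsymm : ∀ ρ, c (conj ρ) = conj (c ρ)) {x y v₀ Γ : ℝ} (hΓ : 0 < Γ) (hx : 0 ≤ x) (hxy : x < y)
    (hdom : ∀ η > 0, x + η < y - η → ∃ σ g, c σ ≠ 0 ∧ Γ ≤ σ.im ∧ 0 < g ∧
      (∀ ρ, c ρ ≠ 0 → ρ ≠ σ → ρ ≠ conj σ → ∀ v, x + η ≤ v → v ≤ y - η →
        growth ρ v ≤ growth σ v - g) ∧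
      ∀ v, x + η ≤ v → v ≤ y - η → g ≤ growth σ v)
    (hP : IterAlt h (Γ / Real.pi) v₀ x) : IterAlt h (Γ / Real.pi) v₀ y := by
  intro ε hε
  set ω := Γ / Real.pi with hω
  have hω0 : 0 < ω := div_pos hΓ Real.pi_pos
  obtain ⟨η, hη0, hη1, hη2⟩ : ∃ η > 0, x + η < y - η ∧ 2 * η * ω ≤ ε / 4 := by
    have hyx : 0 < y - x := by linarith
    refine ⟨min ((y - x) / 4) (ε / (8 * ω)), by positivity, ?_, ?_⟩
    · have := min_le_left ((y - x) / 4) (ε / (8 * ω)); linarith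
    · have h1 := min_le_right ((y - x) / 4) (ε / (8 * ω))
      have h2 : 2 * min ((y - x) / 4) (ε / (8 * ω)) * ω ≤ 2 * (ε / (8 * ω)) * ω := by gcongr
      refine h2.trans (le_of_eq ?_); field_simp; norm_num
  obtain ⟨σ, g, hσ, him, hg, hgap, hpos⟩ := hdom η hη0 hη1
  obtain ⟨k1, hk1⟩ := hP (ε / 4) (by positivity)
  obtain ⟨k2, hk2⟩ := hz.dominated hsymm hσ (hΓ.trans_le him).ne' (by linarith) hg hgap hpos
  obtain ⟨k3, hk3⟩ := exists_nat_ge (8 / ε)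
  refine ⟨max k1 (max k2 k3), fun k hk => ?_⟩
  have hka : k1 ≤ k := (le_max_left _ _).trans hk
  have hkb : k2 ≤ k := ((le_max_left _ _).trans (le_max_right _ _)).trans hk
  have hkc : k3 ≤ k := ((le_max_right _ _).trans (le_max_right _ _)).trans hk
  have hk0 : (0 : ℝ) ≤ k := k.cast_nonneg
  obtain ⟨n, hn1, hn2⟩ := hk1 k hka
  have hlow : (k : ℝ) * x ≤ k * (x + η) := by gcongr; linarith
  obtain ⟨n', h1, h2⟩ := AltUpTo.extend_cos (ω := σ.im) (θ := arg (c σ / (σ + 1) ^ k))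
    (A := fun u => 2 * ‖c σ / (σ + 1) ^ k * cexp (σ * u)‖) (mul_nonneg hk0 (by linarith))
    (hΓ.trans_le him) (hn1.mono hlow) (q := k * (y - η)) (by gcongr)
    (fun u hu1 hu2 => by
      have := hk2 k hkb u hu1 hu2
      rw [re_mul_exp_eq, ← mul_assoc] at this
      exact this)
  refine ⟨n', h1.mono (by gcongr; linarith), le_trans ?_ h2⟩
  have h3 : ω * (k * (y - η - (x + η))) ≤ σ.im * (k * (y - η) - k * (x + η)) / Real.pi := by
    rw [hω, div_mul_eq_mul_div, ← mul_sub]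
    have : 0 ≤ k * (y - η - (x + η)) := mul_nonneg hk0 (by linarith)
    have := Real.pi_pos
    gcongr
  have h4 : 2 ≤ k * (ε / 4) := by
    have h5 : 8 / ε ≤ k := hk3.trans (by exact_mod_cast hkc)
    rw [div_le_iff₀ hε] at h5; linarith
  have h6 : (k : ℝ) * (2 * η * ω) ≤ k * (ε / 4) := by gcongr
  nlinarith [mul_nonneg hk0 hε.le]

theorem eq_or_eq_conj_of_growth {ρ σ : ℂ} (hre : ρ.re = σ.re) (hn : ‖ρ + 1‖ = ‖σ + 1‖) :
    ρ = σ ∨ ρ = conj σ := by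
  have h1 : ‖ρ + 1‖ ^ 2 = ‖σ + 1‖ ^ 2 := by rw [hn]
  rw [← normSq_eq_norm_sq, ← normSq_eq_norm_sq, normSq_apply, normSq_apply] at h1
  simp only [add_re, one_re, add_im, one_im, add_zero, hre] at h1
  have h2 : ρ.im * ρ.im = σ.im * σ.im := by linarith
  rcases mul_self_eq_mul_self_iff.1 h2 with h | h
  · exact .inl (Complex.ext hre h)
  · exact .inr (Complex.ext (by simpa using hre) (by simpa using h))

theorem min_le_of_affine {p q x y v : ℝ} (hx : x ≤ v) (hy : v ≤ y) :
    min (p * x - q) (p * y - q) ≤ p * v - q := by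
  rcases le_total 0 p with h | h
  · exact (min_le_left _ _).trans (by nlinarith)
  · exact (min_le_right _ _).trans (by nlinarith)

theorem ZeroExp.exists_dominator {h : ℝ → ℝ} {c : ℂ → ℂ} {B : ℝ} (hz : ZeroExp h c 0 B 0)
    (hsymm : ∀ ρ, c (conj ρ) = conj (c ρ)) {b v₀ V Γ : ℝ} (hb : 0 ≤ b) (hv₀ : 0 ≤ v₀) {ρ₀ : ℂ}
    (hc₀ : c ρ₀ ≠ 0) (hρ₀ : b < ρ₀.re) (hgrow : ∀ v, v₀ ≤ v → b * v + 1 ≤ growth ρ₀ v)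
    (hV : ‖ρ₀ + 1‖ ≤ Real.exp V) (S : Finset ℂ)
    (hS : ∀ ρ, ρ ∈ S ↔ (c ρ ≠ 0 ∧ ‖ρ + 1‖ ≤ Real.exp V) ∧ b < ρ.re)
    (hΓ : ∀ ρ, c ρ ≠ 0 → b < ρ.re → Γ ≤ |ρ.im|) {x y : ℝ} (hx : v₀ ≤ x) (hy : y ≤ V)
    (htie : ∀ ρ ∈ S, ∀ ρ' ∈ S, ∀ v, x < v → v < y → ρ.re ≠ ρ'.re → growth ρ v ≠ growth ρ' v)
    {η : ℝ} (hη : 0 < η) (hxy : x + η < y - η) :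
    ∃ σ g, c σ ≠ 0 ∧ Γ ≤ σ.im ∧ 0 < g ∧
      (∀ ρ, c ρ ≠ 0 → ρ ≠ σ → ρ ≠ conj σ → ∀ v, x + η ≤ v → v ≤ y - η →
        growth ρ v ≤ growth σ v - g) ∧
      ∀ v, x + η ≤ v → v ≤ y - η → g ≤ growth σ v := by
  classical
  set m := (x + y) / 2 with hm
  have hmx : x < m := by rw [hm]; linarith
  have hmy : m < y := by rw [hm]; linarith
  have hnp : ∀ ρ, c ρ ≠ 0 → 1 < ‖ρ + 1‖ := fun ρ hρ => by
    simpa using hz.coeff.norm_add_ge (a := 1) hρ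
  have h0S : ρ₀ ∈ S := (hS _).2 ⟨⟨hc₀, hV⟩, hρ₀⟩
  obtain ⟨τ, hτS, hτ⟩ := S.exists_max_image (fun ρ => growth ρ m) ⟨ρ₀, h0S⟩
  -- Replace `τ` by its conjugate if necessary.
  obtain ⟨σ, hσS, hσim, hσ⟩ : ∃ σ ∈ S, Γ ≤ σ.im ∧ ∀ ρ ∈ S, growth ρ m ≤ growth σ m := by
    have h1 := hΓ τ ((hS τ).1 hτS).1.1 ((hS τ).1 hτS).2
    have hgc : ∀ v, growth (conj τ) v = growth τ v := fun v => by
      have : ‖conj τ + 1‖ = ‖τ + 1‖ := by rw [← norm_conj (τ + 1)]; simp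
      simp [growth, this]
    rcases le_total 0 τ.im with h | h
    · exact ⟨τ, hτS, by rwa [abs_of_nonneg h] at h1, hτ⟩
    · refine ⟨conj τ, (hS _).2 ⟨⟨?_, ?_⟩, ?_⟩, by rwa [abs_of_nonpos h] at h1, fun ρ hρ => ?_⟩
      · rw [hsymm]; simpa using ((hS τ).1 hτS).1.1
      · have : ‖conj τ + 1‖ = ‖τ + 1‖ := by rw [← norm_conj (τ + 1)]; simp
        rw [this]; exact ((hS τ).1 hτS).1.2
      · simpa using ((hS τ).1 hτS).2
      · rw [hgc]; exact hτ ρ hρ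
  have hD : ∀ ρ v, growth σ v - growth ρ v =
      (σ.re - ρ.re) * v - (Real.log ‖σ + 1‖ - Real.log ‖ρ + 1‖) := fun ρ v => by
    simp only [growth]; ring
  have hpos : ∀ ρ ∈ S, ρ ≠ σ → ρ ≠ conj σ → ∀ v, x < v → v < y → 0 < growth σ v - growth ρ v := by
    intro ρ hρ h1 h2 v hv1 hv2
    by_contra! hneg
    have hmm := hσ ρ hρ
    by_cases hre : ρ.re = σ.re
    · have hl : Real.log ‖ρ + 1‖ = Real.log ‖σ + 1‖ := by
        rw [hD, hre] at hneg
        simp only [growth, hre] at hmm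
        linarith
      have hn : ‖ρ + 1‖ = ‖σ + 1‖ :=
        Real.log_injOn_pos (mem_Ioi.2 (one_pos.trans (hnp ρ ((hS ρ).1 hρ).1.1)))
          (mem_Ioi.2 (one_pos.trans (hnp σ ((hS σ).1 hσS).1.1))) hl
      rcases eq_or_eq_conj_of_growth hre hn with h | h <;> contradiction
    · have hcont : Continuous fun v => growth σ v - growth ρ v := by
        simp only [hD]; fun_prop
      have hiv := isPreconnected_Ioo.intermediate_value (s := Ioo x y) (f := fun v => growth σ v - growth ρ v)
        ⟨hv1, hv2⟩ (b := m) ⟨hmx, hmy⟩ hcont.continuousOn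
      obtain ⟨r, ⟨hr1, hr2⟩, hr⟩ := hiv ⟨hneg, sub_nonneg.2 hmm⟩
      exact htie σ hσS ρ hρ r hr1 hr2 (Ne.symm hre) (sub_eq_zero.1 hr)
  have hge : ∀ v, x < v → v < y → b * v + 1 ≤ growth σ v := by
    intro v hv1 hv2
    refine (hgrow v (hx.trans hv1.le)).trans ?_
    by_cases h1 : ρ₀ = σ
    · rw [h1]
    by_cases h2 : ρ₀ = conj σ
    · have : ‖conj σ + 1‖ = ‖σ + 1‖ := by rw [← norm_conj (σ + 1)]; simp
      simp [h2, growth, this]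
    · linarith [hpos ρ₀ h0S h1 h2 v hv1 hv2]
  set S' := S.filter fun ρ => ρ ≠ σ ∧ ρ ≠ conj σ
  obtain ⟨g, hg, hgS⟩ := S'.exists_pos_le
    (fun ρ => min (growth σ (x + η) - growth ρ (x + η)) (growth σ (y - η) - growth ρ (y - η)))
    (fun ρ hρ => by
      obtain ⟨h1, h2, h3⟩ := Finset.mem_filter.1 hρ
      exact lt_min (hpos ρ h1 h2 h3 _ (by linarith) (by linarith))
        (hpos ρ h1 h2 h3 _ (by linarith) (by linarith)))
  refine ⟨σ, min g 1, ((hS σ).1 hσS).1.1, hσim, lt_min hg one_pos, ?_, ?_⟩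
  · intro ρ hρ h1 h2 v hv1 hv2
    have hv0 : 0 ≤ v := by linarith
    by_cases hρS : ρ ∈ S
    · have h3 := hgS ρ (Finset.mem_filter.2 ⟨hρS, h1, h2⟩)
      simp only [hD] at h3
      have h4 := h3.trans (min_le_of_affine hv1 hv2)
      rw [← hD] at h4
      linarith [min_le_left g 1]
    · have h3 := hge v (by linarith) (by linarith)
      have h4 := min_le_right g 1
      have h5 : growth ρ v ≤ b * v := by
        by_cases hre : b < ρ.re
        · have h6 : Real.exp V < ‖ρ + 1‖ := by
            by_contra! h7
            exact hρS ((hS ρ).2 ⟨⟨hρ, h7⟩, hre⟩)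
          have h7 : V < Real.log ‖ρ + 1‖ := by
            rw [← Real.log_exp V]; exact Real.log_lt_log (Real.exp_pos _) h6
          have h8 := (hz.coeff.strip ρ hρ).2
          have : ρ.re * v ≤ 1 * v := by gcongr
          have : 0 ≤ b * v := mul_nonneg hb hv0
          simp only [growth]; linarith
        · have h6 := Real.log_nonneg (hnp ρ hρ).le
          have : ρ.re * v ≤ b * v := mul_le_mul_of_nonneg_right (not_lt.1 hre) hv0
          simp only [growth]; linarith
      linarith
  · intro v hv1 hv2
    have := hge v (by linarith) (by linarith)
    have : 0 ≤ b * v := mul_nonneg hb (by linarith)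
    linarith [min_le_right g 1]

/-- Zeros with real part above `b` force sign changes with frequency at least the smallest
ordinate among them. -/
theorem ZeroExp.altUpTo {h : ℝ → ℝ} {c : ℂ → ℂ} {B : ℝ} (hz : ZeroExp h c 0 B 0)
    (hsymm : ∀ ρ, c (conj ρ) = conj (c ρ))
    (hfin : ∀ R : ℝ, {ρ | c ρ ≠ 0 ∧ ‖ρ + 1‖ ≤ R}.Finite) {b Γ : ℝ} (hb : 0 ≤ b) {ρ₀ : ℂ}
    (hc₀ : c ρ₀ ≠ 0) (hρ₀ : b < ρ₀.re) (hΓ0 : 0 < Γ)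
    (hΓ : ∀ ρ, c ρ ≠ 0 → b < ρ.re → Γ ≤ |ρ.im|) {ε : ℝ} (hε : 0 < ε) :
    ∃ U₀ : ℝ, ∀ U ≥ U₀, ∃ n : ℕ, AltUpTo h U n ∧ (Γ / Real.pi - ε) * U ≤ n := by
  classical
  have hlog0 : 0 ≤ Real.log ‖ρ₀ + 1‖ := Real.log_nonneg (by
    simpa using (hz.coeff.norm_add_ge (a := 1) hc₀).le)
  set v₀ := (1 + Real.log ‖ρ₀ + 1‖) / (ρ₀.re - b) with hv₀
  have hd : 0 < ρ₀.re - b := by linarith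
  have hv₀0 : 0 ≤ v₀ := by positivity
  have hgrow : ∀ v, v₀ ≤ v → b * v + 1 ≤ growth ρ₀ v := fun v hv => by
    rw [hv₀, div_le_iff₀ hd] at hv
    simp only [growth]; linarith
  set ω := Γ / Real.pi with hω
  have hω0 : 0 < ω := div_pos hΓ0 Real.pi_pos
  set V := max (max v₀ 1) (max (Real.log ‖ρ₀ + 1‖) (ω * (v₀ + 1) * 4 / ε)) with hVdef
  have hVv : v₀ ≤ V := (le_max_left _ _).trans (le_max_left _ _)
  have hV1 : 1 ≤ V := (le_max_right _ _).trans (le_max_left _ _)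
  have hVl : Real.log ‖ρ₀ + 1‖ ≤ V := (le_max_left _ _).trans (le_max_right _ _)
  have hVe : ω * (v₀ + 1) * 4 ≤ V * ε := by
    rw [← div_le_iff₀ hε]; exact (le_max_right _ _).trans (le_max_right _ _)
  have hVR : ‖ρ₀ + 1‖ ≤ Real.exp V := by
    rw [← Real.log_le_iff_le_exp]
    · exact hVl
    · have : 1 < ‖ρ₀ + 1‖ := by simpa using hz.coeff.norm_add_ge (a := 1) hc₀
      linarith
  set S : Finset ℂ := (hfin (Real.exp V)).toFinset.filter fun ρ => b < ρ.re with hSdef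
  have hS : ∀ ρ, ρ ∈ S ↔ (c ρ ≠ 0 ∧ ‖ρ + 1‖ ≤ Real.exp V) ∧ b < ρ.re := fun ρ => by
    simp [hSdef]
  set T : Finset ℝ := (S ×ˢ S).image fun p =>
    (Real.log ‖p.1 + 1‖ - Real.log ‖p.2 + 1‖) / (p.1.re - p.2.re) with hT
  have htie : ∀ x y, (∀ v, x < v → v < y → v ∉ T) → ∀ ρ ∈ S, ∀ ρ' ∈ S, ∀ v, x < v → v < y →
      ρ.re ≠ ρ'.re → growth ρ v ≠ growth ρ' v := by
    intro x y hno ρ hρ ρ' hρ' v hv1 hv2 hre heq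
    refine hno v hv1 hv2 (Finset.mem_image.2 ⟨(ρ, ρ'), Finset.mk_mem_product hρ hρ', ?_⟩)
    rw [div_eq_iff (sub_ne_zero.2 hre)]
    simp only [growth] at heq
    linarith
  have hext : ∀ x y, v₀ ≤ x → x < y → y ≤ V → (∀ v, x < v → v < y → v ∉ T) →
      IterAlt h ω v₀ x → IterAlt h ω v₀ y := fun x y h1 h2 h3 h4 h5 =>
    IterAlt.extend hz hsymm hΓ0 (hv₀0.trans h1) h2 (fun η hη hxy =>
      hz.exists_dominator hsymm hb hv₀0 hc₀ hρ₀ hgrow hVR S hS hΓ h1 h3 (htie x y h4) hη hxy) h5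
  have hbase : IterAlt h ω v₀ v₀ := fun ε' hε' => ⟨0, fun k _ => ⟨0, .inl rfl, by
    have : (0 : ℝ) ≤ k * ε' := by positivity
    simp only [sub_self, mul_zero, zero_sub, Nat.cast_zero]; linarith⟩⟩
  have hall : ∀ N : ℕ, ∀ x, v₀ ≤ x → x ≤ V → (T.filter fun t => v₀ < t ∧ t < x).card ≤ N →
      IterAlt h ω v₀ x := by
    intro N
    induction N with
    | zero =>
      intro x h1 h2 h3
      rcases h1.eq_or_lt with rfl | h1
      · exact hbase
      refine hext v₀ x le_rfl h1 h2 (fun v hv1 hv2 hvT => ?_) hbase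
      have hv : v ∈ T.filter fun t => v₀ < t ∧ t < x := Finset.mem_filter.2 ⟨hvT, hv1, hv2⟩
      have := Finset.card_pos.2 ⟨v, hv⟩
      omega
    | succ N ih =>
      intro x h1 h2 h3
      rcases (T.filter fun t => v₀ < t ∧ t < x).eq_empty_or_nonempty with h4 | h4
      · exact ih x h1 h2 (by rw [h4]; simp)
      · set t := (T.filter fun t => v₀ < t ∧ t < x).max' h4
        have ht : t ∈ T.filter fun t => v₀ < t ∧ t < x := Finset.max'_mem _ _
        obtain ⟨_, ht1, ht2⟩ := Finset.mem_filter.1 ht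
        refine hext t x ht1.le ht2 h2 (fun v hv1 hv2 hvT => ?_) (ih t ht1.le (ht2.le.trans h2) ?_)
        · have hv : v ∈ T.filter fun t => v₀ < t ∧ t < x :=
            Finset.mem_filter.2 ⟨hvT, ht1.trans hv1, hv2⟩
          exact absurd hv1 (not_lt.2 (Finset.le_max' _ v hv))
        · have : (T.filter fun s => v₀ < s ∧ s < t) ⊂ T.filter fun t => v₀ < t ∧ t < x := by
            refine Finset.ssubset_iff_subset_ne.2 ⟨fun s hs => ?_, fun heq => ?_⟩
            · obtain ⟨h5, h6, h7⟩ := Finset.mem_filter.1 hs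
              exact Finset.mem_filter.2 ⟨h5, h6, h7.trans ht2⟩
            · rw [← heq] at ht
              exact lt_irrefl _ (Finset.mem_filter.1 ht).2.2
          have := Finset.card_lt_card this
          omega
  obtain ⟨k0, hk0⟩ := hall _ V hVv le_rfl le_rfl (ε / 4) (by positivity)
  refine ⟨V * (k0 + 1) + V * (4 * ω) / ε, fun U hU => ?_⟩
  have hV0 : 0 < V := by linarith
  have hpos1 : 0 ≤ V * (4 * ω) / ε := by positivity
  set k := ⌊U / V⌋₊
  have hU0 : 0 ≤ U / V := by
    apply div_nonneg _ hV0.le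
    have : 0 ≤ V * (k0 + 1) := by positivity
    linarith
  have hk1 : (k : ℝ) * V ≤ U := by
    rw [← le_div_iff₀ hV0]; exact Nat.floor_le hU0
  have hk2 : U < (k + 1) * V := by
    rw [← div_lt_iff₀ hV0]; exact Nat.lt_floor_add_one _
  have hkk : k0 ≤ k := by
    refine Nat.le_floor ?_
    rw [le_div_iff₀ hV0]; nlinarith
  obtain ⟨n, hn1, hn2⟩ := hk0 k hkk
  have hdesc : ∀ j : ℕ, AltUpTo ((_root_.expInt 1)^[j] h) (k * V) n → AltUpTo h (k * V) n := by
    intro j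
    induction j with
    | zero => exact fun hj => hj
    | succ j ih =>
      intro hj
      rw [Function.iterate_succ_apply'] at hj
      exact ih (hj.of_expInt (hz.iterate j).loc)
  refine ⟨n, (hdesc k hn1).mono hk1, le_trans ?_ hn2⟩
  have hk0' : (0 : ℝ) ≤ k := k.cast_nonneg
  have e1 : V * (4 * ω) ≤ U * ε := by
    rw [← div_le_iff₀ hε]
    have : 0 ≤ V * ((k0 : ℝ) + 1) := by positivity
    linarith
  have e2 : (k : ℝ) * V * ε ≤ U * ε := by gcongr
  have e3 : (k : ℝ) * (ω * (v₀ + 1) * 4) ≤ k * (V * ε) := by gcongr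
  have e4 : (k : ℝ) * (1 * ε) ≤ k * (V * ε) := by gcongr
  have e5 : U * ω ≤ (k + 1) * V * ω := by gcongr
  have e6 : 0 ≤ k * ω := by positivity
  nlinarith

end

section

/-! Verified positivity test for sums of rational functions with integer coefficients. -/

namespace IntPoly

/-- Addition of coefficient lists. -/
def add : List ℤ → List ℤ → List ℤ
  | [], q => q
  | c :: p, [] => c :: p
  | c :: p, d :: q => (c + d) :: add p q

/-- Multiplication of a coefficient list by an integer. -/
def smul (a : ℤ) : List ℤ → List ℤ
  | [] => []
  | c :: p => (a * c) :: smul a p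

/-- Multiplication of coefficient lists. -/
def mul : List ℤ → List ℤ → List ℤ
  | [], _ => []
  | c :: p, q => add (smul c q) (0 :: mul p q)

/-- Value of the polynomial with coefficient list `p` at `y`. -/
noncomputable def eval (y : ℝ) : List ℤ → ℝ
  | [] => 0
  | c :: p => c + y * eval y p

@[simp] theorem eval_nil (y : ℝ) : eval y [] = 0 := rfl
@[simp] theorem eval_cons (y : ℝ) (c : ℤ) (p : List ℤ) : eval y (c :: p) = c + y * eval y p := rfl

theorem eval_add (y : ℝ) : ∀ p q : List ℤ, eval y (add p q) = eval y p + eval y q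
  | [], q => by simp [add]
  | c :: p, [] => by simp [add]
  | c :: p, d :: q => by simp [add, eval_add y p q]; ring

theorem eval_smul (y : ℝ) (a : ℤ) : ∀ p : List ℤ, eval y (smul a p) = a * eval y p
  | [] => by simp [smul]
  | c :: p => by simp [smul, eval_smul y a p]; ring

theorem eval_mul (y : ℝ) : ∀ p q : List ℤ, eval y (mul p q) = eval y p * eval y q
  | [], q => by simp [mul]
  | c :: p, q => by simp [mul, eval_add, eval_smul, eval_mul y p q]; ring

theorem eval_nonneg {y : ℝ} (hy : 0 ≤ y) : ∀ p : List ℤ, p.all (fun c => decide (0 ≤ c)) = true →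
    0 ≤ eval y p
  | [], _ => le_rfl
  | c :: p, h => by
    simp only [List.all_cons, Bool.and_eq_true, decide_eq_true_eq] at h
    have hc : (0 : ℝ) ≤ c := by exact_mod_cast h.1
    have := eval_nonneg hy p h.2
    simp only [eval_cons]
    positivity

/-- Numerator and denominator of a sum of quotients of polynomials. -/
def ratSum : List (List ℤ × List ℤ) → List ℤ × List ℤ
  | [] => ([], [1])
  | (n, d) :: l => match ratSum l with
    | (N, D) => (add (mul N d) (mul n D), mul D d)

/-- Value of a sum of quotients of polynomials. -/
noncomputable def ratEval (y : ℝ) (l : List (List ℤ × List ℤ)) : ℝ :=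
  (l.map fun t => eval y t.1 / eval y t.2).sum

theorem ratSum_spec (y : ℝ) : ∀ l : List (List ℤ × List ℤ), (∀ t ∈ l, 0 < eval y t.2) →
    0 < eval y (ratSum l).2 ∧ ratEval y l = eval y (ratSum l).1 / eval y (ratSum l).2
  | [], _ => by simp [ratSum, ratEval]
  | (n, d) :: l, h => by
    obtain ⟨h1, h2⟩ := ratSum_spec y l fun t ht => h t (List.mem_cons_of_mem _ ht)
    have hd : 0 < eval y d := h (n, d) List.mem_cons_self
    rw [ratEval] at h2
    simp only [ratSum, ratEval, List.map_cons, List.sum_cons, eval_mul, eval_add, h2]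
    refine ⟨mul_pos h1 hd, ?_⟩
    field_simp
    ring

/-- Homogenised composition of `P` with `(p + q z) / (1 + v z)`, with the matching power of
`1 + v z`. -/
def compose (p q v : ℤ) : List ℤ → List ℤ × List ℤ
  | [] => ([], [1])
  | c :: P => match compose p q v P with
    | (acc, den) => (add (mul [p, q] acc) (smul c den), mul [1, v] den)

theorem compose_spec {p q v : ℤ} {y z : ℝ} (hz : 0 < 1 + v * z) (hy : y * (1 + v * z) = p + q * z) :
    ∀ P : List ℤ, 0 < eval z (compose p q v P).2 ∧
      (1 + v * z) * eval z (compose p q v P).1 = eval z (compose p q v P).2 * eval y P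
  | [] => by simp [compose]
  | c :: P => by
    obtain ⟨h1, h2⟩ := compose_spec hz hy P
    simp only [compose, eval_mul, eval_add, eval_smul, eval_cons, eval_nil, Int.cast_one, mul_zero,
      add_zero]
    rw [mul_comm z, mul_comm z]
    refine ⟨mul_pos hz h1, ?_⟩
    rw [mul_add, mul_left_comm, h2, ← hy]
    ring

/-- Sufficient test for nonnegativity on `[p, q)`, by repeated bisection. -/
def checkIco : ℕ → List ℤ → ℤ → ℤ → Bool
  | 0, _, _, _ => false
  | k + 1, P, p, q => (compose p q 1 P).1.all (fun c => decide (0 ≤ c)) ||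
      (checkIco k P p ((p + q) / 2) && checkIco k P ((p + q) / 2) q)

/-- Sufficient test for nonnegativity on `[p, ∞)`. -/
def checkIci (P : List ℤ) (p : ℤ) : Bool := (compose p 1 0 P).1.all (fun c => decide (0 ≤ c))

theorem nonneg_of_checkIco {y : ℝ} (P : List ℤ) : ∀ (k : ℕ) (p q : ℤ), checkIco k P p q = true →
    p ≤ y → y < q → 0 ≤ eval y P
  | 0, _, _, h, _, _ => by simp [checkIco] at h
  | k + 1, p, q, h, h1, h2 => by
    simp only [checkIco, Bool.or_eq_true, Bool.and_eq_true] at h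
    rcases h with h | h
    · have hq : 0 < (q : ℝ) - y := by linarith
      have hp : 0 ≤ y - (p : ℝ) := by linarith
      have hz : 0 ≤ (y - p) / (q - y) := by positivity
      have h1z : (0 : ℝ) < 1 + (1 : ℤ) * ((y - p) / (q - y)) := by push_cast; positivity
      obtain ⟨h3, h4⟩ := compose_spec (p := p) (q := q) (v := 1) h1z
        (y := y) (by push_cast; field_simp; ring) P
      have h5 := eval_nonneg hz _ h
      refine nonneg_of_mul_nonneg_right ?_ h3
      rw [← h4]
      exact mul_nonneg h1z.le h5
    · rcases lt_or_ge y (((p + q) / 2 : ℤ) : ℝ) with hm | hm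
      · exact nonneg_of_checkIco P k _ _ h.1 h1 hm
      · exact nonneg_of_checkIco P k _ _ h.2 hm h2

theorem nonneg_of_checkIci {y : ℝ} (P : List ℤ) (p : ℤ) (h : checkIci P p = true) (h1 : p ≤ y) :
    0 ≤ eval y P := by
  obtain ⟨h3, h4⟩ := compose_spec (p := p) (q := 1) (v := 0) (z := y - p) (y := y) (by simp)
    (by simp) P
  refine nonneg_of_mul_nonneg_right ?_ h3
  rw [← h4]
  simpa using eval_nonneg (by linarith) _ h

/-- Test for nonnegativity of a sum of quotients on `[p, q)`. -/
def ratCheckIco (k : ℕ) (l : List (List ℤ × List ℤ)) (p q : ℤ) : Bool :=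
  checkIco k (ratSum l).1 p q

/-- Test for nonnegativity of a sum of quotients on `[p, ∞)`. -/
def ratCheckIci (k : ℕ) (l : List (List ℤ × List ℤ)) (p q : ℤ) : Bool :=
  checkIco k (ratSum l).1 p q && checkIci (ratSum l).1 q

theorem ratEval_nonneg_of_Ico {k : ℕ} {l : List (List ℤ × List ℤ)} {p q : ℤ} {y : ℝ}
    (h : ratCheckIco k l p q = true) (hl : ∀ t ∈ l, 0 < eval y t.2) (h1 : p ≤ y) (h2 : y < q) :
    0 ≤ ratEval y l := by
  obtain ⟨h3, h4⟩ := ratSum_spec y l hl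
  rw [h4]
  exact div_nonneg (nonneg_of_checkIco _ _ _ _ h h1 h2) h3.le

theorem ratEval_nonneg_of_Ici {k : ℕ} {l : List (List ℤ × List ℤ)} {p q : ℤ} {y : ℝ}
    (h : ratCheckIci k l p q = true) (hl : ∀ t ∈ l, 0 < eval y t.2) (h1 : p ≤ y) :
    0 ≤ ratEval y l := by
  obtain ⟨h3, h4⟩ := ratSum_spec y l hl
  simp only [ratCheckIci, Bool.and_eq_true] at h
  rw [h4]
  rcases lt_or_ge y q with h2 | h2
  · exact div_nonneg (nonneg_of_checkIco _ _ _ _ h.1 h1 h2) h3.le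
  · exact div_nonneg (nonneg_of_checkIci _ _ h.2 h2) h3.le

/-- The kernel `∑ A / (y + s (s - 1))` as a list of quotients. -/
def kernel (A : List (ℤ × ℤ)) : List (List ℤ × List ℤ) :=
  A.map fun t => ([t.2], [t.1 * (t.1 - 1), 1])

/-- Power of a coefficient list. -/
def pow (p : List ℤ) : ℕ → List ℤ
  | 0 => [1]
  | k + 1 => mul (pow p k) p

theorem eval_pow (y : ℝ) (p : List ℤ) : ∀ k, eval y (pow p k) = eval y p ^ k
  | 0 => by simp [pow]
  | k + 1 => by rw [pow, eval_mul, eval_pow y p k, pow_succ]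

/-- A lower bound for the real part of the kernel at `y + i b`, `b ^ 2 = y`. -/
def kernelLow (A : List (ℤ × ℤ)) : List (List ℤ × List ℤ) :=
  A.map fun t => (smul t.2 (add (pow [t.1 * (t.1 - 1), 1] 4) (add (mul [0, -1]
    (pow [t.1 * (t.1 - 1), 1] 2)) (if t.2 < 0 then [0, 0, 1] else []))),
    pow [t.1 * (t.1 - 1), 1] 5)

end IntPoly

end

section

/-! Fixed-point logarithms of natural numbers. -/

/-- Fixed-point partial sum of `∑ T (a/b)^k / (d + 2k)`. -/
def artanhSum (a b : ℕ) : ℕ → ℕ → ℕ → ℕ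
  | 0, _, _ => 0
  | f + 1, d, t => t / d + artanhSum a b f (d + 2) (t * a / b)

theorem artanhSum_bounds {a b : ℕ} (hb : 0 < b) (hab : 9 * a ≤ b) : ∀ (f d t : ℕ) (T : ℝ), 0 < d →
    (t : ℝ) ≤ T → T ≤ t + 2 →
    (artanhSum a b f d t : ℝ) ≤ ∑ k ∈ Finset.range f, T * (a / b : ℝ) ^ k / (d + 2 * k) ∧
    ∑ k ∈ Finset.range f, T * (a / b : ℝ) ^ k / (d + 2 * k) ≤ artanhSum a b f d t + 3 * f
  | 0, d, t, T, _, _, _ => by simp [artanhSum]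
  | f + 1, d, t, T, hd, h1, h2 => by
    have hb' : (0 : ℝ) < b := by exact_mod_cast hb
    have hd' : (1 : ℝ) ≤ d := by exact_mod_cast hd
    have hx0 : (0 : ℝ) ≤ a / b := by positivity
    have hx : (a / b : ℝ) ≤ 1 / 9 := by
      rw [div_le_div_iff₀ hb' (by norm_num)]
      have : (9 * a : ℝ) ≤ b := by exact_mod_cast hab
      linarith
    have ht0 : (0 : ℝ) ≤ t := Nat.cast_nonneg t
    have hfl : ∀ m n : ℕ, 0 < n → ((m / n : ℕ) : ℝ) ≤ m / n ∧ (m / n : ℝ) ≤ (m / n : ℕ) + 1 := by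
      intro m n hn
      refine ⟨Nat.cast_div_le, ?_⟩
      have hn' : (0 : ℝ) < n := by exact_mod_cast hn
      rw [div_le_iff₀ hn']
      have h3 : m ≤ (m / n + 1) * n := by
        have h4 := Nat.div_add_mod m n
        have h5 := Nat.mod_lt m hn
        nlinarith
      exact_mod_cast h3
    obtain ⟨h3, h4⟩ := hfl (t * a) b hb
    obtain ⟨h5, h6⟩ := hfl t d hd
    push_cast at h3 h4
    rw [mul_div_assoc] at h3 h4
    obtain ⟨h7, h8⟩ := artanhSum_bounds hb hab f (d + 2) (t * a / b) (T * (a / b)) (by omega)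
      (h3.trans (mul_le_mul_of_nonneg_right h1 hx0)) (by nlinarith)
    have hs : ∑ k ∈ Finset.range (f + 1), T * (a / b : ℝ) ^ k / (d + 2 * k) =
        T / d + ∑ k ∈ Finset.range f, T * (a / b) * (a / b : ℝ) ^ k / ((d + 2 : ℕ) + 2 * k) := by
      rw [Finset.sum_range_succ', add_comm]
      congr 1
      · simp
      · refine Finset.sum_congr rfl fun k _ => ?_
        push_cast
        rw [pow_succ]
        congr 1
        · ring
        · ring
    have h9 : (t : ℝ) / d ≤ T / d := by gcongr
    have h10 : T / d ≤ t / d + 2 := by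
      have : T / d ≤ (t + 2) / d := by gcongr
      have h11 : (2 : ℝ) / d ≤ 2 := div_le_self (by norm_num) hd'
      rw [add_div] at this
      linarith
    rw [hs, artanhSum]
    push_cast at h7 h8 ⊢
    constructor <;> linarith

/-- Approximation to `10 ^ 24 * log (n / m)` for `m ≤ n ≤ 2 m`. -/
def logRatioFix (n m : ℕ) : ℕ :=
  artanhSum ((n - m) ^ 2) ((n + m) ^ 2) 26 1 (2 * 10 ^ 24 * (n - m) / (n + m))

theorem logRatioFix_bounds {n m : ℕ} (hm : 0 < m) (hmn : m ≤ n) (hn : n ≤ 2 * m) :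
    (logRatioFix n m : ℝ) ≤ 10 ^ 24 * Real.log (n / m) ∧
    10 ^ 24 * Real.log (n / m) ≤ logRatioFix n m + 80 := by
  have hm' : (0 : ℝ) < m := by exact_mod_cast hm
  have hmn' : (m : ℝ) ≤ n := by exact_mod_cast hmn
  have hn' : (n : ℝ) ≤ 2 * m := by exact_mod_cast hn
  set x : ℝ := (n - m) / (n + m) with hx
  have hx0 : 0 ≤ x := div_nonneg (by linarith) (by linarith)
  have hx3 : x ≤ 1 / 3 := by rw [hx, div_le_div_iff₀ (by linarith) (by norm_num)]; linarith
  have hlog : Real.log (1 + x) - Real.log (1 - x) = Real.log (n / m) := by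
    rw [← Real.log_div (by linarith) (by linarith)]
    congr 1
    have h1 : (n : ℝ) + m ≠ 0 := by positivity
    have h2 : 1 + x = 2 * n / (n + m) := by rw [hx]; field_simp; ring
    have h3 : 1 - x = 2 * m / (n + m) := by rw [hx]; field_simp; ring
    rw [h2, h3, div_div_div_cancel_right₀ h1, mul_div_mul_left _ _ two_ne_zero]
  have hS := Real.hasSum_log_sub_log_of_abs_lt_one (x := x) (by rw [abs_of_nonneg hx0]; linarith)
  rw [hlog] at hS
  have hS' := hS.mul_left (10 ^ 24)
  set T : ℝ := 2 * 10 ^ 24 * x with hT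
  have hT0 : 0 ≤ T := by positivity
  have hx2 : ((((n - m) ^ 2 : ℕ) : ℝ) / ((n + m) ^ 2 : ℕ)) = x ^ 2 := by
    rw [hx, div_pow]
    push_cast [Nat.cast_sub hmn]
    rfl
  have hterm : ∀ k : ℕ, (10 : ℝ) ^ 24 * (2 * (1 / (2 * (k : ℝ) + 1)) * x ^ (2 * k + 1)) =
      T * (x ^ 2) ^ k / ((1 : ℕ) + 2 * k) := by
    intro k
    rw [hT, ← pow_mul, pow_succ]
    push_cast
    field_simp
    ring
  have hb := artanhSum_bounds (a := (n - m) ^ 2) (b := (n + m) ^ 2) (by positivity)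
    (by
      obtain ⟨r, rfl⟩ := Nat.exists_eq_add_of_le hmn
      rw [Nat.add_sub_cancel_left]
      have : 3 * r ≤ m + r + m := by omega
      nlinarith) 26 1 (2 * 10 ^ 24 * (n - m) / (n + m)) T (by norm_num) ?_ ?_
  · rw [hx2] at hb
    change (logRatioFix n m : ℝ) ≤ _ ∧ _ ≤ (logRatioFix n m : ℝ) + 3 * (26 : ℕ) at hb
    simp only [hterm] at hS'
    have hle := sum_le_hasSum (Finset.range 26) (fun k _ => by positivity) hS'
    refine ⟨hb.1.trans hle, ?_⟩
    have htail := (hasSum_nat_add_iff' 26).mpr hS'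
    have hgeo := (hasSum_geometric_of_lt_one (r := (1 / 9 : ℝ)) (by norm_num) (by norm_num)).mul_left
      (T * (1 / 9 : ℝ) ^ 26)
    have hcmp := hasSum_le (fun k => ?_) htail hgeo
    · have hT1 : T ≤ 2 * 10 ^ 24 / 3 := by rw [hT]; linarith
      have : T * (1 / 9 : ℝ) ^ 26 * (1 - 1 / 9)⁻¹ ≤ 2 := by
        calc T * (1 / 9 : ℝ) ^ 26 * (1 - 1 / 9)⁻¹ ≤
            2 * 10 ^ 24 / 3 * (1 / 9 : ℝ) ^ 26 * (1 - 1 / 9)⁻¹ := by gcongr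
          _ ≤ 2 := by norm_num
      have h2 := hb.2
      push_cast at h2
      push_cast at hcmp
      linarith
    · have h1 : (x ^ 2) ^ (k + 26) ≤ (1 / 9 : ℝ) ^ (k + 26) := by
        gcongr
        nlinarith
      calc T * (x ^ 2) ^ (k + 26) / ((1 : ℕ) + 2 * ((k + 26 : ℕ) : ℝ))
          ≤ T * (x ^ 2) ^ (k + 26) := div_le_self (by positivity) (by push_cast; nlinarith [Nat.cast_nonneg (α := ℝ) k])
        _ ≤ T * (1 / 9 : ℝ) ^ (k + 26) := by gcongr
        _ = T * (1 / 9) ^ 26 * (1 / 9) ^ k := by rw [pow_add]; ring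
  · refine Nat.cast_div_le.trans (le_of_eq ?_)
    rw [hT, hx]
    push_cast [Nat.cast_sub hmn]
    ring
  · have hfl := Nat.lt_floor_add_one (((2 * 10 ^ 24 * (n - m) : ℕ) : ℝ) / ((n + m : ℕ) : ℝ))
    rw [Nat.floor_div_eq_div] at hfl
    have : T = ((2 * 10 ^ 24 * (n - m) : ℕ) : ℝ) / ((n + m : ℕ) : ℝ) := by
      rw [hT, hx]
      push_cast [Nat.cast_sub hmn]
      ring
    linarith

/-- Approximation to `10 ^ 24 * log n`. -/
def logFix (n : ℕ) : ℕ := Nat.log2 n * logRatioFix 2 1 + logRatioFix n (2 ^ Nat.log2 n)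

theorem logFix_bounds {n : ℕ} (hn : 0 < n) (hn' : n < 2 ^ 20) :
    (logFix n : ℝ) ≤ 10 ^ 24 * Real.log n ∧ 10 ^ 24 * Real.log n ≤ logFix n + 2000 := by
  obtain ⟨h1, h2⟩ := logRatioFix_bounds (n := 2) (m := 1) (by norm_num) (by norm_num) (by norm_num)
  have hk := Nat.log2_self_le hn.ne'
  have hk' := Nat.lt_log2_self (n := n)
  obtain ⟨h3, h4⟩ := logRatioFix_bounds (n := n) (m := 2 ^ Nat.log2 n) (by positivity) hk
    (by rw [pow_succ] at hk'; omega)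
  have h20 : Nat.log2 n ≤ 20 := by
    by_contra h
    have : 2 ^ 20 ≤ 2 ^ Nat.log2 n := Nat.pow_le_pow_right (by norm_num) (by omega)
    omega
  have h20' : (Nat.log2 n : ℝ) ≤ 20 := by exact_mod_cast h20
  have hk0 : (0 : ℝ) ≤ Nat.log2 n := Nat.cast_nonneg _
  have hlog : Real.log n = Nat.log2 n * Real.log 2 + Real.log (n / (2 ^ Nat.log2 n : ℕ)) := by
    rw [Real.log_div (by positivity) (by positivity)]
    push_cast
    rw [Real.log_pow]
    ring
  push_cast [logFix] at h1 h2 ⊢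
  rw [div_one] at h1 h2
  rw [hlog]
  constructor <;> nlinarith

end

section

/-! Numerical bounds for `log π`, the Euler–Mascheroni constant and the von Mangoldt function. -/

open Filter Topology

/-- Approximation to `10 ^ 24 * harmonic n`. -/
def harmonicFix : ℕ → ℕ
  | 0 => 0
  | n + 1 => harmonicFix n + 10 ^ 24 / (n + 1)

theorem Nat.cast_div_add_one_ge (m n : ℕ) : (m / n : ℝ) ≤ ((m / n : ℕ) : ℝ) + 1 := by
  have h := Nat.lt_floor_add_one ((m : ℝ) / n)
  rw [Nat.floor_div_eq_div] at h
  exact h.le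

theorem harmonicFix_bounds (n : ℕ) : (harmonicFix n : ℝ) ≤ 10 ^ 24 * (harmonic n : ℝ) ∧
    10 ^ 24 * (harmonic n : ℝ) ≤ harmonicFix n + n := by
  induction n with
  | zero => simp [harmonicFix]
  | succ n ih =>
    have h1 : (((10 ^ 24 / (n + 1) : ℕ)) : ℝ) ≤ ((10 ^ 24 : ℕ) : ℝ) / ((n + 1 : ℕ) : ℝ) :=
      Nat.cast_div_le
    have h2 := Nat.cast_div_add_one_ge (10 ^ 24) (n + 1)
    rw [harmonic_succ, harmonicFix]
    push_cast at h1 h2 ⊢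
    rw [div_eq_mul_inv] at h1 h2
    constructor <;> nlinarith [ih.1, ih.2]

theorem log_one_add_inv_bounds {a : ℝ} (ha : 0 < a) :
    2 * (1 / (2 * a + 1)) + 2 / 3 * (1 / (2 * a + 1)) ^ 3 ≤ Real.log (1 + a⁻¹) ∧
    Real.log (1 + a⁻¹) ≤ 2 * (1 / (2 * a + 1)) + 2 / 3 * (1 / (2 * a + 1)) ^ 3 +
      2 / 5 * (1 / (2 * a + 1)) ^ 5 / (1 - (1 / (2 * a + 1)) ^ 2) := by
  have hS := Real.hasSum_log_one_add_inv ha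
  set x := 1 / (2 * a + 1) with hx
  have hx0 : 0 < x := by positivity
  have hx1 : x < 1 := by rw [hx, div_lt_one (by positivity)]; linarith
  constructor
  · refine le_trans (le_of_eq ?_) (sum_le_hasSum (Finset.range 2) (fun k _ => by positivity) hS)
    simp only [Finset.sum_range_succ, Finset.sum_range_zero]
    norm_num
  · have htail := (hasSum_nat_add_iff' 2).mpr hS
    have hx2 : x ^ 2 < 1 := by nlinarith
    have hgeo := (hasSum_geometric_of_lt_one (r := x ^ 2) (by positivity) hx2).mul_left
      (2 / 5 * x ^ 5)
    have hc := hasSum_le (fun k => ?_) htail hgeo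
    · simp only [Finset.sum_range_succ, Finset.sum_range_zero] at hc
      norm_num at hc
      rw [div_eq_mul_inv (2 / 5 * x ^ 5)]
      linarith
    · have e : x ^ (2 * (k + 2) + 1) = x ^ 5 * (x ^ 2) ^ k := by ring
      rw [e]
      have : 2 * (1 / (2 * ((k + 2 : ℕ) : ℝ) + 1)) ≤ 2 / 5 := by
        rw [mul_one_div, div_le_div_iff₀ (by positivity) (by norm_num)]
        push_cast
        nlinarith [Nat.cast_nonneg (α := ℝ) k]
      rw [mul_assoc (2 / 5 : ℝ)]
      exact mul_le_mul_of_nonneg_right this (by positivity)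

theorem log_add_one_sub_log_bounds {a : ℝ} (ha : 0 < a) :
    (1 / a + 1 / (a + 1)) / 2 - (1 / a ^ 2 - 1 / (a + 1) ^ 2) / 12 ≤ Real.log (1 + a⁻¹) ∧
    Real.log (1 + a⁻¹) ≤ (1 / a + 1 / (a + 1)) / 2 - (1 / a ^ 2 - 1 / (a + 1) ^ 2) / 12 +
      (1 / a ^ 4 - 1 / (a + 1) ^ 4) / 120 := by
  obtain ⟨h1, h2⟩ := log_one_add_inv_bounds ha
  refine ⟨le_trans ?_ h1, h2.trans ?_⟩
  · rw [← sub_nonneg]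
    have : 2 * (1 / (2 * a + 1)) + 2 / 3 * (1 / (2 * a + 1)) ^ 3 -
        ((1 / a + 1 / (a + 1)) / 2 - (1 / a ^ 2 - 1 / (a + 1) ^ 2) / 12) =
        (1 + 2 * (a * (a + 1))) / (12 * a ^ 2 * (a + 1) ^ 2 * (2 * a + 1) ^ 3) := by
      field_simp
      ring
    rw [this]
    positivity
  · have h3 : 1 - (1 / (2 * a + 1)) ^ 2 = 4 * a * (a + 1) / (2 * a + 1) ^ 2 := by
      field_simp; ring
    rw [h3, ← sub_nonneg]
    have : (1 / a + 1 / (a + 1)) / 2 - (1 / a ^ 2 - 1 / (a + 1) ^ 2) / 12 +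
      (1 / a ^ 4 - 1 / (a + 1) ^ 4) / 120 - (2 * (1 / (2 * a + 1)) + 2 / 3 * (1 / (2 * a + 1)) ^ 3 +
      2 / 5 * (1 / (2 * a + 1)) ^ 5 / (4 * a * (a + 1) / (2 * a + 1) ^ 2)) =
        (1 + 10 * (a * (a + 1)) + 22 * (a * (a + 1)) ^ 2) /
          (120 * a ^ 4 * (a + 1) ^ 4 * (2 * a + 1) ^ 3) := by
      field_simp
      ring
    rw [this]
    positivity

theorem eulerMascheroniConstant_le {n : ℕ} (hn : 0 < n) : Real.eulerMascheroniConstant ≤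
    harmonic n - Real.log n - 1 / (2 * n) + 1 / (12 * n ^ 2) ∧
    harmonic n - Real.log n - 1 / (2 * n) + 1 / (12 * n ^ 2) - 1 / (120 * n ^ 4) ≤
      Real.eulerMascheroniConstant := by
  set e : ℕ → ℝ := fun n => harmonic n - Real.log n - 1 / (2 * n) + 1 / (12 * n ^ 2) with he
  have hstep : ∀ k : ℕ, 0 < k → e (k + 1) ≤ e k ∧
      e k - 1 / (120 * (k : ℝ) ^ 4) ≤ e (k + 1) - 1 / (120 * ((k + 1 : ℕ) : ℝ) ^ 4) := by
    intro k hk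
    have hk' : (0 : ℝ) < k := by exact_mod_cast hk
    obtain ⟨h1, h2⟩ := log_add_one_sub_log_bounds hk'
    have h3 : Real.log (1 + (k : ℝ)⁻¹) = Real.log ((k : ℝ) + 1) - Real.log k := by
      rw [← Real.log_div (by positivity) (by positivity)]
      congr 1
      field_simp
    rw [h3] at h1 h2
    simp only [he, harmonic_succ]
    push_cast
    have e1 : ((k : ℝ) + 1)⁻¹ = 1 / (k + 1) := by rw [one_div]
    have e2 : ∀ c y : ℝ, 1 / (c * y) = 1 / c * (1 / y) := fun c y => by rw [one_div_mul_one_div]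
    rw [e1]
    simp only [e2 2, e2 12, e2 120]
    constructor <;> linarith
  have hlim0 : Tendsto e atTop (𝓝 Real.eulerMascheroniConstant) := by
    have h1 := Real.tendsto_harmonic_sub_log
    have h2 : Tendsto (fun n : ℕ => 1 / (2 * (n : ℝ))) atTop (𝓝 0) := by
      have := tendsto_one_div_atTop_nhds_zero_nat (𝕜 := ℝ)
      have := this.const_mul (1 / 2)
      simp only [one_div_mul_one_div] at this
      simpa using this
    have h3 : Tendsto (fun n : ℕ => 1 / (12 * (n : ℝ) ^ 2)) atTop (𝓝 0) := by
      have := (tendsto_one_div_atTop_nhds_zero_nat (𝕜 := ℝ)).pow 2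
      have := this.const_mul (1 / 12)
      simp only [one_div_pow, one_div_mul_one_div] at this
      simpa using this
    simpa [he] using (h1.sub h2).add h3
  have hlim1 : Tendsto (fun n : ℕ => e n - 1 / (120 * (n : ℝ) ^ 4)) atTop
      (𝓝 Real.eulerMascheroniConstant) := by
    have h3 : Tendsto (fun n : ℕ => 1 / (120 * (n : ℝ) ^ 4)) atTop (𝓝 0) := by
      have := (tendsto_one_div_atTop_nhds_zero_nat (𝕜 := ℝ)).pow 4
      have := this.const_mul (1 / 120)
      simp only [one_div_pow, one_div_mul_one_div] at this
      simpa using this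
    simpa using hlim0.sub h3
  have hanti : Antitone fun k => e (n + k) := antitone_nat_of_succ_le fun k => (hstep (n + k) (by omega)).1
  have hmono : Monotone fun k : ℕ => e (n + k) - 1 / (120 * ((n + k : ℕ) : ℝ) ^ 4) :=
    monotone_nat_of_le_succ fun k => (hstep (n + k) (by omega)).2
  have hshift : Tendsto (fun k => n + k) atTop atTop := tendsto_atTop_mono (fun k => by simp) tendsto_id
  exact ⟨hanti.le_of_tendsto (hlim0.comp hshift) 0, hmono.ge_of_tendsto (hlim1.comp hshift) 0⟩

theorem eulerMascheroniConstant_bounds : 0.577215664901 ≤ Real.eulerMascheroniConstant ∧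
    Real.eulerMascheroniConstant ≤ 0.577215664907 := by
  obtain ⟨h1, h2⟩ := eulerMascheroniConstant_le (n := 200) (by norm_num)
  obtain ⟨h3, h4⟩ := harmonicFix_bounds 200
  obtain ⟨h5, h6⟩ := logFix_bounds (n := 200) (by norm_num) (by norm_num)
  have e1 : logFix 200 = 5298317366548036677453130 := by decide +kernel
  have e2 : harmonicFix 200 = 5878030948121444476057299 := by decide +kernel
  rw [e1] at h5 h6
  rw [e2] at h3 h4
  push_cast at h1 h2 h3 h4 h5 h6
  constructor <;> linarith

theorem log_pi_bounds : 1.14472988584939 ≤ Real.log Real.pi ∧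
    Real.log Real.pi ≤ 1.14472988584941 := by
  obtain ⟨h3, h4⟩ := logFix_bounds (n := 355) (by norm_num) (by norm_num)
  obtain ⟨h5, h6⟩ := logFix_bounds (n := 113) (by norm_num) (by norm_num)
  have e1 : logFix 355 = 5872117789475415795930118 := by decide +kernel
  have e2 : logFix 113 = 4727387818712340568582054 := by decide +kernel
  rw [e1] at h3 h4
  rw [e2] at h5 h6
  push_cast at h3 h4 h5 h6
  have hp := Real.pi_pos
  have hr : Real.log Real.pi = Real.log 355 - Real.log 113 + Real.log (Real.pi * (113 / 355)) := by
    rw [Real.log_mul hp.ne' (by norm_num), Real.log_div (by norm_num) (by norm_num)]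
    ring
  have h1 := Real.pi_gt_d20
  have h2 := Real.pi_lt_d20
  have h7 := Real.log_le_sub_one_of_pos (x := Real.pi * (113 / 355)) (by positivity)
  have h8 := Real.one_sub_inv_le_log_of_pos (x := Real.pi * (113 / 355)) (by positivity)
  have h9 : (Real.pi * (113 / 355))⁻¹ ≤ 1.000000084913679 := by
    rw [inv_le_comm₀ (by positivity) (by norm_num)]
    refine le_trans ?_ (mul_le_mul_of_nonneg_right h1.le (by norm_num))
    norm_num
  rw [hr]
  constructor <;> linarith

end

section

/-! Kernel-computable von Mangoldt function. -/

open ArithmeticFunction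

/-- Smallest divisor of `n` that is at least `d`, by trial division. -/
def trialFactor (n : ℕ) : ℕ → ℕ → ℕ
  | 0, _ => n
  | f + 1, d => bif n % d == 0 then d else bif Nat.ble (d * d) n then trialFactor n f (d + 1) else n

theorem trialFactor_eq {n : ℕ} (hn : 2 ≤ n) : ∀ (f d : ℕ), 2 ≤ d → n < (d + f) ^ 2 →
    (∀ m, 2 ≤ m → m < d → ¬ m ∣ n) → trialFactor n f d = n.minFac
  | f, d => by
    intro hd hf hm
    have hmf := Nat.minFac_prime (n := n) (by omega)
    have hle : d ≤ n.minFac := by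
      by_contra h
      exact hm _ hmf.two_le (by omega) (Nat.minFac_dvd n)
    have hbig : n < d * d → n = n.minFac := by
      intro h
      by_contra hne
      have h1 : ¬ n.Prime := fun hp => hne hp.minFac_eq.symm
      have h2 := Nat.minFac_sq_le_self (by omega) h1
      nlinarith
    cases f with
    | zero => exact hbig (by nlinarith)
    | succ f =>
      rw [trialFactor]
      by_cases h1 : n % d = 0
      · simp only [h1, beq_self_eq_true, cond_true]
        exact le_antisymm hle (Nat.minFac_le_of_dvd hd (Nat.dvd_of_mod_eq_zero h1))
      · have h1' : (n % d == 0) = false := by simpa using h1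
        rw [h1', cond_false]
        by_cases h2 : d * d ≤ n
        · rw [(Nat.ble_eq).mpr h2, cond_true]
          refine trialFactor_eq hn f (d + 1) (by omega) (by convert! hf using 2; ring) fun m h3 h4 => ?_
          rcases Nat.lt_succ_iff_lt_or_eq.mp h4 with h5 | h5
          · exact hm m h3 h5
          · rw [h5]
            exact fun h => h1 (Nat.mod_eq_zero_of_dvd h)
        · have h2' : Nat.ble (d * d) n = false := by
            rw [Bool.eq_false_iff]
            exact fun h => h2 (Nat.ble_eq.mp h)
          rw [h2', cond_false]
          exact hbig (by omega)

/-- Base of the prime power `n`, or `1` if `n` is not a prime power (for `n < 2 ^ 12`). -/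
def primeBase (n : ℕ) : ℕ :=
  bif Nat.ble n 1 then 1 else
    bif (trialFactor n 64 2) ^ 11 % n == 0 then trialFactor n 64 2 else 1

theorem vonMangoldt_eq_log_primeBase {n : ℕ} (hn : n < 2 ^ 12) : Λ n = Real.log (primeBase n) := by
  rw [primeBase]
  by_cases h1 : n ≤ 1
  · rw [Nat.ble_eq.mpr h1, cond_true]
    interval_cases n <;> simp
  · have h1' : Nat.ble n 1 = false := by
      rw [Bool.eq_false_iff]
      exact fun h => h1 (Nat.ble_eq.mp h)
    rw [h1', cond_false, trialFactor_eq (by omega) 64 2 le_rfl (by omega) (by omega),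
      vonMangoldt_apply]
    have hmf := Nat.minFac_prime (n := n) (by omega)
    have key : IsPrimePow n ↔ n.minFac ^ 11 % n = 0 := by
      constructor
      · intro h
        obtain ⟨p, k, hp, hk, rfl⟩ := (isPrimePow_nat_iff n).mp h
        rw [hp.pow_minFac hk.ne']
        refine Nat.mod_eq_zero_of_dvd (pow_dvd_pow _ ?_)
        by_contra hk11
        have : 2 ^ 12 ≤ p ^ k := (Nat.pow_le_pow_left hp.two_le 12).trans
          (Nat.pow_le_pow_right hp.pos (by omega))
        omega
      · intro h
        obtain ⟨k, -, hk⟩ := (Nat.dvd_prime_pow hmf).mp (Nat.dvd_of_mod_eq_zero h)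
        refine (isPrimePow_nat_iff n).mpr ⟨n.minFac, k, hmf, ?_, hk.symm⟩
        rcases Nat.eq_zero_or_pos k with rfl | h
        · simp at hk
          omega
        · exact h
    by_cases h2 : n.minFac ^ 11 % n = 0
    · rw [if_pos (key.mpr h2)]
      simp [h2]
    · rw [if_neg (fun h => h2 (key.mp h))]
      have : (n.minFac ^ 11 % n == 0) = false := by simpa using h2
      rw [this]
      simp

/-- Approximation to `10 ^ 24 * Λ n`. -/
def mangoldtFix (n : ℕ) : ℕ := logFix (primeBase n)

theorem mangoldtFix_bounds {n : ℕ} (hn : n < 2 ^ 12) :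
    (mangoldtFix n : ℝ) ≤ 10 ^ 24 * Λ n ∧ 10 ^ 24 * Λ n ≤ mangoldtFix n + 2000 := by
  rw [vonMangoldt_eq_log_primeBase hn]
  have h : 0 < primeBase n ∧ primeBase n < 2 ^ 20 := by
    rw [primeBase]
    by_cases h1 : n ≤ 1
    · rw [Nat.ble_eq.mpr h1]; simp
    · have h1' : Nat.ble n 1 = false := by
        rw [Bool.eq_false_iff]
        exact fun h => h1 (Nat.ble_eq.mp h)
      rw [h1', cond_false, trialFactor_eq (by omega) 64 2 le_rfl (by omega) (by omega)]
      cases (n.minFac ^ 11 % n == 0) with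
      | false => simp
      | true =>
        rw [cond_true]
        have := Nat.minFac_le (n := n) (by omega)
        exact ⟨Nat.minFac_pos n, by omega⟩
  exact logFix_bounds h.1 h.2

end

section

open Complex ComplexConjugate

namespace xiFun

/-- The sum `∑_ρ 1 / (ρ (1 - ρ) + s (s - 1))` at `s = 2 k`, in closed form. -/
noncomputable def nodeSum (k : ℕ) : ℝ :=
  2 * (1 / (2 * k) + 1 / (2 * k - 1) - Real.log Real.pi / 2 +
    (harmonic (k - 1) - Real.eulerMascheroniConstant) / 2 -
    ∑' n : ℕ, ArithmeticFunction.vonMangoldt n / (n : ℝ) ^ (2 * k)) / (4 * k - 1)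

theorem summable_mangoldt_div {k : ℕ} (hk : 1 ≤ k) :
    Summable fun n : ℕ => ArithmeticFunction.vonMangoldt n / (n : ℝ) ^ (2 * k) := by
  have hk' : (1 : ℝ) ≤ k := by exact_mod_cast hk
  have h := ArithmeticFunction.LSeriesSummable_vonMangoldt (s := 2 * k) (by simp; linarith)
  rw [LSeriesSummable, ← summable_norm_iff] at h
  refine h.congr fun n => ?_
  rcases eq_or_ne n 0 with rfl | hn
  · simp
  · rw [LSeries.term_of_ne_zero hn]
    have : (2 * k : ℂ) = ((2 * k : ℕ) : ℂ) := by push_cast; rfl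
    rw [this, cpow_natCast, norm_div, norm_real, norm_pow, norm_natCast,
      Real.norm_of_nonneg ArithmeticFunction.vonMangoldt_nonneg]

theorem LSeries_mangoldt_natCast (k : ℕ) :
    LSeries (fun n => (ArithmeticFunction.vonMangoldt n : ℂ)) (2 * k) =
      ((∑' n : ℕ, ArithmeticFunction.vonMangoldt n / (n : ℝ) ^ (2 * k) : ℝ) : ℂ) := by
  rw [LSeries, Complex.ofReal_tsum]
  refine tsum_congr fun n => ?_
  rcases eq_or_ne n 0 with rfl | hn
  · simp
  · rw [LSeries.term_of_ne_zero hn]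
    have : (2 * k : ℂ) = ((2 * k : ℕ) : ℂ) := by push_cast; rfl
    rw [this, cpow_natCast]
    push_cast
    rfl

theorem hasSum_nodeSum {k : ℕ} (hk : 1 ≤ k) :
    HasSum (fun ρ : ℂ => (mult ρ : ℝ) * (1 / (ρ * (1 - ρ) + (2 * k) * (2 * k - 1))).re)
      (nodeSum k) := by
  have hk' : (1 : ℝ) ≤ k := by exact_mod_cast hk
  have hre : 1 < (2 * k : ℂ).re := by simp; linarith
  have hne : xiFun (2 * k) ≠ 0 := fun h => by
    have := (re_mem_of_mult_ne (mult_ne_zero h)).2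
    linarith
  have h2 : (2 * (2 * k) - 1 : ℂ) ≠ 0 := fun h => by
    have := congrArg re h
    simp at this
    linarith
  have h := hasSum_re (hasSum_inv_add hne h2)
  have hd : digamma (2 * k / 2) = ((harmonic (k - 1) - Real.eulerMascheroniConstant : ℝ) : ℂ) := by
    obtain ⟨j, rfl⟩ := Nat.exists_eq_add_of_le hk
    have h1 := DigammaSeries.realDigamma_add_nat one_pos j
    have h2 := DigammaSeries.digamma_ofReal (x := 1 + j) (by positivity)
    rw [h1, DigammaSeries.realDigamma_one] at h2
    have e : (2 * ((1 + j : ℕ) : ℂ) / 2) = ((1 + j : ℝ) : ℂ) := by push_cast; ring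
    rw [e, h2, Nat.add_sub_cancel_left, harmonic]
    congr 1
    push_cast
    rw [add_comm, ← sub_eq_add_neg]
    congr 1
    refine Finset.sum_congr rfl fun i _ => ?_
    rw [one_div, add_comm]
  have hval : nodeSum k = (2 * logDeriv xiFun (2 * k) / (2 * (2 * k) - 1)).re := by
    rw [logDeriv_eq hre, hd, LSeries_mangoldt_natCast k]
    have : ∀ x : ℝ, ((x : ℂ)).re = x := ofReal_re
    rw [← this (nodeSum k)]
    congr 1
    rw [nodeSum]
    push_cast
    ring
  rw [hval]
  have hf : (fun ρ : ℂ => (mult ρ : ℝ) * (1 / (ρ * (1 - ρ) + (2 * k) * (2 * k - 1))).re) =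
      fun ρ : ℂ => ((mult ρ : ℂ) / (ρ * (1 - ρ) + (2 * k) * (2 * k - 1))).re := by
    funext ρ
    have : (mult ρ : ℂ) = ((mult ρ : ℝ) : ℂ) := by push_cast; rfl
    rw [div_eq_mul_one_div (mult ρ : ℂ), this, re_ofReal_mul]
  rw [hf]
  exact h

theorem mangoldt_div_le {k m : ℕ} (hk : 4 ≤ k) (hm : 101 ≤ m) :
    ArithmeticFunction.vonMangoldt m / (m : ℝ) ^ (2 * k) ≤
      1 / 10 ^ 10 * (1 / ((m : ℝ) - 1) - 1 / m) := by
  have h1 : ArithmeticFunction.vonMangoldt m ≤ (m : ℝ) :=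
    ArithmeticFunction.vonMangoldt_le_log.trans (Real.log_le_self (by positivity))
  have h0 : 0 ≤ ArithmeticFunction.vonMangoldt m := ArithmeticFunction.vonMangoldt_nonneg
  have hx : (101 : ℝ) ≤ m := by exact_mod_cast hm
  generalize ArithmeticFunction.vonMangoldt m = y at *
  generalize (m : ℝ) = x at *
  have h2 : x ^ 8 ≤ x ^ (2 * k) := pow_le_pow_right₀ (by linarith) (by omega)
  have h3 : (10 : ℝ) ^ 10 ≤ x ^ 5 := by
    calc (10 : ℝ) ^ 10 = 100 ^ 5 := by norm_num
      _ ≤ x ^ 5 := by gcongr; linarith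
  have hx0 : 0 < x := by linarith
  have hx1 : 0 < x - 1 := by linarith
  have h4 : 1 / (x - 1) - 1 / x = 1 / (x * (x - 1)) := by
    field_simp
    ring
  rw [h4, one_div_mul_one_div, div_le_div_iff₀ (by positivity)
    (mul_pos (by norm_num) (mul_pos (by linarith) (by linarith)))]
  have h5 : x * (x - 1) ≤ x * x := by nlinarith
  calc y * (10 ^ 10 * (x * (x - 1))) ≤ x * (x ^ 5 * (x * x)) :=
        mul_le_mul h1 (mul_le_mul h3 h5 (by positivity) (by positivity)) (by positivity) hx0.le
    _ = 1 * x ^ 8 := by ring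
    _ ≤ 1 * x ^ (2 * k) := by linarith

theorem tsum_mangoldt_tail {k : ℕ} (hk : 4 ≤ k) :
    ∑' n : ℕ, ArithmeticFunction.vonMangoldt (n + 101) / ((n + 101 : ℕ) : ℝ) ^ (2 * k) ≤
      1 / 10 ^ 12 := by
  have hterm : ∀ n : ℕ, ArithmeticFunction.vonMangoldt (n + 101) / ((n + 101 : ℕ) : ℝ) ^ (2 * k) ≤
      1 / 10 ^ 10 * (1 / ((n : ℝ) + 100) - 1 / (n + 101)) := by
    intro n
    refine (mangoldt_div_le hk (Nat.le_add_left 101 n)).trans (le_of_eq ?_)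
    rw [Nat.cast_add]
    congr 3
    push_cast
    ring
  refine Real.tsum_le_of_sum_range_le (fun n =>
    div_nonneg ArithmeticFunction.vonMangoldt_nonneg (pow_nonneg (Nat.cast_nonneg _) _)) fun m => ?_
  refine (Finset.sum_le_sum fun n _ => hterm n).trans ?_
  rw [← Finset.mul_sum]
  have hsum : ∀ m : ℕ, ∑ n ∈ Finset.range m, (1 / ((n : ℝ) + 100) - 1 / (n + 101)) =
      1 / 100 - 1 / (m + 100) := by
    intro m
    induction m with
    | zero => simp
    | succ m ih => rw [Finset.sum_range_succ, ih]; push_cast; ring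
  rw [hsum]
  have : (0 : ℝ) ≤ 1 / (m + 100) := by positivity
  linarith

/-- Approximation to `10 ^ 24 * ∑_{n < N} Λ n / n ^ s`. -/
def mangoldtSumFix (s : ℕ) : ℕ → ℕ
  | 0 => 0
  | n + 1 => mangoldtSumFix s n + mangoldtFix n / n ^ s

theorem mangoldtSumFix_bounds (s : ℕ) : ∀ N : ℕ, N ≤ 2 ^ 12 →
    (mangoldtSumFix s N : ℝ) ≤
      10 ^ 24 * ∑ n ∈ Finset.range N, ArithmeticFunction.vonMangoldt n / (n : ℝ) ^ s ∧
    10 ^ 24 * ∑ n ∈ Finset.range N, ArithmeticFunction.vonMangoldt n / (n : ℝ) ^ s ≤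
      mangoldtSumFix s N + 2001 * N
  | 0, _ => by simp [mangoldtSumFix]
  | N + 1, h => by
    obtain ⟨h1, h2⟩ := mangoldtSumFix_bounds s N (by omega)
    obtain ⟨h3, h4⟩ := mangoldtFix_bounds (n := N) (by omega)
    rw [Finset.sum_range_succ, mangoldtSumFix]
    rcases Nat.eq_zero_or_pos N with rfl | hN
    · have : mangoldtFix 0 / 0 ^ s = 0 := by
        have : mangoldtFix 0 = 0 := by decide +kernel
        rw [this, Nat.zero_div]
      rw [this]
      simp [mangoldtSumFix]
    have h5 : ((mangoldtFix N / N ^ s : ℕ) : ℝ) ≤ (mangoldtFix N : ℝ) / ((N ^ s : ℕ) : ℝ) :=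
      Nat.cast_div_le
    have h6 := Nat.cast_div_add_one_ge (mangoldtFix N) (N ^ s)
    have hp : (1 : ℝ) ≤ ((N ^ s : ℕ) : ℝ) := by exact_mod_cast Nat.one_le_pow _ _ hN
    have e : 10 ^ 24 * (ArithmeticFunction.vonMangoldt N / (N : ℝ) ^ s) =
        10 ^ 24 * ArithmeticFunction.vonMangoldt N / ((N ^ s : ℕ) : ℝ) := by push_cast; ring
    have h7 : (mangoldtFix N : ℝ) / ((N ^ s : ℕ) : ℝ) ≤
        10 ^ 24 * ArithmeticFunction.vonMangoldt N / ((N ^ s : ℕ) : ℝ) := by gcongr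
    have h8 : 10 ^ 24 * ArithmeticFunction.vonMangoldt N / ((N ^ s : ℕ) : ℝ) ≤
        (mangoldtFix N : ℝ) / ((N ^ s : ℕ) : ℝ) + 2000 := by
      have h9 : 10 ^ 24 * ArithmeticFunction.vonMangoldt N / ((N ^ s : ℕ) : ℝ) ≤
        (mangoldtFix N + 2000) / ((N ^ s : ℕ) : ℝ) := by gcongr
      rw [add_div] at h9
      have := div_le_self (a := (2000 : ℝ)) (by norm_num) hp
      linarith
    rw [mul_add, e]
    push_cast at *
    constructor <;> linarith

/-- Approximation to `10 ^ 24 * (4 k - 1) / 2 * nodeSum k`. -/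
def nodeFix (k : ℕ) : ℤ :=
  (10 ^ 24 / (2 * k) : ℕ) + (10 ^ 24 / (2 * k - 1) : ℕ) - 572364942924705 * 10 ^ 9 +
    (harmonicFix (k - 1) / 2 : ℕ) - 2886078324535 * 10 ^ 11 - mangoldtSumFix (2 * k) 101 - 10 ^ 12 -
    10 ^ 6

theorem nodeFix_bounds {k : ℕ} (hk : 4 ≤ k) (hk' : k ≤ 100) :
    2 * (nodeFix k : ℝ) ≤ 10 ^ 24 * (4 * k - 1) * nodeSum k ∧
    10 ^ 24 * (4 * k - 1) * nodeSum k ≤ 2 * ((nodeFix k : ℝ) + 5 * 10 ^ 12) := by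
  have hkR : (4 : ℝ) ≤ k := by exact_mod_cast hk
  have hkR' : (k : ℝ) ≤ 100 := by exact_mod_cast hk'
  have hs := (summable_mangoldt_div (k := k) (by omega)).sum_add_tsum_nat_add 101
  have ht := tsum_mangoldt_tail hk
  have ht0 : 0 ≤ ∑' n : ℕ, ArithmeticFunction.vonMangoldt (n + 101) /
      ((n + 101 : ℕ) : ℝ) ^ (2 * k) :=
    tsum_nonneg fun n => div_nonneg ArithmeticFunction.vonMangoldt_nonneg
      (pow_nonneg (Nat.cast_nonneg _) _)
  obtain ⟨m1, m2⟩ := mangoldtSumFix_bounds (2 * k) 101 (by norm_num)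
  obtain ⟨g1, g2⟩ := eulerMascheroniConstant_bounds
  obtain ⟨p1, p2⟩ := log_pi_bounds
  obtain ⟨h1, h2⟩ := harmonicFix_bounds (k - 1)
  have hkc : ((k - 1 : ℕ) : ℝ) ≤ 100 := by exact_mod_cast (by omega)
  have a1 : (((10 ^ 24 / (2 * k) : ℕ)) : ℝ) ≤ ((10 ^ 24 : ℕ) : ℝ) / ((2 * k : ℕ) : ℝ) :=
    Nat.cast_div_le
  have a2 := Nat.cast_div_add_one_ge (10 ^ 24) (2 * k)
  have b1 : (((10 ^ 24 / (2 * k - 1) : ℕ)) : ℝ) ≤ ((10 ^ 24 : ℕ) : ℝ) / ((2 * k - 1 : ℕ) : ℝ) :=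
    Nat.cast_div_le
  have b2 := Nat.cast_div_add_one_ge (10 ^ 24) (2 * k - 1)
  have c1 : ((harmonicFix (k - 1) / 2 : ℕ) : ℝ) ≤ (harmonicFix (k - 1) : ℝ) / ((2 : ℕ) : ℝ) :=
    Nat.cast_div_le
  have c2 := Nat.cast_div_add_one_ge (harmonicFix (k - 1)) 2
  have e1 : ((2 * k - 1 : ℕ) : ℝ) = 2 * k - 1 := by push_cast [Nat.cast_sub (show 1 ≤ 2 * k by omega)]; ring
  have e2 : ((10 ^ 24 : ℕ) : ℝ) / ((2 * k : ℕ) : ℝ) = 10 ^ 24 * (1 / (2 * k)) := by push_cast; ring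
  have e3 : ((10 ^ 24 : ℕ) : ℝ) / ((2 * k - 1 : ℕ) : ℝ) = 10 ^ 24 * (1 / (2 * k - 1)) := by
    rw [e1]; push_cast; ring
  rw [e2] at a1 a2
  rw [e3] at b1 b2
  have hval : 10 ^ 24 * (4 * k - 1) * nodeSum k = 2 * (10 ^ 24 * (1 / (2 * k) + 1 / (2 * k - 1) -
    Real.log Real.pi / 2 + (harmonic (k - 1) - Real.eulerMascheroniConstant) / 2 -
    ∑' n : ℕ, ArithmeticFunction.vonMangoldt n / (n : ℝ) ^ (2 * k))) := by
    rw [nodeSum]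
    have : (4 * k - 1 : ℝ) ≠ 0 := by linarith
    field_simp
  have hF : (nodeFix k : ℝ) = ((10 ^ 24 / (2 * k) : ℕ) : ℝ) + ((10 ^ 24 / (2 * k - 1) : ℕ) : ℝ) -
      572364942924705 * 10 ^ 9 + ((harmonicFix (k - 1) / 2 : ℕ) : ℝ) - 2886078324535 * 10 ^ 11 -
      (mangoldtSumFix (2 * k) 101 : ℝ) - 10 ^ 12 - 10 ^ 6 := by
    rw [nodeFix]
    simp only [Int.cast_add, Int.cast_sub, Int.cast_natCast, Int.cast_mul, Int.cast_pow,
      Int.cast_ofNat]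
  rw [hval, ← hs, hF]
  push_cast at a1 a2 b1 b2 c1 c2 h1 h2 m1 m2 ht ht0 ⊢
  constructor <;> linarith

end xiFun

end

section

open Complex ComplexConjugate

/-! Bounds for sums over zeros by sums of the kernels `1 / (ρ (1 - ρ) + s (s - 1))`. -/

namespace xiFun

/-- `∑ A Re (1 / (y + s (s - 1)))`. -/
noncomputable def kernelRe (A : List (ℤ × ℤ)) (y : ℂ) : ℝ :=
  (A.map fun t => (t.2 : ℝ) * (1 / (y + t.1 * (t.1 - 1))).re).sum

/-- The sum of `kernelRe A` over the zeros. -/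
noncomputable def kernelValue (A : List (ℤ × ℤ)) : ℝ :=
  (A.map fun t => (t.2 : ℝ) * nodeSum (t.1 / 2).toNat).sum

/-- All nodes are even and between `8` and `200`. -/
def nodesOk (A : List (ℤ × ℤ)) : Bool :=
  A.all fun t => t.1 % 2 == 0 && decide (8 ≤ t.1) && decide (t.1 ≤ 200)

/-- Upper bound for `10 ^ 24 * kernelValue A`. -/
def kernelFix (A : List (ℤ × ℤ)) : ℤ :=
  (A.map fun t => (2 * t.2 * nodeFix (t.1 / 2).toNat + max t.2 0 * 10 ^ 13) / (2 * t.1 - 1) + 1).sum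

theorem nodesOk_cons {t : ℤ × ℤ} {A : List (ℤ × ℤ)} (h : nodesOk (t :: A) = true) :
    nodesOk A = true ∧ ∃ k : ℕ, 4 ≤ k ∧ k ≤ 100 ∧ t.1 = 2 * k ∧ (t.1 / 2).toNat = k := by
  simp only [nodesOk, List.all_cons, Bool.and_eq_true, beq_iff_eq, decide_eq_true_eq] at h ⊢
  refine ⟨h.2, (t.1 / 2).toNat, ?_, ?_, ?_, rfl⟩ <;> omega

theorem hasSum_kernelRe : ∀ {A : List (ℤ × ℤ)}, nodesOk A = true →
    HasSum (fun ρ => (mult ρ : ℝ) * kernelRe A (ρ * (1 - ρ))) (kernelValue A)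
  | [], _ => by simp [kernelRe, kernelValue]
  | t :: A, h => by
    obtain ⟨h1, k, hk, -, hk2, hk3⟩ := nodesOk_cons h
    have h2 := ((hasSum_nodeSum (k := k) (by omega)).mul_left (t.2 : ℝ)).add (hasSum_kernelRe h1)
    simp only [kernelRe, kernelValue, List.map_cons, List.sum_cons, hk3] at h2 ⊢
    have hc : (t.1 : ℂ) = 2 * k := by rw [hk2]; push_cast; ring
    rw [hc]
    refine (congrArg (HasSum · _) (funext fun ρ => ?_)).mp h2
    ring

theorem kernelValue_le : ∀ {A : List (ℤ × ℤ)}, nodesOk A = true →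
    10 ^ 24 * kernelValue A ≤ kernelFix A
  | [], _ => by simp [kernelFix, kernelValue]
  | t :: A, h => by
    obtain ⟨h1, k, hk, hk', hk2, hk3⟩ := nodesOk_cons h
    have h2 := kernelValue_le h1
    obtain ⟨b1, b2⟩ := nodeFix_bounds hk hk'
    simp only [kernelFix, kernelValue, List.map_cons, List.sum_cons, hk3] at h2 ⊢
    rw [Int.cast_add, mul_add]
    refine add_le_add ?_ h2
    have hkR : (4 : ℝ) ≤ k := by exact_mod_cast hk
    have hd : (0 : ℝ) < 4 * k - 1 := by linarith
    have hd' : 0 < 2 * t.1 - 1 := by omega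
    have h3 : ∀ a : ℤ, (a : ℝ) / (4 * k - 1) ≤ ((a / (2 * t.1 - 1) + 1 : ℤ) : ℝ) := by
      intro a
      rw [div_le_iff₀ hd]
      have h4 := Int.lt_ediv_add_one_mul_self a hd'
      have h5 : (a : ℝ) ≤ (((a / (2 * t.1 - 1) + 1) * (2 * t.1 - 1) : ℤ) : ℝ) := by
        exact_mod_cast h4.le
      refine h5.trans (le_of_eq ?_)
      rw [Int.cast_mul]
      congr 1
      rw [hk2]
      push_cast
      ring
    refine le_trans ?_ (h3 _)
    rw [le_div_iff₀ hd]
    push_cast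
    generalize (nodeFix k : ℝ) = F at *
    have e : 10 ^ 24 * ((t.2 : ℝ) * nodeSum k) * (4 * k - 1) =
        t.2 * (10 ^ 24 * (4 * k - 1) * nodeSum k) := by ring
    rw [e]
    generalize (10 : ℝ) ^ 24 * (4 * k - 1) * nodeSum k = W at *
    rcases le_total 0 (t.2 : ℝ) with ht | ht
    · rw [max_eq_left ht]
      nlinarith
    · rw [max_eq_right ht]
      nlinarith

theorem tsum_le_kernelValue {A : List (ℤ × ℤ)} (hA : nodesOk A = true) {w : ℂ → ℝ}
    (hw0 : ∀ ρ, mult ρ ≠ 0 → 0 ≤ w ρ)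
    (hw : ∀ ρ, mult ρ ≠ 0 → w ρ ≤ kernelRe A (ρ * (1 - ρ))) :
    Summable (fun ρ => (mult ρ : ℝ) * w ρ) ∧ ∑' ρ, (mult ρ : ℝ) * w ρ ≤ kernelValue A := by
  have h := hasSum_kernelRe hA
  have h0 : ∀ ρ, 0 ≤ (mult ρ : ℝ) * w ρ := fun ρ => by
    rcases eq_or_ne (mult ρ) 0 with h | h
    · simp [h]
    · exact mul_nonneg (Nat.cast_nonneg _) (hw0 ρ h)
  have h1 : ∀ ρ, (mult ρ : ℝ) * w ρ ≤ (mult ρ : ℝ) * kernelRe A (ρ * (1 - ρ)) := fun ρ => by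
    rcases eq_or_ne (mult ρ) 0 with h | h
    · simp [h]
    · exact mul_le_mul_of_nonneg_left (hw ρ h) (Nat.cast_nonneg _)
  have hs := h.summable.of_nonneg_of_le h0 h1
  exact ⟨hs, (hs.tsum_le_tsum h1 h.summable).trans h.tsum_eq.le⟩

theorem sum_le_kernelValue {A : List (ℤ × ℤ)} (hA : nodesOk A = true)
    (h0 : ∀ ρ, mult ρ ≠ 0 → 0 ≤ kernelRe A (ρ * (1 - ρ))) (s : Finset ℂ) :
    ∑ ρ ∈ s, (mult ρ : ℝ) * kernelRe A (ρ * (1 - ρ)) ≤ kernelValue A :=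
  sum_le_hasSum s (fun ρ _ => by
    rcases eq_or_ne (mult ρ) 0 with h | h
    · simp [h]
    · exact mul_nonneg (Nat.cast_nonneg _) (h0 ρ h)) (hasSum_kernelRe hA)

end xiFun

namespace IntPoly

theorem eval_kernel_pos {A : List (ℤ × ℤ)} (hA : xiFun.nodesOk A = true) {y : ℝ} (hy : 0 ≤ y) :
    ∀ t ∈ kernel A, 0 < eval y t.2 := by
  intro t ht
  simp only [kernel, List.mem_map] at ht
  obtain ⟨r, hr, rfl⟩ := ht
  simp only [xiFun.nodesOk, List.all_eq_true, Bool.and_eq_true, decide_eq_true_eq] at hA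
  have h8 : (8 : ℝ) ≤ r.1 := by exact_mod_cast (hA r hr).1.2
  simp
  nlinarith

theorem eval_kernelLow_pos {A : List (ℤ × ℤ)} (hA : xiFun.nodesOk A = true) {y : ℝ} (hy : 0 ≤ y) :
    ∀ t ∈ kernelLow A, 0 < eval y t.2 := by
  intro t ht
  simp only [kernelLow, List.mem_map] at ht
  obtain ⟨r, hr, rfl⟩ := ht
  rw [eval_pow]
  exact pow_pos (eval_kernel_pos hA hy ([r.2], [r.1 * (r.1 - 1), 1])
    (List.mem_map_of_mem (f := fun t : ℤ × ℤ => ([t.2], [t.1 * (t.1 - 1), 1])) hr)) _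

theorem ratEval_append (y : ℝ) (l l' : List (List ℤ × List ℤ)) :
    ratEval y (l ++ l') = ratEval y l + ratEval y l' := by
  simp [ratEval]

theorem kernelRe_ofReal (A : List (ℤ × ℤ)) (y : ℝ) :
    xiFun.kernelRe A y = ratEval y (kernel A) := by
  simp only [xiFun.kernelRe, ratEval, kernel, List.map_map]
  congr 1
  refine List.map_congr_left fun t _ => ?_
  have : (1 / ((y : ℂ) + t.1 * (t.1 - 1))) = ((1 / (y + t.1 * (t.1 - 1)) : ℝ) : ℂ) := by
    push_cast; rfl
  rw [this, ofReal_re]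
  simp [add_comm, div_eq_mul_inv]

theorem kernelRe_ge {y : ℂ} {l : ℝ} (hy : 0 ≤ y.re) (hl : 0 ≤ l) (hl' : l ≤ 1)
    (hb : y.im ^ 2 = l * y.re) : ∀ {A : List (ℤ × ℤ)}, xiFun.nodesOk A = true →
    (1 - l) * ratEval y.re (kernel A) + l * ratEval y.re (kernelLow A) ≤ xiFun.kernelRe A y
  | [], _ => by simp [xiFun.kernelRe, ratEval, kernel, kernelLow]
  | t :: A, h => by
    obtain ⟨h1, k, hk, -, hk2, -⟩ := xiFun.nodesOk_cons h
    have h2 := kernelRe_ge hy hl hl' hb h1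
    simp only [xiFun.kernelRe, ratEval, kernel, kernelLow, List.map_cons, List.sum_cons] at h2 ⊢
    have h3 : (1 - l) * (eval y.re [t.2] / eval y.re [t.1 * (t.1 - 1), 1]) +
        l * (eval y.re (smul t.2 (add (pow [t.1 * (t.1 - 1), 1] 4) (add (mul [0, -1]
          (pow [t.1 * (t.1 - 1), 1] 2)) (if t.2 < 0 then [0, 0, 1] else [])))) /
          eval y.re (pow [t.1 * (t.1 - 1), 1] 5)) ≤
        (t.2 : ℝ) * (1 / (y + t.1 * (t.1 - 1))).re := by
      have ht : (8 : ℝ) ≤ t.1 := by rw [hk2]; push_cast; exact_mod_cast (by omega)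
      have hz : eval y.re [t.1 * (t.1 - 1), 1] = y.re + t.1 * (t.1 - 1) := by simp [add_comm]
      have hz0 : 0 < y.re + t.1 * (t.1 - 1) := by nlinarith
      have hre : (1 / (y + t.1 * (t.1 - 1))).re = (y.re + t.1 * (t.1 - 1)) /
          ((y.re + t.1 * (t.1 - 1)) ^ 2 + l * y.re) := by
        have e1 : (y + t.1 * (t.1 - 1)).re = y.re + t.1 * (t.1 - 1) := by simp
        have e2 : (y + t.1 * (t.1 - 1)).im = y.im := by simp
        rw [one_div, inv_re, normSq_apply, e1, e2, ← hb]
        ring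
      rw [hre, eval_smul, eval_add, eval_add, eval_mul, eval_pow, eval_pow, eval_pow, hz]
      have hi : eval y.re (if t.2 < 0 then [0, 0, 1] else []) =
          if (t.2 : ℝ) < 0 then y.re ^ 2 else 0 := by
        by_cases h0 : t.2 < 0
        · have : (t.2 : ℝ) < 0 := by exact_mod_cast h0
          rw [if_pos h0, if_pos this]
          simp
          ring
        · have : ¬ (t.2 : ℝ) < 0 := by exact_mod_cast h0
          rw [if_neg h0, if_neg this]
          simp
      rw [hi]
      have hm : eval y.re [0, -1] = -y.re := by simp
      have hc : eval y.re [t.2] = t.2 := by simp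
      rw [hm, hc]
      generalize (t.2 : ℝ) = A at *
      generalize y.re + (t.1 : ℝ) * (t.1 - 1) = z at *
      generalize y.re = a at *
      have hla : 0 ≤ l * a := mul_nonneg hl hy
      have hd : 0 < z ^ 2 + l * a := by positivity
      rw [← sub_nonneg]
      split_ifs with hA
      · have : A * (z / (z ^ 2 + l * a)) - ((1 - l) * (A / z) +
            l * (A * (z ^ 4 + (-a * z ^ 2 + a ^ 2)) / z ^ 5)) =
            -A * (l * a ^ 2 * (z ^ 2 * (1 - l) + l * a)) / (z ^ 5 * (z ^ 2 + l * a)) := by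
          field_simp
          ring
        rw [this]
        have h5 : 0 ≤ 1 - l := by linarith
        have h6 : 0 ≤ -A := by linarith
        positivity
      · have : A * (z / (z ^ 2 + l * a)) - ((1 - l) * (A / z) +
            l * (A * (z ^ 4 + (-a * z ^ 2 + 0)) / z ^ 5)) =
            A * (l * a) ^ 2 / (z ^ 3 * (z ^ 2 + l * a)) := by
          field_simp
          ring
        rw [this]
        have h6 : 0 ≤ A := by linarith
        positivity
    linarith

/-- The kernel is at least `C` at complex points of real part `a` and imaginary part at most
`√a`, if both of its extremal bounds are. -/
theorem le_kernelRe {A : List (ℤ × ℤ)} (hA : xiFun.nodesOk A = true) {y : ℂ} {C : ℝ}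
    (hy : 0 ≤ y.re) (hb : y.im ^ 2 ≤ y.re) (h1 : C ≤ ratEval y.re (kernel A))
    (h2 : C ≤ ratEval y.re (kernelLow A)) : C ≤ xiFun.kernelRe A y := by
  have hl : 0 ≤ y.im ^ 2 / y.re := by positivity
  have hl' : y.im ^ 2 / y.re ≤ 1 := div_le_one_of_le₀ hb hy
  have := kernelRe_ge hy hl hl' (by
    rcases hy.eq_or_lt with h | h
    · rw [← h] at hb ⊢
      have := sq_nonneg y.im
      rw [mul_zero]
      linarith
    · field_simp) hA
  nlinarith

end IntPoly

end

section

open Complex ComplexConjugate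

namespace IntPoly

theorem le_ratEval_of_Ico {k : ℕ} {l : List (List ℤ × List ℤ)} {C p q : ℤ} {y : ℝ}
    (h : ratCheckIco k (l ++ [([-C], [1])]) p q = true) (hl : ∀ t ∈ l, 0 < eval y t.2) (h1 : p ≤ y)
    (h2 : y < q) : C ≤ ratEval y l := by
  have := ratEval_nonneg_of_Ico h (fun t ht => by
    rcases List.mem_append.mp ht with ht | ht
    · exact hl t ht
    · rw [List.mem_singleton.mp ht]; simp) h1 h2
  rw [ratEval_append] at this
  simp only [ratEval, List.map_cons, List.map_nil, List.sum_cons, List.sum_nil, eval_cons,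
    eval_nil] at this ⊢
  push_cast at this
  rw [mul_zero, add_zero, add_zero, add_zero, div_one] at this
  linarith

end IntPoly

namespace xiFun

open IntPoly

theorem re_mul_one_sub (ρ : ℂ) : (ρ * (1 - ρ)).re = ρ.re * (1 - ρ.re) + ρ.im ^ 2 := by
  simp [mul_re]; ring

theorem im_mul_one_sub (ρ : ℂ) : (ρ * (1 - ρ)).im = ρ.im * (1 - 2 * ρ.re) := by
  simp [mul_im]; ring

theorem re_mul_one_sub_pos {ρ : ℂ} (h : mult ρ ≠ 0) : 0 < (ρ * (1 - ρ)).re := by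
  obtain ⟨h1, h2⟩ := re_mem_of_mult_ne h
  rw [re_mul_one_sub]
  have : 0 < ρ.re * (1 - ρ.re) := mul_pos h1 (by linarith)
  positivity

theorem im_sq_mul_one_sub_le {ρ : ℂ} (h : mult ρ ≠ 0) : (ρ * (1 - ρ)).im ^ 2 ≤ (ρ * (1 - ρ)).re := by
  obtain ⟨h1, h2⟩ := re_mem_of_mult_ne h
  rw [re_mul_one_sub, im_mul_one_sub]
  have h3 : 0 < ρ.re * (1 - ρ.re) := mul_pos h1 (by linarith)
  have h4 : 0 ≤ ρ.im ^ 2 * (ρ.re * (1 - ρ.re)) := by positivity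
  nlinarith

theorem card_mul_le {A : List (ℤ × ℤ)} (hA : nodesOk A = true)
    (h0 : ∀ ρ, mult ρ ≠ 0 → 0 ≤ kernelRe A (ρ * (1 - ρ))) (s : Finset ℂ) {C : ℝ} (hC : 0 ≤ C)
    (hs : ∀ ρ ∈ s, mult ρ ≠ 0 ∧ C ≤ kernelRe A (ρ * (1 - ρ))) :
    10 ^ 24 * (s.card * C) ≤ kernelFix A := by
  refine le_trans ?_ (kernelValue_le hA)
  gcongr
  refine le_trans ?_ (sum_le_kernelValue hA h0 s)
  rw [← nsmul_eq_mul]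
  refine Finset.card_nsmul_le_sum _ _ _ fun ρ hρ => ?_
  obtain ⟨h1, h2⟩ := hs ρ hρ
  have : (1 : ℝ) ≤ mult ρ := by exact_mod_cast Nat.one_le_iff_ne_zero.mpr h1
  nlinarith

/-- Kernel whose separate values exceed its total on `[0, 1)`. -/
def kernelUnit : List (ℤ × ℤ) := [(8, 1000), (14, -1000)]

theorem one_le_re {ρ : ℂ} (h : mult ρ ≠ 0) : 1 ≤ (ρ * (1 - ρ)).re := by
  by_contra! hlt
  have hA : nodesOk kernelUnit = true := by decide +kernel
  have c1 : ratCheckIco 20 (kernel kernelUnit ++ [([-5], [1])]) 0 1 = true := by decide +kernel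
  have c2 : ratCheckIco 20 (kernelLow kernelUnit ++ [([-5], [1])]) 0 1 = true := by decide +kernel
  have c3 : ratCheckIci 20 (kernel kernelUnit) 0 100000 = true := by decide +kernel
  have c4 : ratCheckIci 20 (kernelLow kernelUnit) 0 100000 = true := by decide +kernel
  have c5 : kernelFix kernelUnit < 5 * 10 ^ 24 := by decide +kernel
  have h0 : ∀ ρ, mult ρ ≠ 0 → 0 ≤ kernelRe kernelUnit (ρ * (1 - ρ)) := fun ρ hρ =>
    have hp := (re_mul_one_sub_pos hρ).le
    le_kernelRe hA hp (im_sq_mul_one_sub_le hρ)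
      (ratEval_nonneg_of_Ici c3 (eval_kernel_pos hA hp) (by simpa using hp))
      (ratEval_nonneg_of_Ici c4 (eval_kernelLow_pos hA hp) (by simpa using hp))
  have hp := (re_mul_one_sub_pos h).le
  have := card_mul_le hA h0 {ρ} (C := 5) (by norm_num) (fun σ hσ => by
    rw [Finset.mem_singleton.mp hσ]
    refine ⟨h, le_kernelRe hA hp (im_sq_mul_one_sub_le h) ?_ ?_⟩
    · exact_mod_cast le_ratEval_of_Ico c1 (eval_kernel_pos hA hp) (by simpa using hp)
        (by simpa using hlt)
    · exact_mod_cast le_ratEval_of_Ico c2 (eval_kernelLow_pos hA hp) (by simpa using hp)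
        (by simpa using hlt))
  have c6 : (kernelFix kernelUnit : ℝ) < 5 * 10 ^ 24 := by exact_mod_cast c5
  rw [Finset.card_singleton] at this
  push_cast at this
  linarith

theorem im_ne_zero {ρ : ℂ} (h : mult ρ ≠ 0) : ρ.im ≠ 0 := by
  intro h0
  have := one_le_re h
  rw [re_mul_one_sub, h0] at this
  nlinarith [sq_nonneg (ρ.re - 1 / 2)]

/-- Kernel separating quadruples of zeros off the critical line from the remaining zeros. -/
def kernelOff : List (ℤ × ℤ) :=
  [(8, -501748), (14, 4242618), (20, -6868758), (30, 4018735), (50, -990180), (100, 101915)]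

theorem le_re_of_re_ne {ρ : ℂ} (h : mult ρ ≠ 0) (hne : ρ.re ≠ 1 / 2) : 251 ≤ (ρ * (1 - ρ)).re := by
  by_contra! hlt
  have hA : nodesOk kernelOff = true := by decide +kernel
  have c1 : ratCheckIco 20 (kernel kernelOff ++ [([-500], [1])]) 0 251 = true := by decide +kernel
  have c2 : ratCheckIco 20 (kernelLow kernelOff ++ [([-500], [1])]) 0 251 = true := by
    decide +kernel
  have c3 : ratCheckIci 20 (kernel kernelOff) 251 100000 = true := by decide +kernel
  have c4 : ratCheckIci 20 (kernelLow kernelOff) 251 100000 = true := by decide +kernel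
  have c5 : kernelFix kernelOff < 2000 * 10 ^ 24 := by decide +kernel
  have h500 : ∀ σ, mult σ ≠ 0 → (σ * (1 - σ)).re < 251 →
      500 ≤ kernelRe kernelOff (σ * (1 - σ)) := fun σ hσ hσ' => by
    have hp := (re_mul_one_sub_pos hσ).le
    refine le_kernelRe hA hp (im_sq_mul_one_sub_le hσ) ?_ ?_
    · exact_mod_cast le_ratEval_of_Ico c1 (eval_kernel_pos hA hp) (by simpa using hp)
        (by simpa using hσ')
    · exact_mod_cast le_ratEval_of_Ico c2 (eval_kernelLow_pos hA hp) (by simpa using hp)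
        (by simpa using hσ')
  have h0 : ∀ σ, mult σ ≠ 0 → 0 ≤ kernelRe kernelOff (σ * (1 - σ)) := fun σ hσ => by
    have hp := (re_mul_one_sub_pos hσ).le
    rcases lt_or_ge (σ * (1 - σ)).re 251 with h1 | h1
    · linarith [h500 σ hσ h1]
    · exact le_kernelRe hA hp (im_sq_mul_one_sub_le hσ)
        (ratEval_nonneg_of_Ici c3 (eval_kernel_pos hA hp) (by simpa using h1))
        (ratEval_nonneg_of_Ici c4 (eval_kernelLow_pos hA hp) (by simpa using h1))
  have him := im_ne_zero h
  have hcard : ({ρ, 1 - ρ, conj ρ, 1 - conj ρ} : Finset ℂ).card = 4 := by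
    have k1 : ρ ≠ 1 - ρ := fun e => him (by have := congrArg im e; simp at this; linarith)
    have k2 : ρ ≠ conj ρ := fun e => him (by have := congrArg im e; simp at this; linarith)
    have k3 : ρ ≠ 1 - conj ρ := fun e => hne (by have := congrArg re e; simp at this; linarith)
    have k4 : 1 - ρ ≠ conj ρ := fun e => hne (by have := congrArg re e; simp at this; linarith)
    have k5 : 1 - ρ ≠ 1 - conj ρ := fun e => k2 (by linear_combination -e)
    have k6 : conj ρ ≠ 1 - conj ρ := fun e => him (by have := congrArg im e; simp at this; linarith)
    rw [Finset.card_insert_of_notMem (by simp [k1, k2, k3]),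
      Finset.card_insert_of_notMem (by simp [k4, k5]), Finset.card_pair k6]
  have := card_mul_le hA h0 {ρ, 1 - ρ, conj ρ, 1 - conj ρ} (C := 500) (by norm_num)
    (fun σ hσ => by
      have e : mult σ ≠ 0 ∧ (σ * (1 - σ)).re < 251 := by
        rw [re_mul_one_sub] at hlt ⊢
        simp only [Finset.mem_insert, Finset.mem_singleton] at hσ
        rcases hσ with rfl | rfl | rfl | rfl
        · exact ⟨h, hlt⟩
        · refine ⟨by rwa [mult_one_sub], ?_⟩
          simp
          linarith
        · refine ⟨by rwa [mult_conj], ?_⟩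
          simp
          linarith
        · refine ⟨by rwa [mult_one_sub, mult_conj], ?_⟩
          simp
          linarith
      exact ⟨e.1, h500 σ e.1 e.2⟩)
  have c6 : (kernelFix kernelOff : ℝ) < 2000 * 10 ^ 24 := by exact_mod_cast c5
  rw [hcard] at this
  push_cast at this
  linarith

/-- Kernel with negative total, negative only on `[0, 250)`. -/
def kernelExists : List (ℤ × ℤ) :=
  [(8, -13747712), (14, 47004150), (20, -52485154), (30, 23806238), (50, -5057010), (100, 492079)]

theorem exists_re_lt : ∃ ρ, mult ρ ≠ 0 ∧ (ρ * (1 - ρ)).re < 250 := by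
  by_contra! hge
  have hA : nodesOk kernelExists = true := by decide +kernel
  have c3 : ratCheckIci 20 (kernel kernelExists) 250 100000 = true := by decide +kernel
  have c4 : ratCheckIci 20 (kernelLow kernelExists) 250 100000 = true := by decide +kernel
  have c5 : kernelFix kernelExists < 0 := by decide +kernel
  have := card_mul_le hA (fun σ hσ =>
    have hp := (re_mul_one_sub_pos hσ).le
    le_kernelRe hA hp (im_sq_mul_one_sub_le hσ)
      (ratEval_nonneg_of_Ici c3 (eval_kernel_pos hA hp) (by simpa using hge σ hσ))
      (ratEval_nonneg_of_Ici c4 (eval_kernelLow_pos hA hp) (by simpa using hge σ hσ))) ∅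
      (C := 0) le_rfl (by simp)
  have c6 : (kernelFix kernelExists : ℝ) < 0 := by exact_mod_cast c5
  simp at this
  linarith

/-- Kernel separating pairs of low zeros on the critical line. -/
def kernelLine : List (ℤ × ℤ) :=
  [(8, 14750399), (14, -67218001), (20, 122429576), (30, -209139282), (40, 352299929),
    (50, -401616073), (60, 235414047), (80, -61622979), (100, 15391032), (150, -688547)]

theorem mul_one_sub_of_re_eq {ρ : ℂ} (h : ρ.re = 1 / 2) :
    ρ * (1 - ρ) = ((1 / 4 + ρ.im ^ 2 : ℝ) : ℂ) := by
  apply Complex.ext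
  · rw [re_mul_one_sub, h, ofReal_re]; norm_num
  · rw [im_mul_one_sub, h, ofReal_im]; norm_num

theorem le_im_sq_of_re_eq (hRH : ∀ ρ, mult ρ ≠ 0 → ρ.re = 1 / 2) {ρ : ℂ} (h : mult ρ ≠ 0) :
    194 ≤ 1 / 4 + ρ.im ^ 2 := by
  by_contra! hlt
  have hA : nodesOk kernelLine = true := by decide +kernel
  have c1 : ratCheckIco 20 (kernel kernelLine ++ [([-1000], [1])]) 0 194 = true := by decide +kernel
  have c3 : ratCheckIci 20 (kernel kernelLine) 194 100000 = true := by decide +kernel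
  have c5 : kernelFix kernelLine < 2000 * 10 ^ 24 := by decide +kernel
  have hval : ∀ σ, mult σ ≠ 0 → kernelRe kernelLine (σ * (1 - σ)) =
      ratEval (1 / 4 + σ.im ^ 2) (kernel kernelLine) := fun σ hσ => by
    rw [mul_one_sub_of_re_eq (hRH σ hσ), kernelRe_ofReal]
  have h1000 : ∀ σ, mult σ ≠ 0 → 1 / 4 + σ.im ^ 2 < 194 →
      1000 ≤ kernelRe kernelLine (σ * (1 - σ)) := fun σ hσ hσ' => by
    have hp : 0 ≤ 1 / 4 + σ.im ^ 2 := by positivity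
    rw [hval σ hσ]
    exact_mod_cast le_ratEval_of_Ico c1 (eval_kernel_pos hA hp) (by simpa using hp)
      (by simpa using hσ')
  have h0 : ∀ σ, mult σ ≠ 0 → 0 ≤ kernelRe kernelLine (σ * (1 - σ)) := fun σ hσ => by
    have hp : 0 ≤ 1 / 4 + σ.im ^ 2 := by positivity
    rcases lt_or_ge (1 / 4 + σ.im ^ 2) 194 with h1 | h1
    · linarith [h1000 σ hσ h1]
    · rw [hval σ hσ]
      exact ratEval_nonneg_of_Ici c3 (eval_kernel_pos hA hp) (by simpa using h1)
  have him := im_ne_zero h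
  have hcard : ({ρ, conj ρ} : Finset ℂ).card = 2 :=
    Finset.card_pair fun e => him (by have := congrArg im e; simp at this; linarith)
  have := card_mul_le hA h0 {ρ, conj ρ} (C := 1000) (by norm_num) (fun σ hσ => by
    simp only [Finset.mem_insert, Finset.mem_singleton] at hσ
    rcases hσ with rfl | rfl
    · exact ⟨h, h1000 _ h hlt⟩
    · have : mult (conj ρ) ≠ 0 := by rwa [mult_conj]
      exact ⟨this, h1000 _ this (by simpa using hlt)⟩)
  have c6 : (kernelFix kernelLine : ℝ) < 2000 * 10 ^ 24 := by exact_mod_cast c5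
  rw [hcard] at this
  push_cast at this
  linarith

end xiFun

end

section

open Complex ComplexConjugate

/-- Alternations of `psiErr` give sign changes of `ψ(x) - x` beyond `2`. -/
theorem sign_changes_of_altUpTo {c : ℝ}
    (h : ∀ ε : ℝ, 0 < ε → ∃ U₀ : ℝ, ∀ U ≥ U₀, ∃ n : ℕ, AltUpTo psiErr U n ∧ (c - ε) * U ≤ n) :
    ∀ ε : ℝ, 0 < ε → ∃ T₀ : ℝ, ∀ T : ℝ, T₀ ≤ T → ∃ (N : ℕ) (x : ℕ → ℝ),
      (c - ε) * Real.log T ≤ (N : ℝ) ∧ (∀ i < N, 2 ≤ x i ∧ x i ≤ T) ∧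
      (∀ i j, i < j → j < N → x i < x j) ∧
      (∀ i, i + 1 < N → (chebyshevPsi (x i) - x i) * (chebyshevPsi (x (i + 1)) - x (i + 1)) < 0) := by
  intro ε hε
  obtain ⟨U₀, hU⟩ := h (ε / 2) (by positivity)
  refine ⟨Real.exp (max U₀ (2 / ε)), fun T hT => ?_⟩
  have hT0 : 0 < T := (Real.exp_pos _).trans_le hT
  have hlog : max U₀ (2 / ε) ≤ Real.log T := (Real.le_log_iff_exp_le hT0).mpr hT
  obtain ⟨n, hn, hcn⟩ := hU (Real.log T) ((le_max_left _ _).trans hlog)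
  have h2 : 2 / ε ≤ Real.log T := (le_max_right _ _).trans hlog
  have h3 : 1 ≤ ε / 2 * Real.log T := by
    rw [div_le_iff₀ hε] at h2
    linarith
  rcases hn with rfl | ⟨s, hs⟩
  · refine ⟨0, fun _ => 0, ?_, by omega, by omega, by omega⟩
    push_cast at hcn ⊢
    nlinarith
  obtain ⟨u, hu1, hu2, hu3⟩ := hs.exists_seq
  refine ⟨n - 1, fun i => Real.exp (u (i + 1)), ?_, fun i hi => ⟨?_, ?_⟩, fun i j hij hj => ?_,
    fun i hi => hu3 (i + 1) (by omega)⟩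
  · have : (n : ℝ) - 1 ≤ ((n - 1 : ℕ) : ℝ) := by
      rcases n with _ | n
      · simp
      · simp
    nlinarith
  · by_contra! hlt
    have hneg : ∀ j, j < n → Real.exp (u j) < 2 → psiErr (u j) < 0 := by
      intro j hj hj2
      have hx : 1 < Real.exp (u j) := Real.one_lt_exp_iff.mpr (hu1 j hj).1
      have hfl : ⌊Real.exp (u j)⌋₊ = 1 := by
        rw [Nat.floor_eq_iff (by positivity)]
        constructor
        · push_cast; linarith
        · push_cast; linarith
      rw [psiErr, chebyshevPsi, hfl]
      simp
      positivity
    have h1 := hneg (i + 1) (by omega) hlt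
    have h2 := hneg i (by omega) ((Real.exp_lt_exp.mpr (hu2 i (i + 1) (by omega) (by omega))).trans
      hlt)
    have := hu3 i (by omega)
    nlinarith
  · exact (Real.le_log_iff_exp_le hT0).mp (hu1 (i + 1) (by omega)).2
  · exact Real.exp_lt_exp.mpr (hu2 (i + 1) (j + 1) (by omega) (by omega))

namespace xiFun

theorem finite_norm_le (R : ℝ) : {ρ : ℂ | mult ρ ≠ 0 ∧ ‖ρ‖ ≤ R}.Finite := by
  have h := summable_mult_div_sq
  have h1 := h.tendsto_cofinite_zero
  have hR : 0 < 1 / (|R| + 1) ^ 2 := by positivity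
  have h2 := (h1.eventually (gt_mem_nhds hR))
  rw [Filter.eventually_cofinite] at h2
  refine h2.subset fun ρ ⟨h3, h4⟩ => ?_
  rw [Set.mem_ofPred_eq, not_lt]
  have h5 : (1 : ℝ) ≤ mult ρ := by exact_mod_cast Nat.one_le_iff_ne_zero.mpr h3
  have h6 : 0 < ‖ρ‖ := by
    rw [norm_pos_iff]
    rintro rfl
    have := (re_mem_of_mult_ne h3).1
    simp at this
  have h7 : ‖ρ‖ ≤ |R| + 1 := by linarith [le_abs_self R]
  gcongr

theorem finite_norm_add_le (a R : ℝ) : {ρ : ℂ | mult ρ ≠ 0 ∧ ‖ρ + a‖ ≤ R}.Finite := by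
  refine (finite_norm_le (R + |a|)).subset fun ρ ⟨h1, h2⟩ => ⟨h1, ?_⟩
  have := norm_sub_le (ρ + a) (a : ℂ)
  rw [add_sub_cancel_right, norm_real, Real.norm_eq_abs] at this
  linarith

theorem mem_zetaOrdinates {t : ℝ} : t ∈ zetaOrdinates ↔ 0 < t ∧ ∃ ρ, mult ρ ≠ 0 ∧ ρ.im = t := by
  rw [zetaOrdinates, Set.mem_ofPred_eq]
  refine and_congr_right fun _ => exists_congr fun ρ => ?_
  have : mult ρ ≠ 0 ↔ riemannZeta ρ = 0 ∧ 0 < ρ.re ∧ ρ.re < 1 :=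
    ⟨fun h => eq_zero_iff.mp (eq_zero_of_mult_ne h), fun h => mult_ne_zero (eq_zero_iff.mpr h)⟩
  rw [this]
  tauto

theorem abs_im_mem_zetaOrdinates {ρ : ℂ} (h : mult ρ ≠ 0) : |ρ.im| ∈ zetaOrdinates := by
  refine mem_zetaOrdinates.mpr ⟨abs_pos.mpr (im_ne_zero h), ?_⟩
  rcases abs_cases ρ.im with ⟨h1, -⟩ | ⟨h1, -⟩
  · exact ⟨ρ, h, h1.symm⟩
  · exact ⟨conj ρ, by rwa [mult_conj], by simp [h1]⟩

/-- The smallest ordinate is attained on the critical line, and is less than `√250`. -/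
theorem exists_first : ∃ ρ₁ : ℂ, mult ρ₁ ≠ 0 ∧ ρ₁.re = 1 / 2 ∧ 0 < ρ₁.im ∧
    ρ₁.im = sInf zetaOrdinates ∧ ρ₁.im ^ 2 < 250 ∧ ∀ ρ, mult ρ ≠ 0 → ρ₁.im ≤ |ρ.im| := by
  obtain ⟨ρ₀, h0, h0'⟩ := exists_re_lt
  have hfin : (zetaOrdinates ∩ Set.Iic |ρ₀.im|).Finite := by
    refine ((finite_norm_le (1 + |ρ₀.im|)).image im).subset fun t ⟨h1, h2⟩ => ?_
    obtain ⟨h3, ρ, h4, h5⟩ := mem_zetaOrdinates.mp h1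
    refine ⟨ρ, ⟨h4, (norm_le_abs_re_add_abs_im ρ).trans (add_le_add ?_ ?_)⟩, h5⟩
    · obtain ⟨h6, h7⟩ := re_mem_of_mult_ne h4
      rw [abs_of_pos h6]
      exact h7.le
    · rw [h5, abs_of_pos h3]
      exact h2
  have hne : (zetaOrdinates ∩ Set.Iic |ρ₀.im|).Nonempty :=
    ⟨|ρ₀.im|, abs_im_mem_zetaOrdinates h0, Set.mem_Iic.mpr le_rfl⟩
  obtain ⟨t, ht, hmin⟩ := hfin.exists_minimalFor id _ hne
  have hle : ∀ r ∈ zetaOrdinates, t ≤ r := fun r hr => by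
    rcases le_total r |ρ₀.im| with h | h
    · rcases le_total t r with h' | h'
      · exact h'
      · exact hmin ⟨hr, h⟩ h'
    · exact (Set.mem_Iic.mp ht.2).trans h
  obtain ⟨ht0, ρ₁, h1, h1'⟩ := mem_zetaOrdinates.mp ht.1
  have hsq : t ^ 2 < 250 := by
    have h2 : t ≤ |ρ₀.im| := ht.2
    have h3 : t ^ 2 ≤ |ρ₀.im| ^ 2 := by gcongr
    rw [sq_abs] at h3
    rw [re_mul_one_sub] at h0'
    obtain ⟨h6, h7⟩ := re_mem_of_mult_ne h0
    nlinarith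
  refine ⟨ρ₁, h1, ?_, h1' ▸ ht0, ?_, h1' ▸ hsq, fun ρ hρ => ?_⟩
  · by_contra hre
    have := le_re_of_re_ne h1 hre
    rw [re_mul_one_sub, h1'] at this
    nlinarith [sq_nonneg (ρ₁.re - 1 / 2)]
  · rw [h1']
    exact (IsLeast.csInf_eq ⟨ht.1, hle⟩).symm
  · rw [h1']
    exact hle _ (abs_im_mem_zetaOrdinates hρ)

theorem coeff_conj (a : ℝ) (ρ : ℂ) : -(mult (conj ρ) : ℂ) / (conj ρ * (conj ρ + a)) =
    conj (-(mult ρ : ℂ) / (ρ * (ρ + a))) := by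
  rw [mult_conj]
  simp

end xiFun

open xiFun in
theorem altUpTo_psiErr_of_off_line {ρ₀ : ℂ} (h0 : mult ρ₀ ≠ 0) (hne : ρ₀.re ≠ 1 / 2) {ε : ℝ}
    (hε : 0 < ε) : ∃ U₀ : ℝ, ∀ U ≥ U₀, ∃ n : ℕ, AltUpTo psiErr U n ∧
      (sInf zetaOrdinates / Real.pi + 1.867 * 10 ^ (-(30 : ℤ)) - ε) * U ≤ n := by
  have hodd : ∀ n : ℕ, (3 : ℝ) - (2 * n + 2) ≠ 0 := fun n h => by
    have : (3 : ℝ) = ((2 * n + 2 : ℕ) : ℝ) := by push_cast; linarith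
    have : 3 = 2 * n + 2 := by exact_mod_cast this
    omega
  have hz := (zeroExp_psiErr (a := 3) (by norm_num) hodd).flatten (by norm_num)
  have hc : ∀ ρ : ℂ, -(mult ρ : ℂ) / (ρ * (ρ + (3 : ℝ))) ≠ 0 → mult ρ ≠ 0 := fun ρ h h' =>
    h (by simp [h'])
  have hc' : ∀ ρ : ℂ, mult ρ ≠ 0 → -(mult ρ : ℂ) / (ρ * (ρ + (3 : ℝ))) ≠ 0 := fun ρ h => by
    have h1 := (re_mem_of_mult_ne h).1
    have h2 : ρ ≠ 0 := fun e => by rw [e] at h1; simp at h1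
    have h3 : ρ + (3 : ℝ) ≠ 0 := fun e => by
      have := congrArg re e
      simp at this
      linarith
    simp only [ne_eq, div_eq_zero_iff, neg_eq_zero, Nat.cast_eq_zero, mul_eq_zero]
    tauto
  obtain ⟨ρ₁, h1, hre1, him1, hinf, hsq, hle⟩ := exists_first
  have hoff : ∃ ρ, mult ρ ≠ 0 ∧ 1 / 2 < ρ.re := by
    rcases lt_or_gt_of_ne hne with h | h
    · exact ⟨1 - ρ₀, by rwa [mult_one_sub], by simp; linarith⟩
    · exact ⟨ρ₀, h0, h⟩
  obtain ⟨ρ, hρ, hρ'⟩ := hoff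
  have hΓ : ∀ ρ : ℂ, -(mult ρ : ℂ) / (ρ * (ρ + (3 : ℝ))) ≠ 0 → 1 / 2 < ρ.re →
      ρ₁.im + 1 / 100 ≤ |ρ.im| := fun σ hσ hσ' => by
    have h2 := le_re_of_re_ne (hc σ hσ) hσ'.ne'
    rw [re_mul_one_sub] at h2
    refine abs_le_of_sq_le_sq' ?_ (abs_nonneg _) |>.2
    rw [sq_abs]
    have h3 : ρ₁.im ≤ 16 := by nlinarith
    nlinarith [sq_nonneg (σ.re - 1 / 2)]
  obtain ⟨U₀, hU⟩ := ZeroExp.altUpTo hz (coeff_conj 3)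
    (fun R => (finite_norm_add_le 1 R).subset fun σ hσ => ⟨hc σ hσ.1, by simpa using hσ.2⟩)
    (by norm_num) (hc' ρ hρ) hρ' (by positivity) hΓ hε
  refine ⟨max U₀ 0, fun U hUU => ?_⟩
  obtain ⟨n, hn, hn'⟩ := hU U ((le_max_left _ _).trans hUU)
  refine ⟨n, hn.of_expInt locInt_psiErr, le_trans ?_ hn'⟩
  have hU0 : 0 ≤ U := (le_max_right _ _).trans hUU
  gcongr
  rw [← hinf, add_div]
  have hpi := Real.pi_lt_four
  have : (1 / 400 : ℝ) ≤ 1 / 100 / Real.pi := by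
    rw [div_le_div_iff₀ (by norm_num) Real.pi_pos]
    linarith
  have h30 : (1.867 : ℝ) * 10 ^ (-(30 : ℤ)) ≤ 1 / 400 := by norm_num
  linarith

end

section

open Complex ComplexConjugate

/-! A step function on the zeros controlling simultaneous approximation under the
Riemann hypothesis. -/

namespace IntPoly

theorem le_ratEval_of_nonneg {y : ℝ} {l : List (List ℤ × List ℤ)} {a : ℤ} {P Q : List ℤ}
    (h : 0 ≤ ratEval y (l ++ [(smul (-a) P, Q)])) : a * eval y P / eval y Q ≤ ratEval y l := by
  rw [ratEval_append] at h
  simp only [ratEval, List.map_cons, List.map_nil, List.sum_cons, List.sum_nil, eval_smul] at h ⊢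
  push_cast at h
  rw [neg_mul, neg_div, add_zero] at h
  linarith

theorem forall_mem_append_singleton {y : ℝ} {l : List (List ℤ × List ℤ)} {P Q : List ℤ}
    (hl : ∀ t ∈ l, 0 < eval y t.2) (hQ : 0 < eval y Q) : ∀ t ∈ l ++ [(P, Q)], 0 < eval y t.2 := by
  intro t ht
  rcases List.mem_append.mp ht with ht | ht
  · exact hl t ht
  · rw [List.mem_singleton.mp ht]; exact hQ

end IntPoly

namespace xiFun

open IntPoly

/-- Kernel dominating the logarithms of the numbers of cells. -/
def kernelCells : List (ℤ × ℤ) :=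
  [(8, -157946), (14, 1130601), (20, -3278789), (30, 10831997), (40, -29927853), (50, 48884930),
    (60, -36999489), (80, 13109571), (100, -3777505), (150, 184593)]

/-- Kernel dominating the approximation errors. -/
def kernelError : List (ℤ × ℤ) :=
  [(8, -557017), (14, 3864881), (20, -10723384), (30, 32272378), (40, -80557526), (50, 119270282),
    (60, -82687422), (80, 25440436), (100, -6592620), (150, 270078)]

/-- Kernel dominating the contributions to the derivative. -/
def kernelLip : List (ℤ × ℤ) :=
  [(8, 61007), (14, -130718), (20, 178191), (30, -265007), (40, 520498), (50, -676923),
    (60, 354674), (80, -54164), (100, 12995), (150, -552)]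

/-- The polynomial `y (y + 2400) (y + 2600) (y + 2808)`. -/
def decayPoly : List ℤ := mul (mul [0, 1] [2400, 1]) (mul [2600, 1] [2808, 1])

theorem eval_decayPoly (y : ℝ) :
    eval y decayPoly = y * (y + 2400) * (y + 2600) * (y + 2808) := by
  simp only [decayPoly, eval_mul, eval_cons, eval_nil]; push_cast; ring

/-- Next breakpoint of the step function. -/
def nextStep (Y : ℕ) : ℕ := 106 * Y / 100

/-- Number of cells on `[Y, nextStep Y)`. -/
def cells (Y : ℕ) : ℕ :=
  let m := (Y + nextStep Y) / 2
  7040000000000000 / (m * (m + 2400) * (m + 2600) * (m + 2808))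

/-- Validity test for the step function with `j` steps from `Y` on. -/
def stepCheck : ℕ → ℕ → Bool
  | 0, Y => ratCheckIci 40 (kernel kernelCells) Y 10000000 &&
      ratCheckIci 40 (kernel kernelError ++ [(smul (-4000000000000000) [1], decayPoly)]) Y 10000000
  | j + 1, Y => decide (1 < cells Y) && decide (cells Y < 2 ^ 20) &&
      ratCheckIco 20 (kernel kernelCells ++
        [(smul (-(((logFix (cells Y) + 2000) / 10 ^ 18 + 1 : ℕ) : ℤ)) [1], [1000000])])
        Y (nextStep Y) &&
      ratCheckIco 20 (kernel kernelError ++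
        [(smul (-1420000000000000000) [1], smul (113 * cells Y) decayPoly)]) Y (nextStep Y) &&
      stepCheck j (nextStep Y)

/-- The step function with `j` steps from `Y` on. -/
noncomputable def stepFun : ℕ → ℕ → ℝ → ℕ
  | 0, _, _ => 1
  | j + 1, Y, y => if y < nextStep Y then cells Y else stepFun j (nextStep Y) y

/-- Oscillation allowed by `n` cells. -/
noncomputable def osc (n : ℕ) : ℝ := if n = 1 then 2 else 710 / (113 * n)

theorem stepFun_spec : ∀ (j Y : ℕ), stepCheck j Y = true → ∀ y : ℝ, 0 < y → Y ≤ y →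
    1 ≤ stepFun j Y y ∧ Real.log (stepFun j Y y) ≤ ratEval y (kernel kernelCells) ∧
      2 * 10 ^ 15 * (osc (stepFun j Y y) / (y * (y + 2400) * (y + 2600) * (y + 2808))) ≤
        ratEval y (kernel kernelError) := by
  have hA : nodesOk kernelCells = true := by decide +kernel
  have hE : nodesOk kernelError = true := by decide +kernel
  intro j
  induction j with
  | zero =>
    intro Y h y hy hY
    simp only [stepCheck, Bool.and_eq_true] at h
    have hQ : 0 < eval y decayPoly := by rw [eval_decayPoly]; positivity
    refine ⟨le_rfl, ?_, ?_⟩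
    · rw [stepFun, Nat.cast_one, Real.log_one]
      exact ratEval_nonneg_of_Ici h.1 (eval_kernel_pos hA hy.le) (by exact_mod_cast hY)
    · have := le_ratEval_of_nonneg (ratEval_nonneg_of_Ici h.2
        (forall_mem_append_singleton (eval_kernel_pos hE hy.le) hQ) (by exact_mod_cast hY))
      refine le_trans (le_of_eq ?_) this
      rw [stepFun, osc, if_pos rfl, eval_decayPoly, eval_cons, eval_nil]
      push_cast
      ring
  | succ j ih =>
    intro Y h y hy hY
    simp only [stepCheck, Bool.and_eq_true, decide_eq_true_eq] at h
    obtain ⟨⟨⟨⟨h1, h2⟩, h3⟩, h4⟩, h5⟩ := h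
    rw [stepFun]
    split_ifs with hlt
    · have hQ : 0 < eval y decayPoly := by rw [eval_decayPoly]; positivity
      generalize cells Y = n at h1 h2 h3 h4 ⊢
      have hn : (0 : ℝ) < n := by exact_mod_cast (zero_lt_one.trans h1)
      refine ⟨h1.le, ?_, ?_⟩
      · have := le_ratEval_of_nonneg (ratEval_nonneg_of_Ico h3
          (forall_mem_append_singleton (eval_kernel_pos hA hy.le) (by simp))
          (by exact_mod_cast hY) (by exact_mod_cast hlt))
        refine le_trans ?_ this
        have b := (logFix_bounds (zero_lt_one.trans h1) h2).2
        have d := Nat.cast_div_add_one_ge (logFix n + 2000) (10 ^ 18)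
        simp only [eval_cons, eval_nil, mul_zero, add_zero, Int.cast_one, mul_one]
        rw [le_div_iff₀ (by norm_num), Int.cast_natCast]
        generalize (logFix n + 2000) / 10 ^ 18 = q at d ⊢
        push_cast at d ⊢
        linarith
      · have := le_ratEval_of_nonneg (ratEval_nonneg_of_Ico h4
          (forall_mem_append_singleton (eval_kernel_pos hE hy.le) (by
            rw [eval_smul]; push_cast; positivity))
          (by exact_mod_cast hY) (by exact_mod_cast hlt))
        refine le_trans (le_of_eq ?_) this
        rw [osc, if_neg h1.ne', eval_smul, eval_decayPoly, eval_cons, eval_nil]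
        push_cast
        field_simp
        ring
    · exact ih _ h5 y hy (not_lt.mp hlt)

theorem exists_stepFun_eq_one : ∀ (j Y : ℕ), ∃ R : ℝ, ∀ y, R ≤ y → stepFun j Y y = 1
  | 0, _ => ⟨0, fun _ _ => rfl⟩
  | j + 1, Y => by
    obtain ⟨R, hR⟩ := exists_stepFun_eq_one j (nextStep Y)
    refine ⟨max R (nextStep Y), fun y hy => ?_⟩
    rw [stepFun, if_neg (not_lt.mpr ((le_max_right _ _).trans hy))]
    exact hR y ((le_max_left _ _).trans hy)

theorem stepCheck_cells : stepCheck 55 193 = true := by decide +kernel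

/-- The number of cells used for the zero `ρ`. -/
noncomputable def cellsAt (ρ : ℂ) : ℕ := stepFun 55 193 (1 / 4 + ρ.im ^ 2)

/-- Upper bound for the coefficient of a zero on the critical line. -/
noncomputable def decay (ρ : ℂ) : ℝ :=
  1 / ((1 / 4 + ρ.im ^ 2) * (1 / 4 + ρ.im ^ 2 + 2400) * (1 / 4 + ρ.im ^ 2 + 2600) *
    (1 / 4 + ρ.im ^ 2 + 2808))

theorem decay_pos (ρ : ℂ) : 0 < decay ρ := by unfold decay; positivity

theorem osc_nonneg (n : ℕ) : 0 ≤ osc n := by unfold osc; split_ifs <;> positivity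

theorem kernelRe_of_re_eq {ρ : ℂ} (h : ρ.re = 1 / 2) (A : List (ℤ × ℤ)) :
    kernelRe A (ρ * (1 - ρ)) = ratEval (1 / 4 + ρ.im ^ 2) (kernel A) := by
  rw [mul_one_sub_of_re_eq h, kernelRe_ofReal]

theorem cellsAt_spec (hRH : ∀ ρ, mult ρ ≠ 0 → ρ.re = 1 / 2)
    {ρ : ℂ} (h : mult ρ ≠ 0) :
    1 ≤ cellsAt ρ ∧ Real.log (cellsAt ρ) ≤ kernelRe kernelCells (ρ * (1 - ρ)) ∧
      2 * 10 ^ 15 * (osc (cellsAt ρ) * decay ρ) ≤ kernelRe kernelError (ρ * (1 - ρ)) := by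
  have h1 := le_im_sq_of_re_eq hRH h
  have := stepFun_spec 55 193 stepCheck_cells (1 / 4 + ρ.im ^ 2) (by linarith)
    (by push_cast; linarith)
  rw [kernelRe_of_re_eq (hRH ρ h), kernelRe_of_re_eq (hRH ρ h), decay, mul_one_div, cellsAt]
  exact this

theorem sum_log_cellsAt_le (hRH : ∀ ρ, mult ρ ≠ 0 → ρ.re = 1 / 2)
    (s : Finset ℂ) (hs : ∀ ρ ∈ s, mult ρ ≠ 0 ∧ 0 < ρ.im) :
    ∑ ρ ∈ s, Real.log (cellsAt ρ) ≤ 71 := by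
  have hA : nodesOk kernelCells = true := by decide +kernel
  have hk : ∀ ρ, mult ρ ≠ 0 → 0 ≤ kernelRe kernelCells (ρ * (1 - ρ)) := fun ρ h =>
    have := cellsAt_spec hRH h
    le_trans (Real.log_nonneg (by exact_mod_cast this.1)) this.2.1
  have hinj : Set.InjOn (starRingEnd ℂ) s := fun a _ b _ h => by simpa using congrArg conj h
  have hdisj : Disjoint s (s.image (starRingEnd ℂ)) := by
    rw [Finset.disjoint_left]
    intro ρ h1 h2
    obtain ⟨σ, h3, h4⟩ := Finset.mem_image.mp h2
    have h5 := (hs ρ h1).2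
    rw [← h4, conj_im] at h5
    linarith [(hs σ h3).2]
  have h1 := sum_le_kernelValue hA hk (s ∪ s.image (starRingEnd ℂ))
  have h2 : ∑ ρ ∈ s, Real.log (cellsAt ρ) ≤
      ∑ ρ ∈ s, (mult ρ : ℝ) * kernelRe kernelCells (ρ * (1 - ρ)) :=
    Finset.sum_le_sum fun ρ hρ => by
      have h := (hs ρ hρ).1
      have : (1 : ℝ) ≤ mult ρ := by exact_mod_cast Nat.one_le_iff_ne_zero.mpr h
      nlinarith [(cellsAt_spec hRH h).2.1, hk ρ h]
  have h3 : ∑ ρ ∈ s, (mult (conj ρ) : ℝ) * kernelRe kernelCells (conj ρ * (1 - conj ρ)) =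
      ∑ ρ ∈ s, (mult ρ : ℝ) * kernelRe kernelCells (ρ * (1 - ρ)) :=
    Finset.sum_congr rfl fun ρ hρ => by
      have h := (hs ρ hρ).1
      rw [mult_conj, kernelRe_of_re_eq (hRH ρ h), kernelRe_of_re_eq (by simpa using hRH ρ h)]
      simp
  rw [Finset.sum_union hdisj, Finset.sum_image hinj, h3] at h1
  have c : (kernelFix kernelCells : ℝ) ≤ (142 * 10 ^ 24 : ℤ) := Int.cast_le.mpr (by decide +kernel)
  have h4 := (kernelValue_le hA).trans c
  push_cast at h4
  clear c
  linarith

theorem prod_cellsAt_le (hRH : ∀ ρ, mult ρ ≠ 0 → ρ.re = 1 / 2)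
    (s : Finset ℂ) (hs : ∀ ρ ∈ s, mult ρ ≠ 0 ∧ 0 < ρ.im) :
    ((∏ ρ ∈ s, cellsAt ρ : ℕ) : ℝ) ≤ 8 * 10 ^ 30 := by
  have h1 := sum_log_cellsAt_le hRH s hs
  have hp : ∀ ρ ∈ s, (0 : ℝ) < cellsAt ρ := fun ρ hρ => by
    exact_mod_cast (cellsAt_spec hRH (hs ρ hρ).1).1
  rw [← Real.log_prod fun ρ hρ => (hp ρ hρ).ne', ← Nat.cast_prod] at h1
  have h2 := (Real.log_le_iff_le_exp (by rw [Nat.cast_prod]; exact Finset.prod_pos hp)).mp h1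
  refine h2.trans ?_
  have h3 : Real.exp 71 = Real.exp 1 ^ 71 := by rw [← Real.exp_nat_mul]; norm_num
  rw [h3]
  calc Real.exp 1 ^ 71 ≤ 2.7182818286 ^ 71 := by
        gcongr
        exact Real.exp_one_lt_d9.le
    _ ≤ _ := by norm_num

theorem tsum_osc_le (hRH : ∀ ρ, mult ρ ≠ 0 → ρ.re = 1 / 2) :
    Summable (fun ρ => (mult ρ : ℝ) * (osc (cellsAt ρ) * decay ρ)) ∧
    ∑' ρ, (mult ρ : ℝ) * (osc (cellsAt ρ) * decay ρ) ≤ 0.5749 / 10 ^ 13 := by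
  have hA : nodesOk kernelError = true := by decide +kernel
  obtain ⟨h1, h2⟩ := tsum_le_kernelValue hA
    (w := fun ρ => 2 * 10 ^ 15 * (osc (cellsAt ρ) * decay ρ))
    (fun ρ _ => mul_nonneg (by positivity) (mul_nonneg (osc_nonneg _) (decay_pos _).le))
    (fun ρ h => (cellsAt_spec hRH h).2.2)
  simp only [mul_left_comm _ (2 * 10 ^ 15 : ℝ)] at h1 h2
  have h3 := (summable_mul_left_iff (by norm_num)).mp h1
  refine ⟨h3, ?_⟩
  rw [tsum_mul_left] at h2
  have c : (kernelFix kernelError : ℝ) ≤ (11498 * 10 ^ 22 : ℤ) := Int.cast_le.mpr (by decide +kernel)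
  have h4 := (kernelValue_le hA).trans c
  push_cast at h4
  clear c
  rw [le_div_iff₀ (by norm_num)]
  linarith

theorem tsum_lip_le (hRH : ∀ ρ, mult ρ ≠ 0 → ρ.re = 1 / 2) :
    Summable (fun ρ => (mult ρ : ℝ) * (|ρ.im| * decay ρ)) ∧
    ∑' ρ, (mult ρ : ℝ) * (|ρ.im| * decay ρ) ≤ 218.1 / 10 ^ 13 := by
  have hA : nodesOk kernelLip = true := by decide +kernel
  have ck : ratCheckIci 40 (kernel kernelLip ++
      [(smul (-1000000000000) [900, 1], smul 3 decayPoly)]) 193 200000 = true := by decide +kernel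
  obtain ⟨h1, h2⟩ := tsum_le_kernelValue hA
    (w := fun ρ => 2 * 10 ^ 13 * (|ρ.im| * decay ρ))
    (fun ρ _ => mul_nonneg (by positivity) (mul_nonneg (abs_nonneg _) (decay_pos _).le))
    (fun ρ h => by
      have hy := le_im_sq_of_re_eq hRH h
      have hQ := eval_decayPoly (1 / 4 + ρ.im ^ 2)
      have hQp : 0 < eval (1 / 4 + ρ.im ^ 2) decayPoly := by rw [hQ]; positivity
      have := le_ratEval_of_nonneg (ratEval_nonneg_of_Ici ck
        (forall_mem_append_singleton (eval_kernel_pos hA (by linarith)) (by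
          rw [eval_smul]; push_cast; positivity)) (y := 1 / 4 + ρ.im ^ 2) (by push_cast; linarith))
      rw [kernelRe_of_re_eq (hRH ρ h)]
      refine le_trans ?_ this
      have hg : |ρ.im| ≤ (1 / 4 + ρ.im ^ 2 + 900) / 60 := by
        nlinarith [sq_nonneg (|ρ.im| - 30), sq_abs ρ.im]
      rw [decay, ← hQ, eval_smul]
      simp only [eval_cons, eval_nil]
      push_cast
      rw [mul_one_div, ← mul_div_assoc, div_le_div_iff₀ hQp (by positivity)]
      nlinarith [mul_le_mul_of_nonneg_right hg hQp.le])
  simp only [mul_left_comm _ (2 * 10 ^ 13 : ℝ)] at h1 h2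
  have h3 := (summable_mul_left_iff (by norm_num)).mp h1
  refine ⟨h3, ?_⟩
  rw [tsum_mul_left] at h2
  have c : (kernelFix kernelLip : ℝ) ≤ (4362 * 10 ^ 23 : ℤ) := Int.cast_le.mpr (by decide +kernel)
  have h4 := (kernelValue_le hA).trans c
  push_cast at h4
  clear c
  rw [le_div_iff₀ (by norm_num)]
  linarith

end xiFun

end

section

open Complex ComplexConjugate

/-! Iterated exponential integrals of the error term, under the Riemann hypothesis. -/

theorem trivialBound_le : trivialBound 49 ≤ 0.15 := by
  set f : ℕ → ℝ := fun n => 1 / ((2 * (n : ℝ) + 2) * |(49 : ℝ) - (2 * n + 2)|) with hf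
  have key : ∀ n : ℕ, ∑ i ∈ Finset.range (50 + n), f i ≤ 0.15 - 1 / (2 * (2 * n + 51)) := by
    intro n
    induction n with
    | zero =>
      simp only [hf, add_zero, Finset.sum_range_succ, Finset.sum_range_zero]
      norm_num [abs_of_pos, abs_of_neg]
    | succ n ih =>
      rw [← add_assoc, Finset.sum_range_succ]
      have h1 : f (50 + n) ≤ 1 / (2 * (2 * (n : ℝ) + 51)) - 1 / (2 * (2 * ((n + 1 : ℕ) : ℝ) + 51)) := by
        simp only [hf]
        push_cast
        rw [abs_of_neg (by linarith [Nat.cast_nonneg (α := ℝ) n]),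
          div_sub_div _ _ (by positivity) (by positivity), div_le_div_iff₀ (by
            have := Nat.cast_nonneg (α := ℝ) n
            exact mul_pos (by linarith) (by linarith)) (by positivity)]
        have := Nat.cast_nonneg (α := ℝ) n
        nlinarith [mul_nonneg this this, mul_nonneg this (mul_nonneg this this)]
      linarith
  refine Real.tsum_le_of_sum_range_le (fun n => by positivity) fun n => ?_
  calc ∑ i ∈ Finset.range n, f i ≤ ∑ i ∈ Finset.range (50 + n), f i :=
        Finset.sum_le_sum_of_subset_of_nonneg (by simp) fun i _ _ => by positivity
    _ ≤ 0.15 := (key n).trans (by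
        have : 0 ≤ 1 / (2 * (2 * (n : ℝ) + 51)) := by positivity
        linarith)

theorem log_two_pi_le : Real.log (2 * Real.pi) ≤ 1.8379 := by
  rw [Real.log_mul (by norm_num) Real.pi_ne_zero]
  linarith [Real.log_two_lt_d9, log_pi_bounds.2]

/-- A zero expansion supported on the zeros, with explicit bounds for its data. -/
structure ZeroExp.Bounded (h : ℝ → ℝ) (c : ℂ → ℂ) (K B b k S : ℝ) : Prop where
  zeroExp : ZeroExp h c K B b
  supp : ∀ ρ, xiFun.mult ρ = 0 → c ρ = 0
  const : |K| ≤ k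
  tsum : ∑' ρ, ‖c ρ‖ ≤ S

namespace xiFun

theorem norm_add_sq {ρ : ℂ} (h : ρ.re = 1 / 2) (a : ℝ) :
    ‖ρ + a‖ ^ 2 = 1 / 4 + ρ.im ^ 2 + a * (a + 1) := by
  rw [← normSq_eq_norm_sq, normSq_apply]
  simp [h]
  ring

theorem le_norm_add (hRH : ∀ ρ, mult ρ ≠ 0 → ρ.re = 1 / 2)
    {ρ : ℂ} (h : mult ρ ≠ 0) {a r : ℝ} (hr : r ^ 2 ≤ 194 + a * (a + 1)) :
    r ≤ ‖ρ + a‖ := by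
  refine (abs_le_of_sq_le_sq' ?_ (norm_nonneg _)).2
  rw [norm_add_sq (hRH ρ h)]
  linarith [le_im_sq_of_re_eq hRH h]

theorem tsum_div_norm_le (hRH : ∀ ρ, mult ρ ≠ 0 → ρ.re = 1 / 2)
    {c : ℂ → ℂ} (hc : StripCoeff c) (supp : ∀ ρ, mult ρ = 0 → c ρ = 0) {a r S : ℝ}
    (ha : 0 < a) (hr : 0 < r) (hr' : r ^ 2 ≤ 194 + a * (a + 1)) (hS : ∑' ρ, ‖c ρ‖ ≤ S) :
    ∑' ρ : ℂ, ‖c ρ‖ / ‖ρ + a‖ ≤ S / r := by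
  refine le_trans ?_ (div_le_div_of_nonneg_right hS hr.le)
  rw [← tsum_div_const]
  refine (hc.summable_div_norm ha).tsum_le_tsum (fun ρ => ?_) (hc.summable.div_const _)
  rcases eq_or_ne (mult ρ) 0 with h | h
  · simp [supp ρ h]
  · gcongr
    exact le_norm_add hRH h hr'

end xiFun

namespace ZeroExp.Bounded

variable {h : ℝ → ℝ} {c : ℂ → ℂ} {K B b k S : ℝ}

theorem expInt (hz : Bounded h c K B b k S) (hRH : ∀ ρ, xiFun.mult ρ ≠ 0 → ρ.re = 1 / 2) {a r : ℝ}
    (ha : 0 < a) (hba : b < a) (hr : 0 < r) (hr' : r ^ 2 ≤ 194 + a * (a + 1)) {B' k' S' : ℝ}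
    (hB : B / (a - b) + k / a + S / r ≤ B') (hk : k / a ≤ k') (hS : S / r ≤ S') :
    Bounded (_root_.expInt a h) (fun ρ => c ρ / (ρ + a)) (K / a) B' b k' S' := by
  have h1 := xiFun.tsum_div_norm_le hRH hz.zeroExp.coeff hz.supp ha hr hr' hz.tsum
  have h2 : |K| / a ≤ k / a := div_le_div_of_nonneg_right hz.const ha.le
  refine ⟨(hz.zeroExp.expInt ha hba).mono_bound (by linarith), fun ρ hρ => by simp [hz.supp ρ hρ],
    ?_, ?_⟩
  · rw [abs_div, abs_of_pos ha]
    linarith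
  · simp only [norm_div]
    linarith

theorem expInt_of_lt (hz : Bounded h c K B b k S) (hRH : ∀ ρ, xiFun.mult ρ ≠ 0 → ρ.re = 1 / 2)
    {a r : ℝ} (ha : 0 < a) (hba : a < b) (hr : 0 < r) (hr' : r ^ 2 ≤ 194 + a * (a + 1))
    {B' k' S' : ℝ} (hB : B / (b - a) + k / a + S / r ≤ B') (hk : k / a ≤ k') (hS : S / r ≤ S') :
    Bounded (_root_.expInt a h) (fun ρ => c ρ / (ρ + a)) (K / a) B' a k' S' := by
  have h1 := xiFun.tsum_div_norm_le hRH hz.zeroExp.coeff hz.supp ha hr hr' hz.tsum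
  have h2 : |K| / a ≤ k / a := div_le_div_of_nonneg_right hz.const ha.le
  refine ⟨(hz.zeroExp.expInt_of_lt ha hba).mono_bound (by linarith),
    fun ρ hρ => by simp [hz.supp ρ hρ], ?_, ?_⟩
  · rw [abs_div, abs_of_pos ha]
    linarith
  · simp only [norm_div]
    linarith

end ZeroExp.Bounded

/-- Sixfold exponential integral of the error term. -/
noncomputable def chainSix : ℝ → ℝ :=
  expInt 53 (expInt 52 (expInt 51 (expInt 50 (expInt 48 (expInt 49 psiErr)))))

/-- Coefficients of the zero expansion of `expInt 1 chainSix`. -/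
noncomputable def chainCoeff (ρ : ℂ) : ℂ :=
  -(xiFun.mult ρ : ℂ) / (ρ * (ρ + (49 : ℝ))) / (ρ + (48 : ℝ)) / (ρ + (50 : ℝ)) / (ρ + (51 : ℝ)) /
    (ρ + (52 : ℝ)) / (ρ + (53 : ℝ)) / (ρ + (1 : ℝ))

/-- Constant term of the expansion of `expInt 1 chainSix`. -/
noncomputable def chainConst : ℝ :=
  -Real.log (2 * Real.pi) / 49 / 48 / 50 / 51 / 52 / 53 / 1

namespace xiFun

theorem tsum_coeff_le (hRH : ∀ ρ, mult ρ ≠ 0 → ρ.re = 1 / 2) :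
    ∑' ρ : ℂ, ‖-(mult ρ : ℂ) / (ρ * (ρ + (49 : ℝ)))‖ ≤ 0.0338 := by
  have hA : nodesOk [(20, 1)] = true := by decide +kernel
  have c : (kernelFix [(20, 1)] : ℝ) ≤ (338 * 10 ^ 20 : ℤ) := Int.cast_le.mpr (by decide +kernel)
  have h4 := (kernelValue_le hA).trans c
  push_cast at h4
  have h := (tsum_le_kernelValue hA (w := fun ρ => 1 / (‖ρ‖ * ‖ρ + (49 : ℝ)‖))
    (fun ρ _ => by positivity) (fun ρ h => by
      have hre := hRH ρ h
      have hy := le_im_sq_of_re_eq hRH h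
      rw [mul_one_sub_of_re_eq hre]
      have e : kernelRe [(20, 1)] ((1 / 4 + ρ.im ^ 2 : ℝ) : ℂ) = 1 / (1 / 4 + ρ.im ^ 2 + 380) := by
        rw [IntPoly.kernelRe_ofReal]
        simp [IntPoly.kernel, IntPoly.ratEval]
        ring
      rw [e]
      refine one_div_le_one_div_of_le (by positivity) ?_
      refine (abs_le_of_sq_le_sq' ?_ (by positivity)).2
      have h0 := norm_add_sq hre 0
      rw [mul_pow, norm_add_sq hre]
      simp only [ofReal_zero, add_zero] at h0
      rw [h0]
      nlinarith)).2
  refine le_trans (le_of_eq ?_) (h.trans (by linarith))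
  refine tsum_congr fun ρ => ?_
  rw [norm_div, norm_neg, norm_natCast, norm_mul, mul_one_div]

theorem norm_chainCoeff_le (hRH : ∀ ρ, mult ρ ≠ 0 → ρ.re = 1 / 2) (ρ : ℂ) :
    ‖chainCoeff ρ‖ ≤ mult ρ * decay ρ := by
  rcases eq_or_ne (mult ρ) 0 with h | h
  · simp [chainCoeff, h]
  have hre := hRH ρ h
  have hy := le_im_sq_of_re_eq hRH h
  have key : ∀ {a b t : ℝ}, 0 ≤ t → 2 * t ≤ a * (a + 1) + b * (b + 1) →
      t ^ 2 ≤ a * (a + 1) * (b * (b + 1)) → 1 / 4 + ρ.im ^ 2 + t ≤ ‖ρ + a‖ * ‖ρ + b‖ := by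
    intro a b t ht h1 h2
    refine (abs_le_of_sq_le_sq' ?_ (by positivity)).2
    rw [mul_pow, norm_add_sq hre, norm_add_sq hre]
    nlinarith
  have k1 := key (a := 0) (b := 1) (t := 0) le_rfl (by norm_num) (by norm_num)
  have k2 := key (a := 49) (b := 48) (t := 2400) (by norm_num) (by norm_num) (by norm_num)
  have k3 := key (a := 50) (b := 51) (t := 2600) (by norm_num) (by norm_num) (by norm_num)
  have k4 := key (a := 52) (b := 53) (t := 2808) (by norm_num) (by norm_num) (by norm_num)
  rw [ofReal_zero, add_zero, add_zero] at k1
  have hp : ∀ {a : ℝ}, 0 ≤ a → 0 < ‖ρ + a‖ := fun {a} ha =>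
    lt_of_lt_of_le one_pos (le_norm_add hRH h (by nlinarith))
  have hp0 : 0 < ‖ρ‖ := by simpa using hp le_rfl
  have e : ‖chainCoeff ρ‖ = mult ρ * (1 / ((‖ρ‖ * ‖ρ + (1 : ℝ)‖) * (‖ρ + (49 : ℝ)‖ * ‖ρ + (48 : ℝ)‖) *
      (‖ρ + (50 : ℝ)‖ * ‖ρ + (51 : ℝ)‖) * (‖ρ + (52 : ℝ)‖ * ‖ρ + (53 : ℝ)‖))) := by
    simp only [chainCoeff, norm_div, norm_neg, norm_natCast, norm_mul, div_div, mul_one_div]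
    congr 1
    ring
  rw [e, decay]
  gcongr

end xiFun

theorem chainCoeff_conj (ρ : ℂ) : chainCoeff (conj ρ) = conj (chainCoeff ρ) := by
  simp only [chainCoeff, xiFun.mult_conj, map_div₀, map_neg, map_mul, map_add, conj_ofReal,
    map_natCast]

theorem chainCoeff_ne_zero {ρ : ℂ} (h : xiFun.mult ρ ≠ 0) : chainCoeff ρ ≠ 0 := by
  have h1 := (xiFun.re_mem_of_mult_ne h).1
  have h2 : ∀ {a : ℝ}, 0 ≤ a → ρ + a ≠ 0 := fun {a} ha e => by
    have := congrArg re e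
    simp at this
    linarith
  have h0 : ρ ≠ 0 := by simpa using h2 le_rfl
  unfold chainCoeff
  refine div_ne_zero (div_ne_zero (div_ne_zero (div_ne_zero (div_ne_zero (div_ne_zero (div_ne_zero ?_
    (mul_ne_zero h0 (h2 ?_))) (h2 ?_)) (h2 ?_)) (h2 ?_)) (h2 ?_)) (h2 ?_)) (h2 ?_) <;> simp [h]

theorem zeroExp_chain (hRH : ∀ ρ, xiFun.mult ρ ≠ 0 → ρ.re = 1 / 2) :
    ZeroExp.Bounded (expInt 1 chainSix) chainCoeff chainConst (2 / 10 ^ 9) 1 (1.2 / 10 ^ 10) 1 := by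
  have hodd : ∀ n : ℕ, (49 : ℝ) - (2 * n + 2) ≠ 0 := fun n h => by
    have : (49 : ℝ) = ((2 * n + 2 : ℕ) : ℝ) := by push_cast; linarith
    have : 49 = 2 * n + 2 := by exact_mod_cast this
    omega
  have hl := log_two_pi_le
  have hl0 : 0 ≤ Real.log (2 * Real.pi) := Real.log_nonneg (by linarith [Real.pi_gt_three])
  have hS := xiFun.tsum_coeff_le hRH
  have ht := trivialBound_le
  have h0 : ZeroExp.Bounded (expInt 49 psiErr) _ (-Real.log (2 * Real.pi) / 49) 0.2214 2 0.037511
      0.0338 :=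
    ⟨(zeroExp_psiErr (a := 49) (by norm_num) hodd).mono_bound (by linarith),
      fun ρ hρ => by simp [hρ], by
        rw [abs_div, abs_neg, abs_of_nonneg hl0, abs_of_pos (by norm_num)]; linarith, hS⟩
  have h1 := h0.expInt hRH (a := 48) (r := 50.45) (B' := 0.00627) (k' := 7.8148e-4) (S' := 6.6999e-4)
    (by norm_num) (by norm_num) (by norm_num) (by norm_num) (by norm_num) (by norm_num) (by norm_num)
  have h2 := h1.expInt hRH (a := 50) (r := 52.38) (B' := 1.591e-4) (k' := 1.563e-5) (S' := 1.28e-5)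
    (by norm_num) (by norm_num) (by norm_num) (by norm_num) (by norm_num) (by norm_num) (by norm_num)
  have h3 := h2.expInt hRH (a := 51) (r := 53.34) (B' := 3.794e-6) (k' := 3.065e-7) (S' := 2.4e-7)
    (by norm_num) (by norm_num) (by norm_num) (by norm_num) (by norm_num) (by norm_num) (by norm_num)
  have h4 := h3.expInt hRH (a := 52) (r := 54.31) (B' := 8.62e-8) (k' := 5.895e-9) (S' := 4.43e-9)
    (by norm_num) (by norm_num) (by norm_num) (by norm_num) (by norm_num) (by norm_num) (by norm_num)
  have h5 := h4.expInt hRH (a := 53) (r := 55.28) (B' := 1.883e-9) (k' := 1.1125e-10) (S' := 8.02e-11)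
    (by norm_num) (by norm_num) (by norm_num) (by norm_num) (by norm_num) (by norm_num) (by norm_num)
  exact h5.expInt_of_lt hRH (a := 1) (r := 14) (B' := 2 / 10 ^ 9) (k' := 1.2 / 10 ^ 10) (S' := 1)
    (by norm_num) (by norm_num) (by norm_num) (by norm_num) (by norm_num) (by norm_num) (by norm_num)

end

section

open Complex ComplexConjugate
open scoped ArithmeticFunction.vonMangoldt

/-! Values of `expInt 1 chainSix` at logarithms of integers. -/

theorem primeSum_chain : PrimeSum (expInt 1 chainSix)
    [(-1, -(1 / 14658134400)), (-53, -(1 / 330720)), (-52, 1 / 63648), (-51, -(1 / 30600)),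
      (-50, 1 / 29400), (-48, 1 / 270720), (-49, -(1 / 56448)), (0, 1 / 16529385600)]
    [(-1, -(1 / 29316268800)), (-53, -(1 / 336960)), (-52, 1 / 64872), (-51, -(1 / 31200)),
      (-50, 1 / 29988), (-48, 1 / 276360), (-49, -(1 / 57600)), (1, 1 / 37191117600)] := by
  have h := ((((((primeSum_psiErr.expInt (a := 49) ?_ ?_).expInt (a := 48) ?_ ?_).expInt
    (a := 50) ?_ ?_).expInt (a := 51) ?_ ?_).expInt (a := 52) ?_ ?_).expInt (a := 53) ?_ ?_).expInt
    (a := 1) ?_ ?_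
  · norm_num [expPolyInt] at h
    exact h
  all_goals norm_num [expPolyInt]

namespace ChainFix

/-- Exponents and integral weights of the prime power part. -/
def weights : List (ℕ × ℤ) :=
  [(1, -954), (53, -42283080), (52, 219706200), (51, -456988896), (50, 475641504), (48, 51654330),
    (49, -247729950), (0, 846)]

/-- The common denominator of the weights. -/
def denom : ℕ := 13983860217600

/-- The main term multiplied by `denom * X ^ 53`. -/
def mainTerm (X : ℤ) : ℤ :=
  -477 * X ^ 52 - 41500060 + 215560800 * X - 448200648 * X ^ 2 + 466315200 * X ^ 3 +
    50600160 * X ^ 5 - 242775351 * X ^ 4 + 376 * X ^ 54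

/-- The sum `∑_{n ≤ X} Λ(n) n ^ a`, in fixed point arithmetic. -/
def powerSum (a : ℕ) : ℕ → ℕ
  | 0 => 0
  | X + 1 => powerSum a X + mangoldtFix (X + 1) * (X + 1) ^ a

theorem powerSum_bounds (a : ℕ) : ∀ X : ℕ, X < 2 ^ 12 →
    powerSum a X ≤ 10 ^ 24 * ∑ n ∈ Finset.Icc 1 X, Λ n * (n : ℝ) ^ a ∧
      10 ^ 24 * ∑ n ∈ Finset.Icc 1 X, Λ n * (n : ℝ) ^ a ≤ powerSum a X + 2000 * (X * (X : ℝ) ^ a)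
  | 0, _ => by simp [powerSum]
  | X + 1, h => by
    obtain ⟨h1, h2⟩ := powerSum_bounds a X (by omega)
    obtain ⟨b1, b2⟩ := mangoldtFix_bounds h
    rw [Finset.sum_Icc_succ_top (by omega), powerSum]
    have hp : (0 : ℝ) ≤ ((X + 1 : ℕ) : ℝ) ^ a := by positivity
    have h3 : (X : ℝ) ^ a ≤ ((X + 1 : ℕ) : ℝ) ^ a := by gcongr; omega
    have h4 := mul_le_mul_of_nonneg_left h3 (Nat.cast_nonneg X)
    have b3 := mul_le_mul_of_nonneg_right b1 hp
    have b4 := mul_le_mul_of_nonneg_right b2 hp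
    rw [Nat.cast_add, Nat.cast_mul, Nat.cast_pow]
    have e : ((X + 1 : ℕ) : ℝ) * ((X + 1 : ℕ) : ℝ) ^ a =
      X * ((X + 1 : ℕ) : ℝ) ^ a + ((X + 1 : ℕ) : ℝ) ^ a := by push_cast; ring
    rw [e]
    constructor <;> nlinarith

/-- The weighted combination of power sums. -/
def combine (X : ℕ) : List (ℕ × ℤ) → List ℕ → ℤ
  | p :: l, s :: S => p.2 * s * (X : ℤ) ^ (53 - p.1) + combine X l S
  | _, _ => 0

/-- Fixed point value of `expInt 1 chainSix (log X)`, from the power sums `S`. -/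
def value (X : ℕ) (S : List ℕ) : ℤ :=
  (combine X weights S - 10 ^ 24 * mainTerm X) / (denom * (X : ℤ) ^ 53)

/-- The list of all power sums at `X`. -/
def sums (X : ℕ) : List ℕ := weights.map fun p => powerSum p.1 X

theorem abs_combine_sub_le {X : ℕ} (hX : X < 2 ^ 12) : ∀ l : List (ℕ × ℤ), (∀ p ∈ l, p.1 ≤ 53) →
    |10 ^ 24 * ∑ n ∈ Finset.Icc 1 X, Λ n * (l.map fun p => (p.2 : ℝ) * ((n : ℝ) ^ p.1 *
        (X : ℝ) ^ (53 - p.1))).sum - combine X l (l.map fun p => powerSum p.1 X)| ≤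
      2000 * X * X ^ 53 * (l.map fun p => |(p.2 : ℝ)|).sum
  | [], _ => by simp [combine]
  | p :: l, h => by
    have ih := abs_combine_sub_le hX l fun q hq => h q (List.mem_cons_of_mem _ hq)
    obtain ⟨h1, h2⟩ := powerSum_bounds p.1 X hX
    have hp := h p List.mem_cons_self
    simp only [List.map_cons, List.sum_cons, combine, mul_add, Finset.sum_add_distrib]
    have e : ∑ n ∈ Finset.Icc 1 X, Λ n * ((p.2 : ℝ) * ((n : ℝ) ^ p.1 * (X : ℝ) ^ (53 - p.1))) =
        p.2 * (X : ℝ) ^ (53 - p.1) * ∑ n ∈ Finset.Icc 1 X, Λ n * (n : ℝ) ^ p.1 := by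
      rw [Finset.mul_sum]
      exact Finset.sum_congr rfl fun n _ => by ring
    have hX53 : (X : ℝ) ^ p.1 * (X : ℝ) ^ (53 - p.1) = (X : ℝ) ^ 53 := by
      rw [← pow_add, Nat.add_sub_cancel' hp]
    rw [e]
    set T := ∑ n ∈ Finset.Icc 1 X, Λ n * (n : ℝ) ^ p.1
    have h3 : |10 ^ 24 * T - powerSum p.1 X| ≤ 2000 * (X * (X : ℝ) ^ p.1) := by
      rw [abs_le]; constructor <;> linarith [show 0 ≤ 2000 * (X * (X : ℝ) ^ p.1) by positivity]
    have h4 : |(p.2 : ℝ) * (X : ℝ) ^ (53 - p.1) * (10 ^ 24 * T - powerSum p.1 X)| ≤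
        2000 * X * X ^ 53 * |(p.2 : ℝ)| := by
      rw [abs_mul, abs_mul, abs_of_nonneg (show (0 : ℝ) ≤ (X : ℝ) ^ (53 - p.1) by positivity), ← hX53]
      calc |(p.2 : ℝ)| * (X : ℝ) ^ (53 - p.1) * |10 ^ 24 * T - powerSum p.1 X| ≤
          |(p.2 : ℝ)| * (X : ℝ) ^ (53 - p.1) * (2000 * (X * (X : ℝ) ^ p.1)) := by gcongr
        _ = _ := by ring
    refine le_trans (le_of_eq ?_) ((abs_add_le _ _).trans (add_le_add h4 ih))
    congr 1
    push_cast
    ring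

theorem abs_sub_value_le {X : ℕ} (h0 : 0 < X) (hX : X < 2 ^ 12) :
    |10 ^ 24 * expInt 1 chainSix (Real.log X) - value X (sums X)| ≤ 1000 := by
  have hXp : (0 : ℝ) < X := by exact_mod_cast h0
  have h1 : (1 : ℝ) ≤ X := by exact_mod_cast h0
  have hp := primeSum_chain (Real.log X) (Real.log_nonneg h1)
  rw [Real.exp_log hXp, Nat.floor_natCast] at hp
  have hq := abs_combine_sub_le hX weights (by decide)
  have hD : (0 : ℝ) < denom * (X : ℝ) ^ 53 := mul_pos (by norm_num [denom]) (by positivity)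
  have hexp : ∀ (k : ℕ) (n : ℕ), 0 < n → Real.exp (-(k : ℝ) * (Real.log X - Real.log n)) =
      (n : ℝ) ^ k / (X : ℝ) ^ k := by
    intro k n hn
    have hn' : (0 : ℝ) < n := by exact_mod_cast hn
    rw [← Real.log_div hXp.ne' hn'.ne', ← Real.log_rpow (by positivity), Real.exp_log (by positivity),
      Real.rpow_neg (by positivity), Real.rpow_natCast, div_pow, inv_div]
  have hsum : ∀ n ∈ Finset.Icc 1 X, Λ n * (weights.map fun p => (p.2 : ℝ) * ((n : ℝ) ^ p.1 *
        (X : ℝ) ^ (53 - p.1))).sum = denom * (X : ℝ) ^ 53 * (Λ n * expPoly [(-1, -(1 / 14658134400)),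
      (-53, -(1 / 330720)), (-52, 1 / 63648), (-51, -(1 / 30600)),
      (-50, 1 / 29400), (-48, 1 / 270720), (-49, -(1 / 56448)), (0, 1 / 16529385600)]
      (Real.log X - Real.log n)) := by
    intro n hn
    have hn0 : 0 < n := (Finset.mem_Icc.mp hn).1
    have e1 := hexp 1 n hn0
    have e2 := hexp 53 n hn0
    have e3 := hexp 52 n hn0
    have e4 := hexp 51 n hn0
    have e5 := hexp 50 n hn0
    have e6 := hexp 48 n hn0
    have e7 := hexp 49 n hn0
    norm_num only [Nat.cast_one, Nat.cast_ofNat] at e1 e2 e3 e4 e5 e6 e7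
    simp only [weights, expPoly, List.map_cons, List.map_nil, List.sum_cons, List.sum_nil, e1, e2, e3,
      e4, e5, e6, e7, denom]
    norm_num
    field_simp
    ring
  have hmain : denom * (X : ℝ) ^ 53 * expPoly [(-1, -(1 / 29316268800)), (-53, -(1 / 336960)),
      (-52, 1 / 64872), (-51, -(1 / 31200)), (-50, 1 / 29988), (-48, 1 / 276360), (-49, -(1 / 57600)),
      (1, 1 / 37191117600)] (Real.log X) = mainTerm X := by
    have hexp' : ∀ k : ℕ, Real.exp (-(k : ℝ) * Real.log X) = 1 / (X : ℝ) ^ k := by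
      intro k
      simpa using hexp k 1 one_pos
    have e1 := hexp' 1
    have e2 := hexp' 53
    have e3 := hexp' 52
    have e4 := hexp' 51
    have e5 := hexp' 50
    have e6 := hexp' 48
    have e7 := hexp' 49
    norm_num only [Nat.cast_one, Nat.cast_ofNat] at e1 e2 e3 e4 e5 e6 e7
    simp only [mainTerm, expPoly, List.map_cons, List.map_nil, List.sum_cons, List.sum_nil, e1, e2, e3,
      e4, e5, e6, e7, denom, one_mul, Real.exp_log hXp]
    push_cast
    field_simp
    ring
  rw [Finset.sum_congr rfl hsum, ← Finset.mul_sum] at hq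
  have hX' : (X : ℝ) ≤ 4096 := by exact_mod_cast hX.le
  set D : ℝ := denom * (X : ℝ) ^ 53 with hDdef
  set C := combine X weights (weights.map fun p => powerSum p.1 X) with hC
  have hw : (weights.map fun p => |(p.2 : ℝ)|).sum = 1494005760 := by
    norm_num [weights]
  rw [hw] at hq
  have hval : value X (sums X) = (C - 10 ^ 24 * mainTerm X) / (denom * (X : ℤ) ^ 53) := rfl
  have hDz : (0 : ℤ) < denom * (X : ℤ) ^ 53 := by
    refine mul_pos (by norm_num [denom]) (by positivity)
  have hDc : ((denom * (X : ℤ) ^ 53 : ℤ) : ℝ) = D := by push_cast; rfl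
  have v1 : value X (sums X) * D ≤ (C : ℝ) - 10 ^ 24 * mainTerm X := by
    rw [← hDc, hval]
    exact_mod_cast Int.ediv_mul_le _ hDz.ne'
  have v2 : (C : ℝ) - 10 ^ 24 * mainTerm X ≤ (value X (sums X) + 1) * D := by
    rw [← hDc, hval]
    exact_mod_cast (Int.lt_ediv_add_one_mul_self _ hDz).le
  have hF : D * (10 ^ 24 * expInt 1 chainSix (Real.log X)) = 10 ^ 24 * (D * ∑ n ∈ Finset.Icc 1 X,
      Λ n * expPoly [(-1, -(1 / 14658134400)),
      (-53, -(1 / 330720)), (-52, 1 / 63648), (-51, -(1 / 30600)),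
      (-50, 1 / 29400), (-48, 1 / 270720), (-49, -(1 / 56448)), (0, 1 / 16529385600)]
      (Real.log X - Real.log n)) - 10 ^ 24 * mainTerm X := by
    rw [hp, ← hmain]; ring
  rw [Finset.mul_sum] at hF
  rw [Finset.mul_sum] at hq
  have herr : 2000 * X * (X : ℝ) ^ 53 * 1494005760 ≤ 999 * D := by
    rw [hDdef, denom]
    have : (0 : ℝ) < (X : ℝ) ^ 53 := by positivity
    push_cast
    nlinarith
  rw [abs_le] at hq ⊢
  constructor
  · refine le_of_mul_le_mul_left ?_ hD
    linarith [hq.1]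
  · refine le_of_mul_le_mul_left ?_ hD
    linarith [hq.2]

/-- Evaluate a natural number before passing it on. -/
def force : ℕ → (ℕ → Bool) → Bool
  | 0, f => f 0
  | k + 1, f => f (k + 1)

theorem force_eq (k : ℕ) (f : ℕ → Bool) : force k f = f k := by cases k <;> rfl

/-- Evaluate a list of natural numbers before passing it on. -/
def forceList : List ℕ → (List ℕ → Bool) → Bool
  | [], f => f []
  | a :: l, f => force a fun a => forceList l fun l => f (a :: l)

theorem forceList_eq : ∀ (l : List ℕ) (f : List ℕ → Bool), forceList l f = f l
  | [], _ => rfl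
  | a :: l, f => by rw [forceList, force_eq, forceList_eq l]

/-- Add the terms of index `n` to the power sums. -/
def advance (n m : ℕ) (S : List ℕ) : List ℕ := List.zipWith (fun p s => s + m * n ^ p.1) weights S

theorem advance_sums (X : ℕ) : advance (X + 1) (mangoldtFix (X + 1)) (sums X) = sums (X + 1) := by
  simp [advance, sums, powerSum, weights]

/-- Run `test` at `X + 1, …, X + j`, given the power sums at `X`. -/
def scan (test : ℕ → List ℕ → Bool) : ℕ → ℕ → List ℕ → Bool
  | 0, _, _ => true
  | j + 1, X, S => force (X + 1) fun n => force (mangoldtFix n) fun m =>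
      forceList (advance n m S) fun S' => test n S' && scan test j n S'

theorem of_scan {test : ℕ → List ℕ → Bool} (j : ℕ) : ∀ X : ℕ, scan test j X (sums X) = true →
    ∀ n, X < n → n ≤ X + j → test n (sums n) = true := by
  induction j with
  | zero => intro X _ n h1 h2; omega
  | succ j ih =>
    intro X h n h1 h2
    rw [scan, force_eq, force_eq, forceList_eq, advance_sums, Bool.and_eq_true] at h
    rcases Nat.lt_or_ge (X + 1) n with h3 | h3
    · exact ih (X + 1) h.2 n h3 (by omega)
    · obtain rfl : n = X + 1 := by omega
      exact h.1

/-- The constant term, lowered by a margin for rounding. -/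
def constLow : ℤ := -111188469276119

/-- Positivity test on even integers. -/
def posTest (X : ℕ) (S : List ℕ) : Bool :=
  decide (420 * 2000000000000000 + (4 * X + 11025) * (X * 60000000000 + 2 * 21810000000000) ≤
    420 * (X : ℤ) * (constLow - value X S))

/-- Peak test. -/
def peakTest (X : ℕ) (S : List ℕ) : Bool :=
  decide (11000000000000000000 + 420 * 2000000000000000 + X * (4 * X + 11025) * 60000000000 ≤
    420 * (X : ℤ) * (constLow - value X S))

/-- Trough test. -/
def troughTest (X : ℕ) (S : List ℕ) : Bool :=
  decide (420 * (X : ℤ) * (constLow + 2000000 - value X S) +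
    420 * 2000000000000000 + X * (4 * X + 11025) * 60000000000 ≤ 11000000000000000000)

/-- All tests on the window. -/
def windowTest (X : ℕ) (S : List ℕ) : Bool :=
  (Nat.blt X 2640 || X % 2 == 1 || posTest X S) &&
    (!(X == 2640) || peakTest X S) && (!(X == 2970) || peakTest X S) && (!(X == 2780) || troughTest X S)

theorem scan_windowTest : scan windowTest 2970 0 (sums 0) = true := by decide +kernel

end ChainFix

end

section

open Complex ComplexConjugate

/-- The normalized zero sum, `-∑ c ρ exp (i γ u)`, of `expInt 1 chainSix` on the critical line. -/
noncomputable def lineSum (u : ℝ) : ℝ := -(∑' ρ : ℂ, chainCoeff ρ * cexp (I * (ρ.im * u : ℝ))).re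

theorem norm_exp_sub_exp_le (x y : ℝ) : ‖cexp (I * x) - cexp (I * y)‖ ≤ |x - y| := by
  have h : cexp (I * x) - cexp (I * y) = cexp (y * I) * (cexp (I * (x - y : ℝ)) - 1) := by
    rw [mul_sub, ← Complex.exp_add, mul_one]
    push_cast
    ring_nf
  rw [h, norm_mul, norm_exp_ofReal_mul_I, one_mul]
  exact Real.norm_exp_I_mul_ofReal_sub_one_le

theorem zeroSum_chainCoeff (hRH : ∀ ρ, xiFun.mult ρ ≠ 0 → ρ.re = 1 / 2)
    (u : ℝ) : zeroSum chainCoeff u = -(Real.exp (u / 2) * lineSum u) := by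
  have h : ∀ ρ, chainCoeff ρ * cexp (ρ * u) =
      (Real.exp (u / 2) : ℂ) * (chainCoeff ρ * cexp (I * (ρ.im * u : ℝ))) := by
    intro ρ
    by_cases hρ : xiFun.mult ρ = 0
    · rw [(zeroExp_chain hRH).supp ρ hρ]; simp
    · have h1 : ρ = (1 / 2 : ℝ) + ρ.im * I := by
        conv_lhs => rw [← re_add_im ρ, hRH ρ hρ]
      have h2 : ρ * u = ((u / 2 : ℝ) : ℂ) + I * (ρ.im * u : ℝ) := by
        conv_lhs => rw [h1]
        push_cast; ring
      rw [h2, Complex.exp_add, Complex.ofReal_exp]; ring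
  rw [zeroSum, tsum_congr h, tsum_mul_left, re_ofReal_mul, lineSum]
  ring

theorem summable_lineSum (hRH : ∀ ρ, xiFun.mult ρ ≠ 0 → ρ.re = 1 / 2)
    (u : ℝ) : Summable fun ρ => chainCoeff ρ * cexp (I * (ρ.im * u : ℝ)) := by
  refine Summable.of_norm ?_
  refine (congrArg Summable (funext fun ρ => ?_)).mp (zeroExp_chain hRH).zeroExp.coeff.summable
  rw [norm_mul, mul_comm I, norm_exp_ofReal_mul_I, mul_one]

theorem abs_lineSum_sub_le (hRH : ∀ ρ, xiFun.mult ρ ≠ 0 → ρ.re = 1 / 2)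
    {u v S : ℝ} {d : ℂ → ℝ}
    (hd : ∀ ρ, xiFun.mult ρ ≠ 0 → ‖cexp (I * (ρ.im * u : ℝ)) - cexp (I * (ρ.im * v : ℝ))‖ ≤ d ρ)
    (hs : Summable fun ρ => (xiFun.mult ρ : ℝ) * (d ρ * xiFun.decay ρ))
    (hS : ∑' ρ, (xiFun.mult ρ : ℝ) * (d ρ * xiFun.decay ρ) ≤ S) :
    |lineSum u - lineSum v| ≤ S := by
  have e : lineSum u - lineSum v =
      -(∑' ρ : ℂ, (chainCoeff ρ * cexp (I * (ρ.im * u : ℝ)) -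
        chainCoeff ρ * cexp (I * (ρ.im * v : ℝ)))).re := by
    rw [(summable_lineSum hRH u).tsum_sub (summable_lineSum hRH v), sub_re, lineSum, lineSum]; ring
  rw [e, abs_neg]
  refine (abs_re_le_norm _).trans ((tsum_of_norm_bounded hs.hasSum fun ρ => ?_).trans hS)
  rw [← mul_sub, norm_mul]
  by_cases hρ : xiFun.mult ρ = 0
  · rw [(zeroExp_chain hRH).supp ρ hρ]; simp [hρ]
  · calc _ ≤ (xiFun.mult ρ * xiFun.decay ρ) * d ρ :=
        mul_le_mul (xiFun.norm_chainCoeff_le hRH ρ) (hd ρ hρ) (norm_nonneg _)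
          (mul_nonneg (Nat.cast_nonneg _) (xiFun.decay_pos ρ).le)
      _ = _ := by ring

theorem abs_lineSum_sub_le_mul (hRH : ∀ ρ, xiFun.mult ρ ≠ 0 → ρ.re = 1 / 2)
    (u v : ℝ) : |lineSum u - lineSum v| ≤ 218.1 / 10 ^ 13 * |u - v| := by
  obtain ⟨h1, h2⟩ := xiFun.tsum_lip_le hRH
  have e : (fun ρ => (xiFun.mult ρ : ℝ) * (|ρ.im| * |u - v| * xiFun.decay ρ)) =
      fun ρ => (xiFun.mult ρ : ℝ) * (|ρ.im| * xiFun.decay ρ) * |u - v| := by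
    funext ρ; ring
  refine abs_lineSum_sub_le hRH (d := fun ρ => |ρ.im| * |u - v|) (fun ρ _ => ?_) ?_ ?_
  · refine (norm_exp_sub_exp_le _ _).trans (le_of_eq ?_)
    rw [← mul_sub, abs_mul]
  · rw [e]; exact h1.mul_right _
  · rw [e, tsum_mul_right]
    exact mul_le_mul_of_nonneg_right h2 (abs_nonneg _)

theorem abs_expInt_chain_le (hRH : ∀ ρ, xiFun.mult ρ ≠ 0 → ρ.re = 1 / 2)
    {u : ℝ} (hu : 0 ≤ u) :
    |expInt 1 chainSix u + Real.exp (u / 2) * lineSum u - chainConst| ≤ 2 / 10 ^ 9 * Real.exp (-u) := by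
  have h := (zeroExp_chain hRH).zeroExp.bound u hu
  rw [zeroSum_chainCoeff hRH, one_mul, sub_neg_eq_add] at h
  exact h

theorem chainConst_bounds : -111188468276119 - 900000 ≤ 10 ^ 24 * chainConst ∧
    10 ^ 24 * chainConst ≤ -111188468276119 + 900000 := by
  obtain ⟨h1, h2⟩ := log_pi_bounds
  have h3 := Real.log_two_gt_d9
  have h4 := Real.log_two_lt_d9
  rw [chainConst, Real.log_mul (by norm_num) Real.pi_ne_zero]
  constructor <;> linarith

namespace ChainFix

theorem windowTest_sums {X : ℕ} (h0 : 0 < X) (hX : X ≤ 2970) : windowTest X (sums X) = true :=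
  of_scan 2970 0 scan_windowTest X h0 (by omega)

theorem sqrt_le_linear (x : ℝ) (hx : 0 ≤ x) : 420 * √x ≤ 4 * x + 11025 := by
  nlinarith [Real.sq_sqrt hx, sq_nonneg (2 * √x - 105)]

theorem lineSum_log_bounds (hRH : ∀ ρ, xiFun.mult ρ ≠ 0 → ρ.re = 1 / 2)
    {X : ℕ} (h0 : 0 < X) (hX : X < 2 ^ 12) :
    X * (constLow - value X (sums X) : ℝ) - 2000000000000000 ≤
        10 ^ 24 * (X * (√X * lineSum (Real.log X))) ∧
      10 ^ 24 * (X * (√X * lineSum (Real.log X))) ≤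
        X * (constLow + 2000000 - value X (sums X) : ℝ) + 2000000000000000 := by
  have hXp : (0 : ℝ) < X := by exact_mod_cast h0
  have h1 : (1 : ℝ) ≤ X := by exact_mod_cast h0
  have h := abs_expInt_chain_le hRH (Real.log_nonneg h1)
  rw [Real.exp_neg, Real.exp_log hXp, ← Real.log_sqrt hXp.le, Real.exp_log (Real.sqrt_pos.mpr hXp)] at h
  have hv := abs_sub_value_le h0 hX
  obtain ⟨k1, k2⟩ := chainConst_bounds
  generalize expInt 1 chainSix (Real.log X) = F at h hv
  generalize (value X (sums X) : ℝ) = f at hv ⊢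
  generalize √(X : ℝ) * lineSum (Real.log X) = v at h ⊢
  have hc : (constLow : ℝ) = -111188469276119 := by norm_num [constLow]
  rw [hc]
  have h' : |10 ^ 24 * (X * (F + v - chainConst))| ≤ 2000000000000000 := by
    rw [abs_mul, abs_mul, abs_of_pos hXp, abs_of_pos (by positivity : (0 : ℝ) < 10 ^ 24)]
    calc (10 : ℝ) ^ 24 * (X * |F + v - chainConst|) ≤ 10 ^ 24 * (X * (2 / 10 ^ 9 * (X : ℝ)⁻¹)) := by
          gcongr
      _ = _ := by field_simp; norm_num
  rw [abs_le] at h' hv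
  have a1 : X * (10 ^ 24 * F) ≤ X * (f + 1000) := by gcongr; linarith [hv.2]
  have a2 : X * (f - 1000) ≤ X * (10 ^ 24 * F) := by gcongr; linarith [hv.1]
  have a3 : X * (10 ^ 24 * chainConst) ≤ X * (-111188468276119 + 900000) := by gcongr
  have a4 : X * (-111188468276119 - 900000) ≤ X * (10 ^ 24 * chainConst) := by gcongr
  constructor <;> linarith [h'.1, h'.2]

theorem le_lineSum_of_even (hRH : ∀ ρ, xiFun.mult ρ ≠ 0 → ρ.re = 1 / 2)
    {X : ℕ} (hX : 2640 ≤ X) (hX' : X ≤ 2970) (h2 : X % 2 = 0) :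
    0.6 / 10 ^ 13 + 218.1 / 10 ^ 13 * (2 / X) ≤ lineSum (Real.log X) := by
  have ht := windowTest_sums (X := X) (by omega) hX'
  have hlt : Nat.blt X 2640 = false := by
    rw [Bool.eq_false_iff, ne_eq, Nat.blt_eq]; omega
  simp only [windowTest, hlt, h2, Bool.and_eq_true, Bool.false_or] at ht
  have hp : posTest X (sums X) = true := by simpa using ht.1.1.1
  rw [posTest, decide_eq_true_eq, ← Int.cast_le (R := ℝ)] at hp
  have hb := (lineSum_log_bounds hRH (X := X) (by omega) (by omega)).1
  push_cast at hp
  generalize (value X (sums X) : ℝ) = f at *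
  generalize (constLow : ℝ) = c at *
  have hXp : (0 : ℝ) < X := by exact_mod_cast (show 0 < X by omega)
  have hs := sqrt_le_linear X hXp.le
  have hsp := Real.sqrt_pos.mpr hXp
  have hm : √X * (X * 60000000000 + 2 * 21810000000000) ≤ 10 ^ 24 * (X * (√X * lineSum (Real.log X))) := by
    nlinarith [mul_le_mul_of_nonneg_right hs (by positivity :
      (0 : ℝ) ≤ X * 60000000000 + 2 * 21810000000000)]
  have hm' : X * 60000000000 + 2 * 21810000000000 ≤ 10 ^ 24 * (X * lineSum (Real.log X)) := by
    refine le_of_mul_le_mul_left (hm.trans (le_of_eq ?_)) hsp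
    ring
  have e : (0.6 / 10 ^ 13 + 218.1 / 10 ^ 13 * (2 / X) : ℝ) =
      (X * 60000000000 + 2 * 21810000000000) / (10 ^ 24 * X) := by
    field_simp; norm_num; ring
  rw [e, div_le_iff₀ (by positivity)]
  linarith

theorem le_of_peakTest (hRH : ∀ ρ, xiFun.mult ρ ≠ 0 → ρ.re = 1 / 2)
    {X : ℕ} (h0 : 0 < X) (hX : X < 2 ^ 12) (hp : peakTest X (sums X) = true) :
    11 / (420 * 10 ^ 6) ≤ X * (√X * (lineSum (Real.log X) - 0.6 / 10 ^ 13)) := by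
  rw [peakTest, decide_eq_true_eq, ← Int.cast_le (R := ℝ)] at hp
  have hb := (lineSum_log_bounds hRH h0 hX).1
  push_cast at hp
  generalize (value X (sums X) : ℝ) = f at *
  generalize (constLow : ℝ) = c at *
  have hs := mul_le_mul_of_nonneg_left (sqrt_le_linear X (Nat.cast_nonneg X)) (Nat.cast_nonneg X)
  rw [← mul_le_mul_iff_right₀ (by norm_num : (0 : ℝ) < 420 * 10 ^ 24)]
  linarith

theorem le_of_troughTest (hRH : ∀ ρ, xiFun.mult ρ ≠ 0 → ρ.re = 1 / 2)
    {X : ℕ} (h0 : 0 < X) (hX : X < 2 ^ 12) (hp : troughTest X (sums X) = true) :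
    X * (√X * (lineSum (Real.log X) + 0.6 / 10 ^ 13)) ≤ 11 / (420 * 10 ^ 6) := by
  rw [troughTest, decide_eq_true_eq, ← Int.cast_le (R := ℝ)] at hp
  have hb := (lineSum_log_bounds hRH h0 hX).2
  push_cast at hp
  generalize (value X (sums X) : ℝ) = f at *
  generalize (constLow : ℝ) = c at *
  have hs := mul_le_mul_of_nonneg_left (sqrt_le_linear X (Nat.cast_nonneg X)) (Nat.cast_nonneg X)
  rw [← mul_le_mul_iff_right₀ (by norm_num : (0 : ℝ) < 420 * 10 ^ 24)]
  linarith

theorem peakTest_left : peakTest 2640 (sums 2640) = true := by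
  have h := windowTest_sums (X := 2640) (by norm_num) (by norm_num)
  simp only [windowTest, Bool.and_eq_true] at h
  simpa using h.1.1.2

theorem peakTest_right : peakTest 2970 (sums 2970) = true := by
  have h := windowTest_sums (X := 2970) (by norm_num) (by norm_num)
  simp only [windowTest, Bool.and_eq_true] at h
  simpa using h.1.2

theorem troughTest_middle : troughTest 2780 (sums 2780) = true := by
  have h := windowTest_sums (X := 2780) (by norm_num) (by norm_num)
  simp only [windowTest, Bool.and_eq_true] at h
  simpa using h.2

end ChainFix

theorem le_lineSum_of_mem_window (hRH : ∀ ρ, xiFun.mult ρ ≠ 0 → ρ.re = 1 / 2) {u : ℝ}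
    (h1 : Real.log 2640 ≤ u) (h2 : u ≤ Real.log 2970) : 0.6 / 10 ^ 13 ≤ lineSum u := by
  set n := ⌊Real.exp u⌋₊ with hn
  have e1 : 2640 ≤ Real.exp u := (Real.log_le_iff_le_exp (by norm_num)).mp h1
  have e2 : Real.exp u ≤ 2970 := (Real.le_log_iff_exp_le (by norm_num)).mp h2
  have n1 : 2640 ≤ n := Nat.le_floor (by exact_mod_cast e1)
  have n2 : n ≤ 2970 := by
    have := Nat.floor_le_floor e2
    simpa [hn] using this
  set X := 2 * (n / 2) with hX
  have hXn : X ≤ n ∧ n + 1 ≤ X + 2 := by omega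
  have hXp : (0 : ℝ) < X := by exact_mod_cast (show 0 < X by omega)
  have l1 : (X : ℝ) ≤ Real.exp u :=
    (Nat.cast_le.mpr hXn.1).trans (Nat.floor_le (Real.exp_pos u).le)
  have l2 : Real.exp u ≤ X + 2 := by
    refine (Nat.lt_floor_add_one _).le.trans ?_
    exact_mod_cast hXn.2
  have g1 : Real.log X ≤ u := (Real.log_le_iff_le_exp hXp).mpr l1
  have g2 : u - Real.log X ≤ 2 / X := by
    have : u ≤ Real.log (X * (1 + 2 / X)) := by
      rw [Real.le_log_iff_exp_le (by positivity)]
      refine l2.trans (le_of_eq ?_)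
      field_simp
    rw [Real.log_mul hXp.ne' (by positivity)] at this
    have := Real.log_le_sub_one_of_pos (show (0 : ℝ) < 1 + 2 / X by positivity)
    linarith
  have h3 := ChainFix.le_lineSum_of_even hRH (X := X) (by omega) (by omega) (by omega)
  have h4 := (abs_le.mp (abs_lineSum_sub_le_mul hRH u (Real.log X))).1
  rw [abs_of_nonneg (by linarith)] at h4
  have := mul_le_mul_of_nonneg_left g2 (by norm_num : (0 : ℝ) ≤ 218.1 / 10 ^ 13)
  linarith

end

section

open Complex ComplexConjugate

/-- The index of the arc of length `1 / n` containing `x` modulo `1`. -/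
noncomputable def arcIndex (n : ℕ) (x : ℝ) : ℕ := ⌊n * Int.fract x⌋₊

theorem arcIndex_lt {n : ℕ} (hn : 1 ≤ n) (x : ℝ) : arcIndex n x < n := by
  have hn' : (0 : ℝ) < n := by exact_mod_cast hn
  rw [arcIndex, Nat.floor_lt (mul_nonneg hn'.le (Int.fract_nonneg x))]
  nlinarith [Int.fract_lt_one x]

theorem exists_abs_sub_sub_le_of_arcIndex_eq {n : ℕ} (hn : 1 ≤ n) {x y : ℝ}
    (h : arcIndex n x = arcIndex n y) : ∃ m : ℤ, |x - y - m| ≤ 1 / n := by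
  have hn' : (0 : ℝ) < n := by exact_mod_cast hn
  refine ⟨⌊x⌋ - ⌊y⌋, ?_⟩
  have e : x - y - ((⌊x⌋ - ⌊y⌋ : ℤ) : ℝ) = Int.fract x - Int.fract y := by
    rw [Int.fract, Int.fract]; push_cast; ring
  have hx := Nat.floor_le (mul_nonneg hn'.le (Int.fract_nonneg x))
  have hx' := Nat.lt_floor_add_one (n * Int.fract x)
  have hy := Nat.floor_le (mul_nonneg hn'.le (Int.fract_nonneg y))
  have hy' := Nat.lt_floor_add_one (n * Int.fract y)
  rw [arcIndex, arcIndex] at h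
  rw [h] at hx hx'
  rw [e, le_div_iff₀ hn', ← abs_of_pos hn', ← abs_mul, abs_le]
  constructor <;> nlinarith

theorem norm_exp_sub_exp_le_two (x y : ℝ) : ‖cexp (I * x) - cexp (I * y)‖ ≤ 2 := by
  refine (norm_sub_le _ _).trans ?_
  rw [mul_comm I, mul_comm I, norm_exp_ofReal_mul_I, norm_exp_ofReal_mul_I]
  norm_num

theorem norm_exp_sub_exp_le_of_mod {x y δ : ℝ} (m : ℤ) (h : |x - y - m * (2 * Real.pi)| ≤ δ) :
    ‖cexp (I * x) - cexp (I * y)‖ ≤ δ := by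
  have e : cexp (I * x) = cexp (I * (x - m * (2 * Real.pi) : ℝ)) := by
    rw [Complex.exp_eq_exp_iff_exists_int]
    exact ⟨m, by push_cast; ring⟩
  rw [e]
  refine (norm_exp_sub_exp_le _ _).trans (le_of_eq_of_le ?_ h)
  congr 1
  ring

/-- A common return time of the phases, for the tolerances encoded by `xiFun.cellsAt`. -/
def IsReturn (s : Finset ℂ) (d : ℕ) : Prop :=
  ∀ ρ ∈ s, ∃ m : ℤ, |ρ.im * ((d : ℝ) / 8) - m * (2 * Real.pi)| ≤ 2 * Real.pi / xiFun.cellsAt ρ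

theorem exists_isReturn (s : Finset ℂ) (hs : ∀ ρ ∈ s, 1 ≤ xiFun.cellsAt ρ) (J : ℕ) :
    ∃ A : Finset ℕ, (∀ d ∈ A, d < J ∧ IsReturn s d) ∧ J ≤ (∏ ρ ∈ s, xiFun.cellsAt ρ) * A.card := by
  classical
  set phase : ℕ → ℂ → ℝ := fun i ρ => ρ.im * ((i : ℝ) / 8) / (2 * Real.pi) with hphase
  set M := ∏ ρ ∈ s, xiFun.cellsAt ρ with hM
  have hMpos : 0 < M := Finset.prod_pos fun ρ hρ => hs ρ hρ
  rcases Nat.eq_zero_or_pos J with rfl | hJ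
  · exact ⟨∅, by simp, by simp⟩
  set t := s.pi fun ρ => Finset.range (xiFun.cellsAt ρ) with ht
  set cell : ℕ → (∀ ρ ∈ s, ℕ) := fun i ρ _ => arcIndex (xiFun.cellsAt ρ) (phase i ρ) with hcell
  have hmaps : ∀ i ∈ Finset.range J, cell i ∈ t := by
    intro i _
    rw [ht, Finset.mem_pi]
    exact fun ρ hρ => Finset.mem_range.mpr (arcIndex_lt (hs ρ hρ) _)
  have htcard : t.card = M := by rw [ht, Finset.card_pi]; simp [hM]
  have hne : t.Nonempty := Finset.card_pos.mp (htcard ▸ hMpos)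
  obtain ⟨f, -, hf⟩ := Finset.exists_le_card_fiber_of_nsmul_le_card_of_maps_to (M := ℚ) (b := (J : ℚ) / M)
    hmaps hne (by
      rw [htcard, nsmul_eq_mul, Finset.card_range]
      exact (mul_div_cancel₀ _ (by positivity)).le)
  set A := {i ∈ Finset.range J | cell i = f} with hA
  have hcard : J ≤ M * A.card := by
    rw [div_le_iff₀ (by positivity)] at hf
    rw [mul_comm]
    exact_mod_cast hf
  have hAne : A.Nonempty := by
    rw [← Finset.card_pos]
    by_contra h
    have : A.card = 0 := by omega
    rw [this] at hcard
    omega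
  set i₀ := A.min' hAne with hi₀
  have hi₀A : i₀ ∈ A := A.min'_mem hAne
  refine ⟨A.image (· - i₀), ?_, ?_⟩
  · intro d hd
    obtain ⟨i, hi, rfl⟩ := Finset.mem_image.mp hd
    have hle : i₀ ≤ i := A.min'_le i hi
    rw [hA, Finset.mem_filter, Finset.mem_range] at hi hi₀A
    refine ⟨by omega, fun ρ hρ => ?_⟩
    have hc : cell i ρ hρ = cell i₀ ρ hρ := by rw [hi.2, hi₀A.2]
    obtain ⟨m, hm⟩ := exists_abs_sub_sub_le_of_arcIndex_eq (hs ρ hρ) hc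
    refine ⟨m, ?_⟩
    have e : ρ.im * (((i - i₀ : ℕ) : ℝ) / 8) - m * (2 * Real.pi) =
        2 * Real.pi * (phase i ρ - phase i₀ ρ - m) := by
      rw [Nat.cast_sub hle, hphase]
      have := Real.pi_ne_zero
      field_simp
    rw [e, abs_mul, abs_of_pos Real.two_pi_pos, div_eq_mul_one_div]
    exact mul_le_mul_of_nonneg_left hm Real.two_pi_pos.le
  · rw [Finset.card_image_of_injOn]
    · exact hcard
    · intro i hi j hj hij
      have h1 := A.min'_le i hi
      have h2 := A.min'_le j hj
      simp only at hij
      omega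

theorem exists_return_set (hRH : ∀ ρ, xiFun.mult ρ ≠ 0 → ρ.re = 1 / 2) :
    ∃ s : Finset ℂ, (∀ ρ ∈ s, xiFun.mult ρ ≠ 0 ∧ 0 < ρ.im) ∧
    ∀ ρ, xiFun.mult ρ ≠ 0 → 0 < ρ.im → xiFun.cellsAt ρ ≠ 1 → ρ ∈ s := by
  classical
  obtain ⟨R, hR⟩ := xiFun.exists_stepFun_eq_one 55 193
  refine ⟨{ρ ∈ (xiFun.finite_norm_le (|R| + 1)).toFinset | 0 < ρ.im}, fun ρ hρ => ?_, fun ρ h1 h2 h3 => ?_⟩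
  · rw [Finset.mem_filter, Set.Finite.mem_toFinset] at hρ
    exact ⟨hρ.1.1, hρ.2⟩
  · rw [Finset.mem_filter, Set.Finite.mem_toFinset]
    refine ⟨⟨h1, ?_⟩, h2⟩
    have h4 : 1 / 4 + ρ.im ^ 2 < R := by
      by_contra! h
      exact h3 (hR _ h)
    refine le_of_sq_le_sq ?_ (by positivity)
    rw [← Complex.normSq_eq_norm_sq, Complex.normSq_apply, hRH ρ h1]
    nlinarith [le_abs_self R, abs_nonneg R]

theorem abs_lineSum_add_sub_le (hRH : ∀ ρ, xiFun.mult ρ ≠ 0 → ρ.re = 1 / 2)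
    {s : Finset ℂ}
    (hs : ∀ ρ, xiFun.mult ρ ≠ 0 → 0 < ρ.im → xiFun.cellsAt ρ ≠ 1 → ρ ∈ s) {d : ℕ} (hd : IsReturn s d)
    (u : ℝ) : |lineSum (u + d / 8) - lineSum u| ≤ 0.5749 / 10 ^ 13 := by
  obtain ⟨h1, h2⟩ := xiFun.tsum_osc_le hRH
  refine abs_lineSum_sub_le hRH (d := fun ρ => xiFun.osc (xiFun.cellsAt ρ)) (fun ρ hρ => ?_) h1 h2
  by_cases hc : xiFun.cellsAt ρ = 1
  · rw [hc, xiFun.osc, if_pos rfl]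
    exact norm_exp_sub_exp_le_two _ _
  have hn : (0 : ℝ) < xiFun.cellsAt ρ := by exact_mod_cast (xiFun.cellsAt_spec hRH hρ).1
  have hosc : 2 * Real.pi / xiFun.cellsAt ρ ≤ xiFun.osc (xiFun.cellsAt ρ) := by
    rw [xiFun.osc, if_neg hc, div_le_div_iff₀ hn (by positivity)]
    have : Real.pi ≤ 355 / 113 := by linarith [Real.pi_lt_d20]
    nlinarith
  obtain ⟨m, hm⟩ : ∃ m : ℤ, |ρ.im * ((d : ℝ) / 8) - m * (2 * Real.pi)| ≤
      2 * Real.pi / xiFun.cellsAt ρ := by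
    rcases lt_or_gt_of_ne (xiFun.im_ne_zero hρ) with h | h
    · have hconj : xiFun.cellsAt (conj ρ) = xiFun.cellsAt ρ := by simp [xiFun.cellsAt]
      obtain ⟨m, hm⟩ := hd (conj ρ) (hs _ (by rwa [xiFun.mult_conj]) (by simpa using h) (by rwa [hconj]))
      refine ⟨-m, ?_⟩
      rw [hconj, conj_im] at hm
      rw [← abs_neg]
      refine le_of_eq_of_le ?_ hm
      congr 1
      push_cast; ring
    · exact hd ρ (hs ρ hρ h hc)
  refine norm_exp_sub_exp_le_of_mod m (le_of_eq_of_le ?_ (hm.trans hosc))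
  congr 1
  ring

theorem exists_returns (hRH : ∀ ρ, xiFun.mult ρ ≠ 0 → ρ.re = 1 / 2)
    (J : ℕ) : ∃ A : Finset ℕ, (∀ d ∈ A, d < J ∧ 64 ≤ d ∧
    ∀ u, |lineSum (u + d / 8) - lineSum u| ≤ 0.5749 / 10 ^ 13) ∧
      (J : ℝ) ≤ 8 * 10 ^ 30 * (A.card + 64) := by
  classical
  obtain ⟨s, hs, hs'⟩ := exists_return_set hRH
  obtain ⟨A, hA, hcard⟩ := exists_isReturn s (fun ρ hρ => (xiFun.cellsAt_spec hRH (hs ρ hρ).1).1) J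
  refine ⟨{d ∈ A | 64 ≤ d}, fun d hd => ?_, ?_⟩
  · rw [Finset.mem_filter] at hd
    exact ⟨(hA d hd.1).1, hd.2, abs_lineSum_add_sub_le hRH hs' (hA d hd.1).2⟩
  · have h1 : A.card ≤ ({d ∈ A | 64 ≤ d}).card + 64 := by
      rw [← Finset.card_filter_add_card_filter_not (s := A) (p := fun d => 64 ≤ d)]
      gcongr
      calc _ ≤ (Finset.range 64).card := Finset.card_le_card fun d hd => by
            rw [Finset.mem_filter] at hd
            exact Finset.mem_range.mpr (by omega)
        _ = 64 := Finset.card_range 64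
    have h2 := xiFun.prod_cellsAt_le hRH s hs
    calc (J : ℝ) ≤ ((∏ ρ ∈ s, xiFun.cellsAt ρ : ℕ) : ℝ) * A.card := by exact_mod_cast hcard
      _ ≤ 8 * 10 ^ 30 * (({d ∈ A | 64 ≤ d}).card + 64) := by
        gcongr
        exact_mod_cast h1

end

section

open Complex ComplexConjugate

theorem locInt_chainSix : LocInt chainSix :=
  locInt_expInt (locInt_expInt (locInt_expInt (locInt_expInt (locInt_expInt (locInt_expInt
    locInt_psiErr 49) 48) 50) 51) 52) 53

theorem AltBy.of_chainSix {t s : ℝ} {n : ℕ} (h : AltBy chainSix t n s) : AltBy psiErr t n s := by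
  have h0 := locInt_psiErr
  have h1 := locInt_expInt h0 49
  have h2 := locInt_expInt h1 48
  have h3 := locInt_expInt h2 50
  have h4 := locInt_expInt h3 51
  have h5 := locInt_expInt h4 52
  exact (((((AltBy.of_expInt h5 h).of_expInt h4).of_expInt h3).of_expInt h2).of_expInt h1).of_expInt h0

/-- The primitive of `exp u * chainSix u`. -/
noncomputable def chainPrim (u : ℝ) : ℝ := Real.exp (1 * u) * expInt 1 chainSix u

theorem abs_chainPrim_le (hRH : ∀ ρ, xiFun.mult ρ ≠ 0 → ρ.re = 1 / 2)
    {u : ℝ} (hu : 0 ≤ u) :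
    |chainPrim u + Real.exp u * (Real.exp (u / 2) * lineSum u) - chainConst * Real.exp u| ≤
      2 / 10 ^ 9 := by
  have h := mul_le_mul_of_nonneg_left (abs_expInt_chain_le hRH hu) (Real.exp_pos u).le
  rw [← abs_of_pos (Real.exp_pos u), ← abs_mul, abs_of_pos (Real.exp_pos u), mul_left_comm,
    ← Real.exp_add, add_neg_cancel, Real.exp_zero, mul_one] at h
  refine le_of_eq_of_le ?_ h
  rw [chainPrim, one_mul]
  congr 1
  ring

theorem abs_chainPrim_log_add_le (hRH : ∀ ρ, xiFun.mult ρ ≠ 0 → ρ.re = 1 / 2)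
    {X τ : ℝ} (hX : 1 ≤ X) (hτ : 0 ≤ τ) :
    |chainPrim (Real.log X + τ) + Real.exp τ * Real.exp (τ / 2) * (X * (√X * lineSum (Real.log X + τ))) -
      chainConst * (X * Real.exp τ)| ≤ 2 / 10 ^ 9 := by
  have hX0 : 0 < X := by linarith
  have h := abs_chainPrim_le hRH (u := Real.log X + τ) (add_nonneg (Real.log_nonneg hX) hτ)
  rw [add_div, Real.exp_add, Real.exp_add, Real.exp_log hX0, ← Real.log_sqrt hX0.le,
    Real.exp_log (Real.sqrt_pos.mpr hX0)] at h
  refine le_of_eq_of_le ?_ h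
  congr 1
  ring

theorem chainPrim_neg (hRH : ∀ ρ, xiFun.mult ρ ≠ 0 → ρ.re = 1 / 2)
    {τ : ℝ} (hτ : 8 ≤ τ) (hret : ∀ u, |lineSum (u + τ) - lineSum u| ≤ 0.5749 / 10 ^ 13)
    {u : ℝ} (h1 : Real.log 2640 + τ ≤ u) (h2 : u ≤ Real.log 2970 + τ) :
    0 < -1 * chainPrim u := by
  have hlog : 0 ≤ Real.log 2640 := Real.log_nonneg (by norm_num)
  have hu : 8 ≤ u := by linarith
  have hV : 0 ≤ lineSum u := by
    have h3 := le_lineSum_of_mem_window hRH (u := u - τ) (by linarith) (by linarith)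
    have h4 := (abs_le.mp (hret (u - τ))).1
    rw [sub_add_cancel] at h4
    linarith
  have h3 := (abs_le.mp (abs_chainPrim_le hRH (by linarith : 0 ≤ u))).2
  have h4 : 0 ≤ Real.exp u * (Real.exp (u / 2) * lineSum u) := by positivity
  have h5 : (100 : ℝ) ≤ Real.exp u := by
    refine le_trans ?_ (Real.exp_le_exp.mpr hu)
    have := Real.exp_one_gt_d9
    rw [show (8 : ℝ) = (8 : ℕ) * 1 by norm_num, Real.exp_nat_mul]
    calc (100 : ℝ) ≤ 2.7 ^ 8 := by norm_num
      _ ≤ Real.exp 1 ^ 8 := by gcongr; linarith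
  have h6 := chainConst_bounds.2
  nlinarith

theorem chainPrim_lt (hRH : ∀ ρ, xiFun.mult ρ ≠ 0 → ρ.re = 1 / 2)
    {τ : ℝ} (hτ : 8 ≤ τ) (hret : ∀ u, |lineSum (u + τ) - lineSum u| ≤ 0.5749 / 10 ^ 13)
    {X Y : ℕ} (hX : 2000 ≤ X) (hY : 2000 ≤ Y) (hYX : Y ≤ X + 140) (hX' : X < 2 ^ 12)
    (hY' : Y < 2 ^ 12) (hp : ChainFix.peakTest X (ChainFix.sums X) = true)
    (ht : ChainFix.troughTest Y (ChainFix.sums Y) = true) :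
    0 < -1 * (chainPrim (Real.log X + τ) - chainPrim (Real.log Y + τ)) := by
  have p := ChainFix.le_of_peakTest hRH (by omega) hX' hp
  have t := ChainFix.le_of_troughTest hRH (by omega) hY' ht
  have x2 : (2000 : ℝ) ≤ X := by exact_mod_cast hX
  have y2 : (2000 : ℝ) ≤ Y := by exact_mod_cast hY
  have hyx : (Y : ℝ) ≤ X + 140 := by exact_mod_cast hYX
  have ex := (abs_le.mp (abs_chainPrim_log_add_le hRH (X := X) (τ := τ) (by linarith) (by linarith))).2
  have ey := (abs_le.mp (abs_chainPrim_log_add_le hRH (X := Y) (τ := τ) (by linarith) (by linarith))).1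
  have hx := (abs_le.mp (hret (Real.log X))).1
  have hy := (abs_le.mp (hret (Real.log Y))).2
  have sx : 40 ≤ √(X : ℝ) := Real.le_sqrt_of_sq_le (by linarith)
  have sy : 40 ≤ √(Y : ℝ) := Real.le_sqrt_of_sq_le (by linarith)
  have mx : (80000 : ℝ) ≤ X * √X := by nlinarith
  have my : (80000 : ℝ) ≤ Y * √Y := by nlinarith
  have bx : 11 / (420 * 10 ^ 6) + 80000 * (0.0251 / 10 ^ 13) ≤
      X * (√X * lineSum (Real.log X + τ)) := by
    have h1 : X * √X * (lineSum (Real.log X) - 0.5749 / 10 ^ 13) ≤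
      X * √X * lineSum (Real.log X + τ) := by gcongr; linarith
    have h2 := mul_le_mul_of_nonneg_right mx (by norm_num : (0 : ℝ) ≤ 0.0251 / 10 ^ 13)
    linarith
  have bY : Y * (√Y * lineSum (Real.log Y + τ)) ≤ 11 / (420 * 10 ^ 6) - 80000 * (0.0251 / 10 ^ 13) := by
    have h1 : Y * √Y * lineSum (Real.log Y + τ) ≤
      Y * √Y * (lineSum (Real.log Y) + 0.5749 / 10 ^ 13) := by gcongr; linarith
    have h2 := mul_le_mul_of_nonneg_right my (by norm_num : (0 : ℝ) ≤ 0.0251 / 10 ^ 13)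
    linarith
  have he : (50 : ℝ) ≤ Real.exp (τ / 2) := by
    refine le_trans ?_ (Real.exp_le_exp.mpr (by linarith : (4 : ℝ) ≤ τ / 2))
    have := Real.exp_one_gt_d9
    rw [show (4 : ℝ) = (4 : ℕ) * 1 by norm_num, Real.exp_nat_mul]
    calc (50 : ℝ) ≤ 2.7 ^ 4 := by norm_num
      _ ≤ Real.exp 1 ^ 4 := by gcongr; linarith
  have hE : 1 ≤ Real.exp τ := Real.one_le_exp (by linarith)
  generalize (X : ℝ) * (√X * lineSum (Real.log X + τ)) = a at *
  generalize (Y : ℝ) * (√Y * lineSum (Real.log Y + τ)) = b at *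
  have hab : 160000 * (0.0251 / 10 ^ 13) ≤ a - b := by linarith
  have hg : Real.exp τ * 50 * (160000 * (0.0251 / 10 ^ 13)) ≤ Real.exp τ * Real.exp (τ / 2) * (a - b) := by
    gcongr
  obtain ⟨k1, k2⟩ := chainConst_bounds
  have hk : chainConst * ((Y : ℝ) - X) ≥ chainConst * 140 :=
    mul_le_mul_of_nonpos_left (by linarith) (by linarith)
  have hk' : Real.exp τ * (chainConst * 140) ≤ Real.exp τ * (chainConst * (Y - X)) := by gcongr
  have hfin : 4 / 10 ^ 9 * 1 < Real.exp τ * (50 * (160000 * (0.0251 / 10 ^ 13)) + chainConst * 140) := by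
    nlinarith
  linarith

theorem altUpTo_expInt_chain (hRH : ∀ ρ, xiFun.mult ρ ≠ 0 → ρ.re = 1 / 2) {ε : ℝ} (hε : 0 < ε) :
    ∃ U₀ : ℝ, ∀ U ≥ U₀, ∃ n : ℕ, AltUpTo (expInt 1 chainSix) U n ∧
      (sInf zetaOrdinates / Real.pi - ε) * U ≤ n := by
  obtain ⟨ρ₁, h1, hre1, him1, hinf, -, hle⟩ := xiFun.exists_first
  have hz := zeroExp_chain hRH
  have hc : ∀ ρ : ℂ, chainCoeff ρ ≠ 0 → xiFun.mult ρ ≠ 0 := fun ρ h h' => h (hz.supp ρ h')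
  rw [← hinf]
  exact (hz.zeroExp.flatten zero_le_one).altUpTo chainCoeff_conj
    (fun R => (xiFun.finite_norm_add_le 1 R).subset fun σ hσ => ⟨hc σ hσ.1, by simpa using hσ.2⟩)
    le_rfl (chainCoeff_ne_zero h1) (by rw [hre1]; norm_num) him1 (fun ρ hρ _ => hle ρ (hc ρ hρ)) hε

theorem altBy_psiErr_add (hRH : ∀ ρ, xiFun.mult ρ ≠ 0 → ρ.re = 1 / 2) {U s : ℝ} {n : ℕ}
    (h : AltBy (expInt 1 chainSix) U n s) :
    ∃ k : ℕ, AltBy psiErr U (n + 2 * k) s ∧ 2 / 10 ^ 30 * U ≤ 2 * k + 129 := by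
  obtain ⟨x, hxU, hx⟩ := h
  obtain ⟨A, hA, hcard⟩ := exists_returns hRH ⌊8 * (U - 9)⌋₊
  have hfin : (Set.ofPred (· ∈ A)).Finite := A.finite_toSet
  have hcardA : hfin.toFinset.card = A.card := by
    congr 1
    ext d
    simp
  set e : ℕ → ℕ := Nat.nth (· ∈ A) with he
  have hmem : ∀ i < A.card, e i ∈ A := fun i hi => Nat.nth_mem_of_lt_card hfin (by rwa [hcardA])
  have hmono : ∀ i, i + 1 < A.card → e i + 1 ≤ e (i + 1) := fun i hi =>
    Nat.nth_lt_nth' (Nat.lt_succ_self i) fun hf => by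
      have : hf.toFinset.card = A.card := hcardA
      omega
  have hτ : ∀ i < A.card, (8 : ℝ) ≤ (e i : ℝ) / 8 := fun i hi => by
    rw [le_div_iff₀ (by norm_num)]
    exact_mod_cast (hA _ (hmem i hi)).2.1
  have hret := fun i hi => (hA _ (hmem i hi)).2.2
  have hlog0 : 0 < Real.log 2640 := Real.log_pos (by norm_num)
  have hlog1 : Real.log 2640 < Real.log 2780 := Real.log_lt_log (by norm_num) (by norm_num)
  have hlog2 : Real.log 2780 < Real.log 2970 := Real.log_lt_log (by norm_num) (by norm_num)
  have hlog3 : Real.log 2970 ≤ Real.log 2640 + 1 / 8 := by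
    have := Real.log_le_sub_one_of_pos (show (0 : ℝ) < 2970 / 2640 by norm_num)
    rw [Real.log_div (by norm_num) (by norm_num)] at this
    linarith
  have hlog4 : Real.log 2970 ≤ 9 := by
    rw [Real.log_le_iff_le_exp (by norm_num), show (9 : ℝ) = (9 : ℕ) * 1 by norm_num, Real.exp_nat_mul]
    calc (2970 : ℝ) ≤ 2.7 ^ 9 := by norm_num
      _ ≤ Real.exp 1 ^ 9 := by gcongr; linarith [Real.exp_one_gt_d9]
  refine ⟨A.card, AltBy.of_chainSix ?_, ?_⟩
  · refine (rollePair_expInt locInt_chainSix 1).altBy_add_windows (Or.inr rfl)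
      (fun i => Real.log 2640 + (e i : ℝ) / 8) (fun i => Real.log 2780 + (e i : ℝ) / 8)
      (fun i => Real.log 2970 + (e i : ℝ) / 8) A.card (fun i hi => ?_) (fun i _ => ?_) (fun i _ => ?_)
      (fun i hi => ?_) (fun i hi y h1 h2 => ?_) (fun i hi => ?_) (fun i hi => ?_)
      (hx.congr_pos (p := fun u => Real.exp (1 * u)) (fun _ => Real.exp_pos _) fun _ => rfl) hxU
      fun i hi => ?_
    · positivity
    · linarith
    · linarith
    · have : (e i : ℝ) + 1 ≤ e (i + 1) := by exact_mod_cast hmono i hi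
      linarith
    · exact chainPrim_neg hRH (hτ i hi) (hret i hi) h1 h2
    · have := chainPrim_lt hRH (hτ i hi) (hret i hi) (X := 2640) (Y := 2780) (by norm_num) (by norm_num)
        (by norm_num) (by norm_num) (by norm_num) ChainFix.peakTest_left ChainFix.troughTest_middle
      exact_mod_cast this
    · have := chainPrim_lt hRH (hτ i hi) (hret i hi) (X := 2970) (Y := 2780) (by norm_num) (by norm_num)
        (by norm_num) (by norm_num) (by norm_num) ChainFix.peakTest_right ChainFix.troughTest_middle
      exact_mod_cast this
    · have h1 := (hA _ (hmem i hi)).1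
      have h2 : (e i : ℝ) ≤ 8 * (U - 9) := (Nat.lt_of_lt_floor h1).le
      linarith
  · have h1 := Nat.lt_floor_add_one (8 * (U - 9))
    have h2 : 8 * (U - 9) - 1 ≤ 8 * 10 ^ 30 * ((A.card : ℝ) + 64) := by linarith
    linarith

theorem altUpTo_psiErr_of_on_line (hRH : ∀ ρ, xiFun.mult ρ ≠ 0 → ρ.re = 1 / 2) {ε : ℝ}
    (hε : 0 < ε) : ∃ U₀ : ℝ, ∀ U ≥ U₀, ∃ n : ℕ, AltUpTo psiErr U n ∧
      (sInf zetaOrdinates / Real.pi + 1.867 * 10 ^ (-(30 : ℤ)) - ε) * U ≤ n := by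
  have hpos : 0 < sInf zetaOrdinates / Real.pi := by
    obtain ⟨ρ₁, -, -, him1, hinf, -⟩ := xiFun.exists_first
    rw [← hinf]
    exact div_pos him1 Real.pi_pos
  set g := sInf zetaOrdinates / Real.pi
  obtain ⟨U₀, hU⟩ := altUpTo_expInt_chain hRH (ε := min (ε / 2) (g / 2)) (by positivity)
  refine ⟨max U₀ (max 1 (258 / ε)), fun U hUU => ?_⟩
  obtain ⟨n, hn, hn'⟩ := hU U ((le_max_left _ _).trans hUU)
  have hU1 : 1 ≤ U := ((le_max_left _ _).trans (le_max_right _ _)).trans hUU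
  have hU2 : 258 / ε ≤ U := ((le_max_right _ _).trans (le_max_right _ _)).trans hUU
  rw [div_le_iff₀ hε] at hU2
  have hm1 : min (ε / 2) (g / 2) * U ≤ ε / 2 * U := by gcongr; exact min_le_left _ _
  have hm2 : min (ε / 2) (g / 2) * U ≤ g / 2 * U := by gcongr; exact min_le_right _ _
  have hgU : 0 < g * U := by positivity
  rcases hn with rfl | ⟨s, hs⟩
  · rw [Nat.cast_zero] at hn'
    linarith
  · obtain ⟨k, hk, hk'⟩ := altBy_psiErr_add hRH hs
    refine ⟨n + 2 * k, Or.inr ⟨s, hk⟩, ?_⟩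
    have h30 : (1.867 : ℝ) * 10 ^ (-(30 : ℤ)) * U ≤ 2 / 10 ^ 30 * U := by
      gcongr
      norm_num
    push_cast
    linarith

end

/-- The Morrill–Platt–Trudgian improvement of Kaczorowski's lower bound on sign changes of `ψ(x) − x`: with `γ₁ = inf` of the
ordinates of `ζ`, for every `ε > 0` and all sufficiently large `T` there are at least
`(γ₁/π + 1.867 × 10^{−30} − ε) log T` points `2 ≤ x₁ < ⋯ < x_N ≤ T` at which `ψ(x) − x` alternates in sign;
that is, `liminf W^ψ(T)/log T ≥ γ₁/π + 1.867 × 10^{−30}`. -/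
theorem sign_changes_psi_morrill_platt_trudgian :
    ∀ ε : ℝ, 0 < ε → ∃ T₀ : ℝ, ∀ T : ℝ, T₀ ≤ T →
      ∃ (N : ℕ) (x : ℕ → ℝ),
        (sInf zetaOrdinates / Real.pi + 1.867 * 10 ^ (-(30 : ℤ)) - ε) * Real.log T ≤ (N : ℝ) ∧
        (∀ i < N, 2 ≤ x i ∧ x i ≤ T) ∧
        (∀ i j, i < j → j < N → x i < x j) ∧
        (∀ i, i + 1 < N →
          (chebyshevPsi (x i) - x i) * (chebyshevPsi (x (i + 1)) - x (i + 1)) < 0) := by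
  refine sign_changes_of_altUpTo fun ε hε => ?_
  by_cases hRH : ∀ ρ, xiFun.mult ρ ≠ 0 → ρ.re = 1 / 2
  · exact altUpTo_psiErr_of_on_line hRH hε
  · push Not at hRH
    obtain ⟨ρ, h1, h2⟩ := hRH
    exact altUpTo_psiErr_of_off_line h1 h2 hε
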